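/- With G = {K_{i+1}}_{i∈ℕ} and, for each m ∈ ℕ, the admissible coloring families L(m) = {L_i(m)}_{i∈ℕ} defined from the prime-distance colorings along fixed Hamiltonian paths (L_i(m) = the set of A_{(i,m)}-valued edge-colorings η of K_{i+1} with η|_{σ_i^{-1}(P_i)} = d_{Θ[i,m]}|_{σ_i^{-1}(P_i)}), there exists N ∈ ℕ such that for every m ∈ ℕ the Ramsey number R_{(G,L(m))}({K_2},{(2N)_{K_2}}) exists. -/

import Mathlib

namespace RamseyGen

open SimpleGraph

/-- A copy of the finite undirected graph `X` inside `G`: an injective vertex map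
preserving adjacency.  Such copies correspond exactly to graph isomorphisms from
subgraphs `Y ≤ G` onto `X`, i.e. to the elements `π` of the isomorphism set `G/X`
(a copy is the inverse of the edge map `π : E(Y) → E(X)`).  In particular
`G/X ≠ ∅` iff `Nonempty (Copy X G)`. -/
structure Copy {W V : Type*} (X : SimpleGraph W) (G : SimpleGraph V) where
  toFun : W → V
  injective : Function.Injective toFun
  map_adj : ∀ {a b : W}, X.Adj a b → G.Adj (toFun a) (toFun b)

theorem Copy.edgeMap_mem {W V : Type*} {X : SimpleGraph W} {G : SimpleGraph V}
    (f : Copy X G) (e : X.edgeSet) : e.1.map f.toFun ∈ G.edgeSet := by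
  obtain ⟨e, he⟩ := e
  induction e using Sym2.ind with
  | _ a b =>
    rw [Sym2.map_pair_eq, SimpleGraph.mem_edgeSet]
    exact f.map_adj (X.mem_edgeSet.mp he)

/-- The map on edges induced by a copy (the inverse of the edge map `π ∈ G/X`). -/
def Copy.edgeMap {W V : Type*} {X : SimpleGraph W} {G : SimpleGraph V}
    (f : Copy X G) (e : X.edgeSet) : G.edgeSet :=
  ⟨e.1.map f.toFun, f.edgeMap_mem e⟩

instance {W V : Type*} [Finite W] [Finite V] {X : SimpleGraph W} {G : SimpleGraph V} :
    Finite (Copy X G) :=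
  Finite.of_injective (fun f => f.toFun) fun f g h => by cases f; cases g; simpa using h

/-- `Hits X ψ G ρ` says: there is `π ∈ G/X` with `ρ|_{π⁻¹(X)} = ψ ∘ π`, i.e. the
edge-coloring `ρ` of `G` restricts, on some subgraph of `G` isomorphic to `X`,
to the target coloring `ψ` of `X`. -/
def Hits {W V A : Type*} (X : SimpleGraph W) (ψ : X.edgeSet → A)
    (G : SimpleGraph V) (ρ : G.edgeSet → A) : Prop :=
  ∃ f : Copy X G, ∀ e : X.edgeSet, ρ (f.edgeMap e) = ψ e

/-- A family of graphs indexed by a (strictly well-)ordered set is hereditary if the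
graphs increase, with respect to containment, along the order. -/
def Hereditary {I : Type*} [LT I] {Vtx : I → Type*} (G : ∀ i, SimpleGraph (Vtx i)) : Prop :=
  ∀ a b : I, a < b → Nonempty (Copy (G a) (G b))

/-- The metrical ("prime-distance") edge-coloring of a graph induced by a vertex
labelling `f : V → ℕ`: the edge joining `v` and `w` gets the color `|f v − f w|`. -/
def distColoring {V : Type*} {G : SimpleGraph V} (f : V → ℕ) (e : G.edgeSet) : ℕ :=
  Sym2.lift ⟨fun u v => Nat.dist (f u) (f v), fun u v => Nat.dist_comm (f u) (f v)⟩ e.1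

end RamseyGen

namespace BoundedGaps

theorem exists_gap_infinitely_often
    (h : ∃ H : ℕ, ∀ N : ℕ, ∃ p p' : ℕ, p.Prime ∧ p'.Prime ∧ N < p ∧ p < p' ∧ p' ≤ p + H) :
    ∃ N : ℕ, ∀ m : ℕ, ∃ r ≥ m,
      Nat.nth Nat.Prime (r + 1) = Nat.nth Nat.Prime r + 2 * N := by
  obtain ⟨H, hH⟩ := h
  have key : ∀ m : ℕ, ∃ r ≥ m, ∃ g ≤ H,
      Nat.nth Nat.Prime (r + 1) = Nat.nth Nat.Prime r + 2 * g := by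
    intro m
    obtain ⟨p, p', hp, hp', hN, hlt, hle⟩ := hH (Nat.nth Nat.Prime m + 2)
    obtain ⟨r, hr⟩ : ∃ r, Nat.nth Nat.Prime r = p := ⟨Nat.count Nat.Prime p, Nat.nth_count hp⟩
    obtain ⟨r', hr'⟩ : ∃ r, Nat.nth Nat.Prime r = p' := ⟨Nat.count Nat.Prime p', Nat.nth_count hp'⟩
    have hmono : StrictMono (Nat.nth Nat.Prime) :=
      Nat.nth_strictMono Nat.infinite_setOfPred_prime
    have hrr : r < r' := by
      rw [← hmono.lt_iff_lt, hr, hr']; exact hlt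
    have hmr : m ≤ r := by
      rw [← hmono.le_iff_le, hr]; omega
    have h1 : Nat.nth Nat.Prime (r + 1) ≤ p' := by
      rw [← hr']; exact hmono.monotone hrr
    have h2 : Nat.nth Nat.Prime r < Nat.nth Nat.Prime (r + 1) := hmono (Nat.lt_succ_self r)
    have o1 : Odd p := hp.odd_of_ne_two (by omega)
    have o2 : Odd (Nat.nth Nat.Prime (r + 1)) :=
      (Nat.prime_nth_prime (r + 1)).odd_of_ne_two (by omega)
    obtain ⟨a, ha⟩ := o1
    obtain ⟨b, hb⟩ := o2
    refine ⟨r, hmr, b - a, by omega, by omega⟩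
  choose r hr g hg hgap using key
  obtain ⟨N, hN⟩ : ∃ N, ∃ᶠ m in Filter.atTop, g m = N := by
    by_contra hcon
    push Not at hcon
    have : ∀ᶠ m in Filter.atTop, ∀ N ∈ Finset.range (H + 1), g m ≠ N := by
      rw [Filter.eventually_all_finset]
      intro N _
      exact hcon N
    obtain ⟨m, hm⟩ := this.exists
    exact hm (g m) (Finset.mem_range.2 (Nat.lt_succ_of_le (hg m))) rfl
  refine ⟨N, fun m => ?_⟩
  obtain ⟨m', hm', he⟩ := (Filter.frequently_atTop.1 hN) m
  exact ⟨r m', le_trans hm' (hr m'), by rw [hgap m', he]⟩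

end BoundedGaps

namespace BoundedGaps
open Finset

/-- The weak large sieve obtained by duality from bounds for the cross-correlations. -/
theorem large_sieve_of_cross {ι : Type*} [DecidableEq ι] (S : Finset ι) (χ : ι → ℕ → ℂ) (B : ℝ)
    (I : Finset ℕ) (a : ℕ → ℂ) (hχ : ∀ i ∈ S, ∀ n, ‖χ i n‖ ≤ 1)
    (hB : 0 ≤ B)
    (hcross : ∀ i ∈ S, ∀ j ∈ S, i ≠ j → ‖∑ n ∈ I, χ i n * starRingEnd ℂ (χ j n)‖ ≤ B) :
    ∑ i ∈ S, ‖∑ n ∈ I, a n * χ i n‖ ^ 2 ≤ (#I + B * #S) * ∑ n ∈ I, ‖a n‖ ^ 2 := by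
  set T : ι → ℂ := fun i => ∑ n ∈ I, a n * χ i n with hT
  set X : ℝ := ∑ i ∈ S, ‖T i‖ ^ 2 with hX
  set A : ℝ := ∑ n ∈ I, ‖a n‖ ^ 2 with hA
  set D : ℕ → ℂ := fun n => ∑ i ∈ S, starRingEnd ℂ (T i) * χ i n with hD
  have hX0 : 0 ≤ X := by positivity
  have hA0 : 0 ≤ A := by positivity
  have hXc : (X : ℂ) = ∑ n ∈ I, a n * D n := by
    simp only [hX, hD, mul_sum]
    rw [sum_comm]
    push_cast
    refine sum_congr rfl fun i _ => ?_
    rw [← Complex.conj_mul', hT]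
    simp only [mul_sum]
    refine sum_congr rfl fun n _ => by ring
  have hcs : X ^ 2 ≤ A * ∑ n ∈ I, ‖D n‖ ^ 2 := by
    have h1 : X ≤ ∑ n ∈ I, ‖a n‖ * ‖D n‖ := by
      calc X = ‖(X : ℂ)‖ := by rw [Complex.norm_real, Real.norm_of_nonneg hX0]
        _ ≤ _ := by
          rw [hXc]
          refine (norm_sum_le _ _).trans (le_of_eq (sum_congr rfl fun n _ => norm_mul _ _))
    calc X ^ 2 ≤ (∑ n ∈ I, ‖a n‖ * ‖D n‖) ^ 2 := by gcongr
      _ ≤ _ := sum_mul_sq_le_sq_mul_sq _ _ _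
  have hd : ∑ n ∈ I, ‖D n‖ ^ 2 ≤ (#I + B * #S) * X := by
    set c : ι → ι → ℂ := fun i j => ∑ n ∈ I, χ i n * starRingEnd ℂ (χ j n) with hc
    have e1 : ((∑ n ∈ I, ‖D n‖ ^ 2 : ℝ) : ℂ) =
        ∑ i ∈ S, ∑ j ∈ S, starRingEnd ℂ (T i) * T j * c i j := by
      push_cast
      simp only [hc, mul_sum]
      rw [show (∑ i ∈ S, ∑ j ∈ S, ∑ n ∈ I,
          starRingEnd ℂ (T i) * T j * (χ i n * starRingEnd ℂ (χ j n))) =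
          ∑ n ∈ I, ∑ i ∈ S, ∑ j ∈ S,
          starRingEnd ℂ (T i) * T j * (χ i n * starRingEnd ℂ (χ j n)) by
        rw [sum_comm]
        refine (sum_congr rfl fun i _ => sum_comm).trans ?_
        rw [sum_comm]
        refine sum_congr rfl fun n _ => sum_comm]
      refine sum_congr rfl fun n _ => ?_
      rw [← Complex.mul_conj', hD]
      simp only [map_sum, map_mul, Complex.conj_conj, sum_mul_sum]
      refine sum_congr rfl fun i _ => sum_congr rfl fun j _ => by ring
    have hcb : ∀ i ∈ S, ∀ j ∈ S, ‖c i j‖ ≤ (if i = j then (#I : ℝ) else 0) + B := by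
      intro i hi j hj
      split_ifs with hij
      · refine (norm_sum_le _ _).trans ?_
        have : ∑ n ∈ I, ‖χ i n * starRingEnd ℂ (χ j n)‖ ≤ ∑ n ∈ I, (1 : ℝ) := by
          refine sum_le_sum fun n _ => ?_
          rw [norm_mul, RCLike.norm_conj]
          exact mul_le_one₀ (hχ i hi n) (norm_nonneg _) (hχ j hj n)
        rw [sum_const, nsmul_eq_mul, mul_one] at this
        linarith
      · rw [zero_add]; exact hcross i hi j hj hij
    have e2 : ∑ n ∈ I, ‖D n‖ ^ 2 ≤ ∑ i ∈ S, ∑ j ∈ S,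
        (‖T i‖ ^ 2 + ‖T j‖ ^ 2) / 2 * ((if i = j then (#I : ℝ) else 0) + B) := by
      calc ∑ n ∈ I, ‖D n‖ ^ 2 = ‖((∑ n ∈ I, ‖D n‖ ^ 2 : ℝ) : ℂ)‖ := by
            rw [Complex.norm_real, Real.norm_of_nonneg (by positivity)]
        _ ≤ _ := by
          rw [e1]
          refine (norm_sum_le _ _).trans (sum_le_sum fun i hi => ?_)
          refine (norm_sum_le _ _).trans (sum_le_sum fun j hj => ?_)
          rw [norm_mul, norm_mul, RCLike.norm_conj]
          refine mul_le_mul ?_ (hcb i hi j hj) (norm_nonneg _) (by positivity)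
          nlinarith [sq_nonneg (‖T i‖ - ‖T j‖)]
    refine e2.trans (le_of_eq ?_)
    simp only [mul_add, sum_add_distrib, mul_ite, mul_zero, sum_ite_eq]
    have e3 : ∑ i ∈ S, ∑ j ∈ S, (‖T i‖ ^ 2 + ‖T j‖ ^ 2) / 2 * B = B * #S * X := by
      simp only [add_div, add_mul, sum_add_distrib, sum_const, nsmul_eq_mul]
      rw [← mul_sum, ← sum_mul, ← sum_div]
      ring
    rw [e3, add_mul]
    congr 1
    rw [hX, mul_sum]
    refine sum_congr rfl fun i hi => ?_
    rw [if_pos hi]; ring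
  by_cases hX1 : X = 0
  · rw [hX1]; positivity
  · have : 0 < X := lt_of_le_of_ne hX0 (Ne.symm hX1)
    have := hcs.trans (mul_le_mul_of_nonneg_left hd hA0)
    nlinarith

theorem sum_Ico_period {N : ℕ} [NeZero N] (f : ZMod N → ℂ) (a : ℕ) :
    ∑ n ∈ Ico a (a + N), f n = ∑ x : ZMod N, f x := by
  rw [sum_Ico_eq_sum_range, Nat.add_sub_cancel_left, sum_range]
  refine Fintype.sum_bijective (fun i : Fin N => ((a + (i : ℕ) : ℕ) : ZMod N)) ?_ _ _ fun i => rfl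
  rw [Fintype.bijective_iff_injective_and_card]
  refine ⟨fun i j hij => ?_, by simp⟩
  simp only [Nat.cast_add, add_right_inj] at hij
  have := (ZMod.natCast_eq_natCast_iff' _ _ _).1 hij
  rw [Nat.mod_eq_of_lt i.2, Nat.mod_eq_of_lt j.2] at this
  exact Fin.ext this

theorem norm_sum_char_Ico_le {N : ℕ} [NeZero N] {χ : DirichletCharacter ℂ N} (hχ : χ ≠ 1)
    (a b : ℕ) : ‖∑ n ∈ Ico a b, χ n‖ ≤ N := by
  induction h : b - a using Nat.strong_induction_on generalizing a b with
  | _ d ih =>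
    by_cases hd : d ≤ N
    · refine (norm_sum_le _ _).trans ?_
      calc ∑ n ∈ Ico a b, ‖χ n‖ ≤ ∑ n ∈ Ico a b, (1 : ℝ) :=
            sum_le_sum fun n _ => χ.norm_le_one _
        _ = (b - a : ℕ) := by simp
        _ ≤ N := by rw [h]; exact_mod_cast hd
    · have hN : 0 < N := Nat.pos_of_ne_zero (NeZero.ne N)
      rw [← sum_Ico_consecutive _ (show a ≤ a + N by omega) (show a + N ≤ b by omega),
        sum_Ico_period (fun x => χ x), MulChar.sum_eq_zero_of_ne_one hχ, zero_add]
      exact ih (d - N) (by omega) _ _ (by omega)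

/-- The product of a primitive character with the conjugate of a different one is the restriction
of a nonprincipal character. -/
theorem exists_char_mul_conj {q r : ℕ} [NeZero q] [NeZero r] {χ : DirichletCharacter ℂ q}
    {ψ : DirichletCharacter ℂ r} (hχ : χ.IsPrimitive) (hψ : ψ.IsPrimitive)
    (hne : (⟨q, χ⟩ : Σ n, DirichletCharacter ℂ n) ≠ ⟨r, ψ⟩) :
    ∃ ξ : DirichletCharacter ℂ (q * r), ξ ≠ 1 ∧ ∀ n : ℕ, χ n * starRingEnd ℂ (ψ n) = ξ n := by
  have hqr : NeZero (q * r) := ⟨mul_ne_zero (NeZero.ne q) (NeZero.ne r)⟩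
  set X := DirichletCharacter.changeLevel (dvd_mul_right q r) χ
  set Y := DirichletCharacter.changeLevel (dvd_mul_left r q) ψ
  have h1 : X * Y⁻¹ ≠ 1 := by
    intro h
    rw [mul_inv_eq_one] at h
    have hc : q = r := by
      have := congrArg DirichletCharacter.conductor h
      rw [DirichletCharacter.conductor_changeLevel, DirichletCharacter.conductor_changeLevel] at this
      rwa [hχ, hψ] at this
    subst hc
    exact hne (by rw [DirichletCharacter.changeLevel_injective _ h])
  refine ⟨X * Y⁻¹, h1, ?_⟩
  intro n
  · have hY : Y⁻¹ (n : ZMod (q * r)) = starRingEnd ℂ (Y n) := by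
      rw [← MulChar.star_eq_inv, MulChar.star_apply]; rfl
    rw [MulChar.mul_apply, hY]
    by_cases hn : IsCoprime (n : ℤ) ((q * r : ℕ) : ℤ)
    · have e1 := DirichletCharacter.changeLevel_eq_cast_of_dvd' χ (dvd_mul_right q r) hn
      have e2 := DirichletCharacter.changeLevel_eq_cast_of_dvd' ψ (dvd_mul_left r q) hn
      simp only [Int.cast_natCast] at e1 e2
      rw [e1, e2]
    · have hX0 : X (n : ZMod (q * r)) = 0 := MulChar.map_nonunit _ (by
        rwa [ZMod.isUnit_iff_coprime, ← Nat.isCoprime_iff_coprime])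
      rw [hX0, zero_mul]
      have : ¬ (n.Coprime q ∧ n.Coprime r) := by
        rwa [← Nat.coprime_mul_iff_right, ← Nat.isCoprime_iff_coprime]
      by_cases h : n.Coprime q
      · rw [show ψ n = 0 from MulChar.map_nonunit _ (by
          rw [ZMod.isUnit_iff_coprime]; tauto)]
        simp
      · rw [show χ n = 0 from MulChar.map_nonunit _ (by
          rwa [ZMod.isUnit_iff_coprime])]
        simp

theorem cross_corr_le {q r : ℕ} [NeZero q] [NeZero r] {χ : DirichletCharacter ℂ q}
    {ψ : DirichletCharacter ℂ r} (hχ : χ.IsPrimitive) (hψ : ψ.IsPrimitive)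
    (hne : (⟨q, χ⟩ : Σ n, DirichletCharacter ℂ n) ≠ ⟨r, ψ⟩) (a b : ℕ) :
    ‖∑ n ∈ Ico a b, χ n * starRingEnd ℂ (ψ n)‖ ≤ q * r := by
  have hqr : NeZero (q * r) := ⟨mul_ne_zero (NeZero.ne q) (NeZero.ne r)⟩
  obtain ⟨ξ, h1, h3⟩ := exists_char_mul_conj hχ hψ hne
  have h2 := norm_sum_char_Ico_le h1 a b
  rw [Nat.cast_mul] at h2
  simp_rw [h3]
  exact h2
end BoundedGaps

namespace BoundedGaps
open Finset ArithmeticFunction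
open scoped ArithmeticFunction.Moebius ArithmeticFunction.zeta

/-- The twist of a real arithmetic function by a Dirichlet character. -/
noncomputable def twist {q : ℕ} (χ : DirichletCharacter ℂ q) (f : ArithmeticFunction ℝ) :
    ArithmeticFunction ℂ := ⟨fun n => (f n : ℂ) * χ n, by simp⟩

theorem twist_apply {q : ℕ} (χ : DirichletCharacter ℂ q) (f : ArithmeticFunction ℝ) (n : ℕ) :
    twist χ f n = (f n : ℂ) * χ n := rfl

theorem twist_mul {q : ℕ} (χ : DirichletCharacter ℂ q) (f g : ArithmeticFunction ℝ) :
    twist χ (f * g) = twist χ f * twist χ g := by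
  ext n
  simp only [twist_apply, ArithmeticFunction.mul_apply, Complex.ofReal_sum, sum_mul]
  refine sum_congr rfl fun p hp => ?_
  rw [← (Nat.mem_divisorsAntidiagonal.1 hp).1]
  push_cast
  rw [map_mul]
  ring

theorem twist_add {q : ℕ} (χ : DirichletCharacter ℂ q) (f g : ArithmeticFunction ℝ) :
    twist χ (f + g) = twist χ f + twist χ g := by
  ext n
  simp [twist_apply, add_mul]

theorem twist_sub {q : ℕ} (χ : DirichletCharacter ℂ q) (f g : ArithmeticFunction ℝ) :
    twist χ (f - g) = twist χ f - twist χ g := by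
  ext n
  simp [twist_apply, sub_eq_add_neg]
  ring

/-- The restriction of an arithmetic function to `[1, U]`. -/
noncomputable def lowPart (U : ℕ) (f : ArithmeticFunction ℝ) : ArithmeticFunction ℝ :=
  ⟨fun n => if n ≤ U then f n else 0, by simp⟩

theorem lowPart_apply (U : ℕ) (f : ArithmeticFunction ℝ) (n : ℕ) :
    lowPart U f n = if n ≤ U then f n else 0 := rfl

theorem vaughan_identity (U : ℕ) :
    Λ = lowPart U Λ + lowPart U (μ : ArithmeticFunction ℝ) * log
      - (lowPart U (μ : ArithmeticFunction ℝ) * lowPart U Λ) * ζ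
      + (((μ : ArithmeticFunction ℝ) - lowPart U μ) * ζ) * (Λ - lowPart U Λ) := by
  have h1 : (μ : ArithmeticFunction ℝ) * ζ = 1 := coe_moebius_mul_coe_zeta
  rw [← vonMangoldt_mul_zeta]
  linear_combination (lowPart U Λ - Λ) * h1

theorem norm_sum_Ioc_le {q : ℕ} [NeZero q] {χ : DirichletCharacter ℂ q} (hχ : χ ≠ 1)
    (a b : ℕ) : ‖∑ n ∈ Ioc a b, χ n‖ ≤ q := by
  have := norm_sum_char_Ico_le hχ (a + 1) (b + 1)
  rwa [show Ico (a + 1) (b + 1) = Ioc a b by ext; simp only [mem_Ico, mem_Ioc]; omega] at this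

theorem norm_sum_log_mul_char_le {q : ℕ} [NeZero q] {χ : DirichletCharacter ℂ q} (hχ : χ ≠ 1)
    (y : ℕ) : ‖∑ n ∈ Ioc 0 y, (Real.log n : ℂ) * χ n‖ ≤ q * Real.log y := by
  have hlog : ∀ n : ℕ, Real.log n = ∑ j ∈ Ico 1 n, (Real.log (j + 1 : ℕ) - Real.log j) := by
    intro n
    induction n with
    | zero => simp
    | succ n ih =>
      rcases Nat.eq_zero_or_pos n with rfl | hn
      · simp
      · rw [sum_Ico_succ_top hn, ← ih]; ring
  have h1 : ∑ n ∈ Ioc 0 y, (Real.log n : ℂ) * χ n =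
      ∑ j ∈ Ico 1 y, ((Real.log (j + 1 : ℕ) - Real.log j : ℝ) : ℂ) * ∑ n ∈ Ioc j y, χ n := by
    calc _ = ∑ n ∈ Ioc 0 y, ∑ j ∈ Ico 1 n,
        ((Real.log (j + 1 : ℕ) - Real.log j : ℝ) : ℂ) * χ n := by
          refine sum_congr rfl fun n _ => ?_
          rw [hlog n, Complex.ofReal_sum, sum_mul]
      _ = _ := by
          simp only [mul_sum]
          refine sum_comm' fun n j => ?_
          simp only [mem_Ioc, mem_Ico]; omega
  rw [h1]
  refine (norm_sum_le _ _).trans ?_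
  rw [hlog y, mul_sum]
  refine sum_le_sum fun j hj => ?_
  have hj1 := (mem_Ico.1 hj).1
  have h0 : 0 ≤ Real.log (j + 1 : ℕ) - Real.log j :=
    sub_nonneg.2 (Real.log_le_log (by exact_mod_cast hj1) (by push_cast; linarith))
  rw [norm_mul, Complex.norm_real, Real.norm_of_nonneg h0, mul_comm]
  exact mul_le_mul_of_nonneg_right (norm_sum_Ioc_le hχ _ _) h0

theorem sum_inv_Ioc_le (y : ℕ) : ∑ n ∈ Ioc 0 y, (n : ℝ)⁻¹ ≤ 1 + Real.log y := by
  have := harmonic_le_one_add_log y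
  rw [harmonic_eq_sum_Icc] at this
  push_cast at this
  exact this

theorem sum_card_divisors_le (y : ℕ) :
    ∑ n ∈ Ioc 0 y, (#n.divisors : ℝ) ≤ y * (1 + Real.log y) := by
  have h := sum_Ioc_sigma0_eq_sum_div y
  simp only [sigma_zero_apply] at h
  have h' : ∑ n ∈ Ioc 0 y, (#n.divisors : ℝ) = ∑ n ∈ Ioc 0 y, ((y / n : ℕ) : ℝ) := by
    exact_mod_cast h
  rw [h']
  calc ∑ n ∈ Ioc 0 y, ((y / n : ℕ) : ℝ) ≤ ∑ n ∈ Ioc 0 y, y * (n : ℝ)⁻¹ :=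
        sum_le_sum fun n _ => by rw [← div_eq_mul_inv]; exact Nat.cast_div_le
    _ ≤ _ := by rw [← mul_sum]; gcongr; exact sum_inv_Ioc_le y

theorem card_filter_dvd_Ioc (y d : ℕ) : #{n ∈ Ioc 0 y | d ∣ n} = y / d := by
  rw [Nat.Ioc_filter_dvd_card_eq_div]

theorem sum_card_divisors_sq_le (y : ℕ) :
    ∑ n ∈ Ioc 0 y, (#n.divisors : ℝ) ^ 2 ≤ y * (1 + Real.log y) ^ 3 := by
  have h1 : ∀ n ∈ Ioc 0 y, (#n.divisors : ℝ) ^ 2 =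
      ∑ a ∈ Ioc 0 y, ∑ b ∈ Ioc 0 y, if a ∣ n ∧ b ∣ n then (1 : ℝ) else 0 := by
    intro n hn
    rw [mem_Ioc] at hn
    have : (#n.divisors : ℝ) = ∑ a ∈ Ioc 0 y, if a ∣ n then (1 : ℝ) else 0 := by
      rw [sum_boole]
      congr 2
      ext a
      simp only [Nat.mem_divisors, mem_filter, mem_Ioc]
      refine ⟨fun h => ⟨⟨Nat.pos_of_dvd_of_pos h.1 hn.1, (Nat.le_of_dvd hn.1 h.1).trans hn.2⟩, h.1⟩,
        fun h => ⟨h.2, by omega⟩⟩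
    rw [this, sq, sum_mul_sum]
    refine sum_congr rfl fun a _ => sum_congr rfl fun b _ => ?_
    split_ifs <;> simp_all
  have h2 : ∀ a ∈ Ioc 0 y, ∀ b ∈ Ioc 0 y,
      ∑ n ∈ Ioc 0 y, (if a ∣ n ∧ b ∣ n then (1 : ℝ) else 0) ≤
      y * ∑ g ∈ Ioc 0 y, if g ∣ a ∧ g ∣ b then (g : ℝ) * (a : ℝ)⁻¹ * (b : ℝ)⁻¹ else 0 := by
    intro a ha b hb
    rw [mem_Ioc] at ha hb
    have hg : 0 < Nat.gcd a b := Nat.gcd_pos_of_pos_left _ ha.1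
    have hga := Nat.gcd_le_left b ha.1
    have e : ∑ n ∈ Ioc 0 y, (if a ∣ n ∧ b ∣ n then (1 : ℝ) else 0) = ((y / Nat.lcm a b : ℕ) : ℝ) := by
      rw [sum_boole, ← card_filter_dvd_Ioc]
      simp only [Nat.lcm_dvd_iff]
    rw [e]
    calc ((y / Nat.lcm a b : ℕ) : ℝ) ≤ y / (Nat.lcm a b : ℕ) := Nat.cast_div_le
      _ = y * ((Nat.gcd a b : ℝ) * (a : ℝ)⁻¹ * (b : ℝ)⁻¹) := by
        have : (Nat.gcd a b : ℝ) * Nat.lcm a b = a * b := by exact_mod_cast Nat.gcd_mul_lcm a b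
        have hl : (Nat.lcm a b : ℝ) ≠ 0 := by
          exact_mod_cast (Nat.lcm_pos ha.1 hb.1).ne'
        have h3 : (a : ℝ) ≠ 0 := by exact_mod_cast ha.1.ne'
        have h4 : (b : ℝ) ≠ 0 := by exact_mod_cast hb.1.ne'
        field_simp
        linear_combination (-(y : ℝ)) * this
      _ ≤ _ := by
        gcongr
        have := single_le_sum (f := fun g : ℕ => if g ∣ a ∧ g ∣ b then
          (g : ℝ) * (a : ℝ)⁻¹ * (b : ℝ)⁻¹ else 0) (s := Ioc 0 y)
          (fun g _ => by split_ifs <;> positivity)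
          (mem_Ioc.2 ⟨hg, hga.trans ha.2⟩)
        simpa [Nat.gcd_dvd_left, Nat.gcd_dvd_right] using this
  have h3 : ∀ g ∈ Ioc 0 y, ∑ a ∈ Ioc 0 y, (if g ∣ a then (a : ℝ)⁻¹ else 0) ≤
      (g : ℝ)⁻¹ * (1 + Real.log y) := by
    intro g hg
    rw [mem_Ioc] at hg
    rw [← sum_filter]
    calc ∑ a ∈ Ioc 0 y with g ∣ a, (a : ℝ)⁻¹ ≤ ∑ a ∈ (Ioc 0 y).image (g * ·), (a : ℝ)⁻¹ := by
          refine sum_le_sum_of_subset_of_nonneg ?_ fun _ _ _ => by positivity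
          intro a ha
          obtain ⟨h1, c, rfl⟩ := mem_filter.1 ha
          rw [mem_Ioc] at h1
          refine mem_image.2 ⟨c, mem_Ioc.2 ⟨Nat.pos_of_mul_pos_left h1.1, ?_⟩, rfl⟩
          exact (Nat.le_mul_of_pos_left _ hg.1).trans h1.2
      _ = ∑ c ∈ Ioc 0 y, ((g * c : ℕ) : ℝ)⁻¹ := by
          refine sum_image fun c _ d _ h => Nat.eq_of_mul_eq_mul_left hg.1 h
      _ = (g : ℝ)⁻¹ * ∑ c ∈ Ioc 0 y, (c : ℝ)⁻¹ := by
          rw [mul_sum]; refine sum_congr rfl fun c _ => by push_cast; rw [mul_inv]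
      _ ≤ _ := by gcongr; exact sum_inv_Ioc_le y
  have hL : 0 ≤ 1 + Real.log y := by have := Real.log_natCast_nonneg y; linarith
  calc ∑ n ∈ Ioc 0 y, (#n.divisors : ℝ) ^ 2
      = ∑ a ∈ Ioc 0 y, ∑ b ∈ Ioc 0 y, ∑ n ∈ Ioc 0 y,
          (if a ∣ n ∧ b ∣ n then (1 : ℝ) else 0) := by
        rw [sum_congr rfl h1, sum_comm]
        refine sum_congr rfl fun a _ => sum_comm
    _ ≤ ∑ a ∈ Ioc 0 y, ∑ b ∈ Ioc 0 y,
      y * ∑ g ∈ Ioc 0 y, (if g ∣ a ∧ g ∣ b then (g : ℝ) * (a : ℝ)⁻¹ * (b : ℝ)⁻¹ else 0) :=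
        sum_le_sum fun a ha => sum_le_sum fun b hb => h2 a ha b hb
    _ = y * ∑ g ∈ Ioc 0 y, (g : ℝ) * (∑ a ∈ Ioc 0 y, if g ∣ a then (a : ℝ)⁻¹ else 0) ^ 2 := by
        simp only [← mul_sum]
        congr 1
        calc _ = ∑ a ∈ Ioc 0 y, ∑ g ∈ Ioc 0 y, ∑ b ∈ Ioc 0 y,
              (if g ∣ a ∧ g ∣ b then (g : ℝ) * (a : ℝ)⁻¹ * (b : ℝ)⁻¹ else 0) :=
              sum_congr rfl fun a _ => sum_comm
          _ = _ := by
            rw [sum_comm]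
            refine sum_congr rfl fun g _ => ?_
            rw [sq, sum_mul_sum, mul_sum]
            refine sum_congr rfl fun a _ => ?_
            rw [mul_sum]
            refine sum_congr rfl fun b _ => ?_
            by_cases h1 : g ∣ a <;> by_cases h2 : g ∣ b <;> simp [h1, h2, mul_assoc]
    _ ≤ y * ∑ g ∈ Ioc 0 y, (g : ℝ) * ((g : ℝ)⁻¹ * (1 + Real.log y)) ^ 2 := by
        gcongr with g hg
        exact h3 g hg
    _ = y * ((1 + Real.log y) ^ 2 * ∑ g ∈ Ioc 0 y, (g : ℝ)⁻¹) := by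
        congr 1
        rw [mul_sum]
        refine sum_congr rfl fun g hg => ?_
        have : (g : ℝ) ≠ 0 := by exact_mod_cast (mem_Ioc.1 hg).1.ne'
        field_simp
    _ ≤ y * ((1 + Real.log y) ^ 2 * (1 + Real.log y)) := by
        gcongr; exact sum_inv_Ioc_le y
    _ = _ := by ring
end BoundedGaps

namespace BoundedGaps
open Finset ArithmeticFunction
open scoped ArithmeticFunction.Moebius ArithmeticFunction.zeta

theorem norm_twist_le {q : ℕ} (χ : DirichletCharacter ℂ q) (f : ArithmeticFunction ℝ) (n : ℕ) :
    ‖twist χ f n‖ ≤ |f n| := by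
  rw [twist_apply, norm_mul, Complex.norm_real, Real.norm_eq_abs]
  exact mul_le_of_le_one_right (abs_nonneg _) (χ.norm_le_one _)

theorem arith_sub_apply {R : Type*} [Ring R] (f g : ArithmeticFunction R) (n : ℕ) :
    (f - g) n = f n - g n := by
  simp [sub_eq_add_neg]

/-- The bilinear sum estimate over a finite family of primitive characters. -/
theorem bilinear_le (R : ℕ) (hR : 1 ≤ R) (S : Finset (Σ n, DirichletCharacter ℂ n))
    (hS : ∀ i ∈ S, 1 ≤ i.1 ∧ i.1 ≤ R ∧ i.2.IsPrimitive) (hcard : #S ≤ R ^ 2)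
    (f b : ArithmeticFunction ℝ) (U x : ℕ) (hU : R ^ 6 ≤ U)
    (hf : ∀ n, |f n| ≤ Real.log n) (hf0 : ∀ n ≤ U, f n = 0)
    (hb : ∀ n, |b n| ≤ #n.divisors) (hb0 : ∀ n ≤ U, b n = 0) :
    ∑ i ∈ S, ‖∑ n ∈ Ioc 0 x, (twist i.2 (b * f)) n‖ ≤ 3 * x * (1 + Real.log x) ^ 4 := by
  set H : ℕ := R ^ 4 with hH
  set ℒ : ℝ := 1 + Real.log x with hℒ
  have hH0 : 0 < H := by positivity
  have hHU : H ≤ U := le_trans (Nat.pow_le_pow_right hR (by norm_num)) hU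
  have hU0 : 0 < U := lt_of_lt_of_le hH0 hHU
  have hℒ1 : 1 ≤ ℒ := by have := Real.log_natCast_nonneg x; linarith
  set A : (Σ n, DirichletCharacter ℂ n) → ℕ → ℂ :=
    fun i j => ∑ m ∈ Ioc (j * H) ((j + 1) * H), (twist i.2 f) m with hA
  set Y : ℕ → ℕ := fun j => x / ((j + 1) * H) with hY
  set B : (Σ n, DirichletCharacter ℂ n) → ℕ → ℂ :=
    fun i j => ∑ l ∈ Ioc 0 (Y j), (twist i.2 b) l with hB
  have hsplit : ∀ i : (Σ n, DirichletCharacter ℂ n), ∀ M : ℕ,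
      ∑ m ∈ Ioc 0 M, (twist i.2 f) m = ∑ j ∈ range (M / H), A i j +
        ∑ m ∈ Ioc (M / H * H) M, (twist i.2 f) m := by
    intro i M
    have h1 : ∀ K : ℕ, ∑ j ∈ range K, A i j = ∑ m ∈ Ioc 0 (K * H), (twist i.2 f) m := by
      intro K
      induction K with
      | zero => simp
      | succ K ih =>
        rw [sum_range_succ, ih, hA]
        dsimp only
        rw [sum_Ioc_consecutive _ (Nat.zero_le _) (Nat.mul_le_mul_right _ (Nat.le_succ K))]
    rw [h1, sum_Ioc_consecutive _ (Nat.zero_le _) (Nat.div_mul_le_self M H)]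
  have hmain : ∀ i ∈ S, ‖∑ n ∈ Ioc 0 x, (twist i.2 (b * f)) n‖ ≤
      ∑ j ∈ range x, ‖A i j‖ * ‖B i j‖ + (x / U : ℕ) * ℒ * (H * ℒ) := by
    intro i hi
    rw [twist_mul, sum_Ioc_mul_eq_sum_sum]
    simp_rw [hsplit i, mul_add, sum_add_distrib]
    refine (norm_add_le _ _).trans (add_le_add ?_ ?_)
    · have : ∑ l ∈ Ioc 0 x, (twist i.2 b) l * ∑ j ∈ range (x / l / H), A i j =
          ∑ j ∈ range x, A i j * B i j := by
        simp only [hB, mul_sum]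
        calc ∑ l ∈ Ioc 0 x, ∑ j ∈ range (x / l / H), (twist i.2 b) l * A i j
            = ∑ j ∈ range x, ∑ l ∈ Ioc 0 (Y j), (twist i.2 b) l * A i j := by
              refine sum_comm' fun l j => ?_
              simp only [mem_Ioc, mem_range, hY]
              have e : l * ((j + 1) * H) = (j + 1) * (l * H) := by ring
              constructor
              · rintro ⟨⟨h1, h2⟩, h3⟩
                rw [Nat.div_div_eq_div_mul, Nat.lt_iff_add_one_le,
                  Nat.le_div_iff_mul_le (Nat.mul_pos h1 hH0)] at h3
                refine ⟨⟨h1, (Nat.le_div_iff_mul_le (by positivity)).2 (by rwa [e])⟩, ?_⟩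
                have : j + 1 ≤ (j + 1) * (l * H) := Nat.le_mul_of_pos_right _ (Nat.mul_pos h1 hH0)
                omega
              · rintro ⟨⟨h1, h2⟩, h3⟩
                refine ⟨⟨h1, h2.trans (Nat.div_le_self _ _)⟩, ?_⟩
                rw [Nat.div_div_eq_div_mul, Nat.lt_iff_add_one_le,
                  Nat.le_div_iff_mul_le (Nat.mul_pos h1 hH0)]
                rw [Nat.le_div_iff_mul_le (by positivity)] at h2
                rwa [← e]
          _ = _ := sum_congr rfl fun j _ => sum_congr rfl fun l _ => mul_comm _ _
      rw [this]
      exact (norm_sum_le _ _).trans (le_of_eq (sum_congr rfl fun j _ => norm_mul _ _))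
    · have h1 : ∀ l ∈ Ioc 0 x, ‖(twist i.2 b) l * ∑ m ∈ Ioc (x / l / H * H) (x / l), (twist i.2 f) m‖
          ≤ if l ≤ x / U then (#l.divisors : ℝ) * (H * ℒ) else 0 := by
        intro l hl
        rw [mem_Ioc] at hl
        split_ifs with h
        · rw [norm_mul]
          refine mul_le_mul ((norm_twist_le _ _ _).trans (hb l)) ?_ (norm_nonneg _) (by positivity)
          calc ‖∑ m ∈ Ioc (x / l / H * H) (x / l), (twist i.2 f) m‖
              ≤ ∑ m ∈ Ioc (x / l / H * H) (x / l), ℒ := by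
                refine (norm_sum_le _ _).trans (sum_le_sum fun m hm => ?_)
                rw [mem_Ioc] at hm
                refine (norm_twist_le _ _ _).trans ((hf m).trans ?_)
                have : Real.log m ≤ Real.log x := Real.log_le_log
                  (by exact_mod_cast (show 0 < m by omega))
                  (by exact_mod_cast hm.2.trans (Nat.div_le_self _ _))
                linarith
            _ = (x / l - x / l / H * H : ℕ) * ℒ := by simp
            _ ≤ H * ℒ := by
                gcongr
                have := Nat.div_add_mod (x / l) H
                have := Nat.mod_lt (x / l) hH0
                rw [mul_comm (x / l / H)]
                omega
        · have hlt : x / l < U := by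
            rw [Nat.div_lt_iff_lt_mul hl.1]
            rw [not_le, Nat.div_lt_iff_lt_mul hU0] at h
            rwa [mul_comm]
          rw [sum_eq_zero, mul_zero, norm_zero]
          intro m hm
          rw [mem_Ioc] at hm
          rw [twist_apply, hf0 m (by omega)]
          simp
      refine (norm_sum_le _ _).trans ((sum_le_sum h1).trans ?_)
      rw [← sum_filter]
      have e : {l ∈ Ioc 0 x | l ≤ x / U} = Ioc 0 (x / U) := by
        ext l
        have := Nat.div_le_self x U
        simp only [mem_filter, mem_Ioc]; omega
      rw [e, ← sum_mul]
      refine mul_le_mul_of_nonneg_right ((sum_card_divisors_le _).trans ?_) (by positivity)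
      rcases Nat.eq_zero_or_pos (x / U) with h0 | h0
      · simp [h0]
      rw [hℒ]
      gcongr
      exact Nat.div_le_self _ _
  have hLS : ∀ (c : ArithmeticFunction ℝ) (u v : ℕ),
      ∑ i ∈ S, ‖∑ n ∈ Ioc u v, (twist i.2 c) n‖ ^ 2 ≤
        ((v - u : ℕ) + H) * ∑ n ∈ Ioc u v, (c n) ^ 2 := by
    intro c u v
    classical
    have := large_sieve_of_cross S (fun i n => i.2 n) ((R : ℝ) ^ 2) (Ioc u v) (fun n => (c n : ℂ))
      (fun i _ n => i.2.norm_le_one _) (by positivity) (by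
        rintro ⟨q, χ⟩ hi ⟨r, ψ⟩ hj hij
        obtain ⟨h1, h2, h3⟩ := hS _ hi
        obtain ⟨h4, h5, h6⟩ := hS _ hj
        have : NeZero q := ⟨by dsimp only at h1; omega⟩
        have : NeZero r := ⟨by dsimp only at h4; omega⟩
        have := cross_corr_le h3 h6 hij (u + 1) (v + 1)
        rw [show Ico (u + 1) (v + 1) = Ioc u v by ext; simp only [mem_Ico, mem_Ioc]; omega] at this
        refine this.trans ?_
        rw [sq]
        gcongr)
    simp only [Complex.norm_real, Real.norm_eq_abs, sq_abs, Nat.card_Ioc] at this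
    refine this.trans (mul_le_mul_of_nonneg_right ?_ (sum_nonneg fun _ _ => sq_nonneg _))
    gcongr
    calc (R : ℝ) ^ 2 * (#S : ℝ) ≤ (R : ℝ) ^ 2 * ((R ^ 2 : ℕ) : ℝ) := by gcongr
      _ = (H : ℝ) := by rw [hH]; push_cast; ring
  have hblock : ∀ j ∈ range x, ∑ i ∈ S, ‖A i j‖ * ‖B i j‖ ≤ 2 * (x * ((j + 1 : ℕ) : ℝ)⁻¹) * ℒ ^ 3 := by
    intro j hj
    rcases le_or_gt (Y j) U with hYU | hYU
    · refine le_trans (le_of_eq ?_) (show (0 : ℝ) ≤ _ by positivity)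
      refine sum_eq_zero fun i _ => ?_
      rw [show B i j = 0 from sum_eq_zero fun l hl => by
        rw [twist_apply, hb0 l ((mem_Ioc.1 hl).2.trans hYU)]; simp]
      simp
    · have hYx : (j + 1) * H ≤ x := by
        by_contra h
        have : Y j = 0 := Nat.div_eq_of_lt (not_le.1 h)
        omega
      have hx0 : 0 < x := by have : 0 < (j + 1) * H := by positivity
                             omega
      have hAs : ∑ i ∈ S, ‖A i j‖ ^ 2 ≤ (H * ℒ) ^ 2 * 2 := by
        refine (hLS f _ _).trans ?_
        have e : (j + 1) * H - j * H = H := by rw [add_mul, one_mul]; omega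
        rw [e]
        have : ∑ n ∈ Ioc (j * H) ((j + 1) * H), (f n) ^ 2 ≤ ∑ n ∈ Ioc (j * H) ((j + 1) * H), ℒ ^ 2 := by
          refine sum_le_sum fun n hn => ?_
          rw [mem_Ioc] at hn
          rw [← sq_abs]
          have : Real.log n ≤ Real.log x := Real.log_le_log
            (by exact_mod_cast (show 0 < n by omega)) (by exact_mod_cast hn.2.trans hYx)
          have := hf n
          gcongr
          linarith
        rw [sum_const, Nat.card_Ioc, e, nsmul_eq_mul] at this
        calc _ ≤ ((H : ℝ) + H) * (H * ℒ ^ 2) := by gcongr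
          _ = _ := by ring
      have hBs : ∑ i ∈ S, ‖B i j‖ ^ 2 ≤ (Y j * ℒ ^ 2) ^ 2 * 2 := by
        refine (hLS b _ _).trans ?_
        have h1 : ∑ n ∈ Ioc 0 (Y j), (b n) ^ 2 ≤ Y j * ℒ ^ 3 := by
          calc _ ≤ ∑ n ∈ Ioc 0 (Y j), (#n.divisors : ℝ) ^ 2 :=
                sum_le_sum fun n _ => by rw [← sq_abs]; gcongr; exact hb n
            _ ≤ _ := sum_card_divisors_sq_le _
            _ ≤ _ := by
              have h0 : 0 < Y j := by omega
              rw [hℒ]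
              gcongr
              exact Nat.div_le_self _ _
        have h2 : (H : ℝ) ≤ Y j := by exact_mod_cast hHU.trans hYU.le
        calc _ ≤ ((Y j : ℝ) + Y j) * (Y j * ℒ ^ 3) := by gcongr; simp
          _ = (Y j : ℝ) ^ 2 * 2 * ℒ ^ 3 := by ring
          _ ≤ (Y j : ℝ) ^ 2 * 2 * ℒ ^ 4 := by gcongr; norm_num
          _ = _ := by ring
      have hcs : (∑ i ∈ S, ‖A i j‖ * ‖B i j‖) ^ 2 ≤ (2 * (H * Y j) * ℒ ^ 3) ^ 2 := by
        refine (sum_mul_sq_le_sq_mul_sq _ _ _).trans ?_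
        calc _ ≤ ((H * ℒ) ^ 2 * 2) * ((Y j * ℒ ^ 2) ^ 2 * 2) := by gcongr
          _ = _ := by ring
      have h3 := (sq_le_sq₀ (sum_nonneg fun _ _ => by positivity) (by positivity)).1 hcs
      refine h3.trans ?_
      have : Y j * ((j + 1) * H) ≤ x := Nat.div_mul_le_self _ _
      have : (Y j : ℝ) * (((j + 1 : ℕ) : ℝ) * H) ≤ x := by exact_mod_cast this
      have key : (H : ℝ) * Y j ≤ x * ((j + 1 : ℕ) : ℝ)⁻¹ := by
        rw [← div_eq_mul_inv, le_div_iff₀ (by positivity)]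
        linarith
      exact mul_le_mul_of_nonneg_right (by linarith) (by positivity)
  calc ∑ i ∈ S, ‖∑ n ∈ Ioc 0 x, (twist i.2 (b * f)) n‖
      ≤ ∑ i ∈ S, (∑ j ∈ range x, ‖A i j‖ * ‖B i j‖ + (x / U : ℕ) * ℒ * (H * ℒ)) := sum_le_sum hmain
    _ = ∑ j ∈ range x, ∑ i ∈ S, ‖A i j‖ * ‖B i j‖ + #S * ((x / U : ℕ) * ℒ * (H * ℒ)) := by
        rw [sum_add_distrib, sum_comm]; simp
    _ ≤ ∑ j ∈ range x, 2 * (x * ((j + 1 : ℕ) : ℝ)⁻¹) * ℒ ^ 3 + x * ℒ ^ 4 := by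
        refine add_le_add (sum_le_sum hblock) ?_
        have h1 : #S * (x / U * H) ≤ x := by
          calc #S * (x / U * H) ≤ R ^ 2 * (x / U * R ^ 4) := by gcongr
            _ = x / U * R ^ 6 := by ring
            _ ≤ x / U * U := by gcongr
            _ ≤ x := Nat.div_mul_le_self _ _
        have h1' : (#S : ℝ) * ((x / U : ℕ) * H) ≤ x := by exact_mod_cast h1
        calc #S * ((x / U : ℕ) * ℒ * (H * ℒ)) = (#S : ℝ) * ((x / U : ℕ) * H) * ℒ ^ 2 := by ring
          _ ≤ x * ℒ ^ 2 := by gcongr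
          _ ≤ x * ℒ ^ 4 := by gcongr; norm_num [hℒ1]
    _ ≤ 2 * (x * ℒ) * ℒ ^ 3 + x * ℒ ^ 4 := by
        gcongr
        rw [← sum_mul, ← mul_sum, ← mul_sum]
        gcongr
        refine le_trans (le_of_eq ?_) (sum_inv_Ioc_le x)
        rw [show Ioc 0 x = Ico (0 + 1) (x + 1) by ext; simp only [mem_Ico, mem_Ioc]; omega,
          ← sum_Ico_add' , range_eq_Ico]
    _ = _ := by ring

theorem large_conductors (R : ℕ) (hR : 1 ≤ R) (x : ℕ) (hx : R ^ 15 ≤ x)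
    (S : Finset (Σ n, DirichletCharacter ℂ n))
    (hS : ∀ i ∈ S, 2 ≤ i.1 ∧ i.1 ≤ R ∧ i.2.IsPrimitive) (hcard : #S ≤ R ^ 2) :
    ∑ i ∈ S, ‖∑ n ∈ Ioc 0 x, (Λ n : ℂ) * i.2 n‖ ≤ 6 * x * (1 + Real.log x) ^ 4 := by
  set U := R ^ 6 with hU
  set ℒ : ℝ := 1 + Real.log x with hℒ
  have hU0 : 1 ≤ U := Nat.one_le_pow _ _ hR
  have hℒ1 : 1 ≤ ℒ := by have := Real.log_natCast_nonneg x; linarith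
  have hlogle : ∀ n ≤ x, Real.log n ≤ ℒ := by
    intro n hn
    rcases Nat.eq_zero_or_pos n with rfl | h
    · simp; linarith
    have : Real.log n ≤ Real.log x := Real.log_le_log (by exact_mod_cast h) (by exact_mod_cast hn)
    linarith
  set g : ArithmeticFunction ℝ := lowPart U (μ : ArithmeticFunction ℝ) with hg
  set b : ArithmeticFunction ℝ := ((μ : ArithmeticFunction ℝ) - g) * ζ with hb
  set f : ArithmeticFunction ℝ := Λ - lowPart U Λ with hf
  have hg1 : ∀ n, |g n| ≤ if n ≤ U then 1 else 0 := by
    intro n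
    rw [hg, lowPart_apply]
    split_ifs
    · rw [intCoe_apply]
      have := abs_moebius_le_one (n := n)
      exact_mod_cast this
    · simp
  have hlowΛ : ∀ n, |lowPart U Λ n| ≤ if n ≤ U then Real.log n else 0 := by
    intro n
    rw [lowPart_apply]
    split_ifs
    · rw [abs_of_nonneg vonMangoldt_nonneg]; exact vonMangoldt_le_log
    · simp
  have hdecomp : ∀ i ∈ S, ‖∑ n ∈ Ioc 0 x, (Λ n : ℂ) * i.2 n‖ ≤
      3 * U ^ 2 * ℒ * R + ‖∑ n ∈ Ioc 0 x, (twist i.2 (b * f)) n‖ := by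
    rintro ⟨q, χ⟩ hi
    obtain ⟨hq2, hqR, hprim⟩ := hS _ hi
    dsimp only at hq2 hqR hprim ⊢
    have : NeZero q := ⟨by omega⟩
    have hχ : χ ≠ 1 := by
      rintro rfl
      rw [DirichletCharacter.IsPrimitive, DirichletCharacter.conductor_one] at hprim
      omega
    have e : ∑ n ∈ Ioc 0 x, (Λ n : ℂ) * χ n =
        ∑ n ∈ Ioc 0 x, twist χ (lowPart U Λ) n + ∑ n ∈ Ioc 0 x, twist χ (g * log) n
        - ∑ n ∈ Ioc 0 x, twist χ (g * lowPart U Λ * ζ) n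
        + ∑ n ∈ Ioc 0 x, (twist χ (b * f)) n := by
      rw [← sum_add_distrib, ← sum_sub_distrib, ← sum_add_distrib]
      refine sum_congr rfl fun n _ => ?_
      rw [← twist_apply]
      conv_lhs => rw [vaughan_identity U]
      rw [twist_add, twist_sub, twist_add]
      simp only [ArithmeticFunction.add_apply, arith_sub_apply, hb, hf, hg]
    have b1 : ‖∑ n ∈ Ioc 0 x, twist χ (lowPart U Λ) n‖ ≤ U * ℒ := by
      calc _ ≤ ∑ n ∈ Ioc 0 x, if n ≤ U then ℒ else 0 := by
            refine (norm_sum_le _ _).trans (sum_le_sum fun n hn => ?_)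
            refine (norm_twist_le _ _ _).trans ((hlowΛ n).trans ?_)
            split_ifs
            · exact hlogle n (mem_Ioc.1 hn).2
            · rfl
        _ ≤ ∑ n ∈ Ioc 0 U, ℒ := by
            rw [← sum_filter]
            refine sum_le_sum_of_subset_of_nonneg ?_ fun _ _ _ => by linarith
            intro n; simp only [mem_filter, mem_Ioc]; omega
        _ = _ := by simp
    have b2 : ‖∑ n ∈ Ioc 0 x, twist χ (g * log) n‖ ≤ U * (R * ℒ) := by
      rw [twist_mul, sum_Ioc_mul_eq_sum_sum]
      calc _ ≤ ∑ n ∈ Ioc 0 x, if n ≤ U then R * ℒ else 0 := by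
            refine (norm_sum_le _ _).trans (sum_le_sum fun n hn => ?_)
            rw [norm_mul]
            have h1 := (norm_twist_le χ g n).trans (hg1 n)
            have h2 : ‖∑ m ∈ Ioc 0 (x / n), twist χ log m‖ ≤ R * ℒ := by
              refine (norm_sum_log_mul_char_le hχ (x / n)).trans ?_
              have := hlogle (x / n) (Nat.div_le_self _ _)
              have := Real.log_natCast_nonneg (x / n)
              gcongr
            split_ifs at h1 ⊢
            · calc _ ≤ 1 * (R * ℒ) := by gcongr
                _ = _ := one_mul _
            · rw [le_antisymm h1 (norm_nonneg _), zero_mul]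
        _ ≤ ∑ n ∈ Ioc 0 U, R * ℒ := by
            rw [← sum_filter]
            refine sum_le_sum_of_subset_of_nonneg ?_ fun _ _ _ => by positivity
            intro n; simp only [mem_filter, mem_Ioc]; omega
        _ = _ := by simp
    have hc : ∀ n, 1 ≤ n → |(g * lowPart U Λ) n| ≤ if n ≤ U ^ 2 then Real.log n else 0 := by
      intro n hn
      rw [ArithmeticFunction.mul_apply]
      split_ifs with h
      · calc _ ≤ ∑ p ∈ n.divisorsAntidiagonal, Λ p.2 := by
              refine (abs_sum_le_sum_abs _ _).trans (sum_le_sum fun p _ => ?_)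
              rw [abs_mul]
              have h1 : |g p.1| ≤ 1 := (hg1 _).trans (by split_ifs <;> norm_num)
              have h2 : |lowPart U Λ p.2| ≤ Λ p.2 := by
                rw [lowPart_apply]; split_ifs
                · rw [abs_of_nonneg vonMangoldt_nonneg]
                · simp [vonMangoldt_nonneg]
              calc _ ≤ 1 * Λ p.2 := by gcongr
                _ = _ := one_mul _
          _ = Real.log n := by
              rw [Nat.sum_divisorsAntidiagonal' (f := fun _ d => Λ d)]
              exact vonMangoldt_sum
      · refine le_of_eq ?_
        rw [abs_eq_zero]
        refine sum_eq_zero fun p hp => ?_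
        rw [Nat.mem_divisorsAntidiagonal] at hp
        by_cases h1 : p.1 ≤ U
        · by_cases h2 : p.2 ≤ U
          · exfalso; apply h; rw [← hp.1, sq]; gcongr
          · rw [lowPart_apply U Λ, if_neg h2, mul_zero]
        · rw [hg, lowPart_apply U _ p.1, if_neg h1, zero_mul]
    have b3 : ‖∑ n ∈ Ioc 0 x, twist χ (g * lowPart U Λ * ζ) n‖ ≤ U ^ 2 * (ℒ * R) := by
      rw [twist_mul, sum_Ioc_mul_eq_sum_sum]
      calc _ ≤ ∑ n ∈ Ioc 0 x, if n ≤ U ^ 2 then ℒ * R else 0 := by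
            refine (norm_sum_le _ _).trans (sum_le_sum fun n hn => ?_)
            rw [mem_Ioc] at hn
            rw [norm_mul]
            have h1 := (norm_twist_le χ (g * lowPart U Λ) n).trans (hc n hn.1)
            have h2 : ‖∑ m ∈ Ioc 0 (x / n), twist χ ζ m‖ ≤ R := by
              have : ∑ m ∈ Ioc 0 (x / n), twist χ ζ m = ∑ m ∈ Ioc 0 (x / n), χ m := by
                refine sum_congr rfl fun m hm => ?_
                rw [mem_Ioc] at hm
                simp [twist_apply, natCoe_apply, zeta_apply, show m ≠ 0 by omega]
              rw [this]
              exact (norm_sum_Ioc_le hχ _ _).trans (by exact_mod_cast hqR)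
            split_ifs at h1 ⊢
            · have := h1.trans (hlogle n hn.2)
              gcongr
            · rw [le_antisymm h1 (norm_nonneg _), zero_mul]
        _ ≤ ∑ n ∈ Ioc 0 (U ^ 2), ℒ * R := by
            rw [← sum_filter]
            refine sum_le_sum_of_subset_of_nonneg ?_ fun _ _ _ => by positivity
            intro n; simp only [mem_filter, mem_Ioc]; omega
        _ = _ := by simp
    rw [e]
    have hR1 : (1 : ℝ) ≤ R := by exact_mod_cast hR
    have hU1 : (1 : ℝ) ≤ U := by exact_mod_cast hU0
    have hUU : (U : ℝ) ≤ U ^ 2 := by nlinarith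
    have c1 : U * ℒ ≤ (U : ℝ) ^ 2 * ℒ * R := by
      calc U * ℒ = U * ℒ * 1 := by ring
        _ ≤ _ := by gcongr
    have c2 : U * (R * ℒ) ≤ (U : ℝ) ^ 2 * ℒ * R := by
      calc U * (R * ℒ) = U * ℒ * R := by ring
        _ ≤ _ := by gcongr
    refine (norm_add_le _ _).trans (add_le_add ?_ le_rfl)
    refine (norm_sub_le _ _).trans ?_
    have := norm_add_le (∑ n ∈ Ioc 0 x, twist χ (lowPart U Λ) n) (∑ n ∈ Ioc 0 x, twist χ (g * log) n)
    linarith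
  have hbil := bilinear_le R hR S (fun i hi => ⟨by have := (hS i hi).1; omega, (hS i hi).2⟩) hcard
    f b U x le_rfl (by
      intro n
      rw [hf, arith_sub_apply, lowPart_apply]
      split_ifs
      · simp [Real.log_natCast_nonneg]
      · rw [sub_zero, abs_of_nonneg vonMangoldt_nonneg]; exact vonMangoldt_le_log) (by
      intro n hn
      rw [hf, arith_sub_apply, lowPart_apply, if_pos hn, sub_self]) (by
      intro n
      rw [hb, coe_mul_zeta_apply]
      calc _ ≤ ∑ d ∈ n.divisors, (1 : ℝ) := by
            refine (abs_sum_le_sum_abs _ _).trans (sum_le_sum fun d _ => ?_)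
            rw [hg, arith_sub_apply, lowPart_apply]
            split_ifs
            · simp
            · rw [sub_zero, intCoe_apply]
              have := abs_moebius_le_one (n := d)
              exact_mod_cast this
        _ = _ := by simp) (by
      intro n hn
      rw [hb, coe_mul_zeta_apply]
      refine sum_eq_zero fun d hd => ?_
      have := Nat.divisor_le hd
      rw [hg, arith_sub_apply, lowPart_apply, if_pos (by omega), sub_self])
  calc _ ≤ ∑ i ∈ S, (3 * U ^ 2 * ℒ * R + ‖∑ n ∈ Ioc 0 x, (twist i.2 (b * f)) n‖) :=
        sum_le_sum hdecomp
    _ ≤ 3 * x * ℒ + 3 * x * ℒ ^ 4 := by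
        rw [sum_add_distrib]
        refine add_le_add ?_ hbil
        have h1 : #S * (U ^ 2 * R) ≤ x := by
          calc #S * (U ^ 2 * R) ≤ R ^ 2 * (U ^ 2 * R) := by gcongr
            _ = R ^ 15 := by rw [hU]; ring
            _ ≤ x := hx
        have h1' : (#S : ℝ) * (U ^ 2 * R) ≤ x := by exact_mod_cast h1
        rw [sum_const, nsmul_eq_mul]
        calc _ = 3 * ((#S : ℝ) * (U ^ 2 * R)) * ℒ := by ring
          _ ≤ _ := by gcongr
    _ ≤ 3 * x * ℒ ^ 4 + 3 * x * ℒ ^ 4 := by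
        gcongr
        exact le_self_pow₀ hℒ1 (by norm_num)
    _ = _ := by ring
end BoundedGaps

namespace BoundedGaps
open Finset Filter Asymptotics MeasureTheory Set
open scoped Topology

section MellinTail

variable {E : ℝ → ℂ} {D : ℝ} {N : ℕ}

theorem tail_locallyIntegrableOn (hm : Measurable E) (hD : ∀ t, ‖E t‖ ≤ D) :
    LocallyIntegrableOn E (Ioi 0) := by
  have : LocallyIntegrable E := by
    refine (locallyIntegrable_const (D : ℝ)).mono hm.aestronglyMeasurable ?_
    exact Eventually.of_forall fun t => (hD t).trans (Real.le_norm_self _)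
  exact this.locallyIntegrableOn _

theorem tail_isBigO_atTop (hD : ∀ t, ‖E t‖ ≤ D) : E =O[atTop] fun t : ℝ => t ^ (-(0 : ℝ)) := by
  refine IsBigO.of_bound D (Eventually.of_forall fun t => ?_)
  simpa using hD t

theorem tail_isBigO_zero (hN : 1 ≤ N) (h0 : ∀ t ≤ (N : ℝ), E t = 0) (b : ℝ) :
    E =O[𝓝[>] 0] fun t : ℝ => t ^ (-b) := by
  refine IsBigO.of_bound 1 ?_
  have : Iio (1 : ℝ) ∈ 𝓝[>] (0 : ℝ) := mem_nhdsWithin_of_mem_nhds (Iio_mem_nhds one_pos)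
  filter_upwards [this] with t ht
  have h1 : (1 : ℝ) ≤ N := by exact_mod_cast hN
  rw [h0 t (by rw [Set.mem_Iio] at ht; linarith)]
  simp only [norm_zero]
  positivity

theorem tail_mellin_differentiableAt (hm : Measurable E) (hD : ∀ t, ‖E t‖ ≤ D) (hN : 1 ≤ N)
    (h0 : ∀ t ≤ (N : ℝ), E t = 0) {s : ℂ} (hs : 0 < s.re) :
    DifferentiableAt ℂ (fun s => mellin E (-s)) s := by
  have := mellin_differentiableAt_of_isBigO_rpow (s := -s) (a := 0) (b := -s.re - 1)
    (tail_locallyIntegrableOn hm hD) (tail_isBigO_atTop hD) (by simpa using hs)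
    (tail_isBigO_zero hN h0 _) (by simp)
  exact this.comp s differentiableAt_id.neg

theorem tail_mellinConvergent (hm : Measurable E) (hD : ∀ t, ‖E t‖ ≤ D) (hN : 1 ≤ N)
    (h0 : ∀ t ≤ (N : ℝ), E t = 0) {s : ℂ} (hs : 0 < s.re) :
    MellinConvergent E (-s) :=
  mellinConvergent_of_isBigO_rpow (s := -s) (a := 0) (b := -s.re - 1)
    (tail_locallyIntegrableOn hm hD) (tail_isBigO_atTop hD) (by simpa using hs)
    (tail_isBigO_zero hN h0 _) (by simp)

theorem tail_mellin_norm_le (hD : ∀ t, ‖E t‖ ≤ D) (hN : 1 ≤ N)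
    (h0 : ∀ t ≤ (N : ℝ), E t = 0) {s : ℂ} (hs : 0 < s.re) :
    ‖mellin E (-s)‖ ≤ D * (N : ℝ) ^ (-s.re) / s.re := by
  have hN0 : (0 : ℝ) < N := by exact_mod_cast hN
  have e : mellin E (-s) = ∫ t in Ioi (N : ℝ), (t : ℂ) ^ (-s - 1) • E t := by
    rw [mellin]
    refine (setIntegral_eq_of_subset_of_forall_sdiff_eq_zero measurableSet_Ioi
      (Ioi_subset_Ioi hN0.le) fun t ht => ?_)
    rw [h0 t (by simpa using ht.2), smul_zero]
  have h_int : IntegrableOn (fun t : ℝ => D * t ^ (-s.re - 1)) (Ioi (N : ℝ)) :=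
    (integrableOn_Ioi_rpow_of_lt (by linarith) hN0).const_mul D
  rw [e]
  calc _ ≤ ∫ t in Ioi (N : ℝ), D * t ^ (-s.re - 1) := by
        refine norm_integral_le_of_norm_le h_int ?_
        refine (ae_restrict_mem measurableSet_Ioi).mono fun t ht => ?_
        have ht0 : 0 < t := hN0.trans ht
        rw [norm_smul, Complex.norm_cpow_eq_rpow_re_of_pos ht0, mul_comm]
        simp only [Complex.sub_re, Complex.neg_re, Complex.one_re]
        gcongr
        exact hD t
    _ = _ := by
        rw [integral_const_mul, integral_Ioi_rpow_of_lt (by linarith) hN0]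
        have : -s.re - 1 + 1 = -s.re := by ring
        rw [this]
        field_simp

end MellinTail

theorem integral_Ioi_sub_mul_cpow {N : ℝ} (hN : 0 < N) {s : ℂ} (hs : 1 < s.re) :
    IntegrableOn (fun t : ℝ => ((t - N : ℝ) : ℂ) * (t : ℂ) ^ (-(s + 1))) (Ioi N) ∧
    ∫ t in Ioi N, ((t - N : ℝ) : ℂ) * (t : ℂ) ^ (-(s + 1)) = (N : ℂ) ^ (1 - s) / (s * (s - 1)) := by
  have hs0 : s ≠ 0 := by rintro rfl; simp at hs; linarith
  have hs1 : s - 1 ≠ 0 := by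
    intro h; rw [sub_eq_zero] at h; subst h; simp at hs
  have i1 := integrableOn_Ioi_cpow_of_lt (a := -s) (by simp; linarith) hN
  have i2 := integrableOn_Ioi_cpow_of_lt (a := -(s + 1)) (by simp; linarith) hN
  have e : EqOn (fun t : ℝ => (t : ℂ) ^ (-s) - (N : ℂ) * (t : ℂ) ^ (-(s + 1)))
      (fun t : ℝ => ((t - N : ℝ) : ℂ) * (t : ℂ) ^ (-(s + 1))) (Ioi N) := by
    intro t ht
    have ht0 : (t : ℂ) ≠ 0 := by exact_mod_cast (hN.trans ht).ne'
    have : (t : ℂ) ^ (-s) = t * (t : ℂ) ^ (-(s + 1)) := by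
      rw [show -s = -(s + 1) + 1 by ring, Complex.cpow_add _ _ ht0, Complex.cpow_one, mul_comm]
    simp only [this]
    push_cast; ring
  have i3 := i1.sub (i2.const_mul (N : ℂ))
  refine ⟨IntegrableOn.congr_fun i3 e measurableSet_Ioi, ?_⟩
  rw [← setIntegral_congr_fun measurableSet_Ioi e, integral_sub i1 (i2.const_mul _),
    integral_const_mul, integral_Ioi_cpow_of_lt (by simp; linarith) hN,
    integral_Ioi_cpow_of_lt (by simp; linarith) hN]
  have hN' : (N : ℂ) ≠ 0 := by exact_mod_cast hN.ne'
  have e1 : (N : ℂ) ^ (-s + 1) = (N : ℂ) ^ (1 - s) := by congr 1; ring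
  have e2 : (N : ℂ) ^ (1 - s) = N * (N : ℂ) ^ (-(s + 1) + 1) := by
    rw [show 1 - s = -(s + 1) + 1 + 1 by ring, Complex.cpow_add _ _ hN', Complex.cpow_one, mul_comm]
  have h3 : -s + 1 ≠ 0 := by intro h; apply hs1; linear_combination -h
  have h4 : -(s + 1) + 1 ≠ 0 := by intro h; apply hs0; linear_combination -h
  rw [e1, e2]
  have h5 : -s + 1 = -(s - 1) := by ring
  have h6 : -(s + 1) + 1 = -s := by ring
  rw [h6, h5]
  field_simp
  ring

/-- Partial-summation formula for a Dirichlet series supported on `n > N`. -/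
theorem LSeries_tail_eq {f : ℕ → ℂ} (hf : ∀ n, ‖f n‖ ≤ 1) {N : ℕ} (hN : 1 ≤ N)
    (hf0 : ∀ n ≤ N, f n = 0) (c : ℂ) {D : ℝ}
    (hD : ∀ n ≥ N, ‖∑ k ∈ Finset.Icc 1 n, f k - c * (n - N : ℕ)‖ ≤ D) (hc : ‖c‖ ≤ 1) :
    ∃ E : ℝ → ℂ, Measurable E ∧ (∀ t, ‖E t‖ ≤ D + 1) ∧ (∀ t ≤ (N : ℝ), E t = 0) ∧
      ∀ s : ℂ, 1 < s.re → LSeries f s = c * ((N : ℂ) ^ (1 - s) / (s - 1)) + s * mellin E (-s) := by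
  have hN0 : (0 : ℝ) < N := by exact_mod_cast hN
  set S : ℝ → ℂ := fun t => ∑ k ∈ Finset.Icc 1 ⌊t⌋₊, f k with hS
  have hSm : Measurable S :=
    (measurable_from_top (f := fun n : ℕ => ∑ k ∈ Finset.Icc 1 n, f k)).comp Nat.measurable_floor
  set E : ℝ → ℂ := (Ioi (N : ℝ)).indicator fun t => S t - c * ((t - N : ℝ) : ℂ) with hE
  have hD0 : 0 ≤ D := (norm_nonneg _).trans (hD N le_rfl)
  have hEm : Measurable E := (hSm.sub (by fun_prop)).indicator measurableSet_Ioi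
  have hEb : ∀ t, ‖E t‖ ≤ D + 1 := by
    intro t
    by_cases ht : t ∈ Ioi (N : ℝ)
    · rw [hE, indicator_of_mem ht]
      rw [Set.mem_Ioi] at ht
      have hfl : N ≤ ⌊t⌋₊ := Nat.le_floor ht.le
      have e : S t - c * ((t - N : ℝ) : ℂ) = (S t - c * (⌊t⌋₊ - N : ℕ)) +
          c * (((⌊t⌋₊ : ℝ) - t : ℝ) : ℂ) := by
        push_cast [Nat.cast_sub hfl]; ring
      rw [e]
      refine (norm_add_le _ _).trans (add_le_add (hD _ hfl) ?_)
      rw [norm_mul, Complex.norm_real, Real.norm_eq_abs]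
      have h1 := Nat.floor_le (hN0.trans ht).le
      have h2 := Nat.lt_floor_add_one t
      refine mul_le_one₀ hc (abs_nonneg _) ?_
      rw [abs_le]; constructor <;> linarith
    · rw [hE, indicator_of_notMem ht, norm_zero]; linarith
  have hE0 : ∀ t ≤ (N : ℝ), E t = 0 := fun t ht => by
    rw [hE, indicator_of_notMem (by simpa using ht)]
  refine ⟨E, hEm, hEb, hE0, fun s hs => ?_⟩
  have hs0 : s ≠ 0 := by rintro rfl; simp at hs; linarith
  have hO : (fun n : ℕ ↦ ∑ k ∈ Finset.Icc 1 n, ‖f k‖) =O[atTop] fun n ↦ (n : ℝ) ^ (1 : ℝ) := by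
    refine IsBigO.of_bound 1 (Eventually.of_forall fun n => ?_)
    rw [Real.norm_of_nonneg (sum_nonneg fun _ _ => norm_nonneg _)]
    calc _ ≤ ∑ k ∈ Finset.Icc 1 n, (1 : ℝ) := sum_le_sum fun k _ => hf k
      _ = _ := by simp
  rw [LSeries_eq_mul_integral' f zero_le_one hs hO]
  have e1 : ∫ t in Ioi (1 : ℝ), (∑ k ∈ Finset.Icc 1 ⌊t⌋₊, f k) * (t : ℂ) ^ (-(s + 1)) =
      ∫ t in Ioi (N : ℝ), S t * (t : ℂ) ^ (-(s + 1)) := by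
    refine (setIntegral_eq_of_subset_of_ae_sdiff_eq_zero measurableSet_Ioi.nullMeasurableSet
      (Ioi_subset_Ioi (by exact_mod_cast hN)) ?_)
    have hne : ∀ᵐ t : ℝ, t ≠ N := by simp [ae_iff]
    filter_upwards [hne] with t ht h
    have h1 : t < N := lt_of_le_of_ne (by simpa using h.2) ht
    have : ∑ k ∈ Finset.Icc 1 ⌊t⌋₊, f k = 0 := by
      refine sum_eq_zero fun k hk => hf0 k ?_
      rw [Finset.mem_Icc] at hk
      refine hk.2.trans ?_
      exact (Nat.floor_lt (by have : (1 : ℝ) < t := h.1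
                              linarith)).2 h1 |>.le
    simp [this]
  have e2 : mellin E (-s) = ∫ t in Ioi (N : ℝ), (t : ℂ) ^ (-(s + 1)) * E t := by
    rw [mellin]
    refine (setIntegral_eq_of_subset_of_forall_sdiff_eq_zero measurableSet_Ioi
      (Ioi_subset_Ioi hN0.le) fun t ht => ?_).trans ?_
    · rw [hE0 t (by simpa using ht.2), smul_zero]
    · simp only [smul_eq_mul, neg_add', sub_eq_add_neg]
  have i2 : IntegrableOn (fun t : ℝ => (t : ℂ) ^ (-(s + 1)) * E t) (Ioi (N : ℝ)) := by
    have := tail_mellinConvergent hEm hEb hN hE0 (s := s) (by linarith)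
    have := IntegrableOn.mono_set this (Ioi_subset_Ioi hN0.le)
    simpa only [smul_eq_mul, neg_add', sub_eq_add_neg] using this
  obtain ⟨i1, e3⟩ := integral_Ioi_sub_mul_cpow hN0 hs
  have e4 : ∫ t in Ioi (N : ℝ), S t * (t : ℂ) ^ (-(s + 1)) =
      ∫ t in Ioi (N : ℝ), (c * (((t - N : ℝ) : ℂ) * (t : ℂ) ^ (-(s + 1))) +
        (t : ℂ) ^ (-(s + 1)) * E t) := by
    refine setIntegral_congr_fun measurableSet_Ioi fun t ht => ?_
    simp only [hE, indicator_of_mem ht]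
    ring
  rw [e1, e4, integral_add (i1.const_mul c) i2, integral_const_mul, e3, e2]
  have hs1 : s - 1 ≠ 0 := by
    intro h; rw [sub_eq_zero] at h; subst h; simp at hs
  push_cast
  field_simp

end BoundedGaps

namespace BoundedGaps
open Finset Filter Asymptotics MeasureTheory Set
open scoped Topology

theorem LSeries_head_tail {f : ℕ → ℂ} (hf : ∀ n, ‖f n‖ ≤ 1) {N : ℕ} (hN : 1 ≤ N)
    (c : ℂ) {D : ℝ} (hD : ∀ n ≥ N, ‖∑ k ∈ Finset.Ioc N n, f k - c * (n - N : ℕ)‖ ≤ D)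
    (hc : ‖c‖ ≤ 1) :
    ∃ E : ℝ → ℂ, Measurable E ∧ (∀ t, ‖E t‖ ≤ D + 1) ∧ (∀ t ≤ (N : ℝ), E t = 0) ∧
      ∀ s : ℂ, 1 < s.re → LSeries f s = ∑ n ∈ Finset.Icc 1 N, f n * (n : ℂ) ^ (-s) +
        c * ((N : ℂ) ^ (1 - s) / (s - 1)) + s * mellin E (-s) := by
  set f1 : ℕ → ℂ := fun n => if n ≤ N then f n else 0 with h1
  set f2 : ℕ → ℂ := fun n => if n ≤ N then 0 else f n with h2
  have hf2 : ∀ n, ‖f2 n‖ ≤ 1 := fun n => by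
    simp only [h2]; split_ifs; · simp
    · exact hf n
  have hf1 : ∀ n, ‖f1 n‖ ≤ 1 := fun n => by
    simp only [h1]; split_ifs; · exact hf n
    · simp
  obtain ⟨E, e1, e2, e3, e4⟩ := LSeries_tail_eq hf2 hN (fun n hn => by simp [h2, hn]) c (D := D) (by
    intro n hn
    have : ∑ k ∈ Finset.Icc 1 n, f2 k = ∑ k ∈ Finset.Ioc N n, f k := by
      simp only [h2]
      rw [show (fun k => if k ≤ N then 0 else f k) = fun k => if ¬ k ≤ N then f k else 0 by
        funext k; split_ifs <;> simp_all, ← sum_filter]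
      refine sum_congr ?_ fun _ _ => rfl
      ext k; simp only [Finset.mem_filter, Finset.mem_Icc, Finset.mem_Ioc]; omega
    rw [this]
    exact hD n hn) hc
  refine ⟨E, e1, e2, e3, fun s hs => ?_⟩
  have hsum : f = f1 + f2 := by
    ext n; simp only [h1, h2, Pi.add_apply]; split_ifs <;> simp
  have hs0 : s ≠ 0 := by rintro rfl; simp at hs; linarith
  have L1 : LSeries f1 s = ∑ n ∈ Finset.Icc 1 N, f n * (n : ℂ) ^ (-s) := by
    rw [LSeries, tsum_eq_sum (s := Finset.Icc 1 N)]
    · refine sum_congr rfl fun n hn => ?_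
      rw [Finset.mem_Icc] at hn
      rw [LSeries.term_of_ne_zero (by omega), h1]
      simp only [hn.2, if_true, Complex.cpow_neg, div_eq_mul_inv]
    · intro n hn
      rw [Finset.mem_Icc] at hn
      rcases Nat.eq_zero_or_pos n with rfl | h
      · simp
      · rw [LSeries.term_of_ne_zero (by omega), h1]
        simp only [show ¬ n ≤ N by omega, if_false, zero_div]
  rw [hsum, LSeries_add (LSeriesSummable_of_le_const_mul_rpow (x := 1) hs ⟨1, fun n _ => by simpa using hf1 n⟩)
    (LSeriesSummable_of_le_const_mul_rpow (x := 1) hs ⟨1, fun n _ => by simpa using hf2 n⟩), L1, e4 s hs, add_assoc]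
  congr 1
  rw [← hsum]

theorem norm_head_le {f : ℕ → ℂ} (hf : ∀ n, ‖f n‖ ≤ 1) {N : ℕ} {ℓ : ℝ} (hℓ : 1 ≤ ℓ)
    (hN : (N : ℝ) ≤ Real.exp ℓ) {s : ℂ} (hs : 1 - 1 / ℓ ≤ s.re) :
    ‖∑ n ∈ Finset.Icc 1 N, f n * (n : ℂ) ^ (-s)‖ ≤ 3 * (1 + ℓ) := by
  have h1 : ∀ n ∈ Finset.Icc 1 N, ‖f n * (n : ℂ) ^ (-s)‖ ≤ 3 * (n : ℝ)⁻¹ := by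
    intro n hn
    rw [Finset.mem_Icc] at hn
    have hn0 : (0 : ℝ) < n := by exact_mod_cast hn.1
    have hn1 : (1 : ℝ) ≤ n := by exact_mod_cast hn.1
    rw [norm_mul, Complex.norm_natCast_cpow_of_pos hn.1, Complex.neg_re]
    have hle : (n : ℝ) ^ (1 / ℓ) ≤ 3 := by
      calc (n : ℝ) ^ (1 / ℓ) ≤ (Real.exp ℓ) ^ (1 / ℓ) := by
            gcongr
            exact (by exact_mod_cast hn.2 : (n : ℝ) ≤ N).trans hN
        _ = Real.exp 1 := by
            rw [← Real.exp_mul]; congr 1; field_simp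
        _ ≤ 3 := by have := Real.exp_one_lt_d9; linarith
    calc ‖f n‖ * (n : ℝ) ^ (-s.re) ≤ 1 * (n : ℝ) ^ (1 / ℓ - 1) := by
          gcongr
          · exact hf n
          · linarith
      _ = (n : ℝ) ^ (1 / ℓ) * (n : ℝ)⁻¹ := by
          rw [one_mul, sub_eq_add_neg, Real.rpow_add hn0, Real.rpow_neg_one]
      _ ≤ _ := by gcongr
  refine (norm_sum_le _ _).trans ((sum_le_sum h1).trans ?_)
  rw [← mul_sum]
  have h2 := sum_inv_Ioc_le N
  have h3 : Finset.Icc 1 N = Finset.Ioc 0 N := by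
    ext; simp only [Finset.mem_Icc, Finset.mem_Ioc]; omega
  rw [h3]
  have h4 : Real.log N ≤ ℓ := by
    rcases Nat.eq_zero_or_pos N with rfl | h
    · simp; linarith
    · rw [← Real.log_exp ℓ]; exact Real.log_le_log (by exact_mod_cast h) hN
  linarith

theorem norm_tail_le {E : ℝ → ℂ} {D : ℝ} {N : ℕ} (hD : ∀ t, ‖E t‖ ≤ D) (hN : 1 ≤ N)
    (h0 : ∀ t ≤ (N : ℝ), E t = 0) {ℓ : ℝ} (hℓ : 2 ≤ ℓ) (hNℓ : (N : ℝ) ≤ Real.exp ℓ)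
    (hNℓ' : Real.exp ℓ ≤ 2 * N)
    {s : ℂ} (hs : 1 - 1 / ℓ ≤ s.re) (hsn : D * ‖s‖ ≤ 3 * Real.exp ℓ) :
    ‖s * mellin E (-s)‖ ≤ 36 := by
  have hℓ0 : 0 < ℓ := by linarith
  have h12 : 1 / ℓ ≤ 1 / 2 := by gcongr
  have hre : 1 / 2 ≤ s.re := by linarith
  have hN0 : (0 : ℝ) < N := by exact_mod_cast hN
  have hN1 : (1 : ℝ) ≤ N := by exact_mod_cast hN
  have hD0 : 0 ≤ D := (norm_nonneg _).trans (hD 0)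
  have h1 := tail_mellin_norm_le hD hN h0 (s := s) (by linarith)
  rw [norm_mul]
  have h2 : (N : ℝ) ^ (-s.re) ≤ 3 * (N : ℝ)⁻¹ := by
    have hle : (N : ℝ) ^ (1 / ℓ) ≤ 3 := by
      calc (N : ℝ) ^ (1 / ℓ) ≤ (Real.exp ℓ) ^ (1 / ℓ) := by gcongr
        _ = Real.exp 1 := by
            rw [← Real.exp_mul]; congr 1; field_simp
        _ ≤ 3 := by have := Real.exp_one_lt_d9; linarith
    calc (N : ℝ) ^ (-s.re) ≤ (N : ℝ) ^ (1 / ℓ - 1) := by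
          gcongr
          linarith
      _ = (N : ℝ) ^ (1 / ℓ) * (N : ℝ)⁻¹ := by
          rw [sub_eq_add_neg, Real.rpow_add hN0, Real.rpow_neg_one]
      _ ≤ _ := by gcongr
  calc ‖s‖ * ‖mellin E (-s)‖ ≤ ‖s‖ * (D * (3 * (N : ℝ)⁻¹) / (1 / 2)) := by
        gcongr
        refine h1.trans ?_
        gcongr
    _ = (D * ‖s‖) * 6 * (N : ℝ)⁻¹ := by ring
    _ ≤ (3 * (2 * N)) * 6 * (N : ℝ)⁻¹ := by
        have : D * ‖s‖ ≤ 3 * (2 * N) := by linarith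
        gcongr
    _ = 36 := by field_simp; norm_num

theorem exists_nat_near_exp {ℓ : ℝ} (hℓ : 0 ≤ ℓ) :
    ∃ N : ℕ, 1 ≤ N ∧ (N : ℝ) ≤ Real.exp ℓ ∧ Real.exp ℓ ≤ 2 * N := by
  have h1 : 1 ≤ Real.exp ℓ := Real.one_le_exp hℓ
  refine ⟨⌊Real.exp ℓ⌋₊, Nat.le_floor (by simpa using h1), Nat.floor_le (by positivity), ?_⟩
  have h2 := Nat.lt_floor_add_one (Real.exp ℓ)
  have h3 : (1 : ℝ) ≤ ⌊Real.exp ℓ⌋₊ := by exact_mod_cast Nat.le_floor (by simpa using h1)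
  linarith

theorem norm_le_re_add_abs_im {s : ℂ} (h : 0 ≤ s.re) : ‖s‖ ≤ s.re + |s.im| := by
  have := Complex.norm_le_abs_re_add_abs_im s
  rwa [abs_of_nonneg h] at this

/-- Upper bound for a nonprincipal `L`-function slightly to the left of the line `Re s = 1`. -/
theorem norm_LFunction_le {q : ℕ} [NeZero q] {χ : DirichletCharacter ℂ q} (hχ : χ ≠ 1)
    {ℓ : ℝ} (hℓ : 2 ≤ ℓ) {s : ℂ} (hs : 1 - 1 / ℓ ≤ s.re) (hs3 : s.re ≤ 3)
    (hq : q * (|s.im| + 3) ≤ Real.exp ℓ) :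
    ‖χ.LFunction s‖ ≤ 24 * ℓ := by
  have hℓ0 : 0 < ℓ := by linarith
  have h12 : 1 / ℓ ≤ 1 / 2 := by gcongr
  obtain ⟨N, hN1, hN2, hN3⟩ := exists_nat_near_exp hℓ0.le
  have hq1 : (1 : ℝ) ≤ q := by exact_mod_cast NeZero.one_le
  obtain ⟨E, e1, e2, e3, e4⟩ := LSeries_head_tail (f := fun n => χ n) (fun n => χ.norm_le_one _) hN1 0
    (D := q) (fun n _ => by simpa using norm_sum_Ioc_le hχ N n) (by simp)
  have key : χ.LFunction s = ∑ n ∈ Finset.Icc 1 N, χ n * (n : ℂ) ^ (-s) + s * mellin E (-s) := by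
    have hopen : IsOpen {z : ℂ | 0 < z.re} := isOpen_lt continuous_const Complex.continuous_re
    have d1 : DifferentiableOn ℂ χ.LFunction {z : ℂ | 0 < z.re} :=
      (DirichletCharacter.differentiable_LFunction hχ).differentiableOn
    have d2 : DifferentiableOn ℂ (fun s => ∑ n ∈ Finset.Icc 1 N, χ n * (n : ℂ) ^ (-s) + s * mellin E (-s))
        {z : ℂ | 0 < z.re} := by
      intro z hz
      refine DifferentiableAt.differentiableWithinAt ?_
      refine DifferentiableAt.add ?_ (differentiableAt_id.mul (tail_mellin_differentiableAt e1 e2 hN1 e3 hz))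
      refine DifferentiableAt.fun_sum fun n hn => ?_
      rw [Finset.mem_Icc] at hn
      refine DifferentiableAt.const_mul (DifferentiableAt.const_cpow differentiableAt_id.neg
        (Or.inl (by simp; omega))) _
    have hpre : IsPreconnected {z : ℂ | 0 < z.re} := (convex_halfSpace_re_gt 0).isPreconnected
    refine (d1.analyticOnNhd hopen).eqOn_of_preconnected_of_eventuallyEq (d2.analyticOnNhd hopen) hpre
      (z₀ := 2) (by simp) ?_ (show 0 < s.re by linarith)
    have : {z : ℂ | 1 < z.re} ∈ 𝓝 (2 : ℂ) :=
      (isOpen_lt continuous_const Complex.continuous_re).mem_nhds (by simp)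
    filter_upwards [this] with z hz
    rw [DirichletCharacter.LFunction_eq_LSeries χ hz, e4 z hz]
    simp
  rw [key]
  refine (norm_add_le _ _).trans ?_
  have h1 := norm_head_le (f := fun n => χ n) (fun n => χ.norm_le_one _) (by linarith) hN2 hs
  have h2 := norm_tail_le e2 hN1 e3 hℓ hN2 hN3 hs (by
    have := norm_le_re_add_abs_im (s := s) (by linarith)
    calc ((q : ℝ) + 1) * ‖s‖ ≤ (2 * q) * (|s.im| + 3) := by gcongr <;> linarith
      _ = 2 * (q * (|s.im| + 3)) := by ring
      _ ≤ 3 * Real.exp ℓ := by have := Real.exp_pos ℓ; linarith)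
  linarith

theorem norm_sum_Ioc_one_sub_le {q : ℕ} [NeZero q] (N n : ℕ) (hn : N ≤ n) :
    ‖∑ k ∈ Finset.Ioc N n, (1 : DirichletCharacter ℂ q) k -
      ((q.totient : ℂ) / q) * (n - N : ℕ)‖ ≤ 2 * q := by
  have hq0 : (q : ℂ) ≠ 0 := by exact_mod_cast NeZero.ne q
  have hq1 : 0 < q := NeZero.pos q
  induction h : n - N using Nat.strong_induction_on generalizing N with
  | _ d ih =>
    by_cases hd : d ≤ q
    · have hc : ‖((q.totient : ℂ) / q)‖ ≤ 1 := by
        rw [norm_div, Complex.norm_natCast, Complex.norm_natCast]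
        exact div_le_one_of_le₀ (by exact_mod_cast Nat.totient_le q) (by positivity)
      calc _ ≤ ∑ k ∈ Finset.Ioc N n, (1 : ℝ) + 1 * d := by
            refine (norm_sub_le _ _).trans (add_le_add ((norm_sum_le _ _).trans
              (sum_le_sum fun k _ => DirichletCharacter.norm_le_one _ _)) ?_)
            rw [norm_mul, Complex.norm_natCast]
            gcongr
        _ = 2 * d := by simp [h]; ring
        _ ≤ _ := by gcongr
    · have e : Finset.Ioc N n = Finset.Ico (N + 1) (N + 1 + q) ∪ Finset.Ioc (N + q) n := by
        ext; simp only [Finset.mem_union, Finset.mem_Ioc, Finset.mem_Ico]; omega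
      have hdisj : Disjoint (Finset.Ico (N + 1) (N + 1 + q)) (Finset.Ioc (N + q) n) := by
        rw [Finset.disjoint_left]; intro k
        simp only [Finset.mem_Ioc, Finset.mem_Ico]; omega
      have := ih (n - (N + q)) (by omega) (N + q) (by omega) rfl
      rw [e, sum_union hdisj, sum_Ico_period]
      have e2 : ∑ x : ZMod q, (1 : DirichletCharacter ℂ q) x = q.totient := by
        have := MulChar.sum_one_eq_card_units (R := ZMod q) (R' := ℂ)
        rw [ZMod.card_units_eq_totient] at this
        exact_mod_cast this
      have e3 : ((d : ℕ) : ℂ) = q + (n - (N + q) : ℕ) := by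
        rw [← Nat.cast_add]; congr 1; omega
      rw [e2, e3]
      convert this using 2
      field_simp
      ring

theorem norm_LSeries_one_le {q : ℕ} [NeZero q]
    {ℓ : ℝ} (hℓ : 2 ≤ ℓ) {s : ℂ} (hs : 1 < s.re) (hs3 : s.re ≤ 3)
    (hq : q * (|s.im| + 3) ≤ Real.exp ℓ) :
    ‖LSeries (fun n => (1 : DirichletCharacter ℂ q) n) s‖ ≤ 24 * ℓ + 1 / ‖s - 1‖ := by
  have hℓ0 : 0 < ℓ := by linarith
  obtain ⟨N, hN1, hN2, hN3⟩ := exists_nat_near_exp hℓ0.le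
  have hq1 : (1 : ℝ) ≤ q := by exact_mod_cast NeZero.one_le
  have hc : ‖((q.totient : ℂ) / q)‖ ≤ 1 := by
    rw [norm_div, Complex.norm_natCast, Complex.norm_natCast]
    exact div_le_one_of_le₀ (by exact_mod_cast Nat.totient_le q) (by positivity)
  obtain ⟨E, e1, e2, e3, e4⟩ := LSeries_head_tail (f := fun n => (1 : DirichletCharacter ℂ q) n)
    (fun n => DirichletCharacter.norm_le_one _ _) hN1 _
    (D := 2 * q) (fun n hn => norm_sum_Ioc_one_sub_le N n hn) hc
  have hsℓ : 1 - 1 / ℓ ≤ s.re := by have : 0 < 1 / ℓ := by positivity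
                                    linarith
  rw [e4 s hs]
  refine (norm_add_le _ _).trans ?_
  have h1 := norm_head_le (f := fun n => (1 : DirichletCharacter ℂ q) n)
    (fun n => DirichletCharacter.norm_le_one _ _) (by linarith) hN2 hsℓ
  have h2 := norm_tail_le e2 hN1 e3 hℓ hN2 hN3 hsℓ (by
    have := norm_le_re_add_abs_im (s := s) (by linarith)
    calc (2 * (q : ℝ) + 1) * ‖s‖ ≤ (3 * q) * (|s.im| + 3) := by gcongr <;> linarith
      _ = 3 * (q * (|s.im| + 3)) := by ring
      _ ≤ 3 * Real.exp ℓ := by gcongr)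
  have h3 : ‖((q.totient : ℂ) / q) * ((N : ℂ) ^ (1 - s) / (s - 1))‖ ≤ 1 / ‖s - 1‖ := by
    rw [norm_mul, norm_div (_ ^ _), Complex.norm_natCast_cpow_of_pos hN1]
    have : (N : ℝ) ^ ((1 - s).re) ≤ 1 :=
      Real.rpow_le_one_of_one_le_of_nonpos (by exact_mod_cast hN1) (by simp; linarith)
    calc _ ≤ 1 * (1 / ‖s - 1‖) := by gcongr
      _ = _ := one_mul _
  have h4 := norm_add_le (∑ n ∈ Finset.Icc 1 N, (1 : DirichletCharacter ℂ q) n * (n : ℂ) ^ (-s))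
    (((q.totient : ℂ) / q) * ((N : ℂ) ^ (1 - s) / (s - 1)))
  linarith

end BoundedGaps

namespace BoundedGaps
open Finset Filter
open scoped Topology

theorem norm_deriv_LFunction_le {q : ℕ} [NeZero q] {χ : DirichletCharacter ℂ q} (hχ : χ ≠ 1)
    {ℓ : ℝ} (hℓ : 2 ≤ ℓ) {s : ℂ} (hs : 1 - 1 / (2 * ℓ) ≤ s.re) (hs3 : s.re ≤ 2)
    (hq : q * (|s.im| + 4) ≤ Real.exp ℓ) :
    ‖deriv χ.LFunction s‖ ≤ 48 * ℓ ^ 2 := by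
  have hℓ0 : 0 < ℓ := by linarith
  have hr : 1 / (2 * ℓ) ≤ 1 := by rw [div_le_one (by positivity)]; linarith
  have h := Complex.norm_deriv_le_of_forall_mem_sphere_norm_le (c := s) (R := 1 / (2 * ℓ))
    (f := χ.LFunction) (C := 24 * ℓ) (by positivity)
    (DirichletCharacter.differentiable_LFunction hχ).diffContOnCl (by
      intro z hz
      rw [mem_sphere_iff_norm] at hz
      have h1 := (Complex.abs_re_le_norm (z - s)).trans hz.le
      have h2 := (Complex.abs_im_le_norm (z - s)).trans hz.le
      rw [Complex.sub_re, abs_le] at h1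
      rw [Complex.sub_im] at h2
      refine norm_LFunction_le hχ hℓ ?_ (by linarith) (le_trans ?_ hq)
      · have : 1 / ℓ = 1 / (2 * ℓ) + 1 / (2 * ℓ) := by field_simp; norm_num
        linarith
      · have := abs_sub_abs_le_abs_sub z.im s.im
        exact mul_le_mul_of_nonneg_left (by linarith) (by positivity))
  calc _ ≤ _ := h
    _ = _ := by field_simp; ring

theorem norm_LFunction_sub_le {q : ℕ} [NeZero q] {χ : DirichletCharacter ℂ q} (hχ : χ ≠ 1)
    {ℓ T : ℝ} (hℓ : 2 ≤ ℓ) (hq : q * (T + 4) ≤ Real.exp ℓ) {s z : ℂ}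
    (hs : 1 - 1 / (2 * ℓ) ≤ s.re) (hs3 : s.re ≤ 2) (hsT : |s.im| ≤ T)
    (hz : 1 - 1 / (2 * ℓ) ≤ z.re) (hz3 : z.re ≤ 2) (hzT : |z.im| ≤ T) :
    ‖χ.LFunction z - χ.LFunction s‖ ≤ 48 * ℓ ^ 2 * ‖z - s‖ := by
  have hconv : Convex ℝ (Set.Icc (1 - 1 / (2 * ℓ)) 2 ×ℂ Set.Icc (-T) T) :=
    ((convex_Icc _ _).linear_preimage Complex.reLm).inter
      ((convex_Icc _ _).linear_preimage Complex.imLm)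
  refine hconv.norm_image_sub_le_of_norm_deriv_le (𝕜 := ℂ)
    (fun x _ => (DirichletCharacter.differentiable_LFunction hχ) x) ?_ ⟨⟨hs, hs3⟩, abs_le.1 hsT⟩
    ⟨⟨hz, hz3⟩, abs_le.1 hzT⟩
  rintro w ⟨⟨h1, h2⟩, h3⟩
  refine norm_deriv_LFunction_le hχ hℓ h1 h2 (le_trans ?_ hq)
  have := abs_le.2 h3
  gcongr

theorem norm_quad_le {x : ℝ} (hx0 : 0 ≤ x) (hx1 : x ≤ 1) {a b : ℂ} (ha : a = 0 ∨ a = 1 ∨ a = -1)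
    (hb : b = 0 ∨ b = 1 ∨ b = -1) :
    ‖(1 - (x : ℂ)) * (1 - a * x) * (1 - b * x) * (1 - a * starRingEnd ℂ b * x)‖ ≤ 1 := by
  have h1 : |1 - x| ≤ 1 := by rw [abs_le]; constructor <;> linarith
  have h2 : |1 - x ^ 2| ≤ 1 := by rw [abs_le]; constructor <;> nlinarith
  have H : ∀ y : ℝ, |y| ≤ 1 → ‖(y : ℂ)‖ ≤ 1 := fun y hy => by
    rwa [Complex.norm_real]
  have k1 : |(1 - x) ^ 2| ≤ 1 := by rw [abs_pow]; exact pow_le_one₀ (abs_nonneg _) h1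
  have k4 : |(1 - x) ^ 4| ≤ 1 := by rw [abs_pow]; exact pow_le_one₀ (abs_nonneg _) h1
  have k2 : |(1 - x ^ 2) ^ 2| ≤ 1 := by rw [abs_pow]; exact pow_le_one₀ (abs_nonneg _) h2
  have z1 := H _ h1
  have z2 := H _ h2
  have z3 := H _ k1
  have z4 := H _ k4
  have z5 := H _ k2
  push_cast at z1 z2 z3 z4 z5
  rcases ha with rfl | rfl | rfl <;> rcases hb with rfl | rfl | rfl <;>
    simp only [map_zero, map_one, map_neg] <;> ring_nf <;> ring_nf at z1 z2 z3 z4 z5 <;> assumption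

theorem one_le_norm_LSeries_prod {q r : ℕ} [NeZero q] [NeZero r] {χ : DirichletCharacter ℂ q}
    {ψ : DirichletCharacter ℂ r} (hχ : χ ^ 2 = 1) (hψ : ψ ^ 2 = 1)
    {ξ : DirichletCharacter ℂ (q * r)} (hξ : ∀ n : ℕ, χ n * starRingEnd ℂ (ψ n) = ξ n)
    {σ : ℝ} (hσ : 1 < σ) :
    1 ≤ ‖LSeries (fun n : ℕ => ((1 : DirichletCharacter ℂ 1) n : ℂ)) σ *
      LSeries (fun n : ℕ => (χ n : ℂ)) σ *
      LSeries (fun n : ℕ => (ψ n : ℂ)) σ * LSeries (fun n : ℕ => (ξ n : ℂ)) σ‖ := by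
  have hs : 1 < ((σ : ℂ)).re := by simpa using hσ
  have H := (((DirichletCharacter.LSeries_eulerProduct_hasProd (1 : DirichletCharacter ℂ 1) hs).mul
    (DirichletCharacter.LSeries_eulerProduct_hasProd χ hs)).mul
    (DirichletCharacter.LSeries_eulerProduct_hasProd ψ hs)).mul
    (DirichletCharacter.LSeries_eulerProduct_hasProd ξ hs)
  refine ge_of_tendsto (H.norm) (Eventually.of_forall fun S => ?_)
  refine Finset.prod_induction _ (fun x => (1 : ℝ) ≤ x) (fun a b ha hb => one_le_mul_of_one_le_of_one_le ha hb)
    le_rfl fun p _ => ?_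
  set x : ℝ := (p : ℝ) ^ (-σ) with hx
  have hp : (2 : ℝ) ≤ p := by exact_mod_cast p.2.two_le
  have hxp : 0 < x := by positivity
  have hx1 : x < 1 := Real.rpow_lt_one_of_one_lt_of_neg (by linarith) (by linarith)
  have e : ((p : ℕ) : ℂ) ^ (-(σ : ℂ)) = x := by
    rw [hx, Complex.ofReal_cpow (by positivity)]; simp
  rw [e, ← hξ]
  have one : (1 : DirichletCharacter ℂ 1) (p : ℕ) = 1 := by
    rw [MulChar.one_apply (isUnit_of_subsingleton _)]
  rw [one, one_mul, ← mul_inv, ← mul_inv, ← mul_inv, norm_inv]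
  have hq := norm_quad_le hxp.le hx1.le (MulChar.isQuadratic_iff_sq_eq_one.2 hχ (p : ℕ))
    (MulChar.isQuadratic_iff_sq_eq_one.2 hψ (p : ℕ))
  refine (one_le_inv₀ (norm_pos_iff.2 ?_)).2 hq
  have nz : ∀ c : ℂ, ‖c‖ ≤ 1 → 1 - c * x ≠ 0 := by
    intro c hc h
    have h1 : ‖c * x‖ = 1 := by rw [← sub_eq_zero.1 h, norm_one]
    rw [norm_mul, Complex.norm_real, Real.norm_of_nonneg hxp.le] at h1
    have : ‖c‖ * x ≤ 1 * x := by gcongr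
    linarith
  have c1 := nz 1 (by simp)
  rw [one_mul] at c1
  refine mul_ne_zero (mul_ne_zero (mul_ne_zero c1 (nz _ (χ.norm_le_one _))) (nz _ (ψ.norm_le_one _))) (nz _ ?_)
  rw [hξ]
  exact ξ.norm_le_one _

/-- Two different primitive real characters cannot both have a small value at `1`. -/
theorem repulsion {q r : ℕ} [NeZero q] [NeZero r] {χ : DirichletCharacter ℂ q}
    {ψ : DirichletCharacter ℂ r} (hχp : χ.IsPrimitive) (hψp : ψ.IsPrimitive)
    (hne : (⟨q, χ⟩ : Σ n, DirichletCharacter ℂ n) ≠ ⟨r, ψ⟩)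
    (hχ1 : χ ≠ 1) (hψ1 : ψ ≠ 1) (hχ : χ ^ 2 = 1) (hψ : ψ ^ 2 = 1)
    {ℓ : ℝ} (hℓ : 2 ≤ ℓ) (hq : (q * r : ℕ) * 4 ≤ Real.exp ℓ) :
    1 ≤ 10 ^ 5 * ℓ ^ 3 * max ‖χ.LFunction 1‖ ‖ψ.LFunction 1‖ := by
  by_contra! hcon
  have hqr : NeZero (q * r) := ⟨mul_ne_zero (NeZero.ne q) (NeZero.ne r)⟩
  obtain ⟨ξ, hξ1, hξ⟩ := exists_char_mul_conj hχp hψp hne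
  set m := max ‖χ.LFunction 1‖ ‖ψ.LFunction 1‖ with hm
  have hℓ0 : 0 < ℓ := by linarith
  set η : ℝ := 1 / (10 ^ 6 * ℓ ^ 5) with hη
  have hη0 : 0 < η := by positivity
  have hη1 : η ≤ 1 := by
    rw [hη, div_le_one (by positivity)]
    have : 1 ≤ ℓ ^ 5 := one_le_pow₀ (by linarith)
    linarith
  have hq1 : (q : ℝ) * 4 ≤ Real.exp ℓ := le_trans (by
    gcongr; exact Nat.le_mul_of_pos_right _ (NeZero.pos r)) hq
  have hr1 : (r : ℝ) * 4 ≤ Real.exp ℓ := le_trans (by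
    gcongr; exact Nat.le_mul_of_pos_left _ (NeZero.pos q)) hq
  have h11 : ((1 : ℕ) : ℝ) * 4 ≤ Real.exp ℓ := le_trans (by
    gcongr; exact NeZero.one_le) hq
  have hs : (1 : ℝ) < ((1 + η : ℝ) : ℂ).re := by simpa using hη0
  have hinv : 0 < 1 / (2 * ℓ) := by positivity
  have bnd : ∀ {N : ℕ} [NeZero N] (φ : DirichletCharacter ℂ N), φ ≠ 1 → (N : ℝ) * 4 ≤ Real.exp ℓ →
      ‖φ.LFunction 1‖ ≤ m →
        ‖LSeries (fun n : ℕ => (φ n : ℂ)) (1 + η : ℝ)‖ ≤ m + 48 * ℓ ^ 2 * η := by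
    intro N _ φ hφ hN hφm
    rw [← DirichletCharacter.LFunction_eq_LSeries φ hs]
    have := norm_LFunction_sub_le hφ hℓ (T := 0) (by simpa using hN) (s := 1) (z := (1 + η : ℝ))
      (by simp; linarith) (by simp) (by simp) (by simp only [Complex.ofReal_re]; linarith)
      (by simp only [Complex.ofReal_re]; linarith) (by simp only [Complex.ofReal_im]; simp)
    have e : ‖((1 + η : ℝ) : ℂ) - 1‖ = η := by
      rw [← Complex.ofReal_one, ← Complex.ofReal_sub, Complex.norm_real,
        Real.norm_of_nonneg (by linarith)]; ring
    rw [e] at this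
    have h2 := norm_le_norm_add_norm_sub' (φ.LFunction (1 + η : ℝ)) (φ.LFunction 1)
    linarith
  have b1 := bnd χ hχ1 hq1 (le_max_left _ _)
  have b2 := bnd ψ hψ1 hr1 (le_max_right _ _)
  have b3 : ‖LSeries (fun n : ℕ => (ξ n : ℂ)) (1 + η : ℝ)‖ ≤ 24 * ℓ := by
    rw [← DirichletCharacter.LFunction_eq_LSeries ξ hs]
    refine norm_LFunction_le hξ1 hℓ ?_ (by simp only [Complex.ofReal_re]; linarith) (le_trans ?_ hq)
    · have : 0 < 1 / ℓ := by positivity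
      linarith
    · simp only [Complex.ofReal_im, abs_zero]
      gcongr; norm_num
  have b0 : ‖LSeries (fun n : ℕ => ((1 : DirichletCharacter ℂ 1) n : ℂ)) (1 + η : ℝ)‖ ≤ 2 / η := by
    have := norm_LSeries_one_le (q := 1) hℓ hs (by simp only [Complex.ofReal_re]; linarith) (le_trans (by
      simp only [Complex.ofReal_im, abs_zero]
      gcongr; norm_num) h11)
    have e : ‖((1 + η : ℝ) : ℂ) - 1‖ = η := by
      rw [← Complex.ofReal_one, ← Complex.ofReal_sub, Complex.norm_real,
        Real.norm_of_nonneg (by linarith)]; ring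
    rw [e] at this
    refine this.trans ?_
    have h24 : 24 * ℓ ≤ 1 / η := by
      rw [hη, one_div_one_div]
      have h1 : ℓ ^ 1 ≤ ℓ ^ 5 := pow_le_pow_right₀ (by linarith) (by norm_num)
      nlinarith
    calc _ ≤ 1 / η + 1 / η := by linarith
      _ = _ := by ring
  have key := one_le_norm_LSeries_prod hχ hψ hξ (σ := 1 + η) (by linarith)
  rw [norm_mul, norm_mul, norm_mul] at key
  have hmle : m ≤ 48 * ℓ ^ 2 * η := by
    have h1 : 48 * ℓ ^ 2 * η = 48 / (10 ^ 6 * ℓ ^ 3) := by rw [hη]; field_simp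
    rw [h1, le_div_iff₀ (by positivity)]
    linarith
  have hm0 : 0 ≤ m := (norm_nonneg _).trans (le_max_left _ _)
  have : (1 : ℝ) ≤ 2 / η * (96 * ℓ ^ 2 * η) * (96 * ℓ ^ 2 * η) * (24 * ℓ) := by
    refine key.trans ?_
    gcongr
    · exact b1.trans (by linarith)
    · exact b2.trans (by linarith)
  have e : 2 / η * (96 * ℓ ^ 2 * η) * (96 * ℓ ^ 2 * η) * (24 * ℓ) = 442368 * ℓ ^ 5 * η := by
    field_simp; ring
  rw [e, hη] at this
  have e2 : 442368 * ℓ ^ 5 * (1 / (10 ^ 6 * ℓ ^ 5)) = 442368 / 10 ^ 6 := by field_simp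
  rw [e2] at this
  norm_num at this

end BoundedGaps

namespace BoundedGaps
open Finset Filter
open scoped Topology

/-- The logarithmic size attached to the conductor level `Q`. -/
noncomputable def logLevel (Q : ℕ) : ℝ := 2 * Real.log (3 * Q)

/-- No real primitive character of conductor at most `Q` has an exceptionally small value at `1`. -/
def IsGoodLevel (Q : ℕ) : Prop :=
  ∀ (q : ℕ) [NeZero q] (χ : DirichletCharacter ℂ q), q ≤ Q → χ.IsPrimitive → χ ≠ 1 → χ ^ 2 = 1 →
    1 ≤ 10 ^ 6 * logLevel Q ^ 3 * ‖χ.LFunction 1‖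

theorem two_le_logLevel {Q : ℕ} (hQ : 1 ≤ Q) : 2 ≤ logLevel Q := by
  unfold logLevel
  have h1 : (1 : ℝ) ≤ Q := by exact_mod_cast hQ
  have : 1 ≤ Real.log (3 * Q) := by
    rw [Real.le_log_iff_exp_le (by positivity)]
    linarith [Real.exp_one_lt_d9]
  linarith

theorem exp_logLevel {Q : ℕ} (hQ : 1 ≤ Q) : Real.exp (logLevel Q) = 9 * Q ^ 2 := by
  have h1 : (1 : ℝ) ≤ Q := by exact_mod_cast hQ
  rw [logLevel, two_mul, Real.exp_add, Real.exp_log (by positivity)]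
  ring

theorem logLevel_succ_le {Q : ℕ} (hQ : 1 ≤ Q) : logLevel (Q + 1) ≤ 2 * logLevel Q := by
  unfold logLevel
  have h1 : (1 : ℝ) ≤ Q := by exact_mod_cast hQ
  have : Real.log (3 * (Q + 1 : ℕ)) ≤ Real.log ((3 * Q) ^ 2) :=
    Real.log_le_log (by positivity) (by push_cast; nlinarith)
  rw [Real.log_pow] at this
  push_cast at this ⊢
  linarith

theorem tendsto_logLevel : Tendsto logLevel atTop atTop := by
  refine Tendsto.const_mul_atTop (by norm_num) (Real.tendsto_log_atTop.comp ?_)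
  exact tendsto_natCast_atTop_atTop.const_mul_atTop (by norm_num)

theorem exists_isGoodLevel (Q₀ : ℕ) : ∃ Q ≥ Q₀, IsGoodLevel Q := by
  by_contra! hbad
  have hbad' : ∀ Q, Q₀ + 1 ≤ Q → ∃ (q : ℕ) (_ : NeZero q) (χ : DirichletCharacter ℂ q), q ≤ Q ∧
      χ.IsPrimitive ∧ χ ≠ 1 ∧ χ ^ 2 = 1 ∧ 10 ^ 6 * logLevel Q ^ 3 * ‖χ.LFunction 1‖ < 1 := by
    intro Q hQ
    have := hbad Q (by omega)
    unfold IsGoodLevel at this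
    push Not at this
    obtain ⟨q, h1, χ, h2⟩ := this
    exact ⟨q, h1, χ, h2⟩
  obtain ⟨q, hq0, χ, hqQ, hχp, hχ1, hχ2, hχ⟩ := hbad' (Q₀ + 1) le_rfl
  have hL : 0 < ‖χ.LFunction 1‖ := norm_pos_iff.2 (DirichletCharacter.LFunction_apply_one_ne_zero hχ1)
  have hex : ∃ Q, Q₀ + 1 ≤ Q ∧ 1 ≤ 10 ^ 6 * logLevel Q ^ 3 * ‖χ.LFunction 1‖ := by
    have t : Tendsto (fun Q => 10 ^ 6 * logLevel Q ^ 3 * ‖χ.LFunction 1‖) atTop atTop :=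
      (Tendsto.const_mul_atTop (by norm_num)
        ((tendsto_pow_atTop (by norm_num)).comp tendsto_logLevel)).atTop_mul_const hL
    obtain ⟨Q, h⟩ := ((t.eventually_ge_atTop 1).and (eventually_ge_atTop (Q₀ + 1))).exists
    exact ⟨Q, h.2, h.1⟩
  classical
  obtain ⟨h1, h2⟩ := Nat.find_spec hex
  set Q := Nat.find hex with hQ
  have hne : Q ≠ Q₀ + 1 := by
    intro h; rw [h] at h2; linarith
  obtain ⟨P, hP⟩ : ∃ P, Q = P + 1 := ⟨Q - 1, by omega⟩
  have h3 : 10 ^ 6 * logLevel P ^ 3 * ‖χ.LFunction 1‖ < 1 := by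
    by_contra! h
    have := Nat.find_min' hex ⟨(by omega : Q₀ + 1 ≤ P), h⟩
    omega
  obtain ⟨r, hr0, ψ, hrQ, hψp, hψ1, hψ2, hψ⟩ := hbad' Q h1
  have hdiff : (⟨q, χ⟩ : Σ n, DirichletCharacter ℂ n) ≠ ⟨r, ψ⟩ := by
    rintro h
    obtain ⟨rfl, h⟩ := Sigma.mk.inj_iff.1 h
    rw [heq_iff_eq.1 h] at h2
    linarith
  have hQ1 : 1 ≤ Q := by omega
  have hl := two_le_logLevel hQ1
  have hlP := two_le_logLevel (Q := P) (by omega)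
  have hrep := repulsion hχp hψp hdiff hχ1 hψ1 hχ2 hψ2 hl (by
    rw [exp_logLevel hQ1]
    have : ((q * r : ℕ) : ℝ) ≤ Q * Q := by
      exact_mod_cast Nat.mul_le_mul (by omega) hrQ
    nlinarith)
  have hs : logLevel Q ^ 3 ≤ 8 * logLevel P ^ 3 := by
    have := logLevel_succ_le (Q := P) (by omega)
    rw [← hP] at this
    calc _ ≤ (2 * logLevel P) ^ 3 := by gcongr
      _ = _ := by ring
  rcases max_choice ‖χ.LFunction 1‖ ‖ψ.LFunction 1‖ with h | h <;> rw [h] at hrep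
  · have := mul_le_mul_of_nonneg_right hs hL.le
    linarith
  · linarith

theorem one_le_of_three_four_one {q : ℕ} [NeZero q] {χ : DirichletCharacter ℂ q}
    {ℓ : ℝ} (hℓ : 2 ≤ ℓ) {u t : ℝ} (hu : 0 < u) (hu1 : u ≤ 1) (hq : q * (2 * |t| + 5) ≤ Real.exp ℓ)
    {M : ℝ} (hM : ‖LSeries (fun n : ℕ => ((χ ^ 2) n : ℂ)) ((1 + u : ℝ) + (2 * t : ℝ) * Complex.I)‖ ≤ M) :
    1 ≤ (24 * ℓ + 1 / u) ^ 3 * ‖χ.LFunction ((1 + u : ℝ) + t * Complex.I)‖ ^ 4 * M := by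
  have h := χ.norm_LSeries_product_ge_one hu t
  rw [norm_mul, norm_mul, norm_pow, norm_pow] at h
  have e1 : (1 : ℂ) + u = ((1 + u : ℝ) : ℂ) := by push_cast; ring
  have e2 : (1 : ℂ) + u + Complex.I * t = (1 + u : ℝ) + t * Complex.I := by push_cast; ring
  have e3 : (1 : ℂ) + u + 2 * Complex.I * t = (1 + u : ℝ) + (2 * t : ℝ) * Complex.I := by
    push_cast; ring
  rw [e2, e3, e1] at h
  refine h.trans ?_
  have h0 : ‖LSeries (fun n => (1 : DirichletCharacter ℂ q) n) ((1 + u : ℝ) : ℂ)‖ ≤ 24 * ℓ + 1 / u := by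
    have := norm_LSeries_one_le (q := q) hℓ (s := ((1 + u : ℝ) : ℂ)) (by simpa using hu)
      (by simp only [Complex.ofReal_re]; linarith) (le_trans (by
      rw [Complex.ofReal_im, abs_zero]
      exact mul_le_mul_of_nonneg_left (by linarith [abs_nonneg t]) (by positivity)) hq)
    have e : ‖((1 + u : ℝ) : ℂ) - 1‖ = u := by
      rw [← Complex.ofReal_one, ← Complex.ofReal_sub, Complex.norm_real,
        Real.norm_of_nonneg (by linarith)]; ring
    rwa [e] at this
  have e4 : χ.LFunction ((1 + u : ℝ) + t * Complex.I) =
      LSeries (fun n => χ n) ((1 + u : ℝ) + t * Complex.I) :=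
    DirichletCharacter.LFunction_eq_LSeries χ (by simpa using hu)
  rw [e4]
  gcongr

theorem le_norm_LFunction_aux {ℓ u a : ℝ} (hℓ : 2 ≤ ℓ) (hu : 1 / (10 ^ 18 * ℓ ^ 13) ≤ u)
    (ha : 0 ≤ a) (h : 1 ≤ (24 * ℓ + 1 / u) ^ 3 * a ^ 4 * (2 * 10 ^ 8 * ℓ ^ 5)) :
    1 ≤ 10 ^ 18 / 96 * ℓ ^ 11 * a := by
  by_contra! hc
  have hu' : 1 / u ≤ 10 ^ 18 * ℓ ^ 13 := by
    rw [← one_div_one_div (10 ^ 18 * ℓ ^ 13)]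
    exact one_div_le_one_div_of_le (by positivity) hu
  have hl : ℓ ≤ ℓ ^ 13 := by
    calc ℓ = ℓ ^ 1 := by ring
      _ ≤ _ := pow_le_pow_right₀ (by linarith) (by norm_num)
  have h0 : 0 ≤ 1 / u := one_div_nonneg.2 (le_trans (by positivity) hu)
  have h2 : (24 * ℓ + 1 / u) ^ 3 ≤ (2 * 10 ^ 18 * ℓ ^ 13) ^ 3 := by
    gcongr
    nlinarith
  have h3 : (10 ^ 18 / 96 * ℓ ^ 11 * a) ^ 4 < 1 := pow_lt_one₀ (by positivity) hc (by norm_num)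
  have h4 : (24 * ℓ + 1 / u) ^ 3 * a ^ 4 * (2 * 10 ^ 8 * ℓ ^ 5) ≤
      (2 * 10 ^ 18 * ℓ ^ 13) ^ 3 * a ^ 4 * (2 * 10 ^ 8 * ℓ ^ 5) := by gcongr
  have h5 : (2 * 10 ^ 18 * ℓ ^ 13) ^ 3 * a ^ 4 * (2 * 10 ^ 8 * ℓ ^ 5) =
      (16 * 10 ^ 62 * 96 ^ 4 / 10 ^ 72) * (10 ^ 18 / 96 * ℓ ^ 11 * a) ^ 4 := by ring
  rw [h5] at h4
  have : (16 * 10 ^ 62 * 96 ^ 4 / 10 ^ 72) * (10 ^ 18 / 96 * ℓ ^ 11 * a) ^ 4 < 1 := by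
    norm_num at h3 ⊢
    linarith
  linarith

/-- Lower bound for `L(s, χ)` to the right of the line `Re s = 1`. -/
theorem one_le_norm_LFunction {Q : ℕ} (hQ : IsGoodLevel Q) {q : ℕ} [NeZero q]
    {χ : DirichletCharacter ℂ q} (hqQ : q ≤ Q) (hχp : χ.IsPrimitive) (hχ : χ ≠ 1)
    {ℓ : ℝ} (hℓQ : logLevel Q ≤ ℓ) {σ t : ℝ} (hσ : 1 < σ) (hσ2 : σ ≤ 2)
    (hℓ : Q * (2 * |t| + 5) ≤ Real.exp ℓ) :
    1 ≤ 10 ^ 17 * ℓ ^ 11 * ‖χ.LFunction (σ + t * Complex.I)‖ := by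
  have hQ1 : 1 ≤ Q := (NeZero.one_le (n := q)).trans hqQ
  have hl2 : 2 ≤ ℓ := (two_le_logLevel hQ1).trans hℓQ
  have hq : q * (2 * |t| + 5) ≤ Real.exp ℓ := le_trans (by gcongr) hℓ
  have hl0 : 0 < ℓ := by linarith
  have ht0 := abs_nonneg t
  have hp11 : 1 ≤ ℓ ^ 11 := one_le_pow₀ (by linarith)
  have hp5 : 1 ≤ ℓ ^ 5 := one_le_pow₀ (by linarith)
  have hp13 : 1 ≤ ℓ ^ 13 := one_le_pow₀ (by linarith)
  have hinv : 0 < ℓ⁻¹ := by positivity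
  have lip : ∀ (a b c d : ℝ), 1 ≤ a → a ≤ 2 → 1 ≤ b → b ≤ 2 → |c| ≤ |t| → |d| ≤ |t| →
      ‖χ.LFunction (b + d * Complex.I) - χ.LFunction (a + c * Complex.I)‖ ≤
        48 * ℓ ^ 2 * ‖((b + d * Complex.I : ℂ)) - (a + c * Complex.I)‖ := by
    intro a b c d ha1 ha2 hb1 hb2 hc hd
    refine norm_LFunction_sub_le hχ hl2 (T := |t|) (le_trans ?_ hq) ?_ ?_ ?_ ?_ ?_ ?_
    · exact mul_le_mul_of_nonneg_left (by linarith) (by positivity)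
    · simp; linarith
    · simpa using ha2
    · simpa using hc
    · simp; linarith
    · simpa using hb2
    · simpa using hd
  by_cases hcase : χ ^ 2 = 1 ∧ |t| < 1 / (2 * 10 ^ 8 * ℓ ^ 5)
  · obtain ⟨h2, ht⟩ := hcase
    have hL1 := hQ q χ hqQ hχp hχ h2
    have hL1' : 1 ≤ 10 ^ 6 * ℓ ^ 3 * ‖χ.LFunction 1‖ := by
      refine hL1.trans ?_
      have := two_le_logLevel hQ1
      gcongr
    set τ := 1 / (2 * 10 ^ 8 * ℓ ^ 5) with hτ
    have hτ0 : 0 < τ := by positivity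
    by_cases hnear : σ - 1 ≤ τ
    · have := lip 1 σ 0 t le_rfl (by norm_num) hσ.le hσ2 (by simp) le_rfl
      have e : ((σ : ℂ) + t * Complex.I) - ((1 : ℝ) + (0 : ℝ) * Complex.I) =
        ((σ - 1 : ℝ) : ℂ) + t * Complex.I := by push_cast; ring
      rw [e] at this
      have hn : ‖((σ - 1 : ℝ) : ℂ) + t * Complex.I‖ ≤ 2 * τ := by
        refine (norm_add_le _ _).trans ?_
        rw [norm_mul, Complex.norm_real, Complex.norm_real, Complex.norm_I, mul_one,
          Real.norm_of_nonneg (by linarith), Real.norm_eq_abs]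
        linarith
      have h3 := norm_sub_norm_le (χ.LFunction 1) (χ.LFunction (σ + t * Complex.I))
      rw [norm_sub_rev] at h3
      simp only [Complex.ofReal_one, Complex.ofReal_zero, zero_mul, add_zero] at this
      have h4 : 48 * ℓ ^ 2 * ‖((σ - 1 : ℝ) : ℂ) + t * Complex.I‖ ≤ 48 * ℓ ^ 2 * (2 * τ) := by gcongr
      have h5 : 10 ^ 6 * ℓ ^ 3 * (48 * ℓ ^ 2 * (2 * τ)) = 96 / 200 := by
        rw [hτ]; field_simp; norm_num
      have h6 : ℓ ^ 3 ≤ ℓ ^ 11 := pow_le_pow_right₀ (by linarith) (by norm_num)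
      have h7 : ‖χ.LFunction 1‖ ≤ ‖χ.LFunction (σ + t * Complex.I)‖ + 48 * ℓ ^ 2 * (2 * τ) := by
        linarith
      have h8 : 10 ^ 6 * ℓ ^ 3 * ‖χ.LFunction 1‖ ≤
          10 ^ 6 * ℓ ^ 3 * (‖χ.LFunction (σ + t * Complex.I)‖ + 48 * ℓ ^ 2 * (2 * τ)) := by gcongr
      have h9 : ℓ ^ 3 * ‖χ.LFunction (σ + t * Complex.I)‖ ≤
        ℓ ^ 11 * ‖χ.LFunction (σ + t * Complex.I)‖ := by gcongr
      nlinarith [norm_nonneg (χ.LFunction (σ + t * Complex.I))]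
    · push Not at hnear
      have h34 := one_le_of_three_four_one (χ := χ) hl2 (u := σ - 1) (t := t) (by linarith) (by linarith)
        hq (M := 24 * ℓ + 1 / (σ - 1)) (by
          have e : χ ^ 2 = 1 := h2
          rw [e]
          refine (norm_LSeries_one_le (q := q) hl2 ?_ ?_ (le_trans ?_ hq)).trans ?_
          · simp; linarith
          · simp; linarith
          · simp only [Complex.add_im, Complex.ofReal_im, Complex.mul_im, Complex.ofReal_re,
              Complex.I_im, Complex.I_re, mul_one, mul_zero, zero_add, add_zero, abs_mul,
              abs_two]
            exact mul_le_mul_of_nonneg_left (by linarith) (by positivity)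
          · have : σ - 1 ≤ ‖(((1 + (σ - 1) : ℝ) : ℂ) + (2 * t : ℝ) * Complex.I) - 1‖ := by
              refine le_trans ?_ (Complex.re_le_norm _)
              simp
            have := one_div_le_one_div_of_le (by linarith) this
            linarith)
      have hh : 24 * ℓ + 1 / (σ - 1) ≤ 3 * 10 ^ 8 * ℓ ^ 5 := by
        have h1 : 1 / (σ - 1) ≤ 1 / τ := one_div_le_one_div_of_le hτ0 hnear.le
        rw [hτ, one_div_one_div] at h1
        have h2 : ℓ ^ 1 ≤ ℓ ^ 5 := pow_le_pow_right₀ (by linarith) (by norm_num)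
        linarith
      have hpos : 0 ≤ 24 * ℓ + 1 / (σ - 1) := by
        have : 0 ≤ 1 / (σ - 1) := one_div_nonneg.2 (by linarith)
        linarith
      rw [show (1 + (σ - 1) : ℝ) = σ by ring] at h34
      have h5 : 1 ≤ ((24 * ℓ + 1 / (σ - 1)) * ‖χ.LFunction (σ + t * Complex.I)‖) ^ 4 := by
        refine h34.trans (le_of_eq ?_); ring
      have h6 : 1 ≤ (24 * ℓ + 1 / (σ - 1)) * ‖χ.LFunction (σ + t * Complex.I)‖ := by
        by_contra! hc
        exact absurd h5 (not_le.2 (pow_lt_one₀ (by positivity) hc (by norm_num)))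
      refine h6.trans ?_
      gcongr
      refine hh.trans ?_
      have h2 : ℓ ^ 5 ≤ ℓ ^ 11 := pow_le_pow_right₀ (by linarith) (by norm_num)
      linarith
  · have hM : ∀ u : ℝ, 0 < u → u ≤ 1 →
        ‖LSeries (fun n : ℕ => ((χ ^ 2) n : ℂ)) ((1 + u : ℝ) + (2 * t : ℝ) * Complex.I)‖ ≤
          2 * 10 ^ 8 * ℓ ^ 5 := by
      intro u hu hu1
      have h15 : ℓ ^ 1 ≤ ℓ ^ 5 := pow_le_pow_right₀ (by linarith) (by norm_num)
      have him : q * (|(((1 + u : ℝ) : ℂ) + (2 * t : ℝ) * Complex.I).im| + 3) ≤ Real.exp ℓ := by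
        refine le_trans ?_ hq
        simp only [Complex.add_im, Complex.ofReal_im, Complex.mul_im, Complex.ofReal_re,
          Complex.I_im, Complex.I_re, mul_one, mul_zero, zero_add, add_zero, abs_mul, abs_two]
        exact mul_le_mul_of_nonneg_left (by linarith) (by positivity)
      by_cases h2 : χ ^ 2 = 1
      · have ht : 1 / (2 * 10 ^ 8 * ℓ ^ 5) ≤ |t| := by
          by_contra! h; exact hcase ⟨h2, h⟩
        rw [h2]
        refine (norm_LSeries_one_le (q := q) hl2 ?_ ?_ him).trans ?_
        · simpa using hu
        · simp; linarith
        · have h3 : 2 * |t| ≤ ‖(((1 + u : ℝ) : ℂ) + (2 * t : ℝ) * Complex.I) - 1‖ := by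
            refine le_trans ?_ (Complex.abs_im_le_norm _)
            simp [abs_mul]
          have h0 : 0 < 2 * (1 / (2 * 10 ^ 8 * ℓ ^ 5)) := by positivity
          have h4 := one_div_le_one_div_of_le h0 (le_trans (by linarith) h3)
          have h5 : 1 / (2 * (1 / (2 * 10 ^ 8 * ℓ ^ 5))) = 10 ^ 8 * ℓ ^ 5 := by field_simp; 
          rw [h5] at h4
          linarith
      · have := norm_LFunction_le (χ := χ ^ 2) h2 hl2
          (s := ((1 + u : ℝ) : ℂ) + (2 * t : ℝ) * Complex.I) ?_ ?_ him
        · rw [DirichletCharacter.LFunction_eq_LSeries _ (by simpa using hu)] at this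
          linarith
        · simp; linarith
        · simp; linarith
    set u₀ : ℝ := 1 / (10 ^ 18 * ℓ ^ 13) with hu₀
    have hu0 : 0 < u₀ := by positivity
    have hu1 : u₀ ≤ 1 := by
      rw [hu₀, div_le_one (by positivity)]; linarith
    have far : ∀ u, u₀ ≤ u → u ≤ 1 →
        1 ≤ 10 ^ 18 / 96 * ℓ ^ 11 * ‖χ.LFunction ((1 + u : ℝ) + t * Complex.I)‖ := fun u h1 h2 =>
      le_norm_LFunction_aux hl2 h1 (norm_nonneg _)
        (one_le_of_three_four_one (χ := χ) hl2 (hu0.trans_le h1) h2 hq (hM u (hu0.trans_le h1) h2))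
    by_cases hnear : σ - 1 ≤ u₀
    · have h1 := far u₀ le_rfl hu1
      have h2 := lip (1 + u₀) σ t t (by linarith) (by linarith) hσ.le hσ2 le_rfl le_rfl
      have e : ‖((σ : ℂ) + t * Complex.I) - ((1 + u₀ : ℝ) + t * Complex.I)‖ ≤ u₀ := by
        have : ((σ : ℂ) + t * Complex.I) - ((1 + u₀ : ℝ) + t * Complex.I) =
          ((σ - (1 + u₀) : ℝ) : ℂ) := by push_cast; ring
        rw [this, Complex.norm_real, Real.norm_eq_abs, abs_le]
        constructor <;> linarith
      have h3 := norm_sub_norm_le (χ.LFunction ((1 + u₀ : ℝ) + t * Complex.I))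
        (χ.LFunction (σ + t * Complex.I))
      rw [norm_sub_rev] at h3
      have h4 : 48 * ℓ ^ 2 * ‖((σ : ℂ) + t * Complex.I) - ((1 + u₀ : ℝ) + t * Complex.I)‖ ≤
        48 * ℓ ^ 2 * u₀ := by gcongr
      have h5 : 10 ^ 18 / 96 * ℓ ^ 11 * (48 * ℓ ^ 2 * u₀) = 1 / 2 := by
        rw [hu₀]; field_simp; norm_num
      have h6 : 10 ^ 18 / 96 * ℓ ^ 11 * ‖χ.LFunction ((1 + u₀ : ℝ) + t * Complex.I)‖ ≤
          10 ^ 18 / 96 * ℓ ^ 11 * (‖χ.LFunction (σ + t * Complex.I)‖ + 48 * ℓ ^ 2 * u₀) := by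
        gcongr; linarith
      have h0 : 0 ≤ ℓ ^ 11 * ‖χ.LFunction (σ + t * Complex.I)‖ := by positivity
      linarith
    · have h1 := far (σ - 1) (by linarith) (by linarith)
      rw [show (1 + (σ - 1) : ℝ) = σ by ring] at h1
      have h0 : 0 ≤ ℓ ^ 11 * ‖χ.LFunction (σ + t * Complex.I)‖ := by positivity
      linarith

end BoundedGaps

namespace BoundedGaps
open Finset Filter MeasureTheory
open scoped Topology

theorem one_add_sq_le_norm_mul {σ t : ℝ} (hσ : 1 ≤ σ) :
    1 + t ^ 2 ≤ ‖((σ : ℂ) + t * Complex.I) * (σ + t * Complex.I + 1)‖ := by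
  have h : ∀ a : ℝ, 1 ≤ a → Real.sqrt (1 + t ^ 2) ≤ ‖(a : ℂ) + t * Complex.I‖ := by
    intro a ha
    rw [Complex.norm_add_mul_I]
    exact Real.sqrt_le_sqrt (by nlinarith)
  have h2 := h (σ + 1) (by linarith)
  have e : ((σ + 1 : ℝ) : ℂ) + t * Complex.I = σ + t * Complex.I + 1 := by push_cast; ring
  rw [e] at h2
  rw [norm_mul, ← Real.mul_self_sqrt (show 0 ≤ 1 + t ^ 2 by positivity)]
  exact mul_le_mul (h σ hσ) h2 (Real.sqrt_nonneg _) (norm_nonneg _)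

theorem vertical_ne_zero {σ t : ℝ} (hσ : 1 ≤ σ) :
    ((σ : ℂ) + t * Complex.I) * (σ + t * Complex.I + 1) ≠ 0 := by
  intro h
  have := one_add_sq_le_norm_mul (t := t) hσ
  rw [h, norm_zero] at this
  nlinarith

theorem integrable_vertical_kernel {σ : ℝ} (hσ : 1 ≤ σ) :
    Integrable fun t : ℝ => 1 / (((σ : ℂ) + t * Complex.I) * (σ + t * Complex.I + 1)) := by
  refine integrable_inv_one_add_sq.mono' ?_ (Eventually.of_forall fun t => ?_)
  · refine Continuous.aestronglyMeasurable ?_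
    exact Continuous.div continuous_const (by fun_prop) fun t => vertical_ne_zero hσ
  · rw [norm_div, norm_one, one_div]
    exact inv_anti₀ (by positivity) (one_add_sq_le_norm_mul hσ)

theorem kernel_inversion {σ y : ℝ} (hσ : 1 ≤ σ) (hy : 0 < y) :
    ∫ t : ℝ, (y : ℂ) ^ (-((σ : ℂ) + t * Complex.I)) *
      (1 / (((σ : ℂ) + t * Complex.I) * (σ + t * Complex.I + 1))) =
      2 * Real.pi * (max (1 - y) 0 : ℝ) := by
  set f : ℝ → ℂ := fun t => (Set.Ioc 0 1).indicator (fun _ => 1 : ℝ → ℂ) t -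
    (Set.Ioc 0 1).indicator (fun t => (t : ℂ) ^ (1 : ℂ) : ℝ → ℂ) t with hf
  have hm : ∀ s : ℂ, 0 < s.re → HasMellin f s (1 / s - 1 / (s + 1)) := by
    intro s hs
    have h1 := hasMellin_one_Ioc hs
    have h2 := hasMellin_cpow_Ioc 1 (s := s) (by simp; linarith)
    have := hasMellin_sub h1.1 h2.1
    rwa [h1.2, h2.2] at this
  have hfy : ∀ x : ℝ, 0 < x → f x = (max (1 - x) 0 : ℝ) := by
    intro x hx
    simp only [hf, Set.indicator_apply, Set.mem_Ioc, hx, true_and, Complex.cpow_one]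
    split_ifs with h
    · rw [max_eq_left (by linarith)]; push_cast; ring
    · rw [max_eq_right (by linarith)]; simp
  have hcont : ContinuousAt f y := by
    have : ContinuousAt (fun x : ℝ => ((max (1 - x) 0 : ℝ) : ℂ)) y := by fun_prop
    refine this.congr ?_
    filter_upwards [lt_mem_nhds hy] with x hx
    rw [hfy x hx]
  have heq : ∀ t : ℝ, mellin f (σ + t * Complex.I) =
      1 / (((σ : ℂ) + t * Complex.I) * (σ + t * Complex.I + 1)) := by
    intro t
    have h0 := vertical_ne_zero (t := t) hσ
    have h1 := left_ne_zero_of_mul h0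
    have h2 := right_ne_zero_of_mul h0
    rw [(hm _ (by simp; linarith)).2]
    field_simp
    ring
  have := mellinInv_mellin_eq σ f hy (hm σ (by simp; linarith)).1 (by
    unfold Complex.VerticalIntegrable
    simp_rw [heq]
    exact integrable_vertical_kernel hσ) hcont
  rw [mellinInv, hfy y hy] at this
  simp_rw [heq, smul_eq_mul] at this
  rw [← this, Complex.real_smul, ← mul_assoc]
  have hpi : (2 * Real.pi : ℂ) * ((1 / (2 * Real.pi) : ℝ) : ℂ) = 1 := by
    have : (Real.pi : ℂ) ≠ 0 := by exact_mod_cast Real.pi_ne_zero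
    push_cast
    field_simp
  rw [hpi, one_mul]

theorem smoothed_sum_eq (f : ℕ → ℂ) {σ : ℝ} (hσ : 1 ≤ σ) (hf : LSeriesSummable f σ) {X : ℕ}
    (hX : 1 ≤ X) :
    2 * Real.pi * ∑ n ∈ Ioc 0 X, f n * (1 - n / X : ℝ) =
      ∫ t : ℝ, (X : ℂ) ^ ((σ : ℂ) + t * Complex.I) * (LSeries f (σ + t * Complex.I) /
        (((σ : ℂ) + t * Complex.I) * (σ + t * Complex.I + 1))) := by
  have hX0 : (0 : ℝ) < X := by exact_mod_cast hX
  have hX0' : (X : ℂ) ≠ 0 := by exact_mod_cast hX0.ne'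
  set F : ℕ → ℝ → ℂ := fun n t => LSeries.term f (σ + t * Complex.I) n *
    ((X : ℂ) ^ ((σ : ℂ) + t * Complex.I) *
      (1 / (((σ : ℂ) + t * Complex.I) * (σ + t * Complex.I + 1)))) with hF
  have hterm : ∀ n t, F n t = (if n = 0 then 0 else f n) * (((n / X : ℝ) : ℂ) ^
      (-((σ : ℂ) + t * Complex.I)) *
      (1 / (((σ : ℂ) + t * Complex.I) * (σ + t * Complex.I + 1)))) := by
    intro n t
    rcases eq_or_ne n 0 with rfl | hn
    · simp [hF]
    · have hn0 : (n : ℂ) ≠ 0 := by exact_mod_cast hn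
      simp only [hF, LSeries.term_of_ne_zero hn, if_neg hn]
      have : ((n / X : ℝ) : ℂ) ^ (-((σ : ℂ) + t * Complex.I)) =
          (X : ℂ) ^ ((σ : ℂ) + t * Complex.I) / (n : ℂ) ^ ((σ : ℂ) + t * Complex.I) := by
        rw [div_eq_mul_inv, Complex.ofReal_mul, Complex.mul_cpow_ofReal_nonneg (by positivity)
          (by positivity), Complex.ofReal_inv, Complex.ofReal_natCast, Complex.ofReal_natCast,
          Complex.cpow_neg, Complex.inv_cpow _ _ (by rw [Complex.natCast_arg]; exact Real.pi_pos.ne),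
          Complex.cpow_neg, inv_inv]
        ring
      rw [this]
      ring
  have hnorm : ∀ n t, ‖F n t‖ = ‖LSeries.term f σ n‖ * X ^ σ *
      ‖1 / (((σ : ℂ) + t * Complex.I) * (σ + t * Complex.I + 1))‖ := by
    intro n t
    simp only [hF, norm_mul, LSeries.norm_term_eq]
    rw [Complex.norm_natCast_cpow_of_pos hX]
    simp
    ring_nf
  have hcontX : Continuous fun t : ℝ => (X : ℂ) ^ ((σ : ℂ) + t * Complex.I) := by
    refine Continuous.const_cpow (by fun_prop) (Or.inl hX0')
  have hmeas : ∀ n, AEStronglyMeasurable (F n) volume := by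
    intro n
    refine Continuous.aestronglyMeasurable ?_
    rcases eq_or_ne n 0 with rfl | hn
    · simp only [hF, LSeries.term_zero, zero_mul]; exact continuous_const
    · simp only [hF, LSeries.term_of_ne_zero hn]
      have hn0 : (n : ℂ) ≠ 0 := by exact_mod_cast hn
      refine (Continuous.div continuous_const (Continuous.const_cpow (by fun_prop) (Or.inl hn0))
        fun t => ?_).mul (hcontX.mul
        (Continuous.div continuous_const (by fun_prop) fun t => vertical_ne_zero hσ))
      exact fun h => hn0 (Complex.cpow_eq_zero_iff _ _ |>.1 h).1
  have h_int : ∀ n, Integrable (F n) := by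
    intro n
    rw [← integrable_norm_iff (hmeas n)]
    simp_rw [hnorm]
    exact (integrable_vertical_kernel hσ).norm.const_mul _
  have hsum : Summable fun n => ∫ t, ‖F n t‖ := by
    simp_rw [hnorm, integral_const_mul]
    exact (Summable.mul_right _ hf.norm).mul_right _
  have H := hasSum_integral_of_summable_integral_norm h_int hsum
  have e2 : ∀ t : ℝ, ∑' n, F n t = (X : ℂ) ^ ((σ : ℂ) + t * Complex.I) *
      (LSeries f (σ + t * Complex.I) / (((σ : ℂ) + t * Complex.I) * (σ + t * Complex.I + 1))) := by
    intro t
    simp only [hF]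
    rw [tsum_mul_right, LSeries]
    ring
  simp_rw [e2] at H
  have e3 : ∀ n, ∫ t, F n t = if n ∈ Ioc 0 X then 2 * Real.pi * (f n * (1 - n / X : ℝ)) else 0 := by
    intro n
    simp_rw [hterm]
    rw [integral_const_mul]
    rcases eq_or_ne n 0 with rfl | hn
    · simp
    · have hn0 : (0 : ℝ) < n := by exact_mod_cast Nat.pos_of_ne_zero hn
      rw [if_neg hn, kernel_inversion hσ (by positivity)]
      split_ifs with h <;> rw [mem_Ioc] at h
      · rw [max_eq_left]
        · ring
        · rw [sub_nonneg, div_le_one hX0]; exact_mod_cast h.2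
      · rw [max_eq_right]
        · simp
        · rw [sub_nonpos, one_le_div hX0]
          have : X < n := by omega
          exact_mod_cast this.le
  simp_rw [e3] at H
  have H2 : HasSum (fun n => if n ∈ Ioc 0 X then 2 * Real.pi * (f n * (1 - n / X : ℝ)) else 0)
      (∑ n ∈ Ioc 0 X, if n ∈ Ioc 0 X then 2 * Real.pi * (f n * (1 - n / X : ℝ)) else 0) :=
    hasSum_sum_of_ne_finset_zero fun n hn => if_neg hn
  refine Eq.trans ?_ (H2.unique H)
  rw [mul_sum]
  exact sum_congr rfl fun n hn => by rw [if_pos hn]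

end BoundedGaps

namespace BoundedGaps
open Finset Filter MeasureTheory
open scoped Topology

theorem differentiableOn_iteratedDeriv {H : ℂ → ℂ} {U : Set ℂ} (hU : IsOpen U)
    (hH : DifferentiableOn ℂ H U) (j : ℕ) : DifferentiableOn ℂ (iteratedDeriv j H) U := by
  induction j with
  | zero => simpa using hH
  | succ j ih => rw [iteratedDeriv_succ]; exact ih.deriv hU

theorem integrable_decay : Integrable fun t : ℝ => (1 + |t|) ^ (-(3 / 2) : ℝ) := by
  have := integrable_one_add_norm (E := ℝ) (μ := volume) (r := 3 / 2) (by norm_num)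
  simpa using this

theorem hasDerivAt_vertical {H : ℂ → ℂ} {σ t : ℝ}
    (hH : DifferentiableAt ℂ H (σ + t * Complex.I)) :
    HasDerivAt (fun t : ℝ => H (σ + t * Complex.I))
      (deriv H (σ + t * Complex.I) * Complex.I) t := by
  have h1 : HasDerivAt (fun t : ℝ => (σ : ℂ) + t * Complex.I) Complex.I t := by
    simpa using ((Complex.ofRealCLM.hasDerivAt (x := t)).mul_const Complex.I).const_add (σ : ℂ)
  exact hH.hasDerivAt.comp t h1

theorem norm_integral_vertical_le {H : ℂ → ℂ} (hH : DifferentiableOn ℂ H {s | 1 < s.re}) {σ : ℝ}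
    (hσ : 1 < σ) {X : ℕ} (hX : 2 ≤ X) {B : ℕ → ℝ} (hB : ∀ j, ∀ t : ℝ,
      ‖iteratedDeriv j H (σ + t * Complex.I)‖ ≤ B j * (1 + |t|) ^ (-(3 / 2) : ℝ)) (J : ℕ) :
    ‖∫ t : ℝ, (X : ℂ) ^ ((σ : ℂ) + t * Complex.I) * H (σ + t * Complex.I)‖ ≤
      X ^ σ * (B J * ∫ t : ℝ, (1 + |t|) ^ (-(3 / 2) : ℝ)) / Real.log X ^ J := by
  have hU : IsOpen {s : ℂ | 1 < s.re} := isOpen_lt continuous_const Complex.continuous_re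
  have hd : ∀ j (t : ℝ), DifferentiableAt ℂ (iteratedDeriv j H) (σ + t * Complex.I) := fun j t =>
    (differentiableOn_iteratedDeriv hU hH j).differentiableAt (hU.mem_nhds (by simpa using hσ))
  have hX0 : (0 : ℝ) < X := by positivity
  have hX0' : (X : ℂ) ≠ 0 := by exact_mod_cast hX0.ne'
  have hlog : 0 < Real.log X := Real.log_pos (by exact_mod_cast hX)
  have hlogc : Complex.log X = (Real.log X : ℝ) := by simp
  have hlog0 : (Real.log X : ℂ) ≠ 0 := by exact_mod_cast hlog.ne'
  have hcontX : Continuous fun t : ℝ => (X : ℂ) ^ ((σ : ℂ) + t * Complex.I) :=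
    Continuous.const_cpow (by fun_prop) (Or.inl hX0')
  have hcont : ∀ j, Continuous fun t : ℝ => iteratedDeriv j H (σ + t * Complex.I) := fun j =>
    continuous_iff_continuousAt.2 fun t => (hasDerivAt_vertical (hd j t)).continuousAt
  have hnX : ∀ t : ℝ, ‖(X : ℂ) ^ ((σ : ℂ) + t * Complex.I)‖ = X ^ σ := fun t => by
    rw [Complex.norm_natCast_cpow_of_pos (by omega)]; simp
  have hbd : ∀ j (t : ℝ), ‖(X : ℂ) ^ ((σ : ℂ) + t * Complex.I) *
      iteratedDeriv j H (σ + t * Complex.I)‖ ≤ X ^ σ * (B j * (1 + |t|) ^ (-(3 / 2) : ℝ)) := by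
    intro j t
    rw [norm_mul, hnX]
    exact mul_le_mul_of_nonneg_left (hB j t) (by positivity)
  have h_int : ∀ j, Integrable fun t : ℝ => (X : ℂ) ^ ((σ : ℂ) + t * Complex.I) *
      iteratedDeriv j H (σ + t * Complex.I) := fun j =>
    ((integrable_decay.const_mul (B j)).const_mul (X ^ σ)).mono'
      (hcontX.mul (hcont j)).aestronglyMeasurable (Eventually.of_forall (hbd j))
  have hderivX : ∀ t : ℝ, HasDerivAt (fun t : ℝ => (X : ℂ) ^ ((σ : ℂ) + t * Complex.I) /
      (Complex.I * Real.log X)) ((X : ℂ) ^ ((σ : ℂ) + t * Complex.I)) t := by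
    intro t
    have h1 : HasDerivAt (fun s : ℂ => (X : ℂ) ^ s)
        ((X : ℂ) ^ ((σ : ℂ) + t * Complex.I) * Complex.log X) (σ + t * Complex.I) := by
      have := (hasDerivAt_id ((σ : ℂ) + t * Complex.I)).const_cpow (c := (X : ℂ)) (Or.inl hX0')
      simpa using this
    have h2 := hasDerivAt_vertical (H := fun s : ℂ => (X : ℂ) ^ s) (σ := σ) (t := t)
      h1.differentiableAt
    rw [h1.deriv, hlogc] at h2
    have h3 := h2.div_const (Complex.I * Real.log X)
    have h4 : (X : ℂ) ^ ((σ : ℂ) + t * Complex.I) * (Real.log X : ℝ) * Complex.I /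
        (Complex.I * Real.log X) = (X : ℂ) ^ ((σ : ℂ) + t * Complex.I) := by
      have := Complex.I_ne_zero
      generalize (X : ℂ) ^ ((σ : ℂ) + t * Complex.I) = y
      field_simp
    rwa [h4] at h3
  have step : ∀ j, ∫ t : ℝ, (X : ℂ) ^ ((σ : ℂ) + t * Complex.I) *
      iteratedDeriv j H (σ + t * Complex.I) = -(Real.log X : ℂ)⁻¹ *
      ∫ t : ℝ, (X : ℂ) ^ ((σ : ℂ) + t * Complex.I) *
        iteratedDeriv (j + 1) H (σ + t * Complex.I) := by
    intro j
    have := integral_mul_deriv_eq_deriv_mul_of_integrable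
      (u := fun t : ℝ => iteratedDeriv j H (σ + t * Complex.I))
      (u' := fun t : ℝ => iteratedDeriv (j + 1) H (σ + t * Complex.I) * Complex.I)
      (v := fun t : ℝ => (X : ℂ) ^ ((σ : ℂ) + t * Complex.I) / (Complex.I * Real.log X))
      (v' := fun t : ℝ => (X : ℂ) ^ ((σ : ℂ) + t * Complex.I))
      (fun t _ => by rw [iteratedDeriv_succ]; exact hasDerivAt_vertical (hd j t))
      (fun t _ => hderivX t) ?_ ?_ ?_
    · rw [← integral_const_mul]
      refine (integral_congr_ae (Eventually.of_forall fun t => mul_comm _ _)).trans (this.trans ?_)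
      rw [← integral_neg]
      refine integral_congr_ae (Eventually.of_forall fun t => ?_)
      change -(iteratedDeriv (j + 1) H (σ + t * Complex.I) * Complex.I * (_ / _)) =
        -(Real.log X : ℂ)⁻¹ * (_ * _)
      generalize (X : ℂ) ^ ((σ : ℂ) + t * Complex.I) = y
      generalize iteratedDeriv (j + 1) H (σ + t * Complex.I) = z
      have := Complex.I_ne_zero
      field_simp
    · refine (h_int j).congr (Eventually.of_forall fun t => ?_)
      exact mul_comm _ _
    · refine ((h_int (j + 1)).const_mul (Real.log X : ℂ)⁻¹).congr (Eventually.of_forall fun t => ?_)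
      change (Real.log X : ℂ)⁻¹ * (_ * _) = iteratedDeriv (j + 1) H (σ + t * Complex.I) * Complex.I * (_ / _)
      generalize (X : ℂ) ^ ((σ : ℂ) + t * Complex.I) = y
      generalize iteratedDeriv (j + 1) H (σ + t * Complex.I) = z
      have := Complex.I_ne_zero
      field_simp
    · refine ((h_int j).const_mul (Complex.I * Real.log X)⁻¹).congr (Eventually.of_forall fun t => ?_)
      change (Complex.I * Real.log X : ℂ)⁻¹ * (_ * _) = iteratedDeriv j H (σ + t * Complex.I) * (_ / _)
      generalize (X : ℂ) ^ ((σ : ℂ) + t * Complex.I) = y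
      generalize iteratedDeriv j H (σ + t * Complex.I) = z
      have := Complex.I_ne_zero
      field_simp
  have iter : ∀ j, ‖∫ t : ℝ, (X : ℂ) ^ ((σ : ℂ) + t * Complex.I) * H (σ + t * Complex.I)‖ =
      ‖∫ t : ℝ, (X : ℂ) ^ ((σ : ℂ) + t * Complex.I) *
        iteratedDeriv j H (σ + t * Complex.I)‖ / Real.log X ^ j := by
    intro j
    induction j with
    | zero => simp
    | succ j ih =>
      rw [ih, step, norm_mul, norm_neg, norm_inv, Complex.norm_real, Real.norm_of_nonneg hlog.le]
      generalize ‖∫ t : ℝ, (X : ℂ) ^ ((σ : ℂ) + t * Complex.I) *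
        iteratedDeriv (j + 1) H (σ + t * Complex.I)‖ = y
      field_simp
      ring
  rw [iter J]
  gcongr
  refine (norm_integral_le_of_norm_le ((integrable_decay.const_mul (B J)).const_mul (X ^ σ))
    (Eventually.of_forall (hbd J))).trans_eq ?_
  rw [integral_const_mul, integral_const_mul]

end BoundedGaps

namespace BoundedGaps
open Finset Filter MeasureTheory ArithmeticFunction
open scoped Topology

/-- The integrand of the inverse Mellin transform for the smoothed Chebyshev sum twisted by `χ`. -/
noncomputable def mellinKernel {q : ℕ} [NeZero q] (χ : DirichletCharacter ℂ q) (s : ℂ) : ℂ :=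
  -deriv χ.LFunction s / χ.LFunction s / (s * (s + 1))

theorem one_add_log_pow_le {y : ℝ} (hy : 1 ≤ y) (b : ℕ) :
    (1 + Real.log y) ^ b ≤ (1 + 2 * b) ^ b * y ^ (1 / 2 : ℝ) := by
  rcases Nat.eq_zero_or_pos b with rfl | hb
  · simpa using Real.one_le_rpow hy (by norm_num)
  · have hb0 : (0 : ℝ) < b := by exact_mod_cast hb
    have hlog := Real.log_le_rpow_div (x := y) (by linarith) (ε := 1 / (2 * b)) (by positivity)
    have h1 : 1 ≤ y ^ (1 / (2 * b) : ℝ) := Real.one_le_rpow hy (by positivity)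
    have h2 : 1 + Real.log y ≤ (1 + 2 * b) * y ^ (1 / (2 * b) : ℝ) := by
      have : y ^ (1 / (2 * b) : ℝ) / (1 / (2 * b)) = 2 * b * y ^ (1 / (2 * b) : ℝ) := by
        rw [div_div_eq_mul_div, div_one]; ring
      linarith
    have h3 : 0 ≤ Real.log y := Real.log_nonneg hy
    calc _ ≤ ((1 + 2 * b) * y ^ (1 / (2 * b) : ℝ)) ^ b := by gcongr
      _ = _ := by
        rw [mul_pow, ← Real.rpow_natCast (y ^ _), ← Real.rpow_mul (by linarith)]
        congr 2
        field_simp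

theorem differentiableOn_mellinKernel {q : ℕ} [NeZero q] {χ : DirichletCharacter ℂ q} (hχ : χ ≠ 1) :
    DifferentiableOn ℂ (mellinKernel χ) {s | 1 < s.re} := by
  have hd := DirichletCharacter.differentiable_LFunction hχ
  have hd' : Differentiable ℂ (deriv χ.LFunction) := fun s =>
    ((hd.differentiableOn (s := Set.univ)).deriv isOpen_univ).differentiableAt Filter.univ_mem
  intro s hs
  have hs' : 1 < s.re := hs
  refine DifferentiableAt.differentiableWithinAt (DifferentiableAt.fun_div
    (DifferentiableAt.fun_div (hd' s).neg (hd s) ?_) (by fun_prop) ?_)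
  · exact DirichletCharacter.LFunction_ne_zero_of_one_le_re χ (Or.inl hχ) hs'.le
  · refine mul_ne_zero (fun h => ?_) fun h => ?_
    · rw [h] at hs'; norm_num at hs'
    · have := congrArg Complex.re h
      simp at this
      linarith

theorem norm_iteratedDeriv_mellinKernel_le {Q : ℕ} (hQ : IsGoodLevel Q) {q : ℕ} [NeZero q]
    {χ : DirichletCharacter ℂ q} (hqQ : q ≤ Q) (hχp : χ.IsPrimitive) (hχ : χ ≠ 1)
    {ℓ : ℝ} (hℓQ : logLevel Q ≤ ℓ) {σ t : ℝ} (hσ : 1 < σ) (hσ2 : σ ≤ 3 / 2)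
    (hℓ : Q * (2 * |t| + 5) ≤ Real.exp ℓ) (j : ℕ) :
    ‖iteratedDeriv j (mellinKernel χ) (σ + t * Complex.I)‖ ≤
      j.factorial * (16 * 10 ^ 19 * ℓ ^ 13 / (1 + |t|) ^ 2) * (10 ^ 20 * ℓ ^ 13) ^ j := by
  have hQ1 : 1 ≤ Q := (NeZero.one_le (n := q)).trans hqQ
  have hl2 : 2 ≤ ℓ := (two_le_logLevel hQ1).trans hℓQ
  have hl0 : 0 < ℓ := by linarith
  have hq : q * ((|t| + 1) + 4) ≤ Real.exp ℓ := le_trans (by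
    have : (q : ℝ) ≤ Q := by exact_mod_cast hqQ
    gcongr ?_ * ?_
    linarith [abs_nonneg t]) hℓ
  have hp13 : ℓ ^ 1 ≤ ℓ ^ 13 := pow_le_pow_right₀ (by linarith) (by norm_num)
  rw [pow_one] at hp13
  set ρ : ℝ := 1 / (10 ^ 20 * ℓ ^ 13) with hρ
  have hρ0 : 0 < ρ := by positivity
  have hρ1 : ρ ≤ 1 / (2 * ℓ) := by
    refine one_div_le_one_div_of_le (by positivity) ?_
    linarith
  have hρ2 : ρ ≤ 1 / 4 := hρ1.trans (one_div_le_one_div_of_le (by norm_num) (by linarith))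
  set s₀ : ℂ := σ + t * Complex.I with hs₀
  have hre0 : s₀.re = σ := by simp [hs₀]
  have him0 : s₀.im = t := by simp [hs₀]
  have hlow := one_le_norm_LFunction hQ hqQ hχp hχ hℓQ hσ (by linarith) hℓ
  have hd := DirichletCharacter.differentiable_LFunction hχ
  have hd' : Differentiable ℂ (deriv χ.LFunction) := fun s =>
    ((hd.differentiableOn (s := Set.univ)).deriv isOpen_univ).differentiableAt Filter.univ_mem
  have hball : ∀ z ∈ Metric.closedBall s₀ ρ, 1 ≤ 2 * 10 ^ 17 * ℓ ^ 11 * ‖χ.LFunction z‖ ∧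
      ‖deriv χ.LFunction z‖ ≤ 48 * ℓ ^ 2 ∧ (1 + |t|) / 4 ≤ ‖z‖ ∧ (1 + |t|) / 4 ≤ ‖z + 1‖ := by
    intro z hz
    rw [mem_closedBall_iff_norm] at hz
    have h1 := (Complex.abs_re_le_norm (z - s₀)).trans hz
    have h2 := (Complex.abs_im_le_norm (z - s₀)).trans hz
    rw [Complex.sub_re, abs_le, hre0] at h1
    rw [Complex.sub_im, him0] at h2
    have h3 := abs_sub_abs_le_abs_sub z.im t
    have h4 := abs_sub_abs_le_abs_sub t z.im
    rw [abs_sub_comm] at h4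
    refine ⟨?_, ?_, ?_, ?_⟩
    · have := norm_LFunction_sub_le hχ hl2 hq (s := s₀) (z := z) (by
        rw [hre0]; have : 0 < 1 / (2 * ℓ) := by positivity
        linarith) (by rw [hre0]; linarith) (by rw [him0]; linarith) (by linarith) (by linarith)
        (by linarith)
      have h5 : 48 * ℓ ^ 2 * ‖z - s₀‖ ≤ 48 * ℓ ^ 2 * ρ := by gcongr
      have h6 : 10 ^ 17 * ℓ ^ 11 * (48 * ℓ ^ 2 * ρ) = 48 / 1000 := by
        rw [hρ]; field_simp; norm_num
      have h7 := norm_sub_norm_le (χ.LFunction s₀) (χ.LFunction z)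
      rw [norm_sub_rev] at h7
      have h8 : 10 ^ 17 * ℓ ^ 11 * ‖χ.LFunction s₀‖ ≤
          10 ^ 17 * ℓ ^ 11 * (‖χ.LFunction z‖ + 48 * ℓ ^ 2 * ρ) := by gcongr; linarith
      have h0 : 0 ≤ ℓ ^ 11 * ‖χ.LFunction z‖ := by positivity
      linarith
    · refine norm_deriv_LFunction_le hχ hl2 (by linarith) (by linarith) (le_trans ?_ hq)
      exact mul_le_mul_of_nonneg_left (by linarith) (by positivity)
    · have := Complex.re_le_norm z
      have := Complex.abs_im_le_norm z
      linarith
    · have := Complex.re_le_norm (z + 1)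
      have := Complex.abs_im_le_norm (z + 1)
      simp only [Complex.add_re, Complex.one_re, Complex.add_im, Complex.one_im, add_zero] at *
      linarith
  have ht1 : 0 < 1 + |t| := by positivity
  have hnz : ∀ z ∈ Metric.closedBall s₀ ρ, χ.LFunction z ≠ 0 ∧ z * (z + 1) ≠ 0 := by
    intro z hz
    obtain ⟨h1, -, h3, h4⟩ := hball z hz
    refine ⟨fun h => ?_, mul_ne_zero (fun h => ?_) fun h => ?_⟩
    · rw [h, norm_zero, mul_zero] at h1; linarith
    · rw [h, norm_zero] at h3; linarith
    · rw [h, norm_zero] at h4; linarith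
  have hdiff : DiffContOnCl ℂ (mellinKernel χ) (Metric.ball s₀ ρ) := by
    refine DifferentiableOn.diffContOnCl ?_
    rw [closure_ball _ hρ0.ne']
    intro z hz
    exact (DifferentiableAt.fun_div (DifferentiableAt.fun_div (hd' z).neg (hd z) (hnz z hz).1)
      (by fun_prop) (hnz z hz).2).differentiableWithinAt
  have := Complex.norm_iteratedDeriv_le_of_forall_mem_sphere_norm_le (f := mellinKernel χ) j hρ0 hdiff
    (C := 16 * 10 ^ 19 * ℓ ^ 13 / (1 + |t|) ^ 2) (by
      intro z hz
      obtain ⟨h1, h2, h3, h4⟩ := hball z (Metric.sphere_subset_closedBall hz)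
      have hL : 0 < ‖χ.LFunction z‖ := norm_pos_iff.2 (hnz z (Metric.sphere_subset_closedBall hz)).1
      have hz0 : 0 < ‖z‖ := by linarith
      have hz1 : 0 < ‖z + 1‖ := by linarith
      rw [mellinKernel, norm_div, norm_div, norm_neg, norm_mul]
      have e1 : ‖deriv χ.LFunction z‖ / ‖χ.LFunction z‖ ≤ 10 ^ 19 * ℓ ^ 13 := by
        rw [div_le_iff₀ hL]
        calc _ ≤ 48 * ℓ ^ 2 := h2
          _ = 48 * ℓ ^ 2 * 1 := by ring
          _ ≤ 48 * ℓ ^ 2 * (2 * 10 ^ 17 * ℓ ^ 11 * ‖χ.LFunction z‖) := by gcongr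
          _ = 96 * 10 ^ 17 * (ℓ ^ 13 * ‖χ.LFunction z‖) := by ring
          _ ≤ 10 ^ 19 * (ℓ ^ 13 * ‖χ.LFunction z‖) := by gcongr; norm_num
          _ = _ := by ring
      have e2 : (1 + |t|) ^ 2 / 16 ≤ ‖z‖ * ‖z + 1‖ := by
        calc (1 + |t|) ^ 2 / 16 = (1 + |t|) / 4 * ((1 + |t|) / 4) := by ring
          _ ≤ _ := by gcongr
      calc _ ≤ 10 ^ 19 * ℓ ^ 13 / ((1 + |t|) ^ 2 / 16) := by gcongr
        _ = _ := by field_simp)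
  refine this.trans_eq ?_
  rw [hρ, one_div, inv_pow, div_inv_eq_mul]

theorem norm_iteratedDeriv_mellinKernel_le' {Q : ℕ} (hQ : IsGoodLevel Q) {q : ℕ} [NeZero q]
    {χ : DirichletCharacter ℂ q} (hqQ : q ≤ Q) (hχp : χ.IsPrimitive) (hχ : χ ≠ 1)
    {σ : ℝ} (hσ : 1 < σ) (hσ2 : σ ≤ 3 / 2) (j : ℕ) (t : ℝ) :
    ‖iteratedDeriv j (mellinKernel χ) (σ + t * Complex.I)‖ ≤
      (j.factorial * 10 ^ (21 + 20 * j) * (27 + 26 * j) ^ (13 * (j + 1)) * 2) *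
        logLevel Q ^ (13 * (j + 1)) * (1 + |t|) ^ (-(3 / 2) : ℝ) := by
  have hQ1 : 1 ≤ Q := (NeZero.one_le (n := q)).trans hqQ
  have hQr : (1 : ℝ) ≤ Q := by exact_mod_cast hQ1
  have hl2 := two_le_logLevel hQ1
  have ht0 := abs_nonneg t
  have hlt : 0 ≤ Real.log (|t| + 2) := Real.log_nonneg (by linarith)
  set ℓ := logLevel Q + 2 * Real.log (|t| + 2) with hℓ
  have hexp : Real.exp ℓ = 9 * Q ^ 2 * (|t| + 2) ^ 2 := by
    rw [hℓ, Real.exp_add, exp_logLevel hQ1, two_mul, Real.exp_add, Real.exp_log (by positivity)]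
    ring
  have h := norm_iteratedDeriv_mellinKernel_le hQ hqQ hχp hχ (ℓ := ℓ) (by linarith) hσ hσ2 (t := t)
    (by
      rw [hexp]
      have h1 : (Q : ℝ) ≤ Q ^ 2 := by nlinarith
      have h2 : 2 * |t| + 5 ≤ 9 * (|t| + 2) ^ 2 := by nlinarith
      calc _ ≤ (Q : ℝ) ^ 2 * (9 * (|t| + 2) ^ 2) := by gcongr
        _ = _ := by ring) j
  refine h.trans ?_
  have hℓle : ℓ ≤ logLevel Q * (1 + Real.log (|t| + 2)) := by nlinarith
  have hℓ0 : 0 ≤ ℓ := by linarith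
  have hpow : ℓ ^ (13 * (j + 1)) ≤ logLevel Q ^ (13 * (j + 1)) *
      ((27 + 26 * j) ^ (13 * (j + 1)) * (2 * (1 + |t|) ^ (1 / 2 : ℝ))) := by
    calc _ ≤ (logLevel Q * (1 + Real.log (|t| + 2))) ^ (13 * (j + 1)) := by gcongr
      _ = logLevel Q ^ (13 * (j + 1)) * (1 + Real.log (|t| + 2)) ^ (13 * (j + 1)) := mul_pow _ _ _
      _ ≤ logLevel Q ^ (13 * (j + 1)) * ((1 + 2 * (13 * (j + 1) : ℕ)) ^ (13 * (j + 1)) *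
          (|t| + 2) ^ (1 / 2 : ℝ)) := by
        gcongr
        exact one_add_log_pow_le (by linarith) _
      _ ≤ _ := by
        have e : (1 + 2 * (13 * (j + 1) : ℕ) : ℝ) = 27 + 26 * j := by push_cast; ring
        rw [e]
        gcongr
        calc (|t| + 2) ^ (1 / 2 : ℝ) ≤ (4 * (1 + |t|)) ^ (1 / 2 : ℝ) := by
              gcongr; linarith
          _ = 4 ^ (1 / 2 : ℝ) * (1 + |t|) ^ (1 / 2 : ℝ) := Real.mul_rpow (by norm_num) (by positivity)
          _ = _ := by
            congr 1
            rw [← Real.sqrt_eq_rpow, show (4 : ℝ) = 2 ^ 2 by norm_num, Real.sqrt_sq (by norm_num)]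
  have e1 : (1 + |t|) ^ (1 / 2 : ℝ) / (1 + |t|) ^ 2 = (1 + |t|) ^ (-(3 / 2) : ℝ) := by
    rw [← Real.rpow_natCast (1 + |t|) 2, ← Real.rpow_sub (by positivity)]
    norm_num
  calc j.factorial * (16 * 10 ^ 19 * ℓ ^ 13 / (1 + |t|) ^ 2) * (10 ^ 20 * ℓ ^ 13) ^ j
      = j.factorial * (16 * 10 ^ (19 + 20 * j)) * ℓ ^ (13 * (j + 1)) / (1 + |t|) ^ 2 := by
        rw [mul_pow, ← pow_mul, ← pow_mul]; ring
    _ ≤ j.factorial * 10 ^ (21 + 20 * j) * (logLevel Q ^ (13 * (j + 1)) *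
      ((27 + 26 * j) ^ (13 * (j + 1)) * (2 * (1 + |t|) ^ (1 / 2 : ℝ)))) / (1 + |t|) ^ 2 := by
        gcongr
        rw [show 21 + 20 * j = 2 + (19 + 20 * j) by ring, pow_add _ 2]
        gcongr
        norm_num
    _ = _ := by rw [← e1]; ring

theorem exists_smoothed_le (J : ℕ) : ∃ C : ℝ, 0 < C ∧ ∀ Q : ℕ, IsGoodLevel Q → ∀ (q : ℕ) [NeZero q]
    (χ : DirichletCharacter ℂ q), q ≤ Q → χ.IsPrimitive → χ ≠ 1 → ∀ X : ℕ, 8 ≤ X →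
    ‖∑ n ∈ Ioc 0 X, χ n * (Λ n : ℂ) * (1 - n / X : ℝ)‖ ≤
      C * logLevel Q ^ (13 * (J + 1)) * X / Real.log X ^ J := by
  set I₀ := ∫ t : ℝ, (1 + |t|) ^ (-(3 / 2) : ℝ) with hI₀
  have hI0 : 0 ≤ I₀ := integral_nonneg fun t => by positivity
  set C₀ : ℝ := J.factorial * 10 ^ (21 + 20 * J) * (27 + 26 * J) ^ (13 * (J + 1)) * 2 with hC₀
  refine ⟨3 * C₀ * (I₀ + 1), by positivity, ?_⟩
  intro Q hQ q _ χ hqQ hχp hχ X hX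
  have hX8 : (8 : ℝ) ≤ X := by exact_mod_cast hX
  have hlX : 2 ≤ Real.log X := by
    rw [Real.le_log_iff_exp_le (by linarith)]
    have : Real.exp 2 = Real.exp 1 * Real.exp 1 := by rw [← Real.exp_add]; norm_num
    nlinarith [Real.exp_one_lt_d9, Real.exp_pos 1]
  have hQ1 : 1 ≤ Q := (NeZero.one_le (n := q)).trans hqQ
  have hl2 := two_le_logLevel hQ1
  set σ : ℝ := 1 + 1 / Real.log X with hσ
  have hσ1 : 1 < σ := by
    have : 0 < 1 / Real.log X := by positivity
    linarith
  have hσ2 : σ ≤ 3 / 2 := by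
    have := one_div_le_one_div_of_le (by norm_num) hlX
    linarith
  have hsum : LSeriesSummable ((fun n : ℕ => (χ n : ℂ)) * (fun n : ℕ => (Λ n : ℂ))) σ :=
    DirichletCharacter.LSeriesSummable_twist_vonMangoldt χ (by simpa using hσ1)
  have heq := smoothed_sum_eq _ hσ1.le hsum (X := X) (by omega)
  have hker : ∀ t : ℝ,
      LSeries ((fun n : ℕ => (χ n : ℂ)) * (fun n : ℕ => (Λ n : ℂ))) (σ + t * Complex.I) /
      (((σ : ℂ) + t * Complex.I) * (σ + t * Complex.I + 1)) = mellinKernel χ (σ + t * Complex.I) := by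
    intro t
    have hs : 1 < ((σ : ℂ) + t * Complex.I).re := by simpa using hσ1
    rw [mellinKernel, DirichletCharacter.LSeries_twist_vonMangoldt_eq χ hs,
      DirichletCharacter.deriv_LFunction_eq_deriv_LSeries χ hs,
      DirichletCharacter.LFunction_eq_LSeries χ hs]
  simp_rw [hker] at heq
  have hle := norm_integral_vertical_le (differentiableOn_mellinKernel hχ) hσ1 (X := X) (by omega)
    (norm_iteratedDeriv_mellinKernel_le' hQ hqQ hχp hχ hσ1 hσ2) J
  rw [← heq, norm_mul] at hle
  have hpi : ‖(2 * Real.pi : ℂ)‖ = 2 * Real.pi := by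
    rw [← Complex.ofReal_ofNat, ← Complex.ofReal_mul, Complex.norm_real,
      Real.norm_of_nonneg (by positivity)]
  rw [hpi] at hle
  have hXσ : (X : ℝ) ^ σ = Real.exp 1 * X := by
    rw [hσ, Real.rpow_add (by linarith), Real.rpow_one, Real.rpow_def_of_pos (by linarith)]
    rw [mul_one_div_cancel (by linarith)]; ring
  rw [hXσ] at hle
  simp only [Pi.mul_apply] at hle
  have h1 : ‖∑ n ∈ Ioc 0 X, χ n * (Λ n : ℂ) * (1 - n / X : ℝ)‖ ≤
      2 * Real.pi * ‖∑ n ∈ Ioc 0 X, χ n * (Λ n : ℂ) * (1 - n / X : ℝ)‖ := by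
    have := norm_nonneg (∑ n ∈ Ioc 0 X, χ n * (Λ n : ℂ) * (1 - n / X : ℝ))
    nlinarith [Real.pi_gt_three]
  refine h1.trans (hle.trans ?_)
  have e : Real.exp 1 ≤ 3 := by linarith [Real.exp_one_lt_d9]
  rw [← hC₀, ← hI₀]
  calc Real.exp 1 * X * (C₀ * logLevel Q ^ (13 * (J + 1)) * I₀) / Real.log X ^ J
      ≤ 3 * X * (C₀ * logLevel Q ^ (13 * (J + 1)) * (I₀ + 1)) / Real.log X ^ J := by
        gcongr
        linarith
    _ = _ := by ring

end BoundedGaps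

namespace BoundedGaps
open Finset Filter ArithmeticFunction
open scoped Topology

theorem norm_psi_le_of_smoothed {f : ℕ → ℂ} (hf : ∀ n, ‖f n‖ ≤ Real.log n) {X h : ℕ} (hX : 1 ≤ X)
    (hh : 1 ≤ h) {D : ℝ} (h1 : ‖∑ n ∈ Ioc 0 X, f n * (X - n : ℝ)‖ ≤ D)
    (h2 : ‖∑ n ∈ Ioc 0 (X + h), f n * ((X + h : ℕ) - n : ℝ)‖ ≤ D) :
    ‖∑ n ∈ Ioc 0 X, f n‖ ≤ 2 * D / h + h * Real.log (X + h : ℕ) := by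
  have hh0 : (0 : ℝ) < h := by exact_mod_cast hh
  have key : (h : ℂ) * ∑ n ∈ Ioc 0 X, f n = ∑ n ∈ Ioc 0 (X + h), f n * ((X + h : ℕ) - n : ℝ) -
      ∑ n ∈ Ioc 0 X, f n * (X - n : ℝ) - ∑ n ∈ Ioc X (X + h), f n * ((X + h : ℕ) - n : ℝ) := by
    rw [← sum_Ioc_consecutive (fun n => f n * ((X + h : ℕ) - n : ℝ)) (Nat.zero_le X)
      (Nat.le_add_right X h), sub_right_comm, add_sub_cancel_right, ← sum_sub_distrib, mul_sum]
    refine sum_congr rfl fun n _ => ?_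
    push_cast
    ring
  have h3 : ‖∑ n ∈ Ioc X (X + h), f n * ((X + h : ℕ) - n : ℝ)‖ ≤ h * (h * Real.log (X + h : ℕ)) := by
    refine (norm_sum_le_of_le (f := fun n => f n * ((X + h : ℕ) - n : ℝ))
      (n := fun _ => h * Real.log (X + h : ℕ)) _ fun n hn => ?_).trans_eq ?_
    · rw [mem_Ioc] at hn
      have hn1 : (X : ℝ) < n := by exact_mod_cast hn.1
      have hn2 : (n : ℝ) ≤ (X + h : ℕ) := by exact_mod_cast hn.2
      have hn0 : (0 : ℝ) < n := lt_of_le_of_lt (by positivity) hn1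
      rw [norm_mul, Complex.norm_real, Real.norm_of_nonneg (by linarith), mul_comm]
      have := hf n
      have hlog := Real.log_le_log hn0 hn2
      push_cast at *
      exact mul_le_mul (by linarith) (this.trans hlog) (norm_nonneg _) (by positivity)
    · simp
  have h4 : h * ‖∑ n ∈ Ioc 0 X, f n‖ ≤ D + D + h * (h * Real.log (X + h : ℕ)) := by
    calc h * ‖∑ n ∈ Ioc 0 X, f n‖ = ‖(h : ℂ) * ∑ n ∈ Ioc 0 X, f n‖ := by
          rw [norm_mul, Complex.norm_natCast]
      _ ≤ _ := by
        rw [key]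
        exact (norm_sub_le _ _).trans (add_le_add ((norm_sub_le _ _).trans (add_le_add h2 h1)) h3)
  have e : 2 * D / h + h * Real.log (X + h : ℕ) =
      (D + D + h * (h * Real.log (X + h : ℕ))) / h := by field_simp; ring
  rw [e, le_div_iff₀ hh0]
  linarith

theorem eventually_logLevel_pow_le (B b : ℕ) : ∀ᶠ y : ℝ in atTop, ∀ Q : ℕ, 1 ≤ Q → (Q : ℝ) ≤ y ^ B →
    logLevel Q ^ b ≤ y := by
  have h := (Real.isLittleO_pow_log_id_atTop (n := b)).bound
    (show (0 : ℝ) < 1 / (2 * B + 2) ^ b by positivity)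
  filter_upwards [h, eventually_ge_atTop 3] with y hy hy3 Q hQ hQy
  have hl : 1 ≤ Real.log y := by
    rw [Real.le_log_iff_exp_le (by linarith)]
    linarith [Real.exp_one_lt_d9]
  have hQ1 : (1 : ℝ) ≤ Q := by exact_mod_cast hQ
  have h1 : logLevel Q ≤ (2 * B + 2) * Real.log y := by
    have : Real.log (3 * Q) ≤ Real.log (y ^ (B + 1)) := by
      refine Real.log_le_log (by positivity) ?_
      rw [pow_succ, mul_comm]
      gcongr
    rw [Real.log_pow] at this
    push_cast at this
    unfold logLevel
    linarith
  have h0 := two_le_logLevel hQ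
  rw [Real.norm_of_nonneg (by positivity), id, Real.norm_of_nonneg (by linarith)] at hy
  calc logLevel Q ^ b ≤ ((2 * B + 2) * Real.log y) ^ b := by gcongr
    _ = (2 * B + 2) ^ b * Real.log y ^ b := mul_pow _ _ _
    _ ≤ (2 * B + 2) ^ b * (1 / (2 * B + 2) ^ b * y) := by gcongr
    _ = y := by field_simp

theorem tendsto_log_natCast : Tendsto (fun X : ℕ => Real.log X) atTop atTop :=
  Real.tendsto_log_atTop.comp tendsto_natCast_atTop_atTop

theorem eventually_norm_psi_char_le (A B : ℕ) : ∀ᶠ X : ℕ in atTop, ∀ Q : ℕ, IsGoodLevel Q →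
    (Q : ℝ) ≤ Real.log X ^ B → ∀ (q : ℕ) [NeZero q] (χ : DirichletCharacter ℂ q), q ≤ Q →
    χ.IsPrimitive → χ ≠ 1 → ‖∑ n ∈ Ioc 0 X, (Λ n : ℂ) * χ n‖ ≤ X / Real.log X ^ A := by
  obtain ⟨C, hC, hsm⟩ := exists_smoothed_le (2 * A + 4)
  have hpow := (Real.isLittleO_pow_log_id_atTop (n := A + 2)).bound (show (0 : ℝ) < 1 by norm_num)
  filter_upwards [tendsto_log_natCast.eventually
      (eventually_logLevel_pow_le B (13 * ((2 * A + 4) + 1))),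
    tendsto_log_natCast.eventually_ge_atTop (8 * C + 4), eventually_ge_atTop 8,
    tendsto_natCast_atTop_atTop.eventually hpow] with X hlev hL hX8 hpw Q hQ hQX q _ χ hqQ hχp hχ
  have hQ1 : 1 ≤ Q := (NeZero.one_le (n := q)).trans hqQ
  specialize hlev Q hQ1 hQX
  set L := Real.log X with hLdef
  have hL4 : 4 ≤ L := by linarith
  have hX0 : (8 : ℝ) ≤ X := by exact_mod_cast hX8
  rw [Real.norm_of_nonneg (by positivity), id, Real.norm_of_nonneg (by linarith), one_mul] at hpw
  set h : ℕ := ⌈(X : ℝ) / L ^ (A + 2)⌉₊ with hh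
  have hge : X / L ^ (A + 2) ≤ h := Nat.le_ceil _
  have hq1 : 1 ≤ X / L ^ (A + 2) := by rw [one_le_div (by positivity)]; exact hpw
  have hh1 : (1 : ℝ) ≤ h := hq1.trans hge
  have hle : (h : ℝ) ≤ 2 * (X / L ^ (A + 2)) := by
    have := Nat.ceil_lt_add_one (a := (X : ℝ) / L ^ (A + 2)) (by positivity)
    linarith
  have hhX : h ≤ X := by
    have : (1 : ℝ) ≤ L ^ (A + 2) := one_le_pow₀ (by linarith)
    refine Nat.ceil_le.2 (div_le_self (by positivity) this)
  have hbound : ∀ Y : ℕ, X ≤ Y → Y ≤ 2 * X →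
      ‖∑ n ∈ Ioc 0 Y, (Λ n : ℂ) * χ n * (Y - n : ℝ)‖ ≤ 4 * C * X ^ 2 / L ^ (2 * A + 3) := by
    intro Y hXY hYX
    have hY := hsm Q hQ q χ hqQ hχp hχ Y (by omega)
    have hXYr : (X : ℝ) ≤ Y := by exact_mod_cast hXY
    have hYXr : (Y : ℝ) ≤ 2 * X := by exact_mod_cast hYX
    have hY0 : (Y : ℂ) ≠ 0 := by
      have : Y ≠ 0 := by omega
      exact_mod_cast this
    have e : ∑ n ∈ Ioc 0 Y, (Λ n : ℂ) * χ n * (Y - n : ℝ) =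
        (Y : ℂ) * ∑ n ∈ Ioc 0 Y, χ n * (Λ n : ℂ) * (1 - n / Y : ℝ) := by
      rw [mul_sum]
      refine sum_congr rfl fun n _ => ?_
      push_cast
      field_simp
    have hLY : L ≤ Real.log Y := Real.log_le_log (by linarith) hXYr
    rw [e, norm_mul, Complex.norm_natCast]
    have hLY0 : 0 < Real.log Y := by linarith
    have hl0 := two_le_logLevel hQ1
    calc _ ≤ (Y : ℝ) * (C * logLevel Q ^ (13 * ((2 * A + 4) + 1)) * Y / Real.log Y ^ (2 * A + 4)) := by
          gcongr
      _ ≤ (2 * X : ℝ) * (C * L * (2 * X) / L ^ (2 * A + 4)) := by gcongr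
      _ = _ := by
        rw [show 2 * A + 4 = (2 * A + 3) + 1 by ring, pow_succ L (2 * A + 3)]
        field_simp
        ring
  have hres := norm_psi_le_of_smoothed (f := fun n => (Λ n : ℂ) * χ n) (X := X) (h := h) (by
      intro n
      rw [norm_mul, Complex.norm_real, Real.norm_of_nonneg vonMangoldt_nonneg]
      exact (mul_le_of_le_one_right vonMangoldt_nonneg (χ.norm_le_one _)).trans vonMangoldt_le_log)
    (by omega) (by exact_mod_cast hh1) (by simpa using hbound X le_rfl (by omega))
    (by simpa using hbound (X + h) (by omega) (by omega))
  refine hres.trans ?_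
  have hlog2 : Real.log (X + h : ℕ) ≤ 2 * L := by
    have : ((X + h : ℕ) : ℝ) ≤ X ^ 2 := by
      have : (h : ℝ) ≤ X := by exact_mod_cast hhX
      push_cast
      nlinarith
    have := Real.log_le_log (by positivity) this
    rwa [Real.log_pow] at this
  have t1 : 2 * (4 * C * X ^ 2 / L ^ (2 * A + 3)) / h ≤ 8 * C * X / L ^ (A + 1) := by
    calc _ ≤ 2 * (4 * C * X ^ 2 / L ^ (2 * A + 3)) / (X / L ^ (A + 2)) := by gcongr
      _ = _ := by
        rw [show 2 * A + 3 = (A + 2) + (A + 1) by ring, pow_add L (A + 2)]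
        field_simp
        ring
  have t2 : h * Real.log (X + h : ℕ) ≤ 4 * X / L ^ (A + 1) := by
    calc _ ≤ (2 * (X / L ^ (A + 2))) * (2 * L) := by gcongr
      _ = _ := by
        rw [show A + 2 = (A + 1) + 1 by ring, pow_succ L (A + 1)]
        field_simp
        ring
  calc _ ≤ 8 * C * X / L ^ (A + 1) + 4 * X / L ^ (A + 1) := add_le_add t1 t2
    _ = (8 * C + 4) * X / L ^ (A + 1) := by ring
    _ ≤ L * X / L ^ (A + 1) := by gcongr
    _ = _ := by rw [pow_succ]; field_simp

end BoundedGaps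

namespace BoundedGaps
open Finset Filter ArithmeticFunction
open scoped Topology

theorem exists_goodLevel_scale {B : ℕ} (hB : B ≠ 0) (X₀ : ℕ) : ∃ X ≥ X₀, ∃ Q, IsGoodLevel Q ∧
    1 ≤ Q ∧ (Q : ℝ) ≤ Real.log X ^ B ∧ (Real.log X / 2) ^ B ≤ Q := by
  obtain ⟨Q, hQ, hgood⟩ := exists_isGoodLevel (max 1 (X₀ ^ B))
  have hQ1 : 1 ≤ Q := (le_max_left _ _).trans hQ
  have hQX : X₀ ^ B ≤ Q := (le_max_right _ _).trans hQ
  have hQ1r : (1 : ℝ) ≤ Q := by exact_mod_cast hQ1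
  set t : ℝ := (Q : ℝ) ^ (1 / B : ℝ) with ht
  have htB : t ^ B = Q := by
    rw [ht, ← Real.rpow_natCast, ← Real.rpow_mul (by positivity),
      one_div_mul_cancel (by exact_mod_cast hB), Real.rpow_one]
  have ht1 : 1 ≤ t := Real.one_le_rpow hQ1r (by positivity)
  have htX : (X₀ : ℝ) ≤ t := by
    have : (X₀ : ℝ) ^ B ≤ t ^ B := by rw [htB]; exact_mod_cast hQX
    exact le_of_pow_le_pow_left₀ hB (by linarith) this
  have he : Real.exp t ≤ ⌈Real.exp t⌉₊ := Nat.le_ceil _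
  have he0 := Real.add_one_le_exp t
  refine ⟨⌈Real.exp t⌉₊, ?_, Q, hgood, hQ1, ?_, ?_⟩
  · have : (X₀ : ℝ) ≤ ⌈Real.exp t⌉₊ := by linarith
    exact_mod_cast this
  · rw [← htB]
    refine pow_le_pow_left₀ (by linarith) ?_ _
    rw [Real.le_log_iff_exp_le (by linarith)]
    exact he
  · rw [← htB]
    refine pow_le_pow_left₀ (div_nonneg (Real.log_natCast_nonneg _) (by norm_num)) ?_ _
    have h1 : Real.log ⌈Real.exp t⌉₊ ≤ t + 1 := by
      rw [Real.log_le_iff_le_exp (by linarith), Real.exp_add]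
      have := Nat.ceil_lt_add_one (Real.exp_pos t).le
      have := Real.add_one_le_exp (1 : ℝ)
      nlinarith
    linarith

/-- The primes in `(√x, x]`. -/
def bigPrimes (x : ℕ) : Finset ℕ := {p ∈ Ioc (Nat.sqrt x) x | p.Prime}

/-- The character sum `∑ χ(p) log p` over the primes in `(√x, x]`. -/
noncomputable def primeCharSum (x : ℕ) {n : ℕ} (χ : DirichletCharacter ℂ n) : ℂ :=
  ∑ p ∈ bigPrimes x, (Real.log p : ℂ) * χ p

open Classical in
/-- The primitive characters of conductor between `2` and `R`. -/
noncomputable def primChars (R : ℕ) : Finset (Σ n, DirichletCharacter ℂ n) :=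
  (Icc 2 R).sigma fun _ => {χ | χ.IsPrimitive}

theorem mem_primChars {R : ℕ} {i : Σ n, DirichletCharacter ℂ n} :
    i ∈ primChars R ↔ 2 ≤ i.1 ∧ i.1 ≤ R ∧ i.2.IsPrimitive := by
  simp [primChars, and_assoc]

theorem card_primChars_le (R : ℕ) : #(primChars R) ≤ R ^ 2 := by
  classical
  rw [primChars, card_sigma]
  calc _ ≤ ∑ n ∈ Icc 2 R, R := by
        refine sum_le_sum fun n hn => ?_
        rw [mem_Icc] at hn
        have : NeZero n := ⟨by omega⟩
        refine (card_filter_le _ _).trans ?_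
        rw [card_univ, ← Nat.card_eq_fintype_card,
          DirichletCharacter.card_eq_totient_of_hasEnoughRootsOfUnity]
        exact (Nat.totient_le n).trans hn.2
    _ ≤ R ^ 2 := by
        rw [sum_const, smul_eq_mul, sq, Nat.card_Icc]
        exact Nat.mul_le_mul_right _ (by omega)

theorem sum_log_bigPrimes (x : ℕ) :
    ∑ p ∈ bigPrimes x, Real.log p = Chebyshev.theta x - Chebyshev.theta (Nat.sqrt x) := by
  rw [Chebyshev.theta, Chebyshev.theta, Nat.floor_natCast, Nat.floor_natCast, bigPrimes, sum_filter,
    sum_filter, sum_filter, ← sum_Ioc_consecutive _ (Nat.zero_le _) (Nat.sqrt_le_self x)]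
  ring

theorem norm_psi_sub_primeCharSum_le {x : ℕ} (hx : 3 ≤ x) {n : ℕ} (χ : DirichletCharacter ℂ n) :
    ‖∑ m ∈ Ioc 0 x, (Λ m : ℂ) * χ m - primeCharSum x χ‖ ≤ 4 * √x * Real.log x := by
  have hx3 : (3 : ℝ) ≤ x := by exact_mod_cast hx
  have hl : 1 ≤ Real.log x := by
    rw [Real.le_log_iff_exp_le (by linarith)]
    linarith [Real.exp_one_lt_d9]
  have hsub : bigPrimes x ⊆ Ioc 0 x := fun p hp => by
    rw [bigPrimes, mem_filter, mem_Ioc] at hp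
    rw [mem_Ioc]
    omega
  have e1 : primeCharSum x χ =
      ∑ m ∈ Ioc 0 x, ((if m ∈ bigPrimes x then Real.log m else 0 : ℝ) : ℂ) * χ m := by
    rw [primeCharSum, ← sum_subset hsub fun m _ hm => by simp [hm]]
    exact sum_congr rfl fun p hp => by simp [hp]
  have e2 : ∑ m ∈ Ioc 0 x, (if m ∈ bigPrimes x then Real.log m else 0) =
      ∑ p ∈ bigPrimes x, Real.log p := by
    rw [← sum_subset hsub fun m _ hm => by simp [hm]]
    exact sum_congr rfl fun p hp => by simp [hp]
  rw [e1, ← sum_sub_distrib]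
  calc _ ≤ ∑ m ∈ Ioc 0 x, (Λ m - if m ∈ bigPrimes x then Real.log m else 0) := by
        refine norm_sum_le_of_le _ fun m _ => ?_
        have h0 : 0 ≤ Λ m - if m ∈ bigPrimes x then Real.log m else 0 := by
          split_ifs with h
          · rw [vonMangoldt_apply_prime (mem_filter.1 h).2, sub_self]
          · simp
        rw [← sub_mul, ← Complex.ofReal_sub, norm_mul, Complex.norm_real,
          Real.norm_of_nonneg h0]
        exact mul_le_of_le_one_right h0 (χ.norm_le_one _)
    _ = Chebyshev.psi x - Chebyshev.theta x + Chebyshev.theta (Nat.sqrt x) := by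
        rw [sum_sub_distrib, e2, sum_log_bigPrimes, Chebyshev.psi, Nat.floor_natCast]
        ring
    _ ≤ 2 * √x * Real.log x + 2 * √x := by
        have h1 := Chebyshev.psi_sub_theta_le (x := x) (by linarith)
        have h2 := Chebyshev.theta_le_log4_mul_x (x := (Nat.sqrt x : ℝ)) (by positivity)
        have h3 : (Nat.sqrt x : ℝ) ≤ √x := Real.nat_sqrt_le_real_sqrt
        have h4 : Real.log 4 ≤ 2 := by
          rw [show (4 : ℝ) = 2 ^ 2 by norm_num, Real.log_pow]
          push_cast
          linarith [Real.log_two_lt_d9]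
        have h5 : Real.log 4 * (Nat.sqrt x : ℝ) ≤ 2 * √x := by gcongr
        linarith
    _ ≤ _ := by
        have : 0 ≤ √(x : ℝ) := by positivity
        nlinarith

theorem tendsto_sqrt_sqrt_natCast : Tendsto (fun x : ℕ => √√(x : ℝ)) atTop atTop :=
  (Real.tendsto_sqrt_atTop.comp Real.tendsto_sqrt_atTop).comp tendsto_natCast_atTop_atTop

theorem eventually_log_pow_le_sqrt_sqrt (c : ℝ) (hc : 0 < c) (A : ℕ) :
    ∀ᶠ x : ℕ in atTop, c * Real.log x ^ A ≤ √√(x : ℝ) := by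
  have h := (Real.isLittleO_pow_log_id_atTop (n := A)).bound
    (show (0 : ℝ) < 1 / (c * 4 ^ A) by positivity)
  filter_upwards [tendsto_sqrt_sqrt_natCast.eventually h, eventually_ge_atTop 1] with x hx hx1
  have hx0 : (1 : ℝ) ≤ x := by exact_mod_cast hx1
  rw [id, Real.log_sqrt (by positivity), Real.log_sqrt (by positivity),
    Real.norm_of_nonneg (pow_nonneg (div_nonneg (div_nonneg (Real.log_natCast_nonneg _)
    (by norm_num)) (by norm_num)) _), Real.norm_of_nonneg (by positivity), div_div, div_pow,
    div_mul_eq_mul_div, one_mul, le_div_iff₀ (by positivity)] at hx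
  norm_num at hx
  calc c * Real.log x ^ A = Real.log x ^ A / 4 ^ A * (c * 4 ^ A) := by field_simp
    _ ≤ _ := hx

theorem exists_sum_primChars_le (A X₀ : ℕ) : ∃ x ≥ X₀, ∀ R : ℕ, 1 ≤ R → R ^ 15 ≤ x →
    ∑ i ∈ primChars R, ‖primeCharSum x i.2‖ / √i.1 ≤ x / Real.log x ^ A := by
  set B := 2 * (A + 6) with hB
  have hev := (((eventually_norm_psi_char_le (A + 2 * B + 2) B).and (eventually_ge_atTop X₀)).and
    ((eventually_ge_atTop 3).and (eventually_log_pow_le_sqrt_sqrt 4 (by norm_num) (A + 3)))).and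
    (tendsto_log_natCast.eventually_ge_atTop (2 + 96 * 2 ^ (A + 6)))
  obtain ⟨X₁, hX₁⟩ := eventually_atTop.1 hev
  obtain ⟨x, hx, Q, hQ, hQ1, hQL, hLQ⟩ := exists_goodLevel_scale (B := B) (by omega) X₁
  obtain ⟨⟨⟨hsmall, hxX⟩, hx3, hpow⟩, hLbig⟩ := hX₁ x hx
  refine ⟨x, hxX, fun R hR hRx => ?_⟩
  set L := Real.log x with hL
  have hx0 : (3 : ℝ) ≤ x := by exact_mod_cast hx3
  have hL2 : 2 ≤ L := le_trans (by linarith [show (0 : ℝ) < 96 * 2 ^ (A + 6) by positivity]) hLbig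
  have hQr : (1 : ℝ) ≤ Q := by exact_mod_cast hQ1
  have hsQ : (L / 2) ^ (A + 6) ≤ √Q := by
    rw [Real.le_sqrt (by positivity) (by positivity), ← pow_mul]
    rwa [mul_comm]
  set p : (Σ n, DirichletCharacter ℂ n) → ℝ := fun i => ‖∑ n ∈ Ioc 0 x, (Λ n : ℂ) * i.2 n‖ with hp
  have hpoint : ∀ i ∈ primChars R, ‖primeCharSum x i.2‖ / √i.1 ≤
      (if i.1 ≤ Q then x / L ^ (A + 2 * B + 2) else 0) + p i / √Q + 4 * √x * L := by
    intro i hi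
    obtain ⟨h2, hiR, hip⟩ := mem_primChars.1 hi
    have hi1 : (1 : ℝ) ≤ i.1 := by exact_mod_cast (by omega : 1 ≤ i.1)
    have hs1 : 1 ≤ √(i.1 : ℝ) := Real.one_le_sqrt.2 hi1
    have h1 : ‖primeCharSum x i.2‖ ≤ p i + 4 * √x * L := by
      have := norm_psi_sub_primeCharSum_le hx3 i.2
      rw [norm_sub_rev] at this
      calc ‖primeCharSum x i.2‖ = ‖(∑ n ∈ Ioc 0 x, (Λ n : ℂ) * i.2 n) + (primeCharSum x i.2 -
            ∑ n ∈ Ioc 0 x, (Λ n : ℂ) * i.2 n)‖ := by rw [add_sub_cancel]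
        _ ≤ _ := (norm_add_le _ _).trans (by gcongr)
    have h3 : ‖primeCharSum x i.2‖ / √i.1 ≤ p i / √i.1 + 4 * √x * L := by
      calc _ ≤ (p i + 4 * √x * L) / √i.1 := by gcongr
        _ = p i / √i.1 + 4 * √x * L / √i.1 := add_div _ _ _
        _ ≤ _ := by gcongr; exact div_le_self (by positivity) hs1
    refine h3.trans ?_
    have hp0 : 0 ≤ p i := norm_nonneg _
    gcongr
    split_ifs with hiQ
    · have hne : i.2 ≠ 1 := by
        intro h
        have : NeZero i.1 := ⟨by omega⟩
        have h5 : i.2.conductor = i.1 := hip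
        rw [h, DirichletCharacter.conductor_one] at h5
        omega
      have : NeZero i.1 := ⟨by omega⟩
      have h4 := hsmall Q hQ hQL i.1 i.2 hiQ hip hne
      have h5 : p i / √i.1 ≤ p i := div_le_self hp0 hs1
      have h6 : 0 ≤ p i / √Q := by positivity
      linarith
    · rw [zero_add]
      push Not at hiQ
      have : (Q : ℝ) ≤ i.1 := by exact_mod_cast hiQ.le
      gcongr
  have hcardQ : (#((primChars R).filter fun i => i.1 ≤ Q) : ℝ) ≤ Q ^ 2 := by
    have : (primChars R).filter (fun i => i.1 ≤ Q) ⊆ primChars Q := by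
      intro i hi
      rw [mem_filter, mem_primChars] at hi
      exact mem_primChars.2 ⟨hi.1.1, hi.2, hi.1.2.2⟩
    exact_mod_cast (card_le_card this).trans (card_primChars_le Q)
  have hpart1 : ∑ i ∈ primChars R, (if i.1 ≤ Q then (x : ℝ) / L ^ (A + 2 * B + 2) else 0) ≤
      x / L ^ (A + 2) := by
    rw [← sum_filter, sum_const, nsmul_eq_mul]
    calc _ ≤ (Q : ℝ) ^ 2 * (x / L ^ (A + 2 * B + 2)) := by gcongr
      _ ≤ (L ^ B) ^ 2 * (x / L ^ (A + 2 * B + 2)) := by gcongr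
      _ = _ := by
        rw [show A + 2 * B + 2 = B * 2 + (A + 2) by ring, pow_add L (B * 2), ← pow_mul]
        generalize B * 2 = b
        field_simp
  have hpart2 : ∑ i ∈ primChars R, p i / √Q ≤ 96 * 2 ^ (A + 6) * x / L ^ (A + 2) := by
    rw [← sum_div]
    have := large_conductors R hR x hRx (primChars R) (fun i hi => mem_primChars.1 hi)
      (card_primChars_le R)
    calc _ ≤ 6 * x * (1 + L) ^ 4 / (L / 2) ^ (A + 6) := by gcongr
      _ ≤ 6 * x * (2 * L) ^ 4 / (L / 2) ^ (A + 6) := by gcongr; linarith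
      _ = _ := by
        rw [div_pow, show A + 6 = 4 + (A + 2) by ring, pow_add L 4, mul_pow]
        field_simp
        ring
  have hpart3 : ∑ i ∈ primChars R, 4 * √x * L ≤ x / L ^ (A + 2) := by
    rw [sum_const, nsmul_eq_mul]
    have hR2 : ((R : ℝ) ^ 2) ≤ √√(x : ℝ) := by
      rw [Real.le_sqrt (by positivity) (by positivity), Real.le_sqrt (by positivity) (by positivity)]
      have : R ^ 8 ≤ x := (Nat.pow_le_pow_right hR (by norm_num)).trans hRx
      rw [← pow_mul, ← pow_mul]
      exact_mod_cast this
    have hcard : (#(primChars R) : ℝ) ≤ R ^ 2 := by exact_mod_cast card_primChars_le R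
    have hL0 : 0 < L := by linarith
    rw [le_div_iff₀ (by positivity)]
    calc _ ≤ √√(x : ℝ) * (4 * √x * L) * L ^ (A + 2) := by gcongr; exact hcard.trans hR2
      _ = √√(x : ℝ) * √x * (4 * L ^ (A + 3)) := by rw [show A + 3 = A + 2 + 1 by ring, pow_succ L (A+2)]; ring
      _ ≤ √√(x : ℝ) * √x * √√(x : ℝ) := by gcongr
      _ = √(x : ℝ) * (√√(x : ℝ) * √√(x : ℝ)) := by ring
      _ = x := by rw [Real.mul_self_sqrt (by positivity), Real.mul_self_sqrt (by positivity)]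
  calc _ ≤ ∑ i ∈ primChars R, ((if i.1 ≤ Q then x / L ^ (A + 2 * B + 2) else 0) + p i / √Q +
          4 * √x * L) := sum_le_sum hpoint
    _ ≤ x / L ^ (A + 2) + 96 * 2 ^ (A + 6) * x / L ^ (A + 2) + x / L ^ (A + 2) := by
        rw [sum_add_distrib, sum_add_distrib]
        gcongr
    _ = (2 + 96 * 2 ^ (A + 6)) * x / L ^ (A + 2) := by ring
    _ ≤ L * x / L ^ (A + 2) := by gcongr
    _ = x / L ^ (A + 1) := by rw [pow_succ L (A + 1)]; field_simp
    _ ≤ x / L ^ A := by gcongr <;> [linarith; omega]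

end BoundedGaps

namespace BoundedGaps
open Finset Filter

theorem sum_dvd_le_sum_mul {f : ℕ → ℝ} (hf : ∀ n, 0 ≤ f n) {d : ℕ} (hd : 0 < d) (R : ℕ) :
    ∑ m ∈ Icc 1 R with d ∣ m, f m ≤ ∑ e ∈ Icc 1 R, f (d * e) := by
  rw [← sum_image (s := Icc 1 R) (g := fun e => d * e) (f := f)
    fun a _ b _ h => Nat.eq_of_mul_eq_mul_left hd h]
  refine sum_le_sum_of_subset_of_nonneg (fun m hm => ?_) fun _ _ _ => hf _
  obtain ⟨hm, e, rfl⟩ := mem_filter.1 hm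
  rw [mem_Icc] at hm
  refine mem_image.2 ⟨e, mem_Icc.2 ⟨?_, ?_⟩, rfl⟩
  · exact Nat.pos_of_ne_zero fun h => by simp [h] at hm
  · nlinarith

/-- `K ^ ω(n) / n`, supported on squarefree numbers. -/
noncomputable def omegaWeight (K n : ℕ) : ℝ :=
  if Squarefree n then (K : ℝ) ^ #n.primeFactors / n else 0

theorem omegaWeight_nonneg (K n : ℕ) : 0 ≤ omegaWeight K n := by
  unfold omegaWeight
  split_ifs <;> positivity

theorem omegaWeight_mul_le (K m n : ℕ) :
    omegaWeight K (m * n) ≤ omegaWeight K m * omegaWeight K n := by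
  unfold omegaWeight
  split_ifs with h h1 h2 h2
  · have hc := Nat.coprime_of_squarefree_mul h
    rw [hc.primeFactors_mul, card_union_of_disjoint hc.disjoint_primeFactors, pow_add, Nat.cast_mul,
      mul_div_mul_comm]
  · exact absurd h.of_mul_right h2
  · exact absurd h.of_mul_left h1
  · exact absurd h.of_mul_left h1
  all_goals positivity

theorem sum_inv_Icc_le (R : ℕ) : ∑ e ∈ Icc 1 R, (1 / e : ℝ) ≤ 1 + Real.log R := by
  have := harmonic_le_one_add_log R
  rw [harmonic_eq_sum_Icc] at this
  push_cast at this
  simpa [one_div] using this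

theorem succ_pow_card_primeFactors_le (K : ℕ) {m : ℕ} (hm : m ≠ 0) :
    ((K : ℝ) + 1) ^ #m.primeFactors ≤
      ∑ d ∈ m.divisors with Squarefree d, (K : ℝ) ^ #d.primeFactors := by
  have h := sum_pow_mul_eq_add_pow (K : ℝ) 1 m.primeFactors
  simp only [one_pow, mul_one] at h
  have hp : ∀ t ∈ m.primeFactors.powerset, ∀ p ∈ t, p.Prime := fun t ht p hpt =>
    Nat.prime_of_mem_primeFactors (mem_powerset.1 ht hpt)
  have hinj : Set.InjOn (fun t : Finset ℕ => ∏ p ∈ t, p) m.primeFactors.powerset := by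
    intro t ht u hu htu
    have := congrArg Nat.primeFactors htu
    simp only [Nat.primeFactors_prod (hp t ht), Nat.primeFactors_prod (hp u hu)] at this
    exact this
  rw [← h]
  calc ∑ t ∈ m.primeFactors.powerset, (K : ℝ) ^ #t =
        ∑ t ∈ m.primeFactors.powerset, (K : ℝ) ^ #(∏ p ∈ t, p).primeFactors :=
        sum_congr rfl fun t ht => by rw [Nat.primeFactors_prod (hp t ht)]
    _ = ∑ d ∈ m.primeFactors.powerset.image (fun t : Finset ℕ => ∏ p ∈ t, p),
        (K : ℝ) ^ #d.primeFactors :=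
        (sum_image (f := fun d : ℕ => (K : ℝ) ^ #d.primeFactors) hinj).symm
    _ ≤ _ := by
      refine sum_le_sum_of_subset_of_nonneg (fun d hd => ?_) fun _ _ _ => by positivity
      obtain ⟨t, ht, rfl⟩ := mem_image.1 hd
      rw [mem_filter, Nat.mem_divisors]
      refine ⟨⟨(prod_dvd_prod_of_subset _ _ _ (mem_powerset.1 ht)).trans
        (Nat.prod_primeFactors_dvd m), hm⟩, ?_⟩
      exact Finset.squarefree_prod_of_pairwise_isCoprime (fun a ha b hb hab =>
        Nat.coprime_iff_isRelPrime.1 ((Nat.coprime_primes (hp t ht a ha) (hp t ht b hb)).2 hab)) fun a ha =>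
        (hp t ht a ha).prime.squarefree

theorem sum_omegaWeight_le (K R : ℕ) :
    ∑ m ∈ Icc 1 R, omegaWeight K m ≤ (1 + Real.log R) ^ K := by
  induction K with
  | zero =>
    rw [pow_zero]
    calc ∑ m ∈ Icc 1 R, omegaWeight 0 m ≤ ∑ m ∈ Icc 1 R, if m = 1 then (1 : ℝ) else 0 := by
          refine sum_le_sum fun m hm => ?_
          rw [mem_Icc] at hm
          unfold omegaWeight
          split_ifs with h1 h2 h2
          · simp [h2]
          · rw [Nat.cast_zero, zero_pow, zero_div]
            rw [Ne, card_eq_zero, Nat.primeFactors_eq_empty]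
            omega
          · norm_num
          · rfl
      _ ≤ 1 := by
        rw [sum_ite_eq']
        split_ifs <;> norm_num
  | succ K ih =>
    have h1 : ∀ m ∈ Icc 1 R, omegaWeight (K + 1) m ≤
        ∑ d ∈ Icc 1 R, if d ∣ m then omegaWeight K d * d * (1 / m) else 0 := by
      intro m hm
      rw [mem_Icc] at hm
      have hm0 : m ≠ 0 := by omega
      have hnn : 0 ≤ ∑ d ∈ Icc 1 R, if d ∣ m then omegaWeight K d * d * (1 / m : ℝ) else 0 := by
        refine sum_nonneg fun d _ => ?_
        have := omegaWeight_nonneg K d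
        split_ifs <;> positivity
      rw [omegaWeight]
      split_ifs with hs
      · push_cast
        rw [← sum_filter, ← mul_one_div]
        calc _ ≤ (∑ d ∈ m.divisors with Squarefree d, (K : ℝ) ^ #d.primeFactors) * (1 / m) := by
              gcongr; exact succ_pow_card_primeFactors_le K hm0
          _ = ∑ d ∈ m.divisors with Squarefree d, omegaWeight K d * d * (1 / m) := by
              rw [sum_mul]
              refine sum_congr rfl fun d hd => ?_
              obtain ⟨hd, hsq⟩ := mem_filter.1 hd
              have : (d : ℝ) ≠ 0 := by exact_mod_cast (Nat.pos_of_mem_divisors hd).ne'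
              rw [omegaWeight, if_pos hsq, div_mul_cancel₀ _ this]
          _ ≤ _ := by
              refine sum_le_sum_of_subset_of_nonneg (fun d hd => ?_) fun d _ _ => ?_
              · obtain ⟨hd, -⟩ := mem_filter.1 hd
                rw [Nat.mem_divisors] at hd
                have h1 := Nat.le_of_dvd (by omega) hd.1
                have h2 := Nat.pos_of_dvd_of_pos hd.1 (by omega)
                exact mem_filter.2 ⟨mem_Icc.2 ⟨h2, h1.trans hm.2⟩, hd.1⟩
              · have := omegaWeight_nonneg K d
                positivity
      · exact hnn
    calc _ ≤ ∑ m ∈ Icc 1 R, ∑ d ∈ Icc 1 R, if d ∣ m then omegaWeight K d * d * (1 / m : ℝ) else 0 :=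
          sum_le_sum h1
      _ = ∑ d ∈ Icc 1 R, omegaWeight K d * d * ∑ m ∈ Icc 1 R with d ∣ m, (1 / m : ℝ) := by
          rw [sum_comm]
          refine sum_congr rfl fun d _ => ?_
          rw [mul_sum, sum_filter]
      _ ≤ ∑ d ∈ Icc 1 R, omegaWeight K d * (1 + Real.log R) := by
          refine sum_le_sum fun d hd => ?_
          rw [mem_Icc] at hd
          have hd0 : (0 : ℝ) < d := by exact_mod_cast hd.1
          have h2 := sum_dvd_le_sum_mul (f := fun m => (1 / m : ℝ)) (fun n => by positivity) hd.1 R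
          have h3 : ∑ e ∈ Icc 1 R, (1 / (d * e : ℕ) : ℝ) = (1 / d) * ∑ e ∈ Icc 1 R, (1 / e : ℝ) := by
            rw [mul_sum]
            refine sum_congr rfl fun e _ => ?_
            push_cast
            rw [one_div_mul_one_div]
          rw [h3] at h2
          have h4 := omegaWeight_nonneg K d
          have h5 := sum_inv_Icc_le R
          calc _ ≤ omegaWeight K d * d * ((1 / d) * (1 + Real.log R)) := by
                refine mul_le_mul_of_nonneg_left (h2.trans ?_) (by positivity)
                gcongr
            _ = _ := by field_simp
      _ ≤ _ := by
          rw [← sum_mul, pow_succ]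
          have := Real.log_natCast_nonneg R
          gcongr

theorem exists_pow_card_primeFactors_le (K : ℕ) :
    ∃ C > 0, ∀ n : ℕ, n ≠ 0 → (K : ℝ) ^ #n.primeFactors ≤ C * √n := by
  refine ⟨((K : ℝ) + 1) ^ (K ^ 2), by positivity, fun n hn => ?_⟩
  have h1 : ∏ p ∈ n.primeFactors, √(p : ℝ) ≤ √n := by
    refine Real.le_sqrt_of_sq_le ?_
    rw [← prod_pow]
    calc ∏ p ∈ n.primeFactors, √(p : ℝ) ^ 2 = ((∏ p ∈ n.primeFactors, p : ℕ) : ℝ) := by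
          push_cast
          exact prod_congr rfl fun p _ => Real.sq_sqrt (by positivity)
      _ ≤ n := by exact_mod_cast Nat.le_of_dvd (by omega) (Nat.prod_primeFactors_dvd n)
  calc (K : ℝ) ^ #n.primeFactors = ∏ p ∈ n.primeFactors, (K : ℝ) := by rw [prod_const]
    _ ≤ ∏ p ∈ n.primeFactors, ((if p < K ^ 2 then (K + 1 : ℝ) else 1) * √(p : ℝ)) := by
        refine prod_le_prod (fun _ _ => by positivity) fun p hp => ?_
        have hp1 : 1 ≤ √(p : ℝ) := by
          rw [Real.one_le_sqrt]
          exact_mod_cast (Nat.prime_of_mem_primeFactors hp).one_lt.le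
        split_ifs with h
        · have : (0 : ℝ) ≤ K := by positivity
          nlinarith
        · rw [one_mul]
          refine Real.le_sqrt_of_sq_le ?_
          push Not at h
          exact_mod_cast h
    _ = (∏ p ∈ n.primeFactors, (if p < K ^ 2 then (K + 1 : ℝ) else 1)) *
        ∏ p ∈ n.primeFactors, √(p : ℝ) := prod_mul_distrib
    _ ≤ _ := by
        gcongr
        rw [prod_ite, prod_const, prod_const_one, mul_one]
        refine pow_le_pow_right₀ (by linarith [show (0 : ℝ) ≤ K by positivity]) ?_
        calc _ ≤ #(range (K ^ 2)) := card_le_card fun p hp => by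
              rw [mem_filter] at hp
              exact mem_range.2 hp.2
          _ = _ := card_range _

theorem le_two_pow_mul_totient {q : ℕ} (hq : Squarefree q) :
    (q : ℝ) ≤ 2 ^ #q.primeFactors * q.totient := by
  have h0 : q ≠ 0 := hq.ne_zero
  have h1 : q.totient = ∏ p ∈ q.primeFactors, (p - 1) := by
    have := Nat.totient_mul_prod_primeFactors q
    rw [Nat.prod_primeFactors_of_squarefree hq, mul_comm] at this
    exact Nat.eq_of_mul_eq_mul_left (Nat.pos_of_ne_zero h0) this
  have : q ≤ 2 ^ #q.primeFactors * q.totient := by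
    calc q = ∏ p ∈ q.primeFactors, p := (Nat.prod_primeFactors_of_squarefree hq).symm
      _ ≤ ∏ p ∈ q.primeFactors, 2 * (p - 1) := prod_le_prod' fun p hp => by
          have := (Nat.prime_of_mem_primeFactors hp).two_le
          omega
      _ = _ := by rw [prod_mul_distrib, prod_const, h1]
  exact_mod_cast this

open Classical in
/-- The bound for the error in the distribution of `bigPrimes x` modulo `q`. -/
noncomputable def distError (x q : ℕ) : ℝ :=
  (1 / q.totient) * ∑ χ : DirichletCharacter ℂ q, if χ = 1 then 0 else ‖primeCharSum x χ‖

theorem distError_nonneg (x q : ℕ) : 0 ≤ distError x q := by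
  unfold distError
  refine mul_nonneg (by positivity) (sum_nonneg fun χ _ => ?_)
  split_ifs <;> positivity

theorem primeCharSum_primitiveCharacter {x q : ℕ} [NeZero q] (hq : q ≤ Nat.sqrt x)
    (χ : DirichletCharacter ℂ q) : primeCharSum x χ.primitiveCharacter = primeCharSum x χ := by
  refine sum_congr rfl fun p hp => ?_
  rw [bigPrimes, mem_filter, mem_Ioc] at hp
  have hc : IsCoprime (p : ℤ) q := by
    rw [Nat.isCoprime_iff_coprime, hp.2.coprime_iff_not_dvd]
    exact fun h => by
      have := Nat.le_of_dvd (NeZero.pos q) h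
      omega
  have := χ.primitiveCharacter_apply_of_isCoprime hc
  push_cast at this
  rw [this]

theorem abs_sum_log_bigPrimes_sub_le {x q : ℕ} [NeZero q] (hq : q ≤ Nat.sqrt x) {a : ZMod q}
    (ha : IsUnit a) :
    |∑ p ∈ bigPrimes x with ((p : ℕ) : ZMod q) = a, Real.log p -
      (∑ p ∈ bigPrimes x, Real.log p) / q.totient| ≤ distError x q := by
  classical
  have hφ : (0 : ℝ) < q.totient := by exact_mod_cast Nat.totient_pos.2 (NeZero.pos q)
  have h1 : ∑ χ : DirichletCharacter ℂ q, χ a⁻¹ * primeCharSum x χ =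
      q.totient * ((∑ p ∈ bigPrimes x with ((p : ℕ) : ZMod q) = a, Real.log p : ℝ) : ℂ) := by
    simp only [primeCharSum, mul_sum]
    rw [sum_comm, Complex.ofReal_sum, mul_sum, sum_filter]
    refine sum_congr rfl fun p _ => ?_
    have := DirichletCharacter.sum_char_inv_mul_char_eq ℂ ha (p : ZMod q)
    calc _ = (Real.log p : ℂ) * ∑ χ : DirichletCharacter ℂ q, χ a⁻¹ * χ p := by
          rw [mul_sum]
          exact sum_congr rfl fun χ _ => by ring
      _ = _ := by
          rw [this]
          by_cases h : a = p
          · simp [h, mul_comm]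
          · simp [h, Ne.symm h]
  have h2 : primeCharSum x (1 : DirichletCharacter ℂ q) = (∑ p ∈ bigPrimes x, Real.log p : ℝ) := by
    rw [primeCharSum]
    push_cast
    refine sum_congr rfl fun p hp => ?_
    rw [bigPrimes, mem_filter, mem_Ioc] at hp
    rw [MulChar.one_apply, mul_one]
    rw [ZMod.isUnit_iff_coprime, hp.2.coprime_iff_not_dvd]
    exact fun h => by
      have := Nat.le_of_dvd (NeZero.pos q) h
      omega
  have h3 : q.totient * ((∑ p ∈ bigPrimes x with ((p : ℕ) : ZMod q) = a, Real.log p -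
      (∑ p ∈ bigPrimes x, Real.log p) / q.totient : ℝ) : ℂ) =
      ∑ χ : DirichletCharacter ℂ q, if χ = 1 then 0 else χ a⁻¹ * primeCharSum x χ := by
    have hu : IsUnit a⁻¹ := by
      obtain ⟨u, rfl⟩ := ha
      rw [ZMod.inv_coe_unit]
      exact u⁻¹.isUnit
    have h4 : ∑ χ : DirichletCharacter ℂ q, χ a⁻¹ * primeCharSum x χ =
        (∑ χ : DirichletCharacter ℂ q, if χ = 1 then 0 else χ a⁻¹ * primeCharSum x χ) +
          primeCharSum x (1 : DirichletCharacter ℂ q) := by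
      rw [← sub_eq_iff_eq_add', ← sum_sub_distrib]
      rw [sum_eq_single (1 : DirichletCharacter ℂ q)]
      · simp [MulChar.one_apply hu]
      · intro χ _ h
        simp [h]
      · simp
    rw [h1, h2] at h4
    push_cast at h4 ⊢
    rw [mul_sub, h4, mul_div_cancel₀ _ (by exact_mod_cast hφ.ne')]
    ring
  have h5 : (q.totient : ℝ) * |∑ p ∈ bigPrimes x with ((p : ℕ) : ZMod q) = a, Real.log p -
      (∑ p ∈ bigPrimes x, Real.log p) / q.totient| ≤
      ∑ χ : DirichletCharacter ℂ q, if χ = 1 then 0 else ‖primeCharSum x χ‖ := by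
    have := congrArg norm h3
    rw [norm_mul, Complex.norm_natCast, Complex.norm_real, Real.norm_eq_abs] at this
    rw [this]
    refine norm_sum_le_of_le _ fun χ _ => ?_
    split_ifs
    · simp
    · rw [norm_mul]
      exact mul_le_of_le_one_left (norm_nonneg _) (χ.norm_le_one _)
  rw [distError, one_div, inv_mul_eq_div, le_div_iff₀ hφ, mul_comm]
  exact h5.trans_eq (sum_congr rfl fun χ _ => by congr)

theorem sum_norm_primeCharSum_le {x q R : ℕ} (hq0 : 1 ≤ q) (hqx : q ≤ Nat.sqrt x) (hqR : q ≤ R)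
    [∀ χ : DirichletCharacter ℂ q, Decidable (χ = 1)] :
    ∑ χ : DirichletCharacter ℂ q, (if χ = 1 then 0 else ‖primeCharSum x χ‖) ≤
      ∑ i ∈ primChars R with i.1 ∣ q, ‖primeCharSum x i.2‖ := by
  classical
  have : NeZero q := ⟨by omega⟩
  set T : DirichletCharacter ℂ q → Σ n, DirichletCharacter ℂ n :=
    fun χ => ⟨χ.conductor, χ.primitiveCharacter⟩ with hT
  have hinj : Function.Injective T := by
    have h0 : ∀ χ : DirichletCharacter ℂ q, ∀ i, T χ = i → ∀ h : i.1 ∣ q,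
        χ = DirichletCharacter.changeLevel h i.2 := by
      rintro χ i rfl h
      exact χ.changeLevel_primitiveCharacter.symm
    intro χ ψ h
    rw [h0 χ _ h ψ.conductor_dvd_level]
    exact ψ.changeLevel_primitiveCharacter
  calc _ = ∑ χ ∈ (univ : Finset (DirichletCharacter ℂ q)).filter (fun χ => ¬ χ = 1),
        ‖primeCharSum x (T χ).2‖ := by
        rw [sum_filter]
        refine sum_congr rfl fun χ _ => ?_
        rw [primeCharSum_primitiveCharacter hqx]
        split_ifs <;> rfl
    _ = ∑ i ∈ ((univ : Finset (DirichletCharacter ℂ q)).filter (fun χ => ¬ χ = 1)).image T,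
        ‖primeCharSum x i.2‖ :=
        (sum_image (f := fun i : Σ n, DirichletCharacter ℂ n => ‖primeCharSum x i.2‖)
          hinj.injOn).symm
    _ ≤ _ := by
        refine sum_le_sum_of_subset_of_nonneg (fun i hi => ?_) fun _ _ _ => norm_nonneg _
        obtain ⟨χ, hχ, rfl⟩ := mem_image.1 hi
        rw [mem_filter] at hχ
        have hd : χ.conductor ∣ q := χ.conductor_dvd_level
        have h0 : χ.conductor ≠ 0 := fun h => by rw [h, zero_dvd_iff] at hd; omega
        have h1 : χ.conductor ≠ 1 := fun h => hχ.2 (χ.eq_one_iff_conductor_eq_one.2 h)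
        have hle := Nat.le_of_dvd (by omega) hd
        rw [mem_filter, mem_primChars]
        exact ⟨⟨show 2 ≤ χ.conductor by omega, hle.trans hqR, χ.primitiveCharacter_isPrimitive⟩, hd⟩

theorem exists_sum_distError_le (K : ℕ) : ∃ C > 0, ∀ x R : ℕ, R ≤ Nat.sqrt x →
    ∑ q ∈ Icc 1 R with Squarefree q, (K : ℝ) ^ #q.primeFactors * distError x q ≤
      C * (1 + Real.log R) ^ (2 * K) * ∑ i ∈ primChars R, ‖primeCharSum x i.2‖ / √i.1 := by
  classical
  obtain ⟨C, hC, hω⟩ := exists_pow_card_primeFactors_le (2 * K)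
  refine ⟨C, hC, fun x R hR => ?_⟩
  have hstep : ∀ q ∈ Icc 1 R, (if Squarefree q then (K : ℝ) ^ #q.primeFactors * distError x q else 0) ≤
      ∑ i ∈ primChars R, if i.1 ∣ q then omegaWeight (2 * K) q * ‖primeCharSum x i.2‖ else 0 := by
    intro q hq
    rw [mem_Icc] at hq
    have hφ : (0 : ℝ) < q.totient := by exact_mod_cast Nat.totient_pos.2 hq.1
    have hq0 : (0 : ℝ) < q := by exact_mod_cast hq.1
    rw [← sum_filter, ← mul_sum]
    have hn : 0 ≤ ∑ i ∈ primChars R with i.1 ∣ q, ‖primeCharSum x i.2‖ :=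
      sum_nonneg fun _ _ => norm_nonneg _
    split_ifs with hs
    · rw [distError, ← mul_assoc]
      refine mul_le_mul ?_ (sum_norm_primeCharSum_le hq.1 (hq.2.trans hR) hq.2) ?_
        (omegaWeight_nonneg _ _)
      · rw [omegaWeight, if_pos hs, mul_one_div, div_le_div_iff₀ hφ hq0]
        push_cast
        rw [mul_pow]
        have := le_two_pow_mul_totient hs
        calc (K : ℝ) ^ #q.primeFactors * q ≤ K ^ #q.primeFactors * (2 ^ #q.primeFactors * q.totient) := by
              gcongr
          _ = _ := by ring
      · refine sum_nonneg fun χ _ => ?_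
        split_ifs <;> positivity
    · exact mul_nonneg (omegaWeight_nonneg _ _) hn
  rw [sum_filter]
  calc _ ≤ ∑ q ∈ Icc 1 R, ∑ i ∈ primChars R,
        (if i.1 ∣ q then omegaWeight (2 * K) q * ‖primeCharSum x i.2‖ else 0) := sum_le_sum hstep
    _ = ∑ i ∈ primChars R, ‖primeCharSum x i.2‖ *
          ∑ q ∈ Icc 1 R with i.1 ∣ q, omegaWeight (2 * K) q := by
        rw [sum_comm]
        refine sum_congr rfl fun i _ => ?_
        rw [mul_sum, sum_filter]
        exact sum_congr rfl fun q _ => by split_ifs <;> ring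
    _ ≤ ∑ i ∈ primChars R, ‖primeCharSum x i.2‖ * (C / √i.1 * (1 + Real.log R) ^ (2 * K)) := by
        refine sum_le_sum fun i hi => mul_le_mul_of_nonneg_left ?_ (norm_nonneg _)
        have hi2 := (mem_primChars.1 hi).1
        have hi0 : (0 : ℝ) < i.1 := by exact_mod_cast (by omega : 0 < i.1)
        calc _ ≤ ∑ e ∈ Icc 1 R, omegaWeight (2 * K) (i.1 * e) :=
              sum_dvd_le_sum_mul (omegaWeight_nonneg _) (by omega) R
          _ ≤ ∑ e ∈ Icc 1 R, omegaWeight (2 * K) i.1 * omegaWeight (2 * K) e :=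
              sum_le_sum fun e _ => omegaWeight_mul_le _ _ _
          _ = omegaWeight (2 * K) i.1 * ∑ e ∈ Icc 1 R, omegaWeight (2 * K) e := (mul_sum _ _ _).symm
          _ ≤ _ := by
              refine mul_le_mul ?_ (sum_omegaWeight_le _ _)
                (sum_nonneg fun _ _ => omegaWeight_nonneg _ _) (by positivity)
              rw [omegaWeight]
              split_ifs
              · have h := hω i.1 (by omega)
                rw [div_le_div_iff₀ hi0 (Real.sqrt_pos.2 hi0)]
                push_cast at h ⊢
                calc _ ≤ C * √i.1 * √i.1 := by gcongr
                  _ = _ := by rw [mul_assoc, Real.mul_self_sqrt hi0.le]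
              · positivity
    _ = _ := by
        rw [mul_sum]
        refine sum_congr rfl fun i _ => ?_
        ring

end BoundedGaps

namespace BoundedGaps
open Finset
open scoped Kronecker

theorem posSemidef_of_sum_nonneg {α : Type*} [Fintype α] {M : Matrix α α ℝ}
    (hs : ∀ x y, M x y = M y x) (h : ∀ u : α → ℝ, 0 ≤ ∑ x, ∑ y, u x * u y * M x y) :
    M.PosSemidef := by
  refine Matrix.PosSemidef.of_dotProduct_mulVec_nonneg ?_ fun u => ?_
  · ext x y
    simp [hs x y]
  · refine (h u).trans_eq ?_
    simp only [dotProduct, Matrix.mulVec, mul_sum]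
    exact sum_congr rfl fun x _ => sum_congr rfl fun y _ => by simp; ring

theorem Matrix.PosSemidef.sum_nonneg {α : Type*} [Fintype α] {M : Matrix α α ℝ}
    (h : M.PosSemidef) (u : α → ℝ) : 0 ≤ ∑ x, ∑ y, u x * u y * M x y := by
  refine (h.dotProduct_mulVec_nonneg u).trans_eq ?_
  simp only [dotProduct, Matrix.mulVec, mul_sum]
  exact sum_congr rfl fun x _ => sum_congr rfl fun y _ => by simp; ring

/-- The tensor product of a family of square matrices. -/
def tensorPower {ι α : Type*} [Fintype ι] (M : ι → Matrix α α ℝ) : Matrix (ι → α) (ι → α) ℝ :=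
  Matrix.of fun v w => ∏ p, M p (v p) (w p)

theorem tensorPower_fin_posSemidef {α : Type*} [Fintype α] {n : ℕ} (A B : Fin n → Matrix α α ℝ)
    (hA : ∀ p, (A p).PosSemidef) (hAB : ∀ p, (B p - A p).PosSemidef) :
    (tensorPower A).PosSemidef ∧ (tensorPower B - tensorPower A).PosSemidef := by
  induction n with
  | zero =>
    constructor
    · refine posSemidef_of_sum_nonneg (fun x y => by simp [tensorPower]) fun u => ?_
      simp only [tensorPower, Matrix.of_apply, univ_eq_empty, prod_empty, mul_one]
      rw [← sum_mul_sum]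
      exact mul_self_nonneg _
    · have : tensorPower B - tensorPower A = 0 := by
        ext x y
        simp [tensorPower]
      rw [this]
      exact Matrix.PosSemidef.zero
  | succ n ih =>
    obtain ⟨h1, h2⟩ := ih (fun p : Fin n => A p.succ) (fun p : Fin n => B p.succ) (fun p => hA _) fun p => hAB _
    have hT : ∀ M : Fin (n + 1) → Matrix α α ℝ, tensorPower M =
        (M 0 ⊗ₖ tensorPower fun p : Fin n => M p.succ).submatrix (fun v => (v 0, Fin.tail v))
          (fun v => (v 0, Fin.tail v)) := by
      intro M
      ext v w
      simp [tensorPower, Fin.prod_univ_succ, Fin.tail]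
    have hB : (tensorPower fun p : Fin n => B p.succ).PosSemidef := by
      simpa using h1.add h2
    have hsplit : tensorPower B - tensorPower A =
        ((B 0 - A 0) ⊗ₖ (tensorPower fun p : Fin n => B p.succ) + A 0 ⊗ₖ ((tensorPower fun p : Fin n => B p.succ) -
          tensorPower fun p : Fin n => A p.succ)).submatrix (fun v => (v 0, Fin.tail v))
          (fun v => (v 0, Fin.tail v)) := by
      rw [hT A, hT B]
      ext v w
      simp
      ring
    rw [hsplit, hT A]
    exact ⟨((hA 0).kronecker h1).submatrix _,
      (((hAB 0).kronecker hB).add ((hA 0).kronecker h2)).submatrix _⟩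

theorem sum_tensor_le {ι α : Type*} [Fintype ι] [Fintype α] (A B : ι → α → α → ℝ)
    (hA : ∀ p x y, A p x y = A p y x) (hB : ∀ p x y, B p x y = B p y x)
    (hA0 : ∀ p (u : α → ℝ), 0 ≤ ∑ x, ∑ y, u x * u y * A p x y)
    (hAB : ∀ p (u : α → ℝ), ∑ x, ∑ y, u x * u y * A p x y ≤ ∑ x, ∑ y, u x * u y * B p x y)
    [Fintype (ι → α)] (c : (ι → α) → ℝ) :
    ∑ v, ∑ w, c v * c w * ∏ p, A p (v p) (w p) ≤ ∑ v, ∑ w, c v * c w * ∏ p, B p (v p) (w p) := by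
  let e := Fintype.equivFin ι
  have h := (tensorPower_fin_posSemidef (fun j => Matrix.of (A (e.symm j)))
    (fun j => Matrix.of (B (e.symm j))) (fun j => posSemidef_of_sum_nonneg (hA _) (hA0 _))
    (fun j => posSemidef_of_sum_nonneg (fun x y => by simp [hA _ x y, hB _ x y]) fun u => ?_)).2
  · have h' := Matrix.PosSemidef.sum_nonneg (h.submatrix fun v : ι → α => fun j => v (e.symm j)) c
    rw [← sub_nonneg, ← sum_sub_distrib]
    refine h'.trans_eq (sum_congr rfl fun v _ => ?_)
    rw [← sum_sub_distrib]
    refine sum_congr rfl fun w _ => ?_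
    simp only [tensorPower, Matrix.submatrix_apply, Matrix.sub_apply, Matrix.of_apply]
    rw [e.symm.prod_comp fun p => A p (v p) (w p), e.symm.prod_comp fun p => B p (v p) (w p), mul_sub]
  · have := hAB (e.symm j) u
    rw [← sub_nonneg, ← sum_sub_distrib] at this
    refine this.trans_eq (sum_congr rfl fun x _ => ?_)
    rw [← sum_sub_distrib]
    exact sum_congr rfl fun y _ => by simp [mul_sub]

end BoundedGaps

namespace BoundedGaps
open Finset

/-- The coefficients expressing a product of two local sieve factors through the indicators of the
residue classes which are sieved out. -/
noncomputable def localCoeff {k : ℕ} (p : ℝ) (x y : Option (Fin k)) : Option (Fin k) → ℝ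
  | none => 1
  | some i => -(if x = some i then p else 0) - (if y = some i then p else 0) +
      (if x = some i ∧ y = some i then p ^ 2 else 0)

/-- A local sieve factor. -/
noncomputable def localFactor {k : ℕ} (p : ℝ) (I : Fin k → ℝ) (x : Option (Fin k)) : ℝ :=
  x.elim 1 fun i => 1 - p * I i

theorem localFactor_mul {k : ℕ} (p : ℝ) (I : Fin k → ℝ)
    (hI : ∀ i j, I i * I j = if i = j then I i else 0) (x y : Option (Fin k)) :
    localFactor p I x * localFactor p I y = ∑ l, localCoeff p x y l * l.elim 1 I := by
  rw [Fintype.sum_option]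
  rcases x with _ | i <;> rcases y with _ | j
  · simp [localFactor, localCoeff]
  · simp [localFactor, localCoeff, ite_mul, sum_neg_distrib]
    ring
  · simp [localFactor, localCoeff, ite_mul, sum_neg_distrib]
    ring
  · have h := hI i j
    have e : (1 - p * I i) * (1 - p * I j) = 1 - p * I i - p * I j + p ^ 2 * (I i * I j) := by ring
    change (1 - p * I i) * (1 - p * I j) = _
    rw [e, h]
    simp only [localCoeff, Option.elim_some, Option.elim_none, Option.some.injEq,
      add_mul, sub_mul, neg_mul, ite_mul, zero_mul, sum_add_distrib, sum_sub_distrib,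
      sum_neg_distrib, sum_ite_eq, mem_univ, if_true, ite_and]
    by_cases hij : i = j
    · subst hij
      simp
      ring
    · simp [hij, Ne.symm hij]
      ring

theorem localCoeff_eq_zero {k : ℕ} (p : ℝ) {l : Option (Fin k)} (hl : l ≠ none) :
    localCoeff p none none l = 0 := by
  rcases l with _ | i
  · exact absurd rfl hl
  · simp [localCoeff]

theorem abs_localCoeff_mul_le {k : ℕ} {p : ℝ} (hp : 2 ≤ p) (x y l : Option (Fin k)) :
    (if x = none then 1 else p)⁻¹ * (if y = none then 1 else p)⁻¹ * |localCoeff p x y l| *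
      (if x = none ∧ y = none then 1 else p) ≤ if l = none then 1 else p := by
  have hp0 : 0 < p := by linarith
  have hp1 : p⁻¹ ≤ 1 := inv_le_one_of_one_le₀ (by linarith)
  rcases l with _ | i
  · rcases x with _ | a <;> rcases y with _ | b <;> simp [localCoeff, hp0.ne', hp1]
  · rcases x with _ | a <;> rcases y with _ | b
    · simp [localCoeff, hp0.le]
    · by_cases h : b = i <;> simp [localCoeff, h, hp0.ne', abs_of_pos hp0, hp0.le]
    · by_cases h : a = i <;> simp [localCoeff, h, hp0.ne', abs_of_pos hp0, hp0.le]
    · by_cases h : a = i <;> by_cases h' : b = i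
      · simp only [localCoeff, h, h', reduceCtorEq, if_true, if_false, and_self]
        rw [show -p - p + p ^ 2 = p * (p - 2) by ring, abs_of_nonneg (by nlinarith)]
        field_simp
        linarith
      all_goals
        simp [localCoeff, h, h', hp0.ne', abs_of_pos hp0, hp0.le]
      all_goals
        field_simp
        linarith

/-- The product of the primes at which `ω` is not `none`. -/
def supportProd {P : Finset ℕ} {k : ℕ} (ω : P → Option (Fin k)) : ℕ :=
  ∏ p, if ω p = none then 1 else (p : ℕ)

/-- The product of the primes at which one of `v`, `w` is not `none`. -/
def unionProd {P : Finset ℕ} {k : ℕ} (v w : P → Option (Fin k)) : ℕ :=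
  ∏ p, if v p = none ∧ w p = none then 1 else (p : ℕ)

theorem dvd_prod_of_ite {P : Finset ℕ} (c : P → Prop) [DecidablePred c] :
    (∏ p : P, if c p then 1 else (p : ℕ)) ∣ ∏ p ∈ P, p := by
  rw [← prod_coe_sort P fun p => p]
  exact prod_dvd_prod_of_dvd _ _ fun p _ => by split_ifs <;> simp

theorem eq_none_of_not_dvd {P : Finset ℕ} (c : P → Prop) [DecidablePred c] {p : P}
    (h : ¬ (p : ℕ) ∣ ∏ p : P, if c p then 1 else (p : ℕ)) : c p := by
  by_contra hc
  refine h ?_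
  have := dvd_prod_of_mem (fun p : P => if c p then 1 else (p : ℕ)) (mem_univ p)
  simpa [hc] using this

theorem card_filter_unionProd_le {P : Finset ℕ} (hP : ∀ p ∈ P, p.Prime) {k : ℕ} {q : ℕ}
    (hq : q ∣ ∏ p ∈ P, p) :
    #{t : (P → Option (Fin k)) × (P → Option (Fin k)) × (P → Option (Fin k)) |
      unionProd t.1 t.2.1 = q ∧ ∀ p, t.1 p = none ∧ t.2.1 p = none → t.2.2 p = none} ≤
      ((k + 1) ^ 3) ^ #q.primeFactors := by
  classical
  let F : Finset (P → Option (Fin k)) :=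
    Fintype.piFinset fun p => if (p : ℕ) ∣ q then univ else {none}
  have hF : #F ≤ (k + 1) ^ #q.primeFactors := by
    rw [Fintype.card_piFinset]
    have : ∀ p : P, #(if (p : ℕ) ∣ q then (univ : Finset (Option (Fin k))) else {none}) =
        if (p : ℕ) ∣ q then k + 1 else 1 := fun p => by split_ifs <;> simp
    rw [prod_congr rfl fun p _ => this p, prod_coe_sort P fun p => if p ∣ q then k + 1 else 1,
      ← prod_filter, prod_const]
    refine Nat.pow_le_pow_right (Nat.succ_pos k) (card_le_card fun p hp => ?_)
    rw [mem_filter] at hp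
    refine Nat.mem_primeFactors.2 ⟨hP p hp.1, hp.2, ?_⟩
    rintro rfl
    exact (prod_pos fun p hp => (hP p hp).pos).ne' (zero_dvd_iff.1 hq)
  calc _ ≤ #(F ×ˢ F ×ˢ F) := by
        refine card_le_card fun t ht => ?_
        obtain ⟨h1, h2⟩ := (mem_filter.1 ht).2
        have h3 : ∀ p : P, ¬ (p : ℕ) ∣ q → t.1 p = none ∧ t.2.1 p = none := fun p hp => by
          rw [← h1] at hp
          exact eq_none_of_not_dvd (fun p => t.1 p = none ∧ t.2.1 p = none) hp
        simp only [mem_product, F, Fintype.mem_piFinset]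
        refine ⟨fun p => ?_, fun p => ?_, fun p => ?_⟩ <;> split_ifs with h
        any_goals simp
        exacts [(h3 p h).1, (h3 p h).2, h2 p (h3 p h)]
    _ ≤ _ := by
        rw [card_product, card_product, ← pow_mul, mul_comm 3, pow_mul, pow_succ, pow_two, mul_assoc]
        exact Nat.mul_le_mul hF (Nat.mul_le_mul hF hF)

set_option maxHeartbeats 1000000 in
theorem abs_sum_sq_sub_le {P : Finset ℕ} (hP : ∀ p ∈ P, p.Prime) {k R : ℕ} {β : Type*}
    (S : Finset β) (w : β → ℝ) (I : β → P → Fin k → ℝ)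
    (hI : ∀ b p i j, I b p i * I b p j = if i = j then I b p i else 0) (X : ℝ)
    (μ : P → Option (Fin k) → ℝ) (E : ℕ → ℝ) (hE0 : ∀ q, 0 ≤ E q)
    (hE : ∀ d q, d ∣ q → q ∣ ∏ p ∈ P, p → q ≤ R ^ 2 → d * E d ≤ q * E q)
    (hS : ∀ l : P → Option (Fin k), supportProd l ≤ R ^ 2 →
      |∑ b ∈ S, w b * ∏ p, (l p).elim 1 (I b p) - X * ∏ p, μ p (l p)| ≤ E (supportProd l))
    (c : (P → Option (Fin k)) → ℝ) (hc : ∀ ω, |c ω| ≤ (supportProd ω : ℝ)⁻¹)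
    (hcR : ∀ ω, R < supportProd ω → c ω = 0) :
    |∑ b ∈ S, w b * (∑ ω, c ω * ∏ p : P, localFactor (p : ℕ) (I b p) (ω p)) ^ 2 -
      X * ∑ v, ∑ w, c v * c w * ∏ p : P, ∑ l, localCoeff (p : ℕ) (v p) (w p) l * μ p l| ≤
    ∑ q ∈ (∏ p ∈ P, p).divisors with q ≤ R ^ 2, ((k + 1 : ℝ) ^ 3) ^ #q.primeFactors * E q := by
  classical
  let D := fun l : P → Option (Fin k) =>
    ∑ b ∈ S, w b * ∏ p, (l p).elim 1 (I b p) - X * ∏ p, μ p (l p)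
  have hexp : ∑ b ∈ S, w b * (∑ ω, c ω * ∏ p : P, localFactor (p : ℕ) (I b p) (ω p)) ^ 2 -
      X * ∑ v, ∑ w, c v * c w * ∏ p : P, ∑ l, localCoeff (p : ℕ) (v p) (w p) l * μ p l =
      ∑ v, ∑ u, ∑ l : P → Option (Fin k),
        c v * c u * (∏ p : P, localCoeff (p : ℕ) (v p) (u p) (l p)) * D l := by
    have h1 : ∀ b, (∑ ω, c ω * ∏ p : P, localFactor (p : ℕ) (I b p) (ω p)) ^ 2 =
        ∑ v, ∑ u, ∑ l : P → Option (Fin k), c v * c u *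
          (∏ p : P, localCoeff (p : ℕ) (v p) (u p) (l p)) * ∏ p, (l p).elim 1 (I b p) := by
      intro b
      rw [sq, sum_mul_sum]
      refine sum_congr rfl fun v _ => sum_congr rfl fun u _ => ?_
      rw [mul_mul_mul_comm, ← prod_mul_distrib,
        prod_congr rfl fun (p : P) _ => localFactor_mul ((p : ℕ) : ℝ) (I b p) (hI b p) (v p) (u p),
        prod_univ_sum, Fintype.piFinset_univ, mul_sum]
      refine sum_congr rfl fun l _ => ?_
      rw [prod_mul_distrib]
      ring
    have h2 : ∀ v u : P → Option (Fin k),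
        ∏ p : P, ∑ l, localCoeff (p : ℕ) (v p) (u p) l * μ p l =
        ∑ l : P → Option (Fin k), (∏ p : P, localCoeff (p : ℕ) (v p) (u p) (l p)) *
          ∏ p, μ p (l p) := by
      intro v u
      rw [prod_univ_sum, Fintype.piFinset_univ]
      exact sum_congr rfl fun l _ => prod_mul_distrib
    simp only [h1, h2, mul_sum]
    rw [sum_comm, ← sum_sub_distrib]
    refine sum_congr rfl fun v _ => ?_
    rw [sum_comm, ← sum_sub_distrib]
    refine sum_congr rfl fun u _ => ?_
    rw [sum_comm, ← sum_sub_distrib]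
    refine sum_congr rfl fun l _ => ?_
    simp only [D, mul_sub, mul_sum]
    congr 1
    · exact sum_congr rfl fun b _ => by ring
    · ring
  rw [hexp]
  have hterm : ∀ v u l : P → Option (Fin k),
      |c v * c u * (∏ p : P, localCoeff (p : ℕ) (v p) (u p) (l p)) * D l| ≤
      if (∀ p, v p = none ∧ u p = none → l p = none) ∧ unionProd v u ≤ R ^ 2 then
        E (unionProd v u) else 0 := by
    intro v u l
    have hnn : 0 ≤ if (∀ p, v p = none ∧ u p = none → l p = none) ∧ unionProd v u ≤ R ^ 2 then
        E (unionProd v u) else 0 := by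
      split_ifs
      exacts [hE0 _, le_rfl]
    by_cases hl : ∀ p, v p = none ∧ u p = none → l p = none
    swap
    · push Not at hl
      obtain ⟨p, ⟨hp1, hp2⟩, hp3⟩ := hl
      rw [prod_eq_zero (mem_univ p) (by rw [hp1, hp2]; exact localCoeff_eq_zero _ hp3)]
      simpa using hnn
    by_cases hv : R < supportProd v
    · simpa [hcR v hv] using hnn
    by_cases hu : R < supportProd u
    · simpa [hcR u hu] using hnn
    have hpos : ∀ (C : P → Prop) [DecidablePred C], 0 < ∏ p : P, if C p then 1 else (p : ℕ) := by
      intro C _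
      refine prod_pos fun p _ => ?_
      split_ifs
      exacts [one_pos, (hP p p.2).pos]
    have hU : unionProd v u ≤ R ^ 2 := by
      refine le_trans (Nat.le_of_dvd (Nat.mul_pos (hpos _) (hpos _)) ?_)
        ((Nat.mul_le_mul (not_lt.1 hv) (not_lt.1 hu)).trans_eq (sq R).symm)
      simp only [unionProd]
      rw [← prod_mul_distrib]
      refine prod_dvd_prod_of_dvd _ _ fun p _ => ?_
      by_cases h1 : v p = none <;> by_cases h2 : u p = none <;> simp [h1, h2]
    have hdvd : supportProd l ∣ unionProd v u := by
      refine prod_dvd_prod_of_dvd _ _ fun p _ => ?_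
      by_cases h1 : v p = none ∧ u p = none
      · simp [hl p h1]
      · simp only [h1, if_false]
        split_ifs <;> simp
    have hq0 : (0 : ℝ) < unionProd v u := by exact_mod_cast hpos _
    have hl0 : (0 : ℝ) < supportProd l := by exact_mod_cast hpos _
    rw [if_pos ⟨hl, hU⟩, abs_mul, abs_mul, abs_mul, abs_prod]
    have hD : |D l| ≤ E (supportProd l) := hS l ((Nat.le_of_dvd (hpos _) hdvd).trans hU)
    have hprod : (supportProd v : ℝ)⁻¹ * (supportProd u : ℝ)⁻¹ *
        (∏ p : P, |localCoeff (p : ℕ) (v p) (u p) (l p)|) * unionProd v u ≤ supportProd l := by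
      simp only [supportProd, unionProd, Nat.cast_prod, Nat.cast_ite, Nat.cast_one]
      rw [← prod_inv_distrib, ← prod_inv_distrib, ← prod_mul_distrib, ← prod_mul_distrib,
        ← prod_mul_distrib]
      refine prod_le_prod (fun p _ => ?_) fun p _ =>
        abs_localCoeff_mul_le (by exact_mod_cast (hP p p.2).two_le) _ _ _
      have : (0 : ℝ) ≤ (p : ℕ) := Nat.cast_nonneg _
      refine mul_nonneg (mul_nonneg (mul_nonneg (inv_nonneg.2 ?_) (inv_nonneg.2 ?_))
        (abs_nonneg _)) ?_ <;> split_ifs <;> simp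
    have hcc : |c v| * |c u| * ∏ p : P, |localCoeff (p : ℕ) (v p) (u p) (l p)| ≤
        supportProd l / unionProd v u := by
      rw [le_div_iff₀ hq0]
      refine le_trans ?_ hprod
      have := mul_le_mul (hc v) (hc u) (abs_nonneg _) (inv_nonneg.2 (Nat.cast_nonneg _))
      exact mul_le_mul_of_nonneg_right (mul_le_mul_of_nonneg_right this
        (prod_nonneg fun p _ => abs_nonneg _)) hq0.le
    calc _ ≤ (supportProd l / unionProd v u : ℝ) * E (supportProd l) :=
          mul_le_mul hcc hD (abs_nonneg _) (by positivity)
      _ ≤ E (unionProd v u) := by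
          rw [div_mul_eq_mul_div, div_le_iff₀ hq0, mul_comm (E _)]
          exact hE _ _ hdvd (dvd_prod_of_ite _) hU
  calc _ ≤ ∑ v, ∑ u, ∑ l : P → Option (Fin k),
        if (∀ p, v p = none ∧ u p = none → l p = none) ∧ unionProd v u ≤ R ^ 2 then
          E (unionProd v u) else 0 := by
        refine (abs_sum_le_sum_abs _ _).trans (sum_le_sum fun v _ => ?_)
        refine (abs_sum_le_sum_abs _ _).trans (sum_le_sum fun u _ => ?_)
        exact (abs_sum_le_sum_abs _ _).trans (sum_le_sum fun l _ => hterm v u l)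
    _ = ∑ t : (P → Option (Fin k)) × (P → Option (Fin k)) × (P → Option (Fin k)) with
          (∀ p, t.1 p = none ∧ t.2.1 p = none → t.2.2 p = none) ∧ unionProd t.1 t.2.1 ≤ R ^ 2,
          E (unionProd t.1 t.2.1) := by
        rw [sum_filter]
        simp only [Fintype.sum_prod_type]
    _ = ∑ q ∈ (∏ p ∈ P, p).divisors with q ≤ R ^ 2,
        ∑ t : (P → Option (Fin k)) × (P → Option (Fin k)) × (P → Option (Fin k)) with
          ((∀ p, t.1 p = none ∧ t.2.1 p = none → t.2.2 p = none) ∧ unionProd t.1 t.2.1 ≤ R ^ 2) ∧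
          unionProd t.1 t.2.1 = q, E (unionProd t.1 t.2.1) := by
        rw [← sum_fiberwise_of_maps_to (g := fun t => unionProd t.1 t.2.1)
          (t := {q ∈ (∏ p ∈ P, p).divisors | q ≤ R ^ 2})]
        · simp only [filter_filter]
        · intro t ht
          rw [mem_filter] at ht
          rw [mem_filter, Nat.mem_divisors]
          exact ⟨⟨dvd_prod_of_ite _, (prod_pos fun p hp => (hP p hp).pos).ne'⟩, ht.2.2⟩
    _ ≤ _ := by
        refine sum_le_sum fun q hq => ?_
        rw [mem_filter, Nat.mem_divisors] at hq
        have h1 := card_filter_unionProd_le hP (k := k) hq.1.1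
        have h2 : (((k + 1) ^ 3) ^ #q.primeFactors : ℕ) = ((k + 1 : ℝ) ^ 3) ^ #q.primeFactors := by
          push_cast
          rfl
        rw [← h2]
        refine le_trans (sum_le_card_nsmul _ _ (E q) fun t ht => ?_) ?_
        · rw [(mem_filter.1 ht).2.2]
        · rw [nsmul_eq_mul]
          refine mul_le_mul_of_nonneg_right (Nat.cast_le.2 (le_trans (card_le_card ?_) h1)) (hE0 q)
          intro t ht
          have h3 := (mem_filter.1 ht).2
          exact mem_filter.2 ⟨mem_univ _, h3.2, h3.1.1⟩

end BoundedGaps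

namespace BoundedGaps
open Finset
theorem localCoeff_comm {k : ℕ} (p : ℝ) (x y l : Option (Fin k)) :
    localCoeff p x y l = localCoeff p y x l := by
  rcases l with _ | i
  · rfl
  · simp only [localCoeff, and_comm]
    ring

theorem sum_localCoeff {k : ℕ} (p : ℝ) (μ : Fin k → ℝ) (u : Option (Fin k) → ℝ) :
    ∑ x, ∑ y, u x * u y * ∑ l, localCoeff p x y l * l.elim 1 μ =
      (∑ x, u x) ^ 2 - 2 * p * (∑ x, u x) * ∑ i, μ i * u (some i) +
        p ^ 2 * ∑ i, μ i * u (some i) ^ 2 := by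
  have h1 : ∀ x y, u x * u y * ∑ l, localCoeff p x y l * l.elim 1 μ = u x * u y +
      ∑ i, μ i * (-p * ((if x = some i then u x else 0) * u y) +
      (-p * (u x * if y = some i then u y else 0) +
      p ^ 2 * ((if x = some i then u x else 0) * if y = some i then u y else 0))) := by
    intro x y
    rw [Fintype.sum_option, mul_add, mul_sum]
    congr 1
    · simp [localCoeff]
    · refine sum_congr rfl fun i _ => ?_
      simp only [localCoeff, Option.elim_some]
      split_ifs <;> simp_all <;> ring
  simp only [h1, sum_add_distrib]
  rw [← sum_mul_sum, sum_congr rfl fun x _ => sum_comm, sum_comm, sub_add, sub_eq_add_neg,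
    sq (∑ x, u x)]
  congr 1
  rw [mul_sum (s := univ) (f := fun i => μ i * u (some i)),
    mul_sum (s := univ) (f := fun i => μ i * u (some i) ^ 2), ← sum_sub_distrib, ← sum_neg_distrib]
  refine sum_congr rfl fun i _ => ?_
  simp only [← mul_sum, sum_add_distrib, ← sum_mul, sum_ite_eq', mem_univ, if_true]
  ring

theorem sum_sum_mul_prod_sum_sq {ι α : Type*} [Fintype ι] [DecidableEq ι] [Fintype α]
    (c : (ι → α) → ℝ) (a : ι → α → ℝ) (φ : α → α → ℝ) :
    ∑ v, ∑ w, c v * c w * ∏ p, ∑ l, a p l * (φ (v p) l * φ (w p) l) =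
      ∑ l : ι → α, (∏ p, a p (l p)) * (∑ ω, c ω * ∏ p, φ (ω p) (l p)) ^ 2 := by
  simp only [prod_univ_sum, Fintype.piFinset_univ, prod_mul_distrib, mul_sum]
  rw [sum_congr rfl fun x _ => sum_comm, sum_comm]
  refine sum_congr rfl fun l _ => ?_
  rw [sq, sum_mul_sum, mul_sum]
  refine sum_congr rfl fun v _ => ?_
  rw [mul_sum]
  exact sum_congr rfl fun w _ => by ring

theorem sum_sum_mul_sum_sq {α : Type*} [Fintype α] (a u : α → ℝ) (φ : α → α → ℝ) :
    ∑ x, ∑ y, u x * u y * ∑ l, a l * (φ x l * φ y l) = ∑ l, a l * (∑ x, u x * φ x l) ^ 2 := by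
  simp only [mul_sum]
  rw [sum_congr rfl fun x _ => sum_comm, sum_comm]
  refine sum_congr rfl fun l _ => ?_
  rw [sq, sum_mul_sum, mul_sum]
  refine sum_congr rfl fun v _ => ?_
  rw [mul_sum]
  exact sum_congr rfl fun w _ => by ring

theorem sum_ite_option {k : ℕ} (u : Option (Fin k) → ℝ) (m : Fin k) (l : Option (Fin k)) :
    ∑ x, u x * (if (if x = some m then none else x) = l then 1 else 0) =
      if l = none then u none + u (some m) else if l = some m then 0 else u l := by
  rw [Fintype.sum_option]
  rcases l with _ | i
  · simp
  · by_cases h : i = m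
    · subst h
      simp
    · rw [sum_eq_single i (fun j _ hj => by by_cases hj' : j = m <;> simp [hj', hj]) (by simp)]
      simp [h]

theorem sum_main_le {P : Finset ℕ} {k : ℕ} (hP : ∀ p ∈ P, p.Prime ∧ k ≤ p)
    (c : (P → Option (Fin k)) → ℝ) :
    ∑ v, ∑ w, c v * c w * ∏ p : P, ∑ l, localCoeff (p : ℕ) (v p) (w p) l *
      l.elim 1 (fun _ => ((p : ℕ) : ℝ)⁻¹) ≤ ∑ v, supportProd v * c v ^ 2 := by
  classical
  have key : ∀ (p : P) (u : Option (Fin k) → ℝ),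
      ∑ x, ∑ y, u x * u y * ∑ l, localCoeff (p : ℕ) x y l *
        l.elim 1 (fun _ => ((p : ℕ) : ℝ)⁻¹) =
      u none ^ 2 - (∑ i, u (some i)) ^ 2 + (p : ℕ) * ∑ i, u (some i) ^ 2 := by
    intro p u
    rw [sum_localCoeff, Fintype.sum_option, ← mul_sum, ← mul_sum]
    have : ((p : ℕ) : ℝ) ≠ 0 := by exact_mod_cast (hP p p.2).1.ne_zero
    field_simp
    ring
  have hdiag : ∀ (p : P) (u : Option (Fin k) → ℝ),
      ∑ x, ∑ y, u x * u y * ∑ l, (if l = none then 1 else ((p : ℕ) : ℝ)) *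
        ((if x = l then 1 else 0) * (if y = l then 1 else 0)) =
      u none ^ 2 + (p : ℕ) * ∑ i, u (some i) ^ 2 := by
    intro p u
    rw [sum_sum_mul_sum_sq (fun l => if l = none then 1 else ((p : ℕ) : ℝ)) u
      fun x l => if x = l then 1 else 0, Fintype.sum_option, mul_sum]
    simp
  have h := sum_tensor_le (fun (p : P) x y => ∑ l, localCoeff (p : ℕ) x y l *
      l.elim 1 (fun _ => ((p : ℕ) : ℝ)⁻¹))
    (fun (p : P) x y => ∑ l, (if l = none then 1 else ((p : ℕ) : ℝ)) *
        ((if x = l then 1 else 0) * (if y = l then 1 else 0)))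
    (fun p x y => sum_congr rfl fun l _ => by rw [localCoeff_comm])
    (fun p x y => sum_congr rfl fun l _ => by ring) (fun p u => ?_) (fun p u => ?_) c
  · refine h.trans_eq ?_
    rw [sum_sum_mul_prod_sum_sq c (fun (p : P) l => if l = none then 1 else ((p : ℕ) : ℝ))
      (fun x l => if x = l then 1 else 0)]
    refine sum_congr rfl fun l _ => ?_
    congr 1
    · simp [supportProd]
    · rw [sum_eq_single l]
      · simp
      · intro v _ hv
        obtain ⟨p, hp⟩ := Function.ne_iff.1 hv
        rw [prod_eq_zero (mem_univ p) (if_neg hp), mul_zero]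
      · simp
  · rw [key]
    have h1 := sq_sum_le_card_mul_sum_sq (s := univ) (f := fun i => u (some i))
    rw [card_univ, Fintype.card_fin] at h1
    have h2 : (k : ℝ) * ∑ i, u (some i) ^ 2 ≤ (p : ℕ) * ∑ i, u (some i) ^ 2 :=
      mul_le_mul_of_nonneg_right (by exact_mod_cast (hP p p.2).2) (sum_nonneg fun i _ => sq_nonneg _)
    nlinarith [sq_nonneg (u none)]
  · rw [key, hdiag]
    nlinarith [sq_nonneg (∑ i, u (some i))]

theorem sum_main_ge {P : Finset ℕ} {k : ℕ} (hP : ∀ p ∈ P, p.Prime ∧ 3 * k + 4 ≤ p) (m : Fin k)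
    (c : (P → Option (Fin k)) → ℝ) :
    ∑ l : P → Option (Fin k),
      (∏ p : P, if l p = none then 1 - k / ((p : ℕ) : ℝ) ^ 2 else ((p : ℕ) : ℝ) - 3 * k - 4) *
      (∑ ω, c ω * ∏ p, if (if ω p = some m then none else ω p) = l p then 1 else 0) ^ 2 ≤
    ∑ v, ∑ w, c v * c w * ∏ p : P, ∑ l, localCoeff (p : ℕ) (v p) (w p) l *
      l.elim 1 (fun i => if i = m then 0 else (((p : ℕ) : ℝ) - 1)⁻¹) := by
  classical
  have hq : ∀ (r : ℝ) (u : Option (Fin k) → ℝ),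
      ∑ x, ∑ y, u x * u y * ∑ l, (if l = none then 1 - k / r ^ 2 else r - 3 * k - 4) *
        ((if (if x = some m then none else x) = l then 1 else 0) *
          (if (if y = some m then none else y) = l then 1 else 0)) =
      (1 - k / r ^ 2) * (u none + u (some m)) ^ 2 +
        (r - 3 * k - 4) * ∑ i, if i = m then 0 else u (some i) ^ 2 := by
    intro r u
    rw [sum_sum_mul_sum_sq (fun l => if l = none then 1 - k / r ^ 2 else r - 3 * k - 4) u
      fun x l => if (if x = some m then none else x) = l then 1 else 0]
    simp only [sum_ite_option]
    rw [Fintype.sum_option, mul_sum]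
    simp
  have h := sum_tensor_le (fun (p : P) x y => ∑ l, (if l = none then 1 - k / ((p : ℕ) : ℝ) ^ 2 else
      ((p : ℕ) : ℝ) - 3 * k - 4) * ((if (if x = some m then none else x) = l then 1 else 0) *
          (if (if y = some m then none else y) = l then 1 else 0)))
    (fun (p : P) x y => ∑ l, localCoeff (p : ℕ) x y l *
      l.elim 1 (fun i => if i = m then 0 else (((p : ℕ) : ℝ) - 1)⁻¹))
    (fun p x y => sum_congr rfl fun l _ => by ring)
    (fun p x y => sum_congr rfl fun l _ => by rw [localCoeff_comm]) (fun p u => ?_)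
    (fun p u => ?_) c
  · refine le_trans (le_of_eq ?_) h
    exact (sum_sum_mul_prod_sum_sq c (fun (p : P) l => if l = none then 1 - k / ((p : ℕ) : ℝ) ^ 2
      else ((p : ℕ) : ℝ) - 3 * k - 4)
      (fun x l => if (if x = some m then none else x) = l then 1 else 0)).symm
  all_goals
    have hp : (3 * k + 4 : ℝ) ≤ (p : ℕ) := by exact_mod_cast (hP p p.2).2
    have hk : (0 : ℝ) ≤ k := Nat.cast_nonneg k
    generalize ((p : ℕ) : ℝ) = r at hp
  · rw [hq]
    have h1 : (k : ℝ) / r ^ 2 ≤ 1 := by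
      rw [div_le_one (by nlinarith)]
      nlinarith
    refine add_nonneg (mul_nonneg (by linarith) (sq_nonneg _)) (mul_nonneg (by linarith)
      (sum_nonneg fun i _ => ?_))
    split_ifs
    exacts [le_rfl, sq_nonneg _]
  · rw [hq, sum_localCoeff, Fintype.sum_option]
    have hk1 : (1 : ℝ) ≤ k := by exact_mod_cast m.pos
    set S := ∑ i, if i = m then 0 else u (some i) ^ 2 with hS
    set t := ∑ i, if i = m then 0 else u (some i) with ht
    have h1 : ∑ i, (if i = m then 0 else (r - 1)⁻¹) * u (some i) = (r - 1)⁻¹ * t := by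
      rw [ht, mul_sum]
      exact sum_congr rfl fun i _ => by split_ifs <;> simp
    have h2 : ∑ i, (if i = m then 0 else (r - 1)⁻¹) * u (some i) ^ 2 = (r - 1)⁻¹ * S := by
      rw [hS, mul_sum]
      exact sum_congr rfl fun i _ => by split_ifs <;> simp
    have h3 : ∑ i, u (some i) = u (some m) + t := by
      rw [ht, ← add_sum_erase _ _ (mem_univ m), ← add_sum_erase univ (fun i => if i = m then 0 else
        u (some i)) (mem_univ m), if_pos rfl, zero_add]
      congr 1
      exact sum_congr rfl fun i hi => by rw [if_neg (ne_of_mem_erase hi)]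
    have h4 : t ^ 2 ≤ k * S := by
      have := sq_sum_le_card_mul_sum_sq (s := univ) (f := fun i => if i = m then 0 else u (some i))
      rw [card_univ, Fintype.card_fin] at this
      refine this.trans_eq ?_
      rw [hS]
      congr 1
      exact sum_congr rfl fun i _ => by split_ifs <;> simp
    rw [h1, h2, h3]
    generalize u none = a
    generalize u (some m) = a'
    have hr : 0 < r := by linarith
    set e := (r - 1)⁻¹ with he
    have he0 : 0 < e := inv_pos.2 (by linarith)
    have he1 : e ≤ 1 := inv_le_one_of_one_le₀ (by linarith)
    have hre : r * e = 1 + e := by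
      have : (r - 1) * e = 1 := mul_inv_cancel₀ (by linarith)
      linarith
    have hS' : t ^ 2 / k ≤ S := by rwa [div_le_iff₀ (by linarith), mul_comm]
    have hSk : 3 * t ^ 2 + 5 * (t ^ 2 / k) ≤ (3 * k + 5) * S := by nlinarith
    have hz : 0 ≤ k * ((a + a') / r) ^ 2 - 2 * (1 + e) * ((a + a') / r) * t +
        (1 + e) ^ 2 * (t ^ 2 / k) := by
      have : k * ((a + a') / r) ^ 2 - 2 * (1 + e) * ((a + a') / r) * t +
        (1 + e) ^ 2 * (t ^ 2 / k) = (k * ((a + a') / r) - (1 + e) * t) ^ 2 / k := by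
        field_simp
        ring
      rw [this]
      positivity
    have htk : 0 ≤ t ^ 2 / k := by positivity
    have hS0 : 0 ≤ S := htk.trans hS'
    have hv : (1 + e) * ((a + a') / r) = e * (a + a') := by
      rw [← hre]
      field_simp
    have e1 : (a + (a' + t)) ^ 2 - 2 * r * (a + (a' + t)) * (e * t) + r ^ 2 * (e * S) =
        (a + a') ^ 2 - 2 * (e * (a + a')) * t - (1 + 2 * e) * t ^ 2 + (r + 1 + e) * S := by
      have : r ^ 2 * (e * S) = r * (r * e) * S := by ring
      rw [this, show 2 * r * (a + (a' + t)) * (e * t) = 2 * (r * e) * (a + (a' + t)) * t by ring, hre]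
      have : r * (1 + e) = r + 1 + e := by linarith
      rw [this]
      ring
    rw [e1, ← hv]
    have e2 : (1 - k / r ^ 2) * (a + a') ^ 2 = (a + a') ^ 2 - k * ((a + a') / r) ^ 2 := by
      rw [div_pow]
      ring
    rw [e2]
    have h5 : (1 + e) ^ 2 * (t ^ 2 / k) ≤ 5 * (t ^ 2 / k) :=
      mul_le_mul_of_nonneg_right (by nlinarith) htk
    have h6 : (1 + 2 * e) * t ^ 2 ≤ 3 * t ^ 2 :=
      mul_le_mul_of_nonneg_right (by linarith) (sq_nonneg t)
    nlinarith [mul_nonneg he0.le hS0]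
end BoundedGaps

namespace BoundedGaps
open Finset

theorem one_sub_sum_le_prod {ι : Type*} (s : Finset ι) (f : ι → ℝ) (h0 : ∀ i ∈ s, 0 ≤ f i)
    (h1 : ∀ i ∈ s, f i ≤ 1) : 1 - ∑ i ∈ s, f i ≤ ∏ i ∈ s, (1 - f i) := by
  classical
  induction s using Finset.induction_on with
  | empty => simp
  | insert a s ha ih =>
    rw [sum_insert ha, prod_insert ha]
    have ih' := ih (fun i hi => h0 i (mem_insert_of_mem hi)) fun i hi => h1 i (mem_insert_of_mem hi)
    have h2 : 0 ≤ ∑ i ∈ s, f i := sum_nonneg fun i hi => h0 i (mem_insert_of_mem hi)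
    have h3 := mul_le_mul_of_nonneg_left ih' (sub_nonneg.2 (h1 a (mem_insert_self a s)))
    nlinarith [h0 a (mem_insert_self a s)]

/-- The product of the primes at which `ω` takes the value `some i`. -/
def coordProd {P : Finset ℕ} {k : ℕ} (ω : P → Option (Fin k)) (i : Fin k) : ℕ :=
  ∏ p, if ω p = some i then (p : ℕ) else 1

theorem dvd_coordProd_iff {P : Finset ℕ} (hP : ∀ p ∈ P, p.Prime) {k : ℕ}
    (ω : P → Option (Fin k)) (i : Fin k) (p : P) : (p : ℕ) ∣ coordProd ω i ↔ ω p = some i := by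
  constructor
  · intro h
    obtain ⟨q, -, hq⟩ := (Prime.dvd_finsetProd_iff (hP p p.2).prime _).1 h
    split_ifs at hq with hqi
    · rw [Subtype.ext ((Nat.prime_dvd_prime_iff_eq (hP p p.2) (hP q q.2)).1 hq), hqi]
    · exact absurd hq (hP p p.2).not_dvd_one
  · intro h
    have := dvd_prod_of_mem (fun p : P => if ω p = some i then (p : ℕ) else 1) (mem_univ p)
    rwa [if_pos h] at this

theorem supportProd_eq_prod_coordProd {P : Finset ℕ} {k : ℕ} (ω : P → Option (Fin k)) :
    supportProd ω = ∏ i, coordProd ω i := by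
  simp only [coordProd]
  rw [prod_comm]
  refine prod_congr rfl fun p _ => ?_
  rcases h : ω p with _ | j
  · simp
  · simp [prod_ite_eq]

theorem coordProd_injective {P : Finset ℕ} (hP : ∀ p ∈ P, p.Prime) {k : ℕ} :
    Function.Injective (coordProd : (P → Option (Fin k)) → Fin k → ℕ) := by
  intro v w h
  funext p
  refine Option.ext fun i => ?_
  rw [← dvd_coordProd_iff hP v i p, ← dvd_coordProd_iff hP w i p, h]

open Classical in
/-- The function on `P` recording which entry of a tuple a prime divides. -/
noncomputable def ofTuple {P : Finset ℕ} {k : ℕ} (s : Fin k → ℕ) (p : P) : Option (Fin k) :=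
  if h : ∃ i, (p : ℕ) ∣ s i then some h.choose else none

theorem ofTuple_eq_some_iff {P : Finset ℕ} (hP : ∀ p ∈ P, p.Prime) {k : ℕ} {s : Fin k → ℕ}
    (hs : Pairwise fun i j => Nat.Coprime (s i) (s j)) (p : P) (i : Fin k) :
    ofTuple s p = some i ↔ (p : ℕ) ∣ s i := by
  unfold ofTuple
  split_ifs with h
  · rw [Option.some.injEq]
    refine ⟨fun h' => h' ▸ h.choose_spec, fun h' => ?_⟩
    by_contra hne
    exact Nat.not_coprime_of_dvd_of_dvd (hP p p.2).one_lt h.choose_spec h' (hs hne)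
  · exact ⟨fun h' => by simp at h', fun h' => absurd ⟨i, h'⟩ h⟩

theorem ofTuple_eq_none_iff {P : Finset ℕ} {k : ℕ} {s : Fin k → ℕ} (p : P) :
    ofTuple s p = none ↔ ∀ i, ¬ (p : ℕ) ∣ s i := by
  unfold ofTuple
  split_ifs with h
  · simpa using h
  · simpa using h

theorem coordProd_ofTuple {P : Finset ℕ} (hP : ∀ p ∈ P, p.Prime) {k : ℕ} {s : Fin k → ℕ}
    (hs : Pairwise fun i j => Nat.Coprime (s i) (s j)) {i : Fin k} (hsq : Squarefree (s i))
    (hsP : (s i).primeFactors ⊆ P) : coordProd (ofTuple s : P → _) i = s i := by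
  simp only [coordProd, ofTuple_eq_some_iff hP hs]
  rw [prod_coe_sort P fun p => if p ∣ s i then p else 1, ← prod_filter]
  conv_rhs => rw [← Nat.prod_primeFactors_of_squarefree hsq]
  refine prod_congr (ext fun p => ?_) fun _ _ => rfl
  rw [mem_filter]
  exact ⟨fun h => Nat.mem_primeFactors.2 ⟨hP p h.1, h.2, hsq.ne_zero⟩,
    fun h => ⟨hsP h, Nat.dvd_of_mem_primeFactors h⟩⟩

/-- The coefficients of the sieve attached to a weight `g`. -/
noncomputable def sieveWeight {P : Finset ℕ} {k : ℕ} (g : ℕ → ℝ) (R : ℕ)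
    (ω : P → Option (Fin k)) : ℝ :=
  if supportProd ω ≤ R then (supportProd ω : ℝ)⁻¹ * ∏ i, g (coordProd ω i) else 0

theorem sieveWeight_nonneg {P : Finset ℕ} {k : ℕ} {g : ℕ → ℝ} (hg : ∀ a, 0 ≤ g a) (R : ℕ)
    (ω : P → Option (Fin k)) : 0 ≤ sieveWeight g R ω := by
  unfold sieveWeight
  split_ifs
  exacts [mul_nonneg (inv_nonneg.2 (Nat.cast_nonneg _)) (prod_nonneg fun _ _ => hg _), le_rfl]

theorem abs_sieveWeight_le {P : Finset ℕ} {k : ℕ} {g : ℕ → ℝ} (hg : ∀ a, 0 ≤ g a)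
    (hg1 : ∀ a, g a ≤ 1) (R : ℕ) (ω : P → Option (Fin k)) :
    |sieveWeight g R ω| ≤ (supportProd ω : ℝ)⁻¹ := by
  rw [abs_of_nonneg (sieveWeight_nonneg hg R ω), sieveWeight]
  have h := inv_nonneg.2 (Nat.cast_nonneg (α := ℝ) (supportProd ω))
  split_ifs
  · exact mul_le_of_le_one_right h (prod_le_one (fun _ _ => hg _) fun _ _ => hg1 _)
  · exact h

theorem sum_supportProd_mul_sq_le {P : Finset ℕ} (hP : ∀ p ∈ P, p.Prime) {k : ℕ} {g : ℕ → ℝ}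
    {V : Finset ℕ} (hgV : ∀ a ∉ V, g a = 0) (R : ℕ) :
    ∑ ω : P → Option (Fin k), supportProd ω * sieveWeight g R ω ^ 2 ≤
      (∑ a ∈ V, g a ^ 2 / a) ^ k := by
  have hpos : ∀ ω : P → Option (Fin k), (0 : ℝ) < supportProd ω := by
    intro ω
    refine Nat.cast_pos.2 (prod_pos fun p _ => ?_)
    split_ifs
    exacts [one_pos, (hP p p.2).pos]
  have h1 : ∀ ω : P → Option (Fin k), supportProd ω * sieveWeight g R ω ^ 2 ≤
      ∏ i, g (coordProd ω i) ^ 2 / coordProd ω i := by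
    intro ω
    have e : ∏ i, g (coordProd ω i) ^ 2 / coordProd ω i =
        (∏ i, g (coordProd ω i)) ^ 2 / supportProd ω := by
      rw [prod_div_distrib, supportProd_eq_prod_coordProd, prod_pow, Nat.cast_prod]
    rw [e]
    have := hpos ω
    unfold sieveWeight
    split_ifs
    · refine le_of_eq ?_
      field_simp
    · simp only [ne_eq, OfNat.ofNat_ne_zero, not_false_eq_true, zero_pow, mul_zero]
      positivity
  have h2 : (∑ a ∈ V, g a ^ 2 / a) ^ k =
      ∑ r ∈ Fintype.piFinset fun _ : Fin k => V, ∏ i, g (r i) ^ 2 / (r i : ℝ) := by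
    have := prod_univ_sum (fun _ : Fin k => V) fun _ (a : ℕ) => g a ^ 2 / (a : ℝ)
    rw [← this, prod_const, card_univ, Fintype.card_fin]
  rw [h2]
  calc _ ≤ ∑ ω : P → Option (Fin k), ∏ i, g (coordProd ω i) ^ 2 / (coordProd ω i : ℝ) :=
        sum_le_sum fun ω _ => h1 ω
    _ = ∑ ω : P → Option (Fin k) with ∀ i, coordProd ω i ∈ V,
          ∏ i, g (coordProd ω i) ^ 2 / (coordProd ω i : ℝ) := by
        rw [sum_filter]
        refine sum_congr rfl fun ω _ => ?_
        split_ifs with h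
        · rfl
        · push Not at h
          obtain ⟨i, hi⟩ := h
          exact prod_eq_zero (mem_univ i) (by simp [hgV _ hi])
    _ = ∑ r ∈ image coordProd {ω : P → Option (Fin k) | ∀ i, coordProd ω i ∈ V},
          ∏ i, g (r i) ^ 2 / (r i : ℝ) := by
        rw [sum_image (f := fun r : Fin k → ℕ => ∏ i, g (r i) ^ 2 / (r i : ℝ))
          ((coordProd_injective hP).injOn)]
    _ ≤ _ := by
        refine sum_le_sum_of_subset_of_nonneg ?_ fun r _ _ => prod_nonneg fun i _ => by positivity
        intro r hr
        obtain ⟨ω, hω, rfl⟩ := mem_image.1 hr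
        exact Fintype.mem_piFinset.2 (mem_filter.1 hω).2

end BoundedGaps

namespace BoundedGaps
open Finset

theorem sum_filter_dvd_le {V : Finset ℕ} {f : ℕ → ℝ} {p : ℕ} (hp : 0 < p)
    (hV : ∀ b, p * b ∈ V → b ∈ V) (hf0 : ∀ a, 0 ≤ f a)
    (hf : ∀ b, f (p * b) ≤ (p : ℝ)⁻¹ * f b) :
    ∑ a ∈ V with p ∣ a, f a ≤ (p : ℝ)⁻¹ * ∑ a ∈ V, f a := by
  calc ∑ a ∈ V with p ∣ a, f a ≤ ∑ a ∈ image (p * ·) V, f a := by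
        refine sum_le_sum_of_subset_of_nonneg (fun a ha => ?_) fun a _ _ => hf0 a
        obtain ⟨h1, b, rfl⟩ := mem_filter.1 ha
        exact mem_image_of_mem _ (hV b h1)
    _ = ∑ b ∈ V, f (p * b) := sum_image fun a _ b _ h => Nat.eq_of_mul_eq_mul_left hp h
    _ ≤ _ := by
        rw [mul_sum]
        exact sum_le_sum fun b _ => hf b

/-- The sum of the reciprocals of the prime factors of the entries of a tuple. -/
noncomputable def sumInvPrimes {k : ℕ} (r : Fin k → ℕ) : ℝ :=
  ∑ i, ∑ p ∈ (r i).primeFactors, (p : ℝ)⁻¹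

theorem sumInvPrimes_nonneg {k : ℕ} (r : Fin k → ℕ) : 0 ≤ sumInvPrimes r :=
  sum_nonneg fun _ _ => sum_nonneg fun _ _ => inv_nonneg.2 (Nat.cast_nonneg _)

theorem mul_one_sub_sumInvPrimes_le {V : Finset ℕ} {f : ℕ → ℝ}
    (hV : ∀ p b, p.Prime → p * b ∈ V → b ∈ V) (hf0 : ∀ a, 0 ≤ f a)
    (hf : ∀ p b, p.Prime → f (p * b) ≤ (p : ℝ)⁻¹ * f b) {k : ℕ} (r : Fin k → ℕ)
    (hr : ∀ i, r i ≠ 0) :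
    (∑ a ∈ V, f a) * (1 - sumInvPrimes r) ≤ ∑ a ∈ V with ∀ i, Nat.Coprime a (r i), f a := by
  have h1 : ∑ a ∈ V with ¬ ∀ i, Nat.Coprime a (r i), f a ≤
      ∑ i, ∑ p ∈ (r i).primeFactors, ∑ a ∈ V with p ∣ a, f a := by
    calc _ ≤ ∑ a ∈ V, ∑ i, ∑ p ∈ (r i).primeFactors, if p ∣ a then f a else 0 := by
          rw [sum_filter]
          refine sum_le_sum fun a ha => ?_
          have hnn : ∀ i, ∀ p ∈ (r i).primeFactors, 0 ≤ if p ∣ a then f a else 0 := fun i p _ => by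
            split_ifs
            exacts [hf0 a, le_rfl]
          split_ifs with h
          · exact sum_nonneg fun i _ => sum_nonneg (hnn i)
          · push Not at h
            obtain ⟨i, hi⟩ := h
            obtain ⟨p, hp, hpa, hpr⟩ := Nat.Prime.not_coprime_iff_dvd.1 hi
            have hp' : p ∈ (r i).primeFactors := Nat.mem_primeFactors.2 ⟨hp, hpr, hr i⟩
            refine le_trans ?_ (single_le_sum (f := fun i => ∑ p ∈ (r i).primeFactors,
              if p ∣ a then f a else 0) (fun i _ => sum_nonneg (hnn i)) (mem_univ i))
            refine le_trans ?_ (single_le_sum (f := fun p => if p ∣ a then f a else 0) (hnn i) hp')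
            simp [hpa]
      _ = _ := by
          rw [sum_comm]
          refine sum_congr rfl fun i _ => ?_
          rw [sum_comm]
          exact sum_congr rfl fun p _ => (sum_filter _ _).symm
  have h2 : ∑ i, ∑ p ∈ (r i).primeFactors, ∑ a ∈ V with p ∣ a, f a ≤
      (∑ a ∈ V, f a) * sumInvPrimes r := by
    rw [sumInvPrimes, mul_sum]
    refine sum_le_sum fun i _ => ?_
    rw [mul_sum]
    refine sum_le_sum fun p hp => ?_
    have hp' := Nat.prime_of_mem_primeFactors hp
    rw [mul_comm]
    exact sum_filter_dvd_le hp'.pos (fun b => hV p b hp') hf0 fun b => hf p b hp'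
  have h3 := sum_filter_add_sum_filter_not V (fun a => ∀ i, Nat.Coprime a (r i)) f
  linarith

theorem sum_sieveWeight_ge {P V : Finset ℕ} (hP : ∀ p ∈ P, p.Prime) {k R : ℕ} {g : ℕ → ℝ}
    (hg0 : ∀ a, 0 ≤ g a) (hg1 : g 1 = 1)
    (hg : ∀ p a, p.Prime → g (p * a) ≤ g a)
    (hV : ∀ a ∈ V, Squarefree a ∧ a.primeFactors ⊆ P ∧ a ^ 2 ≤ R)
    (hVd : ∀ p b, p.Prime → p * b ∈ V → b ∈ V) (m : Fin k) {r : Fin k → ℕ}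
    (hr : ∀ i, r i ∈ V) (hrm : r m = 1) (hc : Pairwise fun i j => Nat.Coprime (r i) (r j))
    (hrR : (∏ i, r i) ^ 2 ≤ R) :
    (∏ i, g (r i)) / (∏ i, (r i : ℝ)) * ((∑ a ∈ V, g a / a) * (1 - sumInvPrimes r)) ≤
    ∑ ω : P → Option (Fin k), sieveWeight g R ω * ∏ p,
      if (if ω p = some m then none else ω p) = (ofTuple r p : Option (Fin k)) then (1 : ℝ)
        else 0 := by
  classical
  let τ : ℕ → P → Option (Fin k) := fun a => ofTuple (Function.update r m a)
  let V' := {a ∈ V | ∀ i, Nat.Coprime a (r i)}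
  have hcop : ∀ a ∈ V', Pairwise fun i j =>
      Nat.Coprime (Function.update r m a i) (Function.update r m a j) := by
    intro a ha i j hij
    have ha' := (mem_filter.1 ha).2
    by_cases hi : i = m
    · subst hi
      rw [Function.update_self, Function.update_of_ne hij.symm]
      exact ha' j
    · by_cases hj : j = m
      · subst hj
        rw [Function.update_self, Function.update_of_ne hi]
        exact (ha' i).symm
      · rw [Function.update_of_ne hi, Function.update_of_ne hj]
        exact hc hij
  have hmem : ∀ a ∈ V', ∀ i, Function.update r m a i ∈ V := by
    intro a ha i
    by_cases hi : i = m
    · subst hi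
      rw [Function.update_self]
      exact (mem_filter.1 ha).1
    · rw [Function.update_of_ne hi]
      exact hr i
  have hcoord : ∀ a ∈ V', ∀ i, coordProd (τ a) i = Function.update r m a i := fun a ha i =>
    coordProd_ofTuple hP (hcop a ha) (hV _ (hmem a ha i)).1 (hV _ (hmem a ha i)).2.1
  have hinj : Set.InjOn τ V' := by
    intro a ha b hb hab
    have h1 := hcoord a ha m
    have h2 := hcoord b hb m
    rw [Function.update_self] at h1 h2
    rw [← h1, ← h2, hab]
  have hφ : ∀ a ∈ V', ∀ p, (if τ a p = some m then none else τ a p) = (ofTuple r p : Option (Fin k)) := by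
    intro a ha p
    have hdiv : ∀ i, τ a p = some i ↔ (p : ℕ) ∣ Function.update r m a i := fun i =>
      ofTuple_eq_some_iff hP (hcop a ha) p i
    split_ifs with h
    · symm
      rw [ofTuple_eq_none_iff]
      intro i hi
      rw [hdiv, Function.update_self] at h
      exact Nat.not_coprime_of_dvd_of_dvd (hP p p.2).one_lt h hi ((mem_filter.1 ha).2 i)
    · refine Option.ext fun i => ?_
      rw [hdiv, ofTuple_eq_some_iff hP hc]
      by_cases hi : i = m
      · subst hi
        rw [hdiv] at h
        refine iff_of_false h ?_
        rw [hrm]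
        exact (hP p p.2).not_dvd_one
      · rw [Function.update_of_ne hi]
  have hprod : ∀ (a : ℕ) (F : ℕ → ℝ), F 1 = 1 →
      ∏ i, F (Function.update r m a i) = F a * ∏ i, F (r i) := by
    intro a F hF
    rw [← mul_prod_erase univ (fun i => F (Function.update r m a i)) (mem_univ m),
      ← mul_prod_erase univ (fun i => F (r i)) (mem_univ m), Function.update_self, hrm, hF, one_mul]
    congr 1
    exact prod_congr rfl fun i hi => by rw [Function.update_of_ne (ne_of_mem_erase hi)]
  have hval : ∀ a ∈ V', sieveWeight g R (τ a) =
      (∏ i, g (r i)) / (∏ i, (r i : ℝ)) * (g a / a) := by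
    intro a ha
    have h1 : (supportProd (τ a) : ℝ) = a * ∏ i, (r i : ℝ) := by
      rw [supportProd_eq_prod_coordProd, prod_congr rfl fun i _ => hcoord a ha i, Nat.cast_prod]
      exact hprod a (fun n => (n : ℝ)) Nat.cast_one
    have h2 : supportProd (τ a) ≤ R := by
      have h3 : supportProd (τ a) = a * ∏ i, r i := by exact_mod_cast h1
      have h4 := (hV a (mem_filter.1 ha).1).2.2
      rw [h3, ← Nat.pow_le_pow_iff_left two_ne_zero, mul_pow, sq R]
      exact Nat.mul_le_mul h4 hrR
    simp only [sieveWeight, if_pos h2, h1, hcoord a ha, hprod a g hg1]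
    rw [mul_inv]
    ring
  have hV0 : ∀ a ∈ V, a ≠ 0 := fun a ha => (hV a ha).1.ne_zero
  have hmain := mul_one_sub_sumInvPrimes_le (f := fun a => g a / a) hVd
    (fun a => div_nonneg (hg0 a) (Nat.cast_nonneg a)) (fun p b hp => ?_) r fun i => hV0 _ (hr i)
  · calc _ ≤ (∏ i, g (r i)) / (∏ i, (r i : ℝ)) * ∑ a ∈ V', g a / a :=
          mul_le_mul_of_nonneg_left hmain (div_nonneg (prod_nonneg fun _ _ => hg0 _)
            (prod_nonneg fun _ _ => Nat.cast_nonneg _))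
      _ = ∑ a ∈ V', sieveWeight g R (τ a) * ∏ p,
            if (if τ a p = some m then none else τ a p) = (ofTuple r p : Option (Fin k)) then (1 : ℝ)
              else 0 := by
          rw [mul_sum]
          refine sum_congr rfl fun a ha => ?_
          rw [hval a ha, prod_eq_one fun p _ => if_pos (hφ a ha p), mul_one]
      _ = ∑ ω ∈ image τ V', sieveWeight g R ω * ∏ p,
            if (if ω p = some m then none else ω p) = (ofTuple r p : Option (Fin k)) then (1 : ℝ)
              else 0 := by
          rw [sum_image (f := fun ω => sieveWeight g R ω * ∏ p,
            if (if ω p = some m then none else ω p) = (ofTuple r p : Option (Fin k)) then (1 : ℝ)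
              else 0) hinj]
      _ ≤ _ := by
          refine sum_le_sum_of_subset_of_nonneg (subset_univ _) fun ω _ _ =>
            mul_nonneg (sieveWeight_nonneg hg0 R ω) (prod_nonneg fun p _ => ?_)
          split_ifs <;> simp
  · have hp0 : (0 : ℝ) < p := by exact_mod_cast hp.pos
    have := div_le_div_of_nonneg_right (hg p b hp) (mul_nonneg hp0.le (Nat.cast_nonneg (α := ℝ) b))
    rw [Nat.cast_mul]
    refine this.trans_eq ?_
    rw [div_mul_eq_div_div_swap]
    field_simp

end BoundedGaps

namespace BoundedGaps
open Finset

theorem sum_ofTuple_inv_le {P : Finset ℕ} {k : ℕ} {r : Fin k → ℕ} (hr : ∀ i, r i ≠ 0)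
    (hP : ∀ p ∈ P, p.Prime) :
    ∑ p : P, (if (ofTuple r p : Option (Fin k)) = none then 0 else ((p : ℕ) : ℝ)⁻¹) ≤
      sumInvPrimes r := by
  classical
  calc _ ≤ ∑ p : P, ∑ i, if (p : ℕ) ∣ r i then ((p : ℕ) : ℝ)⁻¹ else 0 := by
        refine sum_le_sum fun p _ => ?_
        have hnn : ∀ i, 0 ≤ if (p : ℕ) ∣ r i then ((p : ℕ) : ℝ)⁻¹ else 0 := fun i => by
          split_ifs <;> simp
        split_ifs with h
        · exact sum_nonneg fun i _ => hnn i
        · rw [ofTuple_eq_none_iff] at h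
          push Not at h
          obtain ⟨i, hi⟩ := h
          refine le_trans ?_ (single_le_sum (fun i _ => hnn i) (mem_univ i))
          rw [if_pos hi]
    _ = ∑ i, ∑ p ∈ P, if p ∣ r i then (p : ℝ)⁻¹ else 0 := by
        rw [sum_comm]
        exact sum_congr rfl fun i _ => sum_coe_sort P fun p => if p ∣ r i then (p : ℝ)⁻¹ else 0
    _ ≤ _ := by
        refine sum_le_sum fun i _ => ?_
        rw [← sum_filter]
        refine sum_le_sum_of_subset_of_nonneg (fun p hp => ?_) fun p _ _ => by positivity
        rw [mem_filter] at hp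
        exact Nat.mem_primeFactors.2 ⟨hP p hp.1, hp.2, hr i⟩

theorem prod_ofTuple_ge {P : Finset ℕ} {k : ℕ} (hP : ∀ p ∈ P, p.Prime ∧ 3 * k + 4 ≤ p)
    {r : Fin k → ℕ} (hr : ∀ i, r i ≠ 0) :
    ∃ u : ℝ, 0 ≤ u ∧ 1 - k * ∑ p ∈ P, ((p : ℝ) ^ 2)⁻¹ - (3 * k + 4) * sumInvPrimes r ≤ u ∧
      (∏ p : P, if (ofTuple r p : Option (Fin k)) = none then 1 - k / ((p : ℕ) : ℝ) ^ 2
        else ((p : ℕ) : ℝ) - 3 * k - 4) =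
      supportProd (ofTuple r : P → Option (Fin k)) * u := by
  classical
  let f : P → ℝ := fun p => if (ofTuple r p : Option (Fin k)) = none then k / ((p : ℕ) : ℝ) ^ 2
    else (3 * k + 4) / ((p : ℕ) : ℝ)
  have hp : ∀ p : P, (3 * k + 4 : ℝ) ≤ (p : ℕ) := fun p => by exact_mod_cast (hP p p.2).2
  have hk : (0 : ℝ) ≤ k := Nat.cast_nonneg k
  have hf0 : ∀ p, 0 ≤ f p := fun p => by
    dsimp only [f]
    split_ifs <;> positivity
  have hf1 : ∀ p, f p ≤ 1 := fun p => by
    have := hp p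
    dsimp only [f]
    split_ifs
    · rw [div_le_one (by nlinarith)]
      nlinarith
    · rw [div_le_one (by linarith)]
      exact this
  refine ⟨∏ p, (1 - f p), prod_nonneg fun p _ => sub_nonneg.2 (hf1 p), ?_, ?_⟩
  · refine le_trans ?_ (one_sub_sum_le_prod univ f (fun p _ => hf0 p) fun p _ => hf1 p)
    have h1 : ∑ p, f p ≤ ∑ p : P, (k * (((p : ℕ) : ℝ) ^ 2)⁻¹ + (3 * k + 4) *
        (if (ofTuple r p : Option (Fin k)) = none then 0 else ((p : ℕ) : ℝ)⁻¹)) := by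
      refine sum_le_sum fun p _ => ?_
      dsimp only [f]
      split_ifs
      · rw [div_eq_mul_inv]
        simp
      · rw [div_eq_mul_inv]
        exact le_add_of_nonneg_left (by positivity)
    rw [sum_add_distrib, ← mul_sum, ← mul_sum, sum_coe_sort P fun p => ((p : ℝ) ^ 2)⁻¹] at h1
    have h2 := mul_le_mul_of_nonneg_left (sum_ofTuple_inv_le hr fun p h => (hP p h).1)
      (by linarith : (0 : ℝ) ≤ 3 * k + 4)
    linarith
  · rw [supportProd, Nat.cast_prod, ← prod_mul_distrib]
    refine prod_congr rfl fun p _ => ?_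
    have h0 : ((p : ℕ) : ℝ) ≠ 0 := by
      have := hp p
      linarith
    dsimp only [f]
    split_ifs
    · simp
    · field_simp
      ring

theorem mul_bracket_le {P V : Finset ℕ} {k R : ℕ} (hP : ∀ p ∈ P, p.Prime ∧ 3 * k + 4 ≤ p)
    {g : ℕ → ℝ} (hg0 : ∀ a, 0 ≤ g a) (hg1 : g 1 = 1)
    (hg : ∀ p a, p.Prime → g (p * a) ≤ g a)
    (hV : ∀ a ∈ V, Squarefree a ∧ a.primeFactors ⊆ P ∧ a ^ 2 ≤ R)
    (hVd : ∀ p b, p.Prime → p * b ∈ V → b ∈ V) (m : Fin k) {r : Fin k → ℕ}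
    (hr : ∀ i, r i ∈ V) (hrm : r m = 1) (hc : Pairwise fun i j => Nat.Coprime (r i) (r j))
    (hrR : (∏ i, r i) ^ 2 ≤ R) :
    (∑ a ∈ V, g a / a) ^ 2 * ((∏ i, g (r i) ^ 2 / (r i : ℝ)) *
      (1 - k * ∑ p ∈ P, ((p : ℝ) ^ 2)⁻¹ - (3 * k + 6) * sumInvPrimes r)) ≤
    (∏ p : P, if (ofTuple r p : Option (Fin k)) = none then 1 - k / ((p : ℕ) : ℝ) ^ 2
      else ((p : ℕ) : ℝ) - 3 * k - 4) *
    (∑ ω : P → Option (Fin k), sieveWeight g R ω * ∏ p,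
      if (if ω p = some m then none else ω p) = (ofTuple r p : Option (Fin k)) then (1 : ℝ)
        else 0) ^ 2 := by
  have hP' : ∀ p ∈ P, p.Prime := fun p hp => (hP p hp).1
  have hr0 : ∀ i, r i ≠ 0 := fun i => (hV _ (hr i)).1.ne_zero
  obtain ⟨u, hu0, hu1, hu2⟩ := prod_ofTuple_ge hP hr0
  have hin := sum_sieveWeight_ge hP' hg0 hg1 hg hV hVd m hr hrm hc hrR
  have hQ : (supportProd (ofTuple r : P → Option (Fin k)) : ℝ) = ∏ i, (r i : ℝ) := by
    rw [supportProd_eq_prod_coordProd, Nat.cast_prod]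
    exact prod_congr rfl fun i _ => by
      rw [coordProd_ofTuple hP' hc (hV _ (hr i)).1 (hV _ (hr i)).2.1]
  have hQ0 : 0 < ∏ i, (r i : ℝ) := prod_pos fun i _ => Nat.cast_pos.2 (Nat.pos_of_ne_zero (hr0 i))
  have hG0 : 0 ≤ ∑ a ∈ V, g a / a := sum_nonneg fun a _ => div_nonneg (hg0 a) (Nat.cast_nonneg a)
  have hΓ0 : 0 ≤ ∏ i, g (r i) := prod_nonneg fun _ _ => hg0 _
  have hs0 := sumInvPrimes_nonneg r
  have hε0 : 0 ≤ k * ∑ p ∈ P, ((p : ℝ) ^ 2)⁻¹ :=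
    mul_nonneg (Nat.cast_nonneg k) (sum_nonneg fun _ _ => by positivity)
  rw [hu2, hQ, prod_div_distrib, prod_pow]
  generalize (∑ ω : P → Option (Fin k), sieveWeight g R ω * ∏ p,
      if (if ω p = some m then none else ω p) = (ofTuple r p : Option (Fin k)) then (1 : ℝ)
        else 0) = J at hin ⊢
  generalize ∏ i, (r i : ℝ) = Q at hin hQ0 ⊢
  generalize ∏ i, g (r i) = Γ at hin hΓ0 ⊢
  generalize ∑ a ∈ V, g a / a = G at hin hG0 ⊢
  generalize sumInvPrimes r = s at hin hs0 hu1 ⊢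
  generalize k * ∑ p ∈ P, ((p : ℝ) ^ 2)⁻¹ = ε at hε0 hu1 ⊢
  have hk : (0 : ℝ) ≤ k := Nat.cast_nonneg k
  rcases le_or_gt (1 - ε - (3 * k + 6) * s) 0 with hneg | hpos
  · refine le_trans (mul_nonpos_of_nonneg_of_nonpos (sq_nonneg G)
      (mul_nonpos_of_nonneg_of_nonpos (by positivity) hneg)) (by positivity)
  · have hks : 0 ≤ k * s := mul_nonneg hk hs0
    have hs1 : s < 1 := by nlinarith
    have hΓQ : 0 ≤ Γ / Q * (G * (1 - s)) :=
      mul_nonneg (div_nonneg hΓ0 hQ0.le) (mul_nonneg hG0 (by linarith))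
    have hJ : (Γ / Q * (G * (1 - s))) ^ 2 ≤ J ^ 2 := pow_le_pow_left₀ hΓQ hin 2
    have hbr : 1 - ε - (3 * k + 6) * s ≤ (1 - ε - (3 * k + 4) * s) * (1 - s) ^ 2 := by
      have h1 : 0 ≤ 1 - ε - (3 * k + 4) * s := by nlinarith
      have h2 : 1 - 2 * s ≤ (1 - s) ^ 2 := by nlinarith
      have h3 := mul_le_mul_of_nonneg_left h2 h1
      nlinarith [mul_nonneg hε0 hs0, mul_nonneg hks hs0]
    calc _ ≤ G ^ 2 * (Γ ^ 2 / Q * ((1 - ε - (3 * k + 4) * s) * (1 - s) ^ 2)) :=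
          mul_le_mul_of_nonneg_left (mul_le_mul_of_nonneg_left hbr (by positivity)) (sq_nonneg G)
      _ = Q * (1 - ε - (3 * k + 4) * s) * (Γ / Q * (G * (1 - s))) ^ 2 := by
          field_simp
      _ ≤ Q * u * (Γ / Q * (G * (1 - s))) ^ 2 :=
          mul_le_mul_of_nonneg_right (mul_le_mul_of_nonneg_left hu1 hQ0.le) (sq_nonneg _)
      _ ≤ _ := mul_le_mul_of_nonneg_left hJ (mul_nonneg hQ0.le hu0)

end BoundedGaps

namespace BoundedGaps
open Finset

section tuples

variable {k : ℕ} {V : Fin k → Finset ℕ} {h : ℕ → ℝ}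

theorem sum_prod_mul_prod_le (hh : ∀ a, 0 ≤ h a) (u : Fin k → ℕ → ℝ) (hu : ∀ i a, 0 ≤ u i a)
    (c : Fin k → ℝ) (hc : ∀ i, ∑ a ∈ V i, h a * u i a ≤ c i * ∑ a ∈ V i, h a) :
    ∑ r ∈ Fintype.piFinset V, (∏ i, h (r i)) * ∏ i, u i (r i) ≤
      (∏ i, c i) * ∏ i, ∑ a ∈ V i, h a := by
  simp only [← prod_mul_distrib]
  rw [← prod_univ_sum V fun i a => h a * u i a]
  exact prod_le_prod (fun i _ => sum_nonneg fun a _ => mul_nonneg (hh a) (hu i a)) fun i _ => hc i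

theorem sum_prod_mul_single_le (hh : ∀ a, 0 ≤ h a) (l : Fin k) (f : ℕ → ℝ) (hf : ∀ a, 0 ≤ f a)
    {c : ℝ} (hc : ∑ a ∈ V l, h a * f a ≤ c * ∑ a ∈ V l, h a) :
    ∑ r ∈ Fintype.piFinset V, (∏ i, h (r i)) * f (r l) ≤ c * ∏ i, ∑ a ∈ V i, h a := by
  have := sum_prod_mul_prod_le (V := V) hh (fun i a => if i = l then f a else 1)
    (fun i a => by
      split_ifs
      exacts [hf a, zero_le_one]) (fun i => if i = l then c else 1) fun i => by
      split_ifs with hi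
      · rw [hi]
        exact hc
      · simp
  simpa [prod_ite_eq'] using this

theorem sum_prod_mul_pair_le (hh : ∀ a, 0 ≤ h a) {l j : Fin k} (hlj : l ≠ j) (f : ℕ → ℝ)
    (hf : ∀ a, 0 ≤ f a) {c : ℝ} (hc : ∀ i, ∑ a ∈ V i, h a * f a ≤ c * ∑ a ∈ V i, h a) :
    ∑ r ∈ Fintype.piFinset V, (∏ i, h (r i)) * (f (r l) * f (r j)) ≤
      c ^ 2 * ∏ i, ∑ a ∈ V i, h a := by
  have := sum_prod_mul_prod_le (V := V) hh (fun i a => if i ∈ ({l, j} : Finset (Fin k)) then f a else 1)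
    (fun i a => by
      split_ifs
      exacts [hf a, zero_le_one]) (fun i => if i ∈ ({l, j} : Finset (Fin k)) then c else 1) fun i => by
      split_ifs with hi
      · exact hc i
      · simp
  simp only [prod_ite_mem, univ_inter] at this
  simp only [prod_pair hlj] at this
  rw [← sq] at this
  exact this

theorem sum_tuple_ge (hh : ∀ a, 0 ≤ h a) {P : Finset ℕ}
    (hp : ∀ i, ∀ p ∈ P, ∑ a ∈ V i with p ∣ a, h a ≤ (p : ℝ)⁻¹ * ∑ a ∈ V i, h a) {Λ B c : ℝ}
    (hΛ : ∀ i, ∑ a ∈ V i, h a * Real.log a ≤ Λ * ∑ a ∈ V i, h a) (hB : 0 ≤ B) (hc : 0 ≤ c) :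
    (1 - (k + B * k + k ^ 2) * ∑ p ∈ P, ((p : ℝ) ^ 2)⁻¹ - c * (k * Λ)) *
      ∏ i, ∑ a ∈ V i, h a ≤
    ∑ r ∈ Fintype.piFinset V, (∏ i, h (r i)) * (1 - k * ∑ p ∈ P, ((p : ℝ) ^ 2)⁻¹ -
      B * ∑ i, ∑ p ∈ P, (p : ℝ)⁻¹ * (if p ∣ r i then 1 else 0) -
      ∑ i, ∑ j with i ≠ j, ∑ p ∈ P, ((if p ∣ r i then 1 else 0) * (if p ∣ r j then 1 else 0)) -
      c * ∑ i, Real.log (r i)) := by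
  have hZ : 0 ≤ ∏ i, ∑ a ∈ V i, h a := prod_nonneg fun i _ => sum_nonneg fun a _ => hh a
  have h0 : ∑ r ∈ Fintype.piFinset V, (∏ i, h (r i)) = ∏ i, ∑ a ∈ V i, h a :=
    (prod_univ_sum V fun _ a => h a).symm
  have hp' : ∀ i, ∀ p ∈ P, ∑ a ∈ V i, h a * (if p ∣ a then 1 else 0) ≤
      (p : ℝ)⁻¹ * ∑ a ∈ V i, h a := by
    intro i p hpP
    refine le_trans (le_of_eq ?_) (hp i p hpP)
    rw [sum_filter]
    exact sum_congr rfl fun a _ => by simp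
  have hite : ∀ p a : ℕ, (0 : ℝ) ≤ if p ∣ a then 1 else 0 := fun p a => by split_ifs <;> simp
  have h1 : ∑ r ∈ Fintype.piFinset V, (∏ i, h (r i)) *
      ∑ i, ∑ p ∈ P, (p : ℝ)⁻¹ * (if p ∣ r i then 1 else 0) ≤
      k * (∑ p ∈ P, ((p : ℝ) ^ 2)⁻¹) * ∏ i, ∑ a ∈ V i, h a := by
    simp only [mul_sum (s := univ), mul_sum (s := P)]
    rw [sum_comm]
    refine le_trans (sum_le_card_nsmul _ _
      ((∑ p ∈ P, ((p : ℝ) ^ 2)⁻¹) * ∏ i, ∑ a ∈ V i, h a) fun i _ => ?_) (le_of_eq ?_)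
    · rw [sum_comm, sum_mul]
      refine sum_le_sum fun p hpP => ?_
      have := mul_le_mul_of_nonneg_left (sum_prod_mul_single_le hh i _ (hite p) (hp' i p hpP))
        (inv_nonneg.2 (Nat.cast_nonneg (α := ℝ) p))
      rw [mul_sum, ← mul_assoc, ← sq] at this
      rw [← inv_pow]
      refine le_trans (le_of_eq (sum_congr rfl fun r _ => ?_)) this
      ring
    · rw [nsmul_eq_mul, card_univ, Fintype.card_fin]
      simp only [mul_sum, sum_mul]
      exact sum_congr rfl fun _ _ => by ring
  have h2 : ∑ r ∈ Fintype.piFinset V, (∏ i, h (r i)) *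
      ∑ i, ∑ j with i ≠ j, ∑ p ∈ P, ((if p ∣ r i then 1 else 0) * (if p ∣ r j then 1 else 0)) ≤
      (k : ℝ) ^ 2 * (∑ p ∈ P, ((p : ℝ) ^ 2)⁻¹) * ∏ i, ∑ a ∈ V i, h a := by
    have hnn : 0 ≤ (∑ p ∈ P, ((p : ℝ) ^ 2)⁻¹) * ∏ i, ∑ a ∈ V i, h a :=
      mul_nonneg (sum_nonneg fun _ _ => by positivity) hZ
    have hij : ∀ i j : Fin k, i ≠ j → ∑ r ∈ Fintype.piFinset V, (∏ i, h (r i)) *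
        ∑ p ∈ P, ((if p ∣ r i then 1 else 0) * (if p ∣ r j then 1 else 0)) ≤
        (∑ p ∈ P, ((p : ℝ) ^ 2)⁻¹) * ∏ i, ∑ a ∈ V i, h a := by
      intro i j hne
      simp only [mul_sum (s := P)]
      rw [sum_comm, sum_mul]
      refine sum_le_sum fun p hpP => ?_
      rw [← inv_pow]
      exact sum_prod_mul_pair_le hh hne _ (hite p) fun i => hp' i p hpP
    simp only [mul_sum (s := univ), mul_sum (s := filter _ _)]
    rw [sum_comm]
    calc _ ≤ ∑ _i : Fin k, ∑ _j : Fin k, (∑ p ∈ P, ((p : ℝ) ^ 2)⁻¹) * ∏ i, ∑ a ∈ V i, h a := by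
          refine sum_le_sum fun i _ => ?_
          rw [sum_comm, sum_filter]
          refine sum_le_sum fun j _ => ?_
          split_ifs with hne
          · exact hij i j hne
          · exact hnn
      _ = _ := by
          simp only [sum_const, card_univ, Fintype.card_fin, nsmul_eq_mul]
          ring
  have h3 : ∑ r ∈ Fintype.piFinset V, (∏ i, h (r i)) * ∑ i, Real.log (r i) ≤
      k * Λ * ∏ i, ∑ a ∈ V i, h a := by
    simp only [mul_sum (s := univ)]
    rw [sum_comm]
    refine le_trans (sum_le_card_nsmul _ _ (Λ * ∏ i, ∑ a ∈ V i, h a) fun i _ => ?_) (le_of_eq ?_)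
    · exact sum_prod_mul_single_le hh i (fun a => Real.log a)
        (fun a => Real.log_natCast_nonneg a) (hΛ i)
    · rw [nsmul_eq_mul, card_univ, Fintype.card_fin, mul_assoc]
  have key : ∀ (H a X Y L : (Fin k → ℕ) → ℝ) (e : ℝ) (s : Finset (Fin k → ℕ)),
      ∑ r ∈ s, H r * (1 - e - B * X r - Y r - c * L r) =
      (1 - e) * ∑ r ∈ s, H r - B * ∑ r ∈ s, H r * X r - ∑ r ∈ s, H r * Y r -
        c * ∑ r ∈ s, H r * L r := by
    intro H a X Y L e s
    simp only [mul_sum, ← sum_sub_distrib]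
    exact sum_congr rfl fun r _ => by ring
  rw [key _ (fun _ => 0), h0]
  have h1' := mul_le_mul_of_nonneg_left h1 hB
  have h3' := mul_le_mul_of_nonneg_left h3 hc
  linarith

end tuples

theorem sum_main_ge_of_bounds {P V : Finset ℕ} {k R : ℕ} (hP : ∀ p ∈ P, p.Prime ∧ 3 * k + 4 ≤ p)
    {g : ℕ → ℝ} (hg0 : ∀ a, 0 ≤ g a) (hg1 : g 1 = 1)
    (hg : ∀ p a, p.Prime → g (p * a) ≤ g a)
    (hV : ∀ a ∈ V, Squarefree a ∧ a.primeFactors ⊆ P ∧ a ^ 2 ≤ R)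
    (hVd : ∀ p b, p.Prime → p * b ∈ V → b ∈ V) (h1 : 1 ∈ V) (hR : 1 < R) (m : Fin k) {Λ : ℝ}
    (hΛ0 : 0 ≤ Λ)
    (hΛ : ∑ a ∈ V, g a ^ 2 / a * Real.log a ≤ Λ * ∑ a ∈ V, g a ^ 2 / a)
    (hP2 : (4 * k ^ 2 + 7 * k) * ∑ p ∈ P, ((p : ℝ) ^ 2)⁻¹ ≤ 1 / 4)
    (hΛR : 4 * (k * Λ) ≤ Real.log R) :
    (∑ a ∈ V, g a / a) ^ 2 * (∑ a ∈ V, g a ^ 2 / a) ^ (k - 1) / 4 ≤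
    ∑ v : P → Option (Fin k), ∑ w, sieveWeight g R v * sieveWeight g R w *
      ∏ p : P, ∑ l, localCoeff (p : ℕ) (v p) (w p) l *
        l.elim 1 (fun i => if i = m then 0 else (((p : ℕ) : ℝ) - 1)⁻¹) := by
  classical
  refine le_trans ?_ (sum_main_ge hP m (sieveWeight g R))
  set term : (P → Option (Fin k)) → ℝ := fun l =>
    (∏ p : P, if l p = none then 1 - k / ((p : ℕ) : ℝ) ^ 2 else ((p : ℕ) : ℝ) - 3 * k - 4) *
      (∑ ω, sieveWeight g R ω * ∏ p, if (if ω p = some m then none else ω p) = l p then 1 else 0) ^ 2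
    with hterm
  have hP' : ∀ p ∈ P, p.Prime := fun p hp => (hP p hp).1
  have hlogR : 0 < Real.log R := Real.log_pos (by exact_mod_cast hR)
  have hterm0 : ∀ l, 0 ≤ term l := by
    intro l
    refine mul_nonneg (prod_nonneg fun p _ => ?_) (sq_nonneg _)
    have hp : (3 * k + 4 : ℝ) ≤ (p : ℕ) := by exact_mod_cast (hP p p.2).2
    have hk : (0 : ℝ) ≤ k := Nat.cast_nonneg k
    split_ifs
    · rw [sub_nonneg, div_le_one (by nlinarith)]
      nlinarith
    · linarith
  let V' : Fin k → Finset ℕ := fun i => if i = m then {1} else V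
  have hV' : ∀ i, V' i ⊆ V := by
    intro i
    dsimp only [V']
    split_ifs
    · exact singleton_subset_iff.2 h1
    · exact Subset.rfl
  let h : ℕ → ℝ := fun a => g a ^ 2 / a
  have hh : ∀ a, 0 ≤ h a := fun a => by positivity
  have hZ : ∏ i, ∑ a ∈ V' i, h a = (∑ a ∈ V, g a ^ 2 / a) ^ (k - 1) := by
    rw [← mul_prod_erase univ _ (mem_univ m)]
    have e1 : ∑ a ∈ V' m, h a = 1 := by simp [V', h, hg1]
    rw [e1, one_mul, prod_congr rfl fun i hi => by
      rw [show V' i = V from if_neg (ne_of_mem_erase hi)], prod_const, card_erase_of_mem (mem_univ m),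
      card_univ, Fintype.card_fin]
  have hpd : ∀ i, ∀ p ∈ P, ∑ a ∈ V' i with p ∣ a, h a ≤ (p : ℝ)⁻¹ * ∑ a ∈ V' i, h a := by
    intro i p hp
    dsimp only [V']
    split_ifs
    · rw [filter_singleton, if_neg (hP' p hp).not_dvd_one, sum_empty]
      exact mul_nonneg (by positivity) (sum_nonneg fun a _ => hh a)
    · refine sum_filter_dvd_le (hP' p hp).pos (fun b => hVd p b (hP' p hp)) hh fun b => ?_
      have := pow_le_pow_left₀ (hg0 _) (hg p b (hP' p hp)) 2
      simp only [h]
      push_cast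
      rw [div_eq_mul_inv, mul_inv, ← mul_assoc, mul_comm _ ((p : ℝ)⁻¹), mul_assoc, ← div_eq_mul_inv]
      exact mul_le_mul_of_nonneg_left (div_le_div_of_nonneg_right this (Nat.cast_nonneg b))
        (by positivity)
  have hΛ' : ∀ i, ∑ a ∈ V' i, h a * Real.log a ≤ Λ * ∑ a ∈ V' i, h a := by
    intro i
    dsimp only [V']
    split_ifs
    · simp only [sum_singleton, Nat.cast_one, Real.log_one, mul_zero]
      exact mul_nonneg hΛ0 (hh 1)
    · exact hΛ
  have key := sum_tuple_ge (V := V') hh hpd hΛ' (B := 3 * k + 6) (c := 2 / Real.log R)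
    (by positivity) (by positivity)
  rw [hZ] at key
  let good : Finset (Fin k → ℕ) := {r ∈ Fintype.piFinset V' |
    (Pairwise fun i j => Nat.Coprime (r i) (r j)) ∧ (∏ i, r i) ^ 2 ≤ R}
  have hgV : ∀ r ∈ Fintype.piFinset V', ∀ i, r i ∈ V :=
    fun r hr i => hV' i (Fintype.mem_piFinset.1 hr i)
  have hinj : ∑ r ∈ good, term (ofTuple r) ≤ ∑ l, term l := by
    rw [← sum_image (f := term) (g := fun r : Fin k → ℕ => (ofTuple r : P → Option (Fin k)))]
    · exact sum_le_sum_of_subset_of_nonneg (subset_univ _) fun l _ _ => hterm0 l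
    · intro r hr s hs hrs
      have hr' := mem_filter.1 hr
      have hs' := mem_filter.1 hs
      funext i
      have hri := hV _ (hgV r hr'.1 i)
      have hsi := hV _ (hgV s hs'.1 i)
      rw [← coordProd_ofTuple hP' hr'.2.1 hri.1 hri.2.1,
        ← coordProd_ofTuple hP' hs'.2.1 hsi.1 hsi.2.1]
      dsimp only at hrs
      rw [hrs]
  have hgood : ∀ r ∈ good, (∑ a ∈ V, g a / a) ^ 2 * ((∏ i, h (r i)) *
      (1 - k * ∑ p ∈ P, ((p : ℝ) ^ 2)⁻¹ - (3 * k + 6) * sumInvPrimes r)) ≤ term (ofTuple r) := by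
    intro r hr
    have hr' := mem_filter.1 hr
    refine mul_bracket_le hP hg0 hg1 hg hV hVd m (hgV r hr'.1) ?_ hr'.2.1 hr'.2.2
    have := Fintype.mem_piFinset.1 hr'.1 m
    simpa [V'] using this
  have hsip : ∀ r ∈ Fintype.piFinset V', ∑ i, ∑ p ∈ P, (p : ℝ)⁻¹ * (if p ∣ r i then 1 else 0) =
      sumInvPrimes r := by
    intro r hr
    refine sum_congr rfl fun i _ => ?_
    simp only [mul_ite, mul_one, mul_zero]
    rw [← sum_filter]
    have hri := hV _ (hgV r hr i)
    refine sum_congr (ext fun p => ?_) fun _ _ => rfl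
    rw [mem_filter]
    exact ⟨fun h => Nat.mem_primeFactors.2 ⟨hP' p h.1, h.2, hri.1.ne_zero⟩,
      fun h => ⟨hri.2.1 h, Nat.dvd_of_mem_primeFactors h⟩⟩
  have hε0 : 0 ≤ k * ∑ p ∈ P, ((p : ℝ) ^ 2)⁻¹ :=
    mul_nonneg (Nat.cast_nonneg k) (sum_nonneg fun _ _ => by positivity)
  have hH0 : ∀ r : Fin k → ℕ, 0 ≤ ∏ i, h (r i) := fun r => prod_nonneg fun i _ => hh _
  have hlog0 : ∀ r : Fin k → ℕ, 0 ≤ 2 / Real.log R * ∑ i, Real.log (r i) := fun r =>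
    mul_nonneg (by positivity) (sum_nonneg fun i _ => Real.log_natCast_nonneg _)
  have hpr0 : ∀ r : Fin k → ℕ, (0 : ℝ) ≤ ∑ i, ∑ j with i ≠ j, ∑ p ∈ P,
      ((if p ∣ r i then 1 else 0) * (if p ∣ r j then 1 else 0)) := fun r =>
    sum_nonneg fun i _ => sum_nonneg fun j _ => sum_nonneg fun p _ => by
      split_ifs <;> norm_num
  have hcmp : ∑ r ∈ Fintype.piFinset V', (∏ i, h (r i)) * (1 - k * ∑ p ∈ P, ((p : ℝ) ^ 2)⁻¹ -
      (3 * k + 6) * ∑ i, ∑ p ∈ P, (p : ℝ)⁻¹ * (if p ∣ r i then 1 else 0) -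
      ∑ i, ∑ j with i ≠ j, ∑ p ∈ P, ((if p ∣ r i then 1 else 0) * (if p ∣ r j then 1 else 0)) -
      2 / Real.log R * ∑ i, Real.log (r i)) ≤ ∑ r ∈ good, (∏ i, h (r i)) *
        (1 - k * ∑ p ∈ P, ((p : ℝ) ^ 2)⁻¹ - (3 * k + 6) * sumInvPrimes r) := by
    rw [sum_filter]
    refine sum_le_sum fun r hr => ?_
    rw [hsip r hr]
    have hs0 : 0 ≤ (3 * k + 6) * sumInvPrimes r := mul_nonneg (by positivity) (sumInvPrimes_nonneg r)
    split_ifs with hgd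
    · exact mul_le_mul_of_nonneg_left (by linarith [hlog0 r, hpr0 r]) (hH0 r)
    · refine mul_nonpos_of_nonneg_of_nonpos (hH0 r) ?_
      rw [not_and_or] at hgd
      rcases hgd with hgd | hgd
      · have : (1 : ℝ) ≤ ∑ i, ∑ j with i ≠ j, ∑ p ∈ P,
            ((if p ∣ r i then 1 else 0) * (if p ∣ r j then 1 else 0)) := by
          unfold Pairwise at hgd
          push Not at hgd
          obtain ⟨i, j, hne, hij⟩ := hgd
          obtain ⟨p, hp, hpi, hpj⟩ := Nat.Prime.not_coprime_iff_dvd.1 hij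
          have hri := hV _ (hgV r hr i)
          have hpP : p ∈ P := hri.2.1 (Nat.mem_primeFactors.2 ⟨hp, hpi, hri.1.ne_zero⟩)
          have hnn : ∀ (i j : Fin k) (p : ℕ),
              (0 : ℝ) ≤ (if p ∣ r i then 1 else 0) * (if p ∣ r j then 1 else 0) := fun i j p => by
            split_ifs <;> norm_num
          calc (1 : ℝ) = (if p ∣ r i then 1 else 0) * (if p ∣ r j then 1 else 0) := by
                rw [if_pos hpi, if_pos hpj, one_mul]
            _ ≤ ∑ p ∈ P, ((if p ∣ r i then 1 else 0) * (if p ∣ r j then 1 else 0)) :=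
                single_le_sum (f := fun p => (if p ∣ r i then (1 : ℝ) else 0) *
                  (if p ∣ r j then 1 else 0)) (fun p _ => hnn i j p) hpP
            _ ≤ ∑ j with i ≠ j, ∑ p ∈ P,
                ((if p ∣ r i then 1 else 0) * (if p ∣ r j then 1 else 0)) :=
                single_le_sum (f := fun j => ∑ p ∈ P, (if p ∣ r i then (1 : ℝ) else 0) *
                  (if p ∣ r j then 1 else 0)) (fun j _ => sum_nonneg fun p _ => hnn i j p)
                  (mem_filter.2 ⟨mem_univ j, hne⟩)
            _ ≤ _ :=
                single_le_sum (f := fun i => ∑ j with i ≠ j, ∑ p ∈ P,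
                  (if p ∣ r i then (1 : ℝ) else 0) * (if p ∣ r j then 1 else 0))
                  (fun i _ => sum_nonneg fun j _ => sum_nonneg fun p _ => hnn i j p) (mem_univ i)
        linarith [hlog0 r]
      · have : 1 ≤ 2 / Real.log R * ∑ i, Real.log (r i) := by
          have h0 : ∀ i ∈ univ, ((r i : ℕ) : ℝ) ≠ 0 := fun i _ =>
            Nat.cast_ne_zero.2 (hV _ (hgV r hr i)).1.ne_zero
          have hlt : (R : ℝ) < (∏ i, (r i : ℝ)) ^ 2 := by
            push Not at hgd
            exact_mod_cast hgd
          have := Real.log_le_log (by exact_mod_cast (by omega : 0 < R)) hlt.le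
          rw [Real.log_pow, Real.log_prod h0] at this
          rw [div_mul_eq_mul_div, le_div_iff₀ hlogR]
          push_cast at this
          linarith
        linarith [hpr0 r]
  have hfin : (1 : ℝ) / 4 ≤ 1 - (k + (3 * k + 6) * k + k ^ 2) * ∑ p ∈ P, ((p : ℝ) ^ 2)⁻¹ -
      2 / Real.log R * (k * Λ) := by
    have : 2 / Real.log R * (k * Λ) ≤ 1 / 2 := by
      rw [div_mul_eq_mul_div, div_le_iff₀ hlogR]
      linarith
    nlinarith
  have hG0 : 0 ≤ (∑ a ∈ V, g a / a) ^ 2 := sq_nonneg _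
  have hZ0 : 0 ≤ (∑ a ∈ V, g a ^ 2 / a) ^ (k - 1) := pow_nonneg (sum_nonneg fun a _ => hh a) _
  calc _ = (∑ a ∈ V, g a / a) ^ 2 * (1 / 4 * (∑ a ∈ V, g a ^ 2 / a) ^ (k - 1)) := by ring
    _ ≤ (∑ a ∈ V, g a / a) ^ 2 * ∑ r ∈ good, (∏ i, h (r i)) *
        (1 - k * ∑ p ∈ P, ((p : ℝ) ^ 2)⁻¹ - (3 * k + 6) * sumInvPrimes r) :=
        mul_le_mul_of_nonneg_left
          ((mul_le_mul_of_nonneg_right hfin hZ0).trans (key.trans hcmp)) hG0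
    _ ≤ ∑ r ∈ good, term (ofTuple r) := by
        rw [mul_sum]
        exact sum_le_sum hgood
    _ ≤ _ := hinj

end BoundedGaps

namespace BoundedGaps
open Finset

theorem card_filter_coprime_block (W j : ℕ) :
    #{a ∈ Ioc (j * W) (j * W + W) | Nat.Coprime a W} = W.totient := by
  have := Nat.filter_coprime_Ico_eq_totient W (j * W + 1)
  rw [← this]
  congr 1
  ext a
  simp only [mem_filter, mem_Ico, mem_Ioc]
  constructor <;> rintro ⟨⟨h1, h2⟩, h3⟩ <;> exact ⟨⟨by omega, by omega⟩, h3.symm⟩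

theorem sum_Ioc_mul_eq (W M : ℕ) (f : ℕ → ℝ) :
    ∑ a ∈ Ioc 0 (M * W), f a = ∑ j ∈ range M, ∑ a ∈ Ioc (j * W) (j * W + W), f a := by
  induction M with
  | zero => simp
  | succ M ih =>
    rw [sum_range_succ, ← ih, Nat.succ_mul, sum_Ioc_consecutive _ (Nat.zero_le _) (by omega)]

theorem sum_coprime_le {W : ℕ} (hW : 0 < W) {f : ℕ → ℝ} (hf0 : ∀ a, 0 ≤ f a)
    (hf : ∀ a b, 1 ≤ a → a ≤ b → f b ≤ f a) (M : ℕ) :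
    ∑ a ∈ Ioc 0 (M * W) with Nat.Coprime a W, f a ≤
      W * f 1 + (W.totient / W : ℝ) * ∑ a ∈ Ioc 0 (M * W), f a := by
  have hW' : (0 : ℝ) < W := Nat.cast_pos.2 hW
  have hblock : ∀ j, ∑ a ∈ Ioc (j * W) (j * W + W) with Nat.Coprime a W, f a ≤
      W.totient * f (j * W + 1) := by
    intro j
    rw [← card_filter_coprime_block W j, ← nsmul_eq_mul]
    refine sum_le_card_nsmul _ _ _ fun a ha => ?_
    have := mem_Ioc.1 (mem_filter.1 ha).1
    exact hf _ _ (by omega) (by omega)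
  have hprev : ∀ j, W * f ((j + 1) * W + 1) ≤ ∑ a ∈ Ioc (j * W) (j * W + W), f a := by
    intro j
    have e : #(Ioc (j * W) (j * W + W)) = W := by simp
    have := card_nsmul_le_sum (Ioc (j * W) (j * W + W)) f (f ((j + 1) * W + 1)) fun a ha => by
      have := mem_Ioc.1 ha
      refine hf _ _ (by omega) ?_
      rw [add_mul, one_mul]
      omega
    rwa [e, nsmul_eq_mul] at this
  rw [sum_filter, sum_Ioc_mul_eq, sum_Ioc_mul_eq]
  simp only [← sum_filter]
  rcases M with _ | M
  · simp only [range_zero, sum_empty, mul_zero, add_zero]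
    exact mul_nonneg hW'.le (hf0 1)
  rw [sum_range_succ', add_comm]
  refine add_le_add ?_ ?_
  · refine (hblock 0).trans ?_
    rw [zero_mul, zero_add]
    exact mul_le_mul_of_nonneg_right (Nat.cast_le.2 (Nat.totient_le W)) (hf0 1)
  · refine le_trans ?_ (mul_le_mul_of_nonneg_left (sum_le_sum_of_subset_of_nonneg
      (range_subset_range.2 (Nat.le_succ M)) fun j _ _ => sum_nonneg fun a _ => hf0 a)
      (by positivity))
    rw [mul_sum]
    refine sum_le_sum fun j _ => (hblock (j + 1)).trans ?_
    refine le_trans (le_of_eq ?_) (mul_le_mul_of_nonneg_left (hprev j) (by positivity))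
    field_simp

theorem le_sum_coprime {W : ℕ} (hW : 0 < W) {f : ℕ → ℝ} (hf0 : ∀ a, 0 ≤ f a)
    (hf : ∀ a b, 1 ≤ a → a ≤ b → f b ≤ f a) (M : ℕ) :
    (W.totient / W : ℝ) * ∑ a ∈ Ioc 0 (M * W), f a - W * f 1 ≤
      ∑ a ∈ Ioc 0 (M * W) with Nat.Coprime a W, f a := by
  have hW' : (0 : ℝ) < W := Nat.cast_pos.2 hW
  have hblock : ∀ j, W.totient * f ((j + 1) * W) ≤
      ∑ a ∈ Ioc (j * W) (j * W + W) with Nat.Coprime a W, f a := by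
    intro j
    rw [← card_filter_coprime_block W j, ← nsmul_eq_mul]
    refine card_nsmul_le_sum _ _ _ fun a ha => ?_
    have := mem_Ioc.1 (mem_filter.1 ha).1
    refine hf _ _ (by omega) ?_
    rw [add_mul, one_mul]
    omega
  have hnext : ∀ j n, j * W ≤ n → 1 ≤ n →
      ∑ a ∈ Ioc (j * W) (j * W + W), f a ≤ W * f n ∨ j * W < n := by
    intro j n h1 h2
    rcases h1.eq_or_lt with h | h
    · left
      have e : #(Ioc (j * W) (j * W + W)) = W := by simp
      have := sum_le_card_nsmul (Ioc (j * W) (j * W + W)) f (f n) fun a ha => by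
        have := mem_Ioc.1 ha
        exact hf _ _ h2 (by omega)
      rwa [e, nsmul_eq_mul] at this
    · exact Or.inr h
  have hδ1 : (W.totient / W : ℝ) ≤ 1 := by
    rw [div_le_one hW']
    exact Nat.cast_le.2 (Nat.totient_le W)
  rw [sum_filter, sum_Ioc_mul_eq, sum_Ioc_mul_eq]
  simp only [← sum_filter]
  rcases M with _ | M
  · simp only [range_zero, sum_empty, mul_zero, zero_sub]
    exact neg_nonpos.2 (mul_nonneg hW'.le (hf0 1))
  have h0 : (W.totient / W : ℝ) * ∑ a ∈ Ioc (0 * W) (0 * W + W), f a ≤ W * f 1 := by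
    refine (mul_le_of_le_one_left (sum_nonneg fun a _ => hf0 a) hδ1).trans ?_
    have e : #(Ioc (0 * W) (0 * W + W)) = W := by simp
    have := sum_le_card_nsmul (Ioc (0 * W) (0 * W + W)) f (f 1) fun a ha => by
      have := mem_Ioc.1 ha
      exact hf _ _ le_rfl (by omega)
    rwa [e, nsmul_eq_mul] at this
  rw [sum_range_succ', mul_add]
  have h1 : (W.totient / W : ℝ) * ∑ j ∈ range M, ∑ a ∈ Ioc ((j + 1) * W) ((j + 1) * W + W), f a ≤
      ∑ j ∈ range (M + 1), ∑ a ∈ Ioc (j * W) (j * W + W) with Nat.Coprime a W, f a := by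
    refine le_trans ?_ (sum_le_sum_of_subset_of_nonneg (range_subset_range.2 (Nat.le_succ M))
      fun j _ _ => sum_nonneg fun a _ => hf0 a)
    rw [mul_sum]
    refine sum_le_sum fun j _ => le_trans ?_ (hblock j)
    rcases hnext (j + 1) ((j + 1) * W) le_rfl (Nat.mul_pos (Nat.succ_pos j) hW) with h | h
    · refine (mul_le_mul_of_nonneg_left h (by positivity)).trans (le_of_eq ?_)
      field_simp
    · exact absurd h (lt_irrefl _)
  linarith

/-- The part of a sum over the integers coprime to `W` carried by the squarefree ones. -/
theorem sum_coprime_le_two_mul_sum_squarefree {W Y : ℕ} {F : ℕ → ℝ} (hF0 : ∀ a, 0 ≤ F a)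
    (hF : ∀ a b, 1 ≤ a → 1 ≤ b → F (b ^ 2 * a) ≤ ((b : ℝ) ^ 2)⁻¹ * F a) :
    ∑ a ∈ Ioc 0 Y with Nat.Coprime a W, F a ≤
      2 * ∑ a ∈ Ioc 0 Y with Squarefree a ∧ Nat.Coprime a W, F a := by
  have hsq : ∑ b ∈ Ioc 0 Y, ((b : ℝ) ^ 2)⁻¹ ≤ 2 := by
    rcases Nat.eq_zero_or_pos Y with rfl | hY
    · simp
    have := sum_Ioc_inv_sq_le_sub (α := ℝ) (k := 1) (n := Y) one_ne_zero hY
    rw [← sum_Ioc_consecutive (fun b : ℕ => ((b : ℝ) ^ 2)⁻¹) (Nat.zero_le 1) hY]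
    have h2 : (0 : ℝ) ≤ (Y : ℝ)⁻¹ := by positivity
    rw [Nat.cast_one, inv_one] at this
    have h3 : ∑ b ∈ Ioc (0 : ℕ) 1, ((b : ℝ) ^ 2)⁻¹ = 1 := by simp
    linarith
  have hsub : ∑ a ∈ Ioc 0 Y with Nat.Coprime a W, F a ≤
      ∑ a ∈ image (fun x : ℕ × ℕ => x.1 ^ 2 * x.2)
        (Ioc 0 Y ×ˢ {a ∈ Ioc 0 Y | Squarefree a ∧ Nat.Coprime a W}), F a := by
    refine sum_le_sum_of_subset_of_nonneg (fun a ha => ?_) fun a _ _ => hF0 a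
    obtain ⟨h1, h2⟩ := mem_filter.1 ha
    obtain ⟨h3, h4⟩ := mem_Ioc.1 h1
    obtain ⟨s, b, rfl, hs⟩ := Nat.sq_mul_squarefree a
    have hb : 0 < b := Nat.pos_of_ne_zero fun h => by simp [h] at h3
    have hs0 : 0 < s := Nat.pos_of_ne_zero fun h => by simp [h] at h3
    refine mem_image.2 ⟨(b, s), mem_product.2 ⟨mem_Ioc.2 ⟨hb, ?_⟩, mem_filter.2
      ⟨mem_Ioc.2 ⟨hs0, ?_⟩, hs, Nat.Coprime.coprime_mul_left h2⟩⟩, rfl⟩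
    · have : b ≤ b ^ 2 * s := by nlinarith [Nat.mul_pos hb hs0]
      exact this.trans h4
    · exact (Nat.le_mul_of_pos_left s (by positivity)).trans h4
  refine hsub.trans ?_
  refine (sum_image_le_of_nonneg ?_).trans ?_
  · exact fun x _ => hF0 _
  rw [sum_product]
  calc _ ≤ ∑ b ∈ Ioc 0 Y, ((b : ℝ) ^ 2)⁻¹ *
        ∑ a ∈ Ioc 0 Y with Squarefree a ∧ Nat.Coprime a W, F a := by
        refine sum_le_sum fun b hb => ?_
        rw [mul_sum]
        exact sum_le_sum fun a ha => hF a b (mem_Ioc.1 (mem_filter.1 ha).1).1 (mem_Ioc.1 hb).1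
    _ ≤ _ := by
        rw [← sum_mul]
        exact mul_le_mul_of_nonneg_right hsq (sum_nonneg fun a _ => hF0 a)

end BoundedGaps

namespace BoundedGaps
open Finset

/-- The smooth weight of the sieve. -/
noncomputable def logWeight (κ : ℝ) (a : ℕ) : ℝ := (1 + κ * Real.log a)⁻¹

theorem one_le_one_add_mul_log {κ : ℝ} (hκ : 0 ≤ κ) (a : ℕ) : 1 ≤ 1 + κ * Real.log a :=
  le_add_of_nonneg_right (mul_nonneg hκ (Real.log_natCast_nonneg a))

theorem logWeight_pos {κ : ℝ} (hκ : 0 ≤ κ) (a : ℕ) : 0 < logWeight κ a :=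
  inv_pos.2 (one_pos.trans_le (one_le_one_add_mul_log hκ a))

theorem logWeight_le_one {κ : ℝ} (hκ : 0 ≤ κ) (a : ℕ) : logWeight κ a ≤ 1 :=
  inv_le_one_of_one_le₀ (one_le_one_add_mul_log hκ a)

theorem logWeight_anti {κ : ℝ} (hκ : 0 ≤ κ) {a b : ℕ} (ha : 1 ≤ a) (hab : a ≤ b) :
    logWeight κ b ≤ logWeight κ a := by
  refine inv_anti₀ (one_pos.trans_le (one_le_one_add_mul_log hκ a)) ?_
  have := Real.log_le_log (Nat.cast_pos.2 ha) (Nat.cast_le (α := ℝ).2 hab)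
  linarith [mul_le_mul_of_nonneg_left this hκ]

theorem log_succ_sub_log_le {a : ℕ} (ha : 1 ≤ a) :
    Real.log (a + 1 : ℕ) - Real.log a ≤ (a : ℝ)⁻¹ := by
  have h0 : (0 : ℝ) < a := Nat.cast_pos.2 ha
  rw [← Real.log_div (by positivity) h0.ne']
  refine (Real.log_le_sub_one_of_pos (by positivity)).trans (le_of_eq ?_)
  push_cast
  field_simp
  ring

theorem inv_succ_le_log_succ_sub_log {a : ℕ} (ha : 1 ≤ a) :
    ((a + 1 : ℕ) : ℝ)⁻¹ ≤ Real.log (a + 1 : ℕ) - Real.log a := by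
  have h0 : (0 : ℝ) < a := Nat.cast_pos.2 ha
  rw [← Real.log_div (by positivity) h0.ne']
  refine le_trans (le_of_eq ?_) (Real.one_sub_inv_le_log_of_pos (by positivity))
  push_cast
  field_simp
  ring

theorem log_sub_log_le {u v : ℝ} (hu : 0 < u) (hv : 0 < v) : Real.log v - Real.log u ≤ (v - u) / u := by
  rw [← Real.log_div hv.ne' hu.ne']
  refine (Real.log_le_sub_one_of_pos (div_pos hv hu)).trans (le_of_eq ?_)
  field_simp

theorem sum_logWeight_ge {κ : ℝ} (hκ : 0 < κ) (Y : ℕ) :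
    Real.log (1 + κ * Real.log (Y + 1 : ℕ)) / κ ≤ ∑ a ∈ Ioc 0 Y, logWeight κ a / a := by
  induction Y with
  | zero => simp
  | succ Y ih =>
    rw [sum_Ioc_succ_top (Nat.zero_le Y)]
    have hu := one_pos.trans_le (one_le_one_add_mul_log hκ.le (Y + 1))
    have hv := one_pos.trans_le (one_le_one_add_mul_log hκ.le (Y + 1 + 1))
    have h1 := log_sub_log_le hu hv
    have h2 := log_succ_sub_log_le (Nat.le_add_left 1 Y)
    have h3 : (Real.log (1 + κ * Real.log (Y + 1 + 1 : ℕ)) -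
        Real.log (1 + κ * Real.log (Y + 1 : ℕ))) / κ ≤ logWeight κ (Y + 1) / (Y + 1 : ℕ) := by
      rw [div_le_iff₀ hκ]
      refine h1.trans ?_
      rw [logWeight, div_eq_mul_inv, div_eq_mul_inv]
      have h4 := mul_le_mul_of_nonneg_left h2 hκ.le
      have h5 := mul_le_mul_of_nonneg_right h4 (inv_nonneg.2 hu.le)
      linarith
    rw [sub_div] at h3
    linarith

theorem sum_logWeight_le {κ : ℝ} (hκ : 0 < κ) {Y : ℕ} (hY : 1 ≤ Y) :
    ∑ a ∈ Ioc 0 Y, logWeight κ a / a ≤ 1 + Real.log (1 + κ * Real.log Y) / κ := by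
  induction Y, hY using Nat.le_induction with
  | base => simp [logWeight]
  | succ Y hY ih =>
    rw [sum_Ioc_succ_top (Nat.zero_le Y)]
    have hu := one_pos.trans_le (one_le_one_add_mul_log hκ.le Y)
    have hv := one_pos.trans_le (one_le_one_add_mul_log hκ.le (Y + 1))
    have h1 := log_sub_log_le hv hu
    have h2 := inv_succ_le_log_succ_sub_log hY
    have h3 : logWeight κ (Y + 1) / (Y + 1 : ℕ) ≤ (Real.log (1 + κ * Real.log (Y + 1 : ℕ)) -
        Real.log (1 + κ * Real.log Y)) / κ := by
      rw [le_div_iff₀ hκ]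
      rw [div_eq_mul_inv] at h1
      rw [logWeight, div_eq_mul_inv]
      have h4 := mul_le_mul_of_nonneg_left h2 hκ.le
      have h5 := mul_le_mul_of_nonneg_right h4 (inv_nonneg.2 hv.le)
      linarith
    rw [sub_div] at h3
    linarith

theorem sum_logWeight_sq_ge {κ : ℝ} (hκ : 0 < κ) (Y : ℕ) :
    (1 - (1 + κ * Real.log (Y + 1 : ℕ))⁻¹) / κ ≤ ∑ a ∈ Ioc 0 Y, logWeight κ a ^ 2 / a := by
  induction Y with
  | zero => simp
  | succ Y ih =>
    rw [sum_Ioc_succ_top (Nat.zero_le Y)]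
    have hu := one_pos.trans_le (one_le_one_add_mul_log hκ.le (Y + 1))
    have hv := one_pos.trans_le (one_le_one_add_mul_log hκ.le (Y + 1 + 1))
    have h2 := log_succ_sub_log_le (Nat.le_add_left 1 Y)
    have h6 : Real.log (Y + 1 : ℕ) ≤ Real.log (Y + 1 + 1 : ℕ) :=
      Real.log_le_log (by positivity) (by push_cast; linarith)
    have h3 : ((1 + κ * Real.log (Y + 1 : ℕ))⁻¹ - (1 + κ * Real.log (Y + 1 + 1 : ℕ))⁻¹) / κ ≤
        logWeight κ (Y + 1) ^ 2 / (Y + 1 : ℕ) := by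
      rw [logWeight]
      generalize Real.log (Y + 1 : ℕ) = s at *
      generalize Real.log (Y + 1 + 1 : ℕ) = t at *
      generalize ((Y + 1 : ℕ) : ℝ) = y at *
      have e : ((1 + κ * s)⁻¹ - (1 + κ * t)⁻¹) / κ = (t - s) * ((1 + κ * s)⁻¹ * (1 + κ * t)⁻¹) := by
        field_simp
        ring
      rw [e, div_eq_mul_inv, mul_comm _ y⁻¹, sq]
      have hst : (1 + κ * t)⁻¹ ≤ (1 + κ * s)⁻¹ :=
        inv_anti₀ hu (by linarith [mul_le_mul_of_nonneg_left h6 hκ.le])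
      have h0 := inv_nonneg.2 hu.le
      exact mul_le_mul h2 (mul_le_mul_of_nonneg_left hst h0) (mul_nonneg h0 (inv_nonneg.2 hv.le))
        ((sub_nonneg.2 h6).trans h2)
    rw [sub_div] at h3 ⊢
    rw [sub_div] at ih
    linarith

theorem sum_logWeight_sq_le {κ : ℝ} (hκ : 0 < κ) {Y : ℕ} (hY : 1 ≤ Y) :
    ∑ a ∈ Ioc 0 Y, logWeight κ a ^ 2 / a ≤ 1 + (1 - (1 + κ * Real.log Y)⁻¹) / κ := by
  induction Y, hY using Nat.le_induction with
  | base => simp [logWeight]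
  | succ Y hY ih =>
    rw [sum_Ioc_succ_top (Nat.zero_le Y)]
    have hu := one_pos.trans_le (one_le_one_add_mul_log hκ.le Y)
    have hv := one_pos.trans_le (one_le_one_add_mul_log hκ.le (Y + 1))
    have h2 := inv_succ_le_log_succ_sub_log hY
    have h6 : Real.log Y ≤ Real.log (Y + 1 : ℕ) :=
      Real.log_le_log (by exact_mod_cast hY) (by push_cast; linarith)
    have h3 : logWeight κ (Y + 1) ^ 2 / (Y + 1 : ℕ) ≤
        ((1 + κ * Real.log Y)⁻¹ - (1 + κ * Real.log (Y + 1 : ℕ))⁻¹) / κ := by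
      rw [logWeight]
      generalize Real.log (Y + 1 : ℕ) = t at *
      generalize Real.log Y = s at *
      generalize ((Y + 1 : ℕ) : ℝ) = y at *
      have e : ((1 + κ * s)⁻¹ - (1 + κ * t)⁻¹) / κ = (t - s) * ((1 + κ * s)⁻¹ * (1 + κ * t)⁻¹) := by
        field_simp
        ring
      rw [e, div_eq_mul_inv, mul_comm _ y⁻¹, sq]
      have hst : (1 + κ * t)⁻¹ ≤ (1 + κ * s)⁻¹ :=
        inv_anti₀ hu (by linarith [mul_le_mul_of_nonneg_left h6 hκ.le])
      have h0 := inv_nonneg.2 hv.le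
      exact mul_le_mul h2 (mul_le_mul_of_nonneg_right hst h0) (mul_nonneg h0 h0) (sub_nonneg.2 h6)
    rw [sub_div] at h3 ih ⊢
    linarith

theorem sum_squarefree_coprime_bounds {W Y : ℕ} (hW : 0 < W) {F : ℕ → ℝ} (hF0 : ∀ a, 0 ≤ F a)
    (hF1 : F 1 = 1) (hF : ∀ a b, 1 ≤ a → a ≤ b → F b ≤ F a)
    (hF2 : ∀ a b, 1 ≤ a → 1 ≤ b → F (b ^ 2 * a) ≤ ((b : ℝ) ^ 2)⁻¹ * F a) :
    (W.totient / W : ℝ) * ∑ a ∈ Ioc 0 Y, F a - W ≤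
        2 * ∑ a ∈ Ioc 0 Y with Squarefree a ∧ Nat.Coprime a W, F a ∧
      ∑ a ∈ Ioc 0 Y with Squarefree a ∧ Nat.Coprime a W, F a ≤
        W + (W.totient / W : ℝ) * ∑ a ∈ Ioc 0 Y, F a := by
  classical
  let f : ℕ → ℝ := fun a => if a ≤ Y then F a else 0
  have hf0 : ∀ a, 0 ≤ f a := fun a => by
    dsimp only [f]
    split_ifs
    exacts [hF0 a, le_rfl]
  have hf : ∀ a b, 1 ≤ a → a ≤ b → f b ≤ f a := by
    intro a b ha hab
    dsimp only [f]
    split_ifs with h1 h2 h2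
    · exact hF a b ha hab
    · omega
    · exact hF0 a
    · exact le_rfl
  have hf1 : f 1 ≤ 1 := by
    dsimp only [f]
    split_ifs
    exacts [hF1.le, zero_le_one]
  have hYW : Y ≤ Y * W := Nat.le_mul_of_pos_right Y hW
  have hcut : ∀ (p : ℕ → Prop) [DecidablePred p],
      ∑ a ∈ Ioc 0 (Y * W) with p a, f a = ∑ a ∈ Ioc 0 Y with p a, F a := by
    intro p _
    rw [← sum_filter, filter_filter]
    refine sum_congr (ext fun a => ?_) fun _ _ => rfl
    simp only [mem_filter, mem_Ioc]
    constructor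
    · rintro ⟨⟨h1, -⟩, h2, h3⟩
      exact ⟨⟨h1, h3⟩, h2⟩
    · rintro ⟨⟨h1, h3⟩, h2⟩
      exact ⟨⟨h1, h3.trans hYW⟩, h2, h3⟩
  have hcut' : ∑ a ∈ Ioc 0 (Y * W), f a = ∑ a ∈ Ioc 0 Y, F a := by
    simpa using hcut fun _ => True
  have h1 := sum_coprime_le hW hf0 hf Y
  have h2 := le_sum_coprime hW hf0 hf Y
  rw [hcut, hcut'] at h1 h2
  have h3 : W * f 1 ≤ W := mul_le_of_le_one_right (Nat.cast_nonneg W) hf1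
  constructor
  · linarith [sum_coprime_le_two_mul_sum_squarefree (W := W) (Y := Y) hF0 hF2]
  · refine le_trans (sum_le_sum_of_subset_of_nonneg (fun a ha => ?_) fun a _ _ => hF0 a)
      (h1.trans (by linarith))
    rw [mem_filter] at ha ⊢
    exact ⟨ha.1, ha.2.2⟩

theorem logWeight_pow_div_bounds {κ : ℝ} (hκ : 0 ≤ κ) (n : ℕ) :
    (∀ a : ℕ, 0 ≤ logWeight κ a ^ n / a) ∧ logWeight κ 1 ^ n / (1 : ℕ) = 1 ∧
    (∀ a b : ℕ, 1 ≤ a → a ≤ b → logWeight κ b ^ n / b ≤ logWeight κ a ^ n / a) ∧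
    ∀ a b : ℕ, 1 ≤ a → 1 ≤ b →
      logWeight κ (b ^ 2 * a) ^ n / (b ^ 2 * a : ℕ) ≤ ((b : ℝ) ^ 2)⁻¹ * (logWeight κ a ^ n / a) := by
  have h0 : ∀ a, 0 ≤ logWeight κ a := fun a => (logWeight_pos hκ a).le
  refine ⟨fun a => div_nonneg (pow_nonneg (h0 a) n) (Nat.cast_nonneg a), by simp [logWeight],
    fun a b ha hab => ?_, fun a b ha hb => ?_⟩
  · exact div_le_div₀ (pow_nonneg (h0 a) n) (pow_le_pow_left₀ (h0 b) (logWeight_anti hκ ha hab) n)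
      (Nat.cast_pos.2 ha) (Nat.cast_le.2 hab)
  · have h1 := pow_le_pow_left₀ (h0 _)
      (logWeight_anti hκ ha (Nat.le_mul_of_pos_left a (by positivity : 0 < b ^ 2))) n
    push_cast
    rw [div_eq_mul_inv, mul_inv, ← mul_assoc, mul_comm _ (((b : ℝ) ^ 2)⁻¹), mul_assoc,
      ← div_eq_mul_inv]
    exact mul_le_mul_of_nonneg_left (div_le_div_of_nonneg_right h1 (Nat.cast_nonneg a))
      (by positivity)

theorem logWeight_sums {W : ℕ} (hW : 0 < W) {κ T : ℝ} (hκ : 0 < κ)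
    (hκW : 8 * (κ * W) ≤ W.totient / W) (hT : 1 ≤ T) (hT1 : 1 ≤ Real.log (1 + T)) :
    (W.totient / W : ℝ) * Real.log (1 + T) / (4 * κ) ≤
        ∑ a ∈ Ioc 0 ⌊Real.exp (T / κ)⌋₊ with Squarefree a ∧ Nat.Coprime a W, logWeight κ a / a ∧
      ∑ a ∈ Ioc 0 ⌊Real.exp (T / κ)⌋₊ with Squarefree a ∧ Nat.Coprime a W, logWeight κ a / a ≤
        2 * ((W.totient / W : ℝ) * Real.log (1 + T)) / κ ∧
      (W.totient / W : ℝ) / (8 * κ) ≤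
        ∑ a ∈ Ioc 0 ⌊Real.exp (T / κ)⌋₊ with Squarefree a ∧ Nat.Coprime a W, logWeight κ a ^ 2 / a ∧
      ∑ a ∈ Ioc 0 ⌊Real.exp (T / κ)⌋₊ with Squarefree a ∧ Nat.Coprime a W, logWeight κ a ^ 2 / a ≤
        2 * (W.totient / W : ℝ) / κ := by
  set Y := ⌊Real.exp (T / κ)⌋₊ with hY
  have hTκ : 0 < T / κ := by positivity
  have hY1 : 1 ≤ Y := Nat.le_floor (by
    rw [Nat.cast_one]
    exact Real.one_le_exp hTκ.le)
  have hlo : T ≤ κ * Real.log (Y + 1 : ℕ) := by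
    have := Real.log_le_log (Real.exp_pos (T / κ)) (Nat.lt_floor_add_one (Real.exp (T / κ))).le
    rw [Real.log_exp, div_le_iff₀ hκ] at this
    push_cast
    linarith
  have hhi : κ * Real.log Y ≤ T := by
    have := Real.log_le_log (Nat.cast_pos.2 hY1) (Nat.floor_le (Real.exp_pos (T / κ)).le)
    rw [Real.log_exp, le_div_iff₀ hκ] at this
    linarith
  obtain ⟨a1, a2, a3, a4⟩ := logWeight_pow_div_bounds hκ.le 1
  obtain ⟨b1, b2, b3, b4⟩ := logWeight_pow_div_bounds hκ.le 2
  obtain ⟨hG1, hG2⟩ := sum_squarefree_coprime_bounds (Y := Y) hW a1 a2 a3 a4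
  obtain ⟨hZ1, hZ2⟩ := sum_squarefree_coprime_bounds (Y := Y) hW b1 b2 b3 b4
  simp only [pow_one] at hG1 hG2
  have s1 := sum_logWeight_ge hκ Y
  have s2 := sum_logWeight_le hκ hY1
  have s3 := sum_logWeight_sq_ge hκ Y
  have s4 := sum_logWeight_sq_le hκ hY1
  have hδ0 : (0 : ℝ) ≤ W.totient / W := by positivity
  have hW1 : (1 : ℝ) ≤ W := by exact_mod_cast hW
  have hδ1 : (W.totient / W : ℝ) ≤ 1 := by
    rw [div_le_one (by linarith)]
    exact Nat.cast_le.2 (Nat.totient_le W)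
  have t1 : Real.log (1 + T) / κ ≤ ∑ a ∈ Ioc 0 Y, logWeight κ a / a := by
    refine le_trans (div_le_div_of_nonneg_right (Real.log_le_log (by linarith) ?_) hκ.le) s1
    linarith
  have t2 : ∑ a ∈ Ioc 0 Y, logWeight κ a / a ≤ 1 + Real.log (1 + T) / κ := by
    refine s2.trans (add_le_add_right (div_le_div_of_nonneg_right (Real.log_le_log ?_ ?_) hκ.le) _)
    · linarith [one_le_one_add_mul_log hκ.le Y]
    · linarith
  have t3 : 1 / (2 * κ) ≤ ∑ a ∈ Ioc 0 Y, logWeight κ a ^ 2 / a := by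
    refine le_trans ?_ s3
    rw [div_mul_eq_div_div]
    refine div_le_div_of_nonneg_right ?_ hκ.le
    have : (1 + κ * Real.log (Y + 1 : ℕ))⁻¹ ≤ (2 : ℝ)⁻¹ := inv_anti₀ two_pos (by linarith)
    linarith
  have t4 : ∑ a ∈ Ioc 0 Y, logWeight κ a ^ 2 / a ≤ 1 + 1 / κ := by
    refine s4.trans (add_le_add_right (div_le_div_of_nonneg_right ?_ hκ.le) _)
    linarith [logWeight_pos hκ.le Y, show logWeight κ Y = (1 + κ * Real.log Y)⁻¹ from rfl]
  generalize Real.log (1 + T) = L at *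
  generalize (W.totient / W : ℝ) = δ at *
  have e8 : 8 * (W : ℝ) ≤ δ / κ := by
    rw [le_div_iff₀ hκ]
    linarith
  have hδκ : 0 ≤ δ / κ := div_nonneg hδ0 hκ.le
  have eL : δ / κ ≤ δ / κ * L := le_mul_of_one_le_right hδκ hT1
  have u1 := mul_le_mul_of_nonneg_left t1 hδ0
  have u2 := mul_le_mul_of_nonneg_left t2 hδ0
  have u3 := mul_le_mul_of_nonneg_left t3 hδ0
  have u4 := mul_le_mul_of_nonneg_left t4 hδ0
  have f1 : δ * (L / κ) = δ / κ * L := by ring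
  have f2 : δ * (1 / (2 * κ)) = δ / κ / 2 := by
    rw [div_div, mul_one_div, mul_comm κ]
  have f3 : δ * (1 + L / κ) = δ + δ / κ * L := by ring
  have f4 : δ * (1 + 1 / κ) = δ + δ / κ := by ring
  rw [f1] at u1
  rw [f2] at u3
  rw [f3] at u2
  rw [f4] at u4
  have g1 : δ * L / (4 * κ) = δ / κ * L / 4 := by field_simp
  have g2 : 2 * (δ * L) / κ = 2 * (δ / κ * L) := by ring
  have g3 : δ / (8 * κ) = δ / κ / 8 := by rw [div_div, mul_comm κ]
  have g4 : 2 * δ / κ = 2 * (δ / κ) := by ring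
  rw [g1, g2, g3, g4]
  refine ⟨?_, ?_, ?_, ?_⟩ <;> linarith

end BoundedGaps

namespace BoundedGaps
open Finset

theorem lt_of_coprime_primorial {D p : ℕ} (hp : p.Prime) (h : ¬ p ∣ primorial D) : D < p := by
  by_contra hle
  exact h (dvd_prod_of_mem _ (mem_filter.2 ⟨mem_range.2 (by omega), hp⟩))

theorem sum_primes_inv_sq_le (D R : ℕ) (hD : 0 < D) :
    ∑ p ∈ Ioc D R with p.Prime, ((p : ℝ) ^ 2)⁻¹ ≤ (D : ℝ)⁻¹ := by
  refine (sum_le_sum_of_subset_of_nonneg (filter_subset _ _) fun p _ _ => by positivity).trans ?_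
  rcases le_or_gt D R with h | h
  · have := sum_Ioc_inv_sq_le_sub (α := ℝ) hD.ne' h
    have h2 : (0 : ℝ) ≤ (R : ℝ)⁻¹ := by positivity
    linarith
  · rw [Ioc_eq_empty (by omega), sum_empty]
    positivity

theorem exists_sieve_coeffs {k D R : ℕ} {T : ℝ} (hk : 0 < k) (hT : 1 ≤ T)
    (hL : 1 ≤ Real.log (1 + T)) (hTk : 2 * T ≤ k * (64 * Real.log (1 + T)))
    (hD : 4 * (4 * k ^ 2 + 7 * k) ≤ D)
    (hR : 8 * (k * (64 * Real.log (1 + T)) * primorial D) ≤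
      (primorial D).totient / primorial D * Real.log R) :
    ∃ (c : (({p ∈ Ioc D R | p.Prime} : Finset ℕ) → Option (Fin k)) → ℝ) (G Z : ℝ),
      (∀ ω, |c ω| ≤ (supportProd ω : ℝ)⁻¹) ∧ (∀ ω, R < supportProd ω → c ω = 0) ∧
      1 ≤ G ∧ 1 ≤ Z ∧ (primorial D).totient / primorial D * Real.log R * Real.log (1 + T) * Z ≤
        2048 * k * G ^ 2 ∧
      ∑ v, ∑ w, c v * c w * ∏ p : ({p ∈ Ioc D R | p.Prime} : Finset ℕ),
        ∑ l, localCoeff (p : ℕ) (v p) (w p) l * l.elim 1 (fun _ => ((p : ℕ) : ℝ)⁻¹) ≤ Z ^ k ∧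
      ∀ m : Fin k, G ^ 2 * Z ^ (k - 1) / 4 ≤
        ∑ v, ∑ w, c v * c w * ∏ p : ({p ∈ Ioc D R | p.Prime} : Finset ℕ),
          ∑ l, localCoeff (p : ℕ) (v p) (w p) l *
            l.elim 1 (fun i => if i = m then 0 else (((p : ℕ) : ℝ) - 1)⁻¹) := by
  classical
  set L := Real.log (1 + T) with hLdef
  set W := primorial D with hWdef
  set P : Finset ℕ := {p ∈ Ioc D R | p.Prime} with hPdef
  have hW : 0 < W := primorial_pos D
  have hk1 : (1 : ℝ) ≤ k := by exact_mod_cast hk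
  have hW1 : (1 : ℝ) ≤ W := by exact_mod_cast hW
  have hδ0 : (0 : ℝ) < W.totient / W :=
    div_pos (Nat.cast_pos.2 (Nat.totient_pos.2 hW)) (by linarith)
  have hlogR : 0 < Real.log R := by
    refine pos_of_mul_pos_right (lt_of_lt_of_le ?_ hR) hδ0.le
    positivity
  have hR1 : 1 < R := by
    by_contra h
    have : (R : ℝ) ≤ 1 := by exact_mod_cast not_lt.1 h
    linarith [Real.log_nonpos (Nat.cast_nonneg R) this]
  set κ := k * (64 * L) / Real.log R with hκdef
  have hκ : 0 < κ := by positivity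
  have hκR : κ * Real.log R = k * (64 * L) := div_mul_cancel₀ _ hlogR.ne'
  have hκW : 8 * (κ * W) ≤ W.totient / W := by
    refine le_of_mul_le_mul_right ?_ hlogR
    refine le_trans (le_of_eq ?_) hR
    rw [← hκR]
    ring
  obtain ⟨hG1, hG2, hZ1, hZ2⟩ := logWeight_sums hW hκ hκW hT hL
  rw [← hLdef] at hG1 hG2
  set Y := ⌊Real.exp (T / κ)⌋₊ with hYdef
  set V : Finset ℕ := {a ∈ Ioc 0 Y | Squarefree a ∧ Nat.Coprime a W} with hVdef
  let g : ℕ → ℝ := fun a => if a ∈ V then logWeight κ a else 0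
  have hgV : ∀ a ∈ V, g a = logWeight κ a := fun a ha => if_pos ha
  have hgV' : ∀ a ∉ V, g a = 0 := fun a ha => if_neg ha
  have hg0 : ∀ a, 0 ≤ g a := fun a => by
    dsimp only [g]
    split_ifs
    exacts [(logWeight_pos hκ.le a).le, le_rfl]
  have hgle : ∀ a, g a ≤ 1 := fun a => by
    dsimp only [g]
    split_ifs
    exacts [logWeight_le_one hκ.le a, zero_le_one]
  have hYR : (Y : ℝ) ^ 2 ≤ R := by
    have h1 : (Y : ℝ) ≤ Real.exp (T / κ) := Nat.floor_le (Real.exp_pos _).le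
    calc (Y : ℝ) ^ 2 ≤ Real.exp (T / κ) ^ 2 := pow_le_pow_left₀ (Nat.cast_nonneg _) h1 2
      _ = Real.exp (2 * T / κ) := by
          rw [← Real.exp_nat_mul]
          congr 1
          push_cast
          ring
      _ ≤ Real.exp (Real.log R) := by
          refine Real.exp_le_exp.2 ?_
          rw [div_le_iff₀ hκ]
          linarith
      _ = R := Real.exp_log (by exact_mod_cast (by omega : 0 < R))
  have hY1 : 1 ≤ Y := Nat.le_floor (by
    rw [Nat.cast_one]
    exact Real.one_le_exp (by positivity))
  have h1V : 1 ∈ V := mem_filter.2 ⟨mem_Ioc.2 ⟨one_pos, hY1⟩, squarefree_one, Nat.coprime_one_left W⟩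
  have hV : ∀ a ∈ V, Squarefree a ∧ a.primeFactors ⊆ P ∧ a ^ 2 ≤ R := by
    intro a ha
    obtain ⟨h1, h2, h3⟩ := mem_filter.1 ha
    obtain ⟨h4, h5⟩ := mem_Ioc.1 h1
    have haR : a ^ 2 ≤ R := by
      have : ((a ^ 2 : ℕ) : ℝ) ≤ R := by
        push_cast
        exact (pow_le_pow_left₀ (Nat.cast_nonneg a) (Nat.cast_le.2 h5) 2).trans hYR
      exact_mod_cast this
    refine ⟨h2, fun p hp => ?_, haR⟩
    have hpp := Nat.prime_of_mem_primeFactors hp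
    have hpa := Nat.dvd_of_mem_primeFactors hp
    refine mem_filter.2 ⟨mem_Ioc.2 ⟨lt_of_coprime_primorial hpp fun hpW =>
      Nat.not_coprime_of_dvd_of_dvd hpp.one_lt hpa hpW h3, ?_⟩, hpp⟩
    exact (Nat.le_of_dvd h4 hpa).trans ((Nat.le_self_pow two_ne_zero a).trans haR)
  have hVd : ∀ p b, p.Prime → p * b ∈ V → b ∈ V := by
    intro p b hp hpb
    obtain ⟨h1, h2, h3⟩ := mem_filter.1 hpb
    obtain ⟨h4, h5⟩ := mem_Ioc.1 h1
    refine mem_filter.2 ⟨mem_Ioc.2 ⟨Nat.pos_of_mul_pos_left h4, ?_⟩, h2.squarefree_of_dvd (Dvd.intro_left p rfl),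
      Nat.Coprime.coprime_mul_left h3⟩
    exact (Nat.le_mul_of_pos_left b hp.pos).trans h5
  have hgp : ∀ p a, p.Prime → g (p * a) ≤ g a := by
    intro p a hp
    by_cases h : p * a ∈ V
    · have h' := hVd p a hp h
      rw [hgV _ h, hgV _ h']
      exact logWeight_anti hκ.le (mem_Ioc.1 (mem_filter.1 h').1).1 (Nat.le_mul_of_pos_left a hp.pos)
    · rw [hgV' _ h]
      exact hg0 a
  have hPk : ∀ p ∈ P, p.Prime ∧ 3 * k + 4 ≤ p := by
    intro p hp
    obtain ⟨h1, h2⟩ := mem_filter.1 hp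
    have := (mem_Ioc.1 h1).1
    refine ⟨h2, ?_⟩
    nlinarith
  have hP' : ∀ p ∈ P, p.Prime := fun p hp => (hPk p hp).1
  have eG : ∑ a ∈ V, g a / a = ∑ a ∈ V, logWeight κ a / a :=
    sum_congr rfl fun a ha => by rw [hgV a ha]
  have eZ : ∑ a ∈ V, g a ^ 2 / a = ∑ a ∈ V, logWeight κ a ^ 2 / a :=
    sum_congr rfl fun a ha => by rw [hgV a ha]
  have hδW : (W : ℝ) ≤ W.totient / W / (8 * κ) := by
    rw [le_div_iff₀ (by positivity)]
    linarith
  have hZpos : 1 ≤ ∑ a ∈ V, g a ^ 2 / a := by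
    rw [eZ]
    linarith
  have hGpos : 1 ≤ ∑ a ∈ V, g a / a := by
    rw [eG]
    refine le_trans ?_ hG1
    have : W.totient / W * L / (4 * κ) = 2 * (W.totient / W / (8 * κ)) * L := by
      field_simp
      norm_num
    rw [this]
    nlinarith
  have hΛ : ∑ a ∈ V, g a ^ 2 / a * Real.log a ≤ 16 * L / κ * ∑ a ∈ V, g a ^ 2 / a := by
    calc _ ≤ ∑ a ∈ V, κ⁻¹ * (logWeight κ a / a) := by
          refine sum_le_sum fun a ha => ?_
          rw [hgV a ha]
          have h0 := logWeight_pos hκ.le a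
          have h1 : logWeight κ a * (κ * Real.log a) ≤ 1 := by
            rw [logWeight, inv_mul_le_iff₀ (one_pos.trans_le (one_le_one_add_mul_log hκ.le a))]
            linarith
          have h2 : logWeight κ a * Real.log a ≤ κ⁻¹ := by
            rw [← one_div, le_div_iff₀ hκ]
            linarith
          calc _ = logWeight κ a * Real.log a * (logWeight κ a / a) := by ring
            _ ≤ _ := mul_le_mul_of_nonneg_right h2 (div_nonneg h0.le (Nat.cast_nonneg a))
      _ ≤ κ⁻¹ * (2 * (W.totient / W * L) / κ) := by
          rw [← mul_sum]
          exact mul_le_mul_of_nonneg_left hG2 (by positivity)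
      _ = 16 * L / κ * (W.totient / W / (8 * κ)) := by
          field_simp
          norm_num
      _ ≤ _ := by
          rw [eZ]
          exact mul_le_mul_of_nonneg_left hZ1 (by positivity)
  have hDr : (4 * (4 * k ^ 2 + 7 * k) : ℝ) ≤ D := by exact_mod_cast hD
  have hD0 : 0 < D := by
    have : 0 < k ^ 2 := by positivity
    omega
  have hP2 : (4 * k ^ 2 + 7 * k) * ∑ p ∈ P, ((p : ℝ) ^ 2)⁻¹ ≤ 1 / 4 := by
    refine (mul_le_mul_of_nonneg_left (sum_primes_inv_sq_le D R hD0) (by positivity)).trans ?_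
    rw [← div_eq_mul_inv, div_le_iff₀ (Nat.cast_pos.2 hD0)]
    linarith
  refine ⟨sieveWeight g R, ∑ a ∈ V, g a / a, ∑ a ∈ V, g a ^ 2 / a, abs_sieveWeight_le hg0 hgle R,
    fun ω hω => if_neg (not_le.2 hω), hGpos, hZpos, ?_, ?_, fun m => ?_⟩
  · rw [eG, eZ]
    have h1 : Real.log R = k * (64 * L) / κ := by rw [← hκR, mul_div_cancel_left₀ _ hκ.ne']
    have h2 := pow_le_pow_left₀ (by positivity) hG1 2
    have hδL : 0 ≤ W.totient / W * Real.log R * L := by positivity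
    refine (mul_le_mul_of_nonneg_left hZ2 hδL).trans
      (le_trans (le_of_eq ?_) (mul_le_mul_of_nonneg_left h2 (by positivity)))
    rw [h1]
    field_simp
    norm_num
  · exact (sum_main_le (fun p hp => ⟨hP' p hp, by have := (hPk p hp).2; omega⟩) _).trans
      (sum_supportProd_mul_sq_le hP' hgV' R)
  · refine sum_main_ge_of_bounds hPk hg0 ?_ hgp hV hVd h1V hR1 m (by positivity) hΛ hP2 ?_
    · rw [hgV 1 h1V]
      simp [logWeight]
    · rw [show 4 * (k * (16 * L / κ)) = k * (64 * L) / κ by ring, ← hκR,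
        mul_div_cancel_left₀ _ hκ.ne']

end BoundedGaps

namespace BoundedGaps
open Finset

theorem modEq_prod_iff {ι : Type*} {s : Finset ι} {f : ι → ℕ}
    (h : (s : Set ι).Pairwise fun i j => Nat.Coprime (f i) (f j)) {a b : ℕ} :
    a ≡ b [MOD ∏ i ∈ s, f i] ↔ ∀ i ∈ s, a ≡ b [MOD f i] := by
  simp only [Nat.modEq_iff_dvd, Nat.cast_prod]
  constructor
  · exact fun hd i hi => (dvd_prod_of_mem (fun i => (f i : ℤ)) hi).trans hd
  · exact fun hd => Finset.prod_dvd_of_coprime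
      (fun i hi j hj hij => (Nat.isCoprime_iff_coprime.2 (h hi hj hij))) hd

section crt

variable {P : Finset ℕ} {k W : ℕ}

theorem eq_of_dvd_add_mul {p : ℕ} (hp : p.Prime) (hk : k ≤ p) (hW : ¬ p ∣ W) {n : ℕ} {i j : Fin k}
    (hi : p ∣ n + i * W) (hj : p ∣ n + j * W) : i = j := by
  have h1 : (p : ℤ) ∣ ((i : ℤ) - j) * W := by
    have h := dvd_sub (Int.natCast_dvd_natCast.2 hi) (Int.natCast_dvd_natCast.2 hj)
    have e : (((n + i * W : ℕ) : ℤ) - ((n + j * W : ℕ) : ℤ)) = ((i : ℤ) - j) * W := by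
      simp only [Nat.cast_add, Nat.cast_mul]
      ring
    rwa [e] at h
  rcases (Nat.prime_iff_prime_int.1 hp).dvd_or_dvd h1 with h | h
  · have := Int.eq_zero_of_abs_lt_dvd h (by
      have := i.2
      have := j.2
      rw [abs_lt]
      omega)
    exact Fin.ext (by omega)
  · exact absurd (Int.natCast_dvd_natCast.1 h) hW

/-- The indicator of divisibility of a shift of `n` by the elements of `P`. -/
noncomputable def shiftInd (W n : ℕ) (p : P) (i : Fin k) : ℝ :=
  if (p : ℕ) ∣ n + i * W then 1 else 0

theorem shiftInd_mul (hP : ∀ p ∈ P, p.Prime ∧ k ≤ p ∧ ¬ p ∣ W) (n : ℕ) (p : P) (i j : Fin k) :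
    shiftInd W n p i * shiftInd W n p j = if i = j then shiftInd W n p i else 0 := by
  unfold shiftInd
  by_cases hij : i = j
  · subst hij
    simp
  · rw [if_neg hij]
    split_ifs with h1 h2
    · exact absurd (eq_of_dvd_add_mul (hP p p.2).1 (hP p p.2).2.1 (hP p p.2).2.2 h1 h2) hij
    all_goals simp

open Classical in
theorem prod_elim_shiftInd (n : ℕ) (l : P → Option (Fin k)) :
    ∏ p, (l p).elim 1 (shiftInd W n p) =
      if ∀ (p : P) (i : Fin k), l p = some i → (p : ℕ) ∣ n + i * W then 1 else 0 := by
  split_ifs with h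
  · refine prod_eq_one fun p _ => ?_
    rcases hl : l p with _ | i
    · rfl
    · exact if_pos (h p i hl)
  · push Not at h
    obtain ⟨p, i, hl, hd⟩ := h
    refine prod_eq_zero (mem_univ p) ?_
    rw [hl]
    exact if_neg hd

theorem coprime_supportProd (hP : ∀ p ∈ P, p.Prime ∧ k ≤ p ∧ ¬ p ∣ W) (l : P → Option (Fin k)) :
    Nat.Coprime W (supportProd l) := by
  refine Nat.Coprime.prod_right fun p _ => ?_
  split_ifs
  · exact Nat.coprime_one_right W
  · exact ((hP p p.2).1.coprime_iff_not_dvd.2 (hP p p.2).2.2).symm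

theorem exists_modEq_iff (hP : ∀ p ∈ P, p.Prime ∧ k ≤ p ∧ ¬ p ∣ W)
    (l : P → Option (Fin k)) :
    ∃ a : ℕ, ∀ n : ℕ, n ≡ a [MOD W * supportProd l] ↔ n ≡ 1 [MOD W] ∧
      ∀ (p : P) (i : Fin k), l p = some i → (p : ℕ) ∣ n + i * W := by
  classical
  let s : P → ℕ := fun p => if l p = none then 1 else (p : ℕ)
  have hs0 : ∀ p ∈ (univ : Finset P), s p ≠ 0 := fun p _ => by
    dsimp only [s]
    split_ifs
    exacts [one_ne_zero, (hP p p.2).1.ne_zero]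
  have hsc : ((univ : Finset P) : Set P).Pairwise (Function.onFun Nat.Coprime s) := by
    intro p _ q _ hpq
    simp only [Function.onFun, s]
    split_ifs
    any_goals simp
    exact (Nat.coprime_primes (hP p p.2).1 (hP q q.2).1).2 fun h => hpq (Subtype.ext h)
  have hres : ∀ p : P, ∃ c : ℕ, ∀ i : Fin k, l p = some i → (p : ℕ) ∣ c + i * W := by
    intro p
    rcases hl : l p with _ | i
    · exact ⟨0, fun i h => by simp at h⟩
    · refine ⟨(p - 1) * (i * W), fun j h => ?_⟩
      obtain rfl : i = j := Option.some_injective _ h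
      have hp := (hP p p.2).1.pos
      refine ⟨i * W, ?_⟩
      rw [← Nat.succ_mul, Nat.succ_eq_add_one, Nat.sub_add_cancel hp]
  choose c hc using hres
  obtain ⟨z, hz⟩ := Nat.chineseRemainderOfFinset c s univ hs0 hsc
  obtain ⟨a, ha1, ha2⟩ := Nat.chineseRemainder (coprime_supportProd hP l) 1 z
  refine ⟨a, fun n => ?_⟩
  rw [← Nat.modEq_and_modEq_iff_modEq_mul (coprime_supportProd hP l)]
  refine and_congr ⟨fun h => h.trans ha1, fun h => h.trans ha1.symm⟩ ?_
  have h1 : n ≡ a [MOD supportProd l] ↔ n ≡ z [MOD supportProd l] :=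
    ⟨fun h => h.trans ha2, fun h => h.trans ha2.symm⟩
  rw [h1]
  change n ≡ z [MOD ∏ p, s p] ↔ _
  rw [modEq_prod_iff hsc]
  refine ⟨fun h p i hl => ?_, fun h p _ => ?_⟩
  · have hsp : s p = p := if_neg (by simp [hl])
    have h2 := (h p (mem_univ p)).trans (hz p (mem_univ p))
    rw [hsp] at h2
    exact ((h2.add_right (i * W)).dvd_iff dvd_rfl).2 (hc p i hl)
  · refine Nat.ModEq.trans ?_ (hz p (mem_univ p)).symm
    rcases hl : l p with _ | i
    · have hsp : s p = 1 := if_pos hl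
      rw [hsp]
      exact Nat.modEq_one
    · have hsp : s p = p := if_neg (by simp [hl])
      rw [hsp]
      have h2 : n + i * W ≡ c p + i * W [MOD p] :=
        ((Nat.modEq_zero_iff_dvd.2 (h p i hl)).trans
          (Nat.modEq_zero_iff_dvd.2 (hc p i hl)).symm)
      exact Nat.ModEq.add_right_cancel' _ h2

theorem abs_card_modEq_sub_le (x a M : ℕ) (hM : 0 < M) :
    |(#{n ∈ Ioc 0 x | n ≡ a [MOD M]} : ℝ) - x / M| ≤ 1 := by
  have h := Nat.Ioc_filter_modEq_card 0 x hM a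
  have hM' : (0 : ℝ) < M := Nat.cast_pos.2 hM
  have h1 : (#{n ∈ Ioc 0 x | n ≡ a [MOD M]} : ℝ) =
      ((max (⌊((x : ℚ) - a) / M⌋ - ⌊(((0 : ℕ) : ℚ) - a) / M⌋) 0 : ℤ) : ℝ) := by
    rw [← h]
    rfl
  have hle : ⌊(((0 : ℕ) : ℚ) - a) / M⌋ ≤ ⌊((x : ℚ) - a) / M⌋ := by
    refine Int.floor_le_floor (div_le_div_of_nonneg_right ?_ (Nat.cast_nonneg M))
    push_cast
    linarith [Nat.cast_nonneg (α := ℚ) x]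
  rw [max_eq_left (by omega)] at h1
  have f1 := Int.floor_le (((x : ℚ) - a) / M)
  have f2 := Int.lt_floor_add_one (((x : ℚ) - a) / M)
  have f3 := Int.floor_le ((((0 : ℕ) : ℚ) - a) / M)
  have f4 := Int.lt_floor_add_one ((((0 : ℕ) : ℚ) - a) / M)
  generalize ⌊(((x : ℚ) - a) / M)⌋ = u at *
  generalize ⌊((((0 : ℕ) : ℚ) - a) / M)⌋ = v at *
  have e : ((x : ℚ) - a) / M - (((0 : ℕ) : ℚ) - a) / M = x / M := by
    rw [← sub_div]
    push_cast
    ring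
  have k1 : (u : ℚ) - v - x / M ≤ 1 := by linarith
  have k2 : -1 ≤ (u : ℚ) - v - x / M := by linarith
  rw [h1, abs_le]
  constructor
  · have : ((-1 : ℚ) : ℝ) ≤ (((u : ℚ) - v - x / M : ℚ) : ℝ) := by exact_mod_cast k2
    push_cast at this ⊢
    exact this
  · have : (((u : ℚ) - v - x / M : ℚ) : ℝ) ≤ ((1 : ℚ) : ℝ) := by exact_mod_cast k1
    push_cast at this ⊢
    exact this

/-- The sieve weight at the integer `n`. -/
noncomputable def sieveVal (W : ℕ) (c : (P → Option (Fin k)) → ℝ) (n : ℕ) : ℝ :=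
  (∑ ω, c ω * ∏ p : P, localFactor (p : ℕ) (shiftInd W n p) (ω p)) ^ 2

theorem supportProd_pos (hP : ∀ p ∈ P, p.Prime) (l : P → Option (Fin k)) : 0 < supportProd l :=
  prod_pos fun p _ => by
    split_ifs
    exacts [one_pos, (hP p p.2).pos]

theorem abs_sum_sieveVal_sub_le (hW : 0 < W) (hP : ∀ p ∈ P, p.Prime ∧ k ≤ p ∧ ¬ p ∣ W) {R : ℕ}
    {C : ℝ} (hC : ∀ q : ℕ, q ≠ 0 → ((k + 1 : ℝ) ^ 3) ^ #q.primeFactors ≤ C * √q) (x : ℕ)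
    (c : (P → Option (Fin k)) → ℝ) (hc : ∀ ω, |c ω| ≤ (supportProd ω : ℝ)⁻¹)
    (hcR : ∀ ω, R < supportProd ω → c ω = 0) :
    |∑ n ∈ Ioc 0 x with n ≡ 1 [MOD W], sieveVal W c n -
      x / W * ∑ v, ∑ w, c v * c w * ∏ p : P, ∑ l, localCoeff (p : ℕ) (v p) (w p) l *
        l.elim 1 (fun _ => ((p : ℕ) : ℝ)⁻¹)| ≤ C * R ^ 3 := by
  classical
  have hP' : ∀ p ∈ P, p.Prime := fun p hp => (hP p hp).1
  have hE : ∀ l : P → Option (Fin k), supportProd l ≤ R ^ 2 →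
      |∑ n ∈ Ioc 0 x with n ≡ 1 [MOD W], (1 : ℝ) * ∏ p, (l p).elim 1 (shiftInd W n p) -
        x / W * ∏ p : P, (l p).elim 1 (fun _ => ((p : ℕ) : ℝ)⁻¹)| ≤ 1 := by
    intro l _
    obtain ⟨a, ha⟩ := exists_modEq_iff hP l
    have h1 : ∑ n ∈ Ioc 0 x with n ≡ 1 [MOD W], (1 : ℝ) * ∏ p, (l p).elim 1 (shiftInd W n p) =
        #{n ∈ Ioc 0 x | n ≡ a [MOD W * supportProd l]} := by
      simp only [one_mul, prod_elim_shiftInd]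
      rw [← sum_filter, filter_filter, sum_const, nsmul_eq_mul, mul_one]
      simp only [ha]
    have h2 : ∏ p : P, (l p).elim 1 (fun _ => ((p : ℕ) : ℝ)⁻¹) = (supportProd l : ℝ)⁻¹ := by
      rw [supportProd, Nat.cast_prod, ← prod_inv_distrib]
      refine prod_congr rfl fun p _ => ?_
      rcases l p with _ | i <;> simp
    rw [h1, h2, ← div_eq_mul_inv, div_div]
    have := abs_card_modEq_sub_le x a (W * supportProd l) (Nat.mul_pos hW (supportProd_pos hP' l))
    push_cast at this
    exact this
  have key := abs_sum_sq_sub_le hP' {n ∈ Ioc 0 x | n ≡ 1 [MOD W]} (fun _ => 1)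
    (fun n => shiftInd W n) (fun n p i j => shiftInd_mul hP n p i j) (x / W)
    (fun p l => l.elim 1 (fun _ => ((p : ℕ) : ℝ)⁻¹)) (fun _ => 1) (fun _ => zero_le_one)
    (fun d q hdq hq _ => by
      have hq0 : 0 < q := Nat.pos_of_dvd_of_pos hq (prod_pos fun p hp => (hP' p hp).pos)
      simpa using Nat.le_of_dvd hq0 hdq) hE c hc hcR
  simp only [one_mul, mul_one] at key
  refine key.trans ?_
  have hC0 : 0 ≤ C := by
    have := hC 1 one_ne_zero
    simp at this
    linarith
  calc _ ≤ ∑ q ∈ Ioc 0 (R ^ 2), C * R := by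
        refine le_trans (sum_le_sum_of_subset_of_nonneg (t := Ioc 0 (R ^ 2)) (fun q hq => ?_)
          fun q _ _ => by positivity) (sum_le_sum fun q hq => ?_)
        · obtain ⟨h1, h2⟩ := mem_filter.1 hq
          exact mem_Ioc.2 ⟨Nat.pos_of_mem_divisors h1, h2⟩
        · obtain ⟨h1, h2⟩ := mem_Ioc.1 hq
          refine (hC q h1.ne').trans (mul_le_mul_of_nonneg_left ?_ hC0)
          rw [Real.sqrt_le_left (Nat.cast_nonneg R)]
          exact_mod_cast h2
    _ = C * R ^ 3 := by
        rw [sum_const, Nat.card_Ioc, Nat.sub_zero, nsmul_eq_mul]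
        push_cast
        ring

end crt

end BoundedGaps

namespace BoundedGaps
open Finset

theorem not_dvd_of_mem_bigPrimes {x d p : ℕ} (hp : p ∈ bigPrimes x) (h1 : d ≠ 1)
    (hd : d ≤ Nat.sqrt x) : ¬ d ∣ p := by
  rw [bigPrimes, mem_filter, mem_Ioc] at hp
  intro h
  rcases (Nat.dvd_prime hp.2).1 h with h | h
  · exact h1 h
  · omega

theorem coprime_of_mem_bigPrimes {x q p : ℕ} (hq0 : 0 < q) (hp : p ∈ bigPrimes x)
    (hq : q ≤ Nat.sqrt x) : p.Coprime q := by
  rw [bigPrimes, mem_filter, mem_Ioc] at hp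
  rw [hp.2.coprime_iff_not_dvd]
  exact fun h => by
    have := Nat.le_of_dvd hq0 h
    omega

theorem primeCharSum_changeLevel {x m n : ℕ} (hmn : m ∣ n) (hn0 : 0 < n) (hn : n ≤ Nat.sqrt x)
    (χ : DirichletCharacter ℂ m) :
    primeCharSum x (DirichletCharacter.changeLevel hmn χ) = primeCharSum x χ := by
  refine sum_congr rfl fun p hp => ?_
  have hu : IsUnit ((p : ℕ) : ZMod n) := (ZMod.isUnit_iff_coprime p n).2
    (coprime_of_mem_bigPrimes hn0 hp hn)
  obtain ⟨u, hu⟩ := hu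
  rw [← hu, DirichletCharacter.changeLevel_eq_cast_of_dvd, hu, ZMod.cast_natCast hmn]

theorem distError_le_mul_distError {x m e : ℕ} (hme : m.Coprime e) (h0 : 0 < m * e)
    (hx : m * e ≤ Nat.sqrt x) : distError x m ≤ e * distError x (m * e) := by
  classical
  have : NeZero m := ⟨(Nat.pos_of_mul_pos_right h0).ne'⟩
  have : NeZero (m * e) := ⟨h0.ne'⟩
  have he : 0 < e := Nat.pos_of_mul_pos_left h0
  have hm : (0 : ℝ) < m.totient := by exact_mod_cast Nat.totient_pos.2 (NeZero.pos m)
  have he' : (0 : ℝ) < e.totient := by exact_mod_cast Nat.totient_pos.2 he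
  have hle : (e.totient : ℝ) ≤ e := by exact_mod_cast Nat.totient_le e
  have hinj := DirichletCharacter.changeLevel_injective (R := ℂ) (Dvd.intro e rfl : m ∣ m * e)
  have hS : ∑ χ : DirichletCharacter ℂ m, (if χ = 1 then 0 else ‖primeCharSum x χ‖) ≤
      ∑ χ : DirichletCharacter ℂ (m * e), if χ = 1 then 0 else ‖primeCharSum x χ‖ := by
    calc _ = ∑ χ : DirichletCharacter ℂ m,
          (fun ψ : DirichletCharacter ℂ (m * e) => if ψ = 1 then 0 else ‖primeCharSum x ψ‖)
            (DirichletCharacter.changeLevel (Dvd.intro e rfl) χ) := by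
          refine sum_congr rfl fun χ _ => ?_
          dsimp only
          rw [primeCharSum_changeLevel _ h0 hx]
          have : DirichletCharacter.changeLevel (Dvd.intro e rfl : m ∣ m * e) χ = 1 ↔ χ = 1 := by
            rw [← hinj.eq_iff (a := χ), map_one]
          simp only [this]
      _ = ∑ ψ ∈ univ.image (DirichletCharacter.changeLevel (R := ℂ)
            (Dvd.intro e rfl : m ∣ m * e)), if ψ = 1 then 0 else ‖primeCharSum x ψ‖ :=
          (sum_image (f := fun ψ : DirichletCharacter ℂ (m * e) =>
            if ψ = 1 then 0 else ‖primeCharSum x ψ‖) hinj.injOn).symm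
      _ ≤ _ := sum_le_sum_of_subset_of_nonneg (subset_univ _) fun ψ _ _ => by
          split_ifs <;> positivity
  have hS0 : 0 ≤ ∑ χ : DirichletCharacter ℂ m, (if χ = 1 then 0 else ‖primeCharSum x χ‖) :=
    sum_nonneg fun ψ _ => by split_ifs <;> positivity
  have e1 : distError x m = (1 / m.totient) *
      ∑ χ : DirichletCharacter ℂ m, (if χ = 1 then 0 else ‖primeCharSum x χ‖) := by
    rw [distError]
    congr! 3
  have e2 : distError x (m * e) = (1 / (m * e).totient) *
      ∑ χ : DirichletCharacter ℂ (m * e), (if χ = 1 then 0 else ‖primeCharSum x χ‖) := by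
    rw [distError]
    congr! 3
  rw [e1, e2, Nat.totient_mul hme, ← mul_assoc]
  push_cast
  refine mul_le_mul ?_ hS hS0 (by positivity)
  rw [mul_one_div, div_le_div_iff₀ hm (by positivity)]
  nlinarith

theorem totient_prod_of_pairwise_coprime {ι : Type*} (s : Finset ι) (f : ι → ℕ)
    (h : (s : Set ι).Pairwise fun i j => Nat.Coprime (f i) (f j)) :
    (∏ i ∈ s, f i).totient = ∏ i ∈ s, (f i).totient := by
  classical
  induction s using Finset.induction_on with
  | empty => simp
  | insert a s ha ih =>
    rw [prod_insert ha, prod_insert ha, Nat.totient_mul, ih]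
    · exact h.mono (by simp)
    · refine Nat.Coprime.prod_right fun i hi => h (by simp) (by simp [hi]) ?_
      rintro rfl
      exact ha hi

variable {P : Finset ℕ} {k W : ℕ}

theorem prod_totient_elim (hP : ∀ p ∈ P, p.Prime) (m : Fin k) (l : P → Option (Fin k))
    (hl : ∀ p, l p ≠ some m) :
    ∏ p : P, (l p).elim 1 (fun i => if i = m then 0 else (((p : ℕ) : ℝ) - 1)⁻¹) =
      ((supportProd l).totient : ℝ)⁻¹ := by
  classical
  rw [supportProd, totient_prod_of_pairwise_coprime, Nat.cast_prod, ← prod_inv_distrib]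
  · refine prod_congr rfl fun p _ => ?_
    rcases h : l p with _ | i
    · simp
    · have him : i ≠ m := fun e => hl p (by rw [h, e])
      have := (hP p p.2).one_le
      simp [him, Nat.totient_prime (hP p p.2), Nat.cast_sub this]
  · intro p _ q _ hpq
    split_ifs
    any_goals simp
    exact (Nat.coprime_primes (hP p p.2) (hP q q.2)).2 fun h => hpq (Subtype.ext h)

theorem dvd_supportProd {l : P → Option (Fin k)} {p : P} (h : l p ≠ none) :
    (p : ℕ) ∣ supportProd l := by
  have := dvd_prod_of_mem (fun p : P => if l p = none then 1 else (p : ℕ)) (mem_univ p)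
  rwa [if_neg h] at this

theorem isUnit_add_mul (hP : ∀ p ∈ P, p.Prime ∧ k ≤ p ∧ ¬ p ∣ W) (m : Fin k)
    (l : P → Option (Fin k)) (hl : ∀ p, l p ≠ some m) {a : ℕ} (ha : a ≡ 1 [MOD W])
    (hd : ∀ (p : P) (i : Fin k), l p = some i → (p : ℕ) ∣ a + i * W) :
    IsUnit (((a + m * W : ℕ)) : ZMod (W * supportProd l)) := by
  rw [ZMod.isUnit_iff_coprime]
  refine Nat.Coprime.mul_right ?_ ?_
  · have h : a + m * W ≡ 1 [MOD W] := by
      simpa [Nat.ModEq] using ha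
    rw [Nat.Coprime, h.gcd_eq]
    simp
  · refine Nat.Coprime.prod_right fun p _ => ?_
    split_ifs with h
    · exact Nat.coprime_one_right _
    · obtain ⟨i, hi⟩ := Option.ne_none_iff_exists'.1 h
      refine ((hP p p.2).1.coprime_iff_not_dvd.2 fun h' => hl p ?_).symm
      rw [hi, eq_of_dvd_add_mul (hP p p.2).1 (hP p p.2).2.1 (hP p p.2).2.2 (hd p i hi) h']

theorem sum_shift_bigPrimes {x M a t : ℕ} (ht : t ≤ Nat.sqrt x) :
    ∑ n ∈ Ioc 0 x with n ≡ a [MOD M] ∧ n + t ∈ bigPrimes x, Real.log (n + t : ℕ) =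
      ∑ p ∈ bigPrimes x with ((p : ℕ) : ZMod M) = (a + t : ℕ), Real.log p := by
  refine sum_nbij' (fun n => n + t) (fun p => p - t) ?_ ?_ ?_ ?_ ?_
  · intro n hn
    obtain ⟨-, h1, h2⟩ := mem_filter.1 hn
    exact mem_filter.2 ⟨h2, (ZMod.natCast_eq_natCast_iff _ _ _).2 (h1.add_right t)⟩
  · intro p hp
    obtain ⟨h1, h2⟩ := mem_filter.1 hp
    have h3 := mem_Ioc.1 (mem_filter.1 h1).1
    have h4 : p - t + t = p := by omega
    refine mem_filter.2 ⟨mem_Ioc.2 ⟨by omega, by omega⟩, ?_, by rwa [h4]⟩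
    have h5 := (ZMod.natCast_eq_natCast_iff _ _ _).1 h2
    rw [← h4] at h5
    exact Nat.ModEq.add_right_cancel' _ h5
  · intro n _
    simp
  · intro p hp
    have h3 := mem_Ioc.1 (mem_filter.1 (mem_filter.1 hp).1).1
    omega
  · intro n _
    rfl

theorem abs_sum_log_prod_shiftInd_sub_le (hW : 0 < W) (hP : ∀ p ∈ P, p.Prime ∧ k ≤ p ∧ ¬ p ∣ W)
    {x : ℕ} (hk : k * W ≤ Nat.sqrt x) (m : Fin k) (l : P → Option (Fin k))
    (hl : W * supportProd l ≤ Nat.sqrt x) :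
    |∑ n ∈ Ioc 0 x with n ≡ 1 [MOD W] ∧ n + m * W ∈ bigPrimes x,
        Real.log (n + m * W : ℕ) * ∏ p, (l p).elim 1 (shiftInd W n p) -
      (∑ p ∈ bigPrimes x, Real.log p) / W.totient *
        ∏ p : P, (l p).elim 1 (fun i => if i = m then 0 else (((p : ℕ) : ℝ) - 1)⁻¹)| ≤
      distError x (W * supportProd l) := by
  classical
  have hP' : ∀ p ∈ P, p.Prime := fun p hp => (hP p hp).1
  have hs0 := supportProd_pos hP' l
  by_cases hm : ∀ p, l p ≠ some m
  · obtain ⟨a, ha⟩ := exists_modEq_iff hP l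
    obtain ⟨ha1, ha2⟩ := (ha a).1 rfl
    have : NeZero (W * supportProd l) := ⟨(Nat.mul_pos hW hs0).ne'⟩
    have ht : m * W ≤ Nat.sqrt x := (Nat.mul_le_mul_right W m.2.le).trans hk
    have h1 : ∑ n ∈ Ioc 0 x with n ≡ 1 [MOD W] ∧ n + m * W ∈ bigPrimes x,
        Real.log (n + m * W : ℕ) * ∏ p, (l p).elim 1 (shiftInd W n p) =
        ∑ p ∈ bigPrimes x with ((p : ℕ) : ZMod (W * supportProd l)) = (a + m * W : ℕ),
          Real.log p := by
      rw [← sum_shift_bigPrimes ht]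
      simp only [prod_elim_shiftInd, mul_ite, mul_one, mul_zero]
      rw [← sum_filter, filter_filter]
      refine sum_congr (filter_congr fun n _ => ?_) fun _ _ => rfl
      rw [ha]
      tauto
    rw [h1, prod_totient_elim hP' m l hm, ← div_eq_mul_inv, div_div, ← Nat.cast_mul,
      ← Nat.totient_mul (coprime_supportProd hP l)]
    exact abs_sum_log_bigPrimes_sub_le hl (isUnit_add_mul hP m l hm ha1 ha2)
  · push Not at hm
    obtain ⟨p, hp⟩ := hm
    have h2 : ∏ p : P, (l p).elim 1
        (fun i => if i = m then 0 else (((p : ℕ) : ℝ) - 1)⁻¹) = 0 :=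
      prod_eq_zero (mem_univ p) (by simp [hp])
    have h1 : ∑ n ∈ Ioc 0 x with n ≡ 1 [MOD W] ∧ n + m * W ∈ bigPrimes x,
        Real.log (n + m * W : ℕ) * ∏ p, (l p).elim 1 (shiftInd W n p) = 0 := by
      refine sum_eq_zero fun n hn => ?_
      obtain ⟨-, -, hn⟩ := mem_filter.1 hn
      refine mul_eq_zero_of_right _ (prod_eq_zero (mem_univ p) ?_)
      rw [hp]
      refine if_neg (not_dvd_of_mem_bigPrimes hn (hP' p p.2).ne_one ?_)
      refine le_trans ?_ hl
      exact (Nat.le_of_dvd hs0 (dvd_supportProd (by simp [hp]))).trans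
        (Nat.le_mul_of_pos_left _ hW)
    rw [h1, h2]
    simpa using distError_nonneg _ _

theorem squarefree_prod_primes (hP : ∀ p ∈ P, p.Prime) : Squarefree (∏ p ∈ P, p) := by
  refine Finset.squarefree_prod_of_pairwise_isCoprime ?_ ?_
  · intro p hp q hq hpq
    exact Nat.coprime_iff_isRelPrime.1 ((Nat.coprime_primes (hP p hp) (hP q hq)).2 hpq)
  · exact fun p hp => (hP p hp).prime.squarefree

theorem sum_divisors_distError_le (hW : Squarefree W)
    (hP : ∀ p ∈ P, p.Prime ∧ k ≤ p ∧ ¬ p ∣ W) (x R K : ℕ) (hK : 1 ≤ K) :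
    ∑ q ∈ (∏ p ∈ P, p).divisors with q ≤ R, (K : ℝ) ^ #q.primeFactors * distError x (W * q) ≤
      ∑ q ∈ Icc 1 (W * R) with Squarefree q, (K : ℝ) ^ #q.primeFactors * distError x q := by
  classical
  have hW0 : 0 < W := Nat.pos_of_ne_zero hW.ne_zero
  have hK' : (1 : ℝ) ≤ K := by exact_mod_cast hK
  have hinj : Function.Injective fun q => W * q := fun a b h => Nat.eq_of_mul_eq_mul_left hW0 h
  have hPc : Nat.Coprime W (∏ p ∈ P, p) :=
    Nat.Coprime.prod_right fun p hp => ((hP p hp).1.coprime_iff_not_dvd.2 (hP p hp).2.2).symm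
  have hPs := squarefree_prod_primes fun p hp => (hP p hp).1
  calc _ ≤ ∑ q ∈ (∏ p ∈ P, p).divisors with q ≤ R,
        (K : ℝ) ^ #(W * q).primeFactors * distError x (W * q) := by
        refine sum_le_sum fun q hq => mul_le_mul_of_nonneg_right ?_ (distError_nonneg _ _)
        have hq0 := Nat.pos_of_mem_divisors (mem_filter.1 hq).1
        refine pow_le_pow_right₀ hK' (card_le_card ?_)
        exact Nat.primeFactors_mono (Dvd.intro_left W rfl) (Nat.mul_pos hW0 hq0).ne'
    _ = ∑ q ∈ ((∏ p ∈ P, p).divisors.filter (· ≤ R)).image (fun q => W * q),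
        (K : ℝ) ^ #q.primeFactors * distError x q :=
        (sum_image (f := fun q => (K : ℝ) ^ #q.primeFactors * distError x q) hinj.injOn).symm
    _ ≤ _ := by
        refine sum_le_sum_of_subset_of_nonneg (fun i hi => ?_) fun q _ _ =>
          mul_nonneg (by positivity) (distError_nonneg _ _)
        obtain ⟨q, hq, rfl⟩ := mem_image.1 hi
        obtain ⟨h1, h2⟩ := mem_filter.1 hq
        have hd := Nat.dvd_of_mem_divisors h1
        refine mem_filter.2 ⟨mem_Icc.2 ⟨Nat.mul_pos hW0 (Nat.pos_of_mem_divisors h1),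
          Nat.mul_le_mul_left W h2⟩, ?_⟩
        exact (Nat.squarefree_mul (hPc.coprime_dvd_right hd)).2 ⟨hW, hPs.squarefree_of_dvd hd⟩

theorem abs_sum_log_mul_sieveVal_sub_le (hW : Squarefree W)
    (hP : ∀ p ∈ P, p.Prime ∧ k ≤ p ∧ ¬ p ∣ W) {x R : ℕ} (hR : W * R ^ 2 ≤ Nat.sqrt x)
    (hk : k * W ≤ Nat.sqrt x) (m : Fin k) (c : (P → Option (Fin k)) → ℝ)
    (hc : ∀ ω, |c ω| ≤ (supportProd ω : ℝ)⁻¹) (hcR : ∀ ω, R < supportProd ω → c ω = 0) :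
    |∑ n ∈ Ioc 0 x with n ≡ 1 [MOD W] ∧ n + m * W ∈ bigPrimes x,
        Real.log (n + m * W : ℕ) * sieveVal W c n -
      (∑ p ∈ bigPrimes x, Real.log p) / W.totient *
        ∑ v, ∑ w, c v * c w * ∏ p : P, ∑ l, localCoeff (p : ℕ) (v p) (w p) l *
          l.elim 1 (fun i => if i = m then 0 else (((p : ℕ) : ℝ) - 1)⁻¹)| ≤
      ∑ q ∈ Icc 1 (W * R ^ 2) with Squarefree q,
        (((k + 1) ^ 3 : ℕ) : ℝ) ^ #q.primeFactors * distError x q := by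
  have hP' : ∀ p ∈ P, p.Prime := fun p hp => (hP p hp).1
  have hW0 : 0 < W := Nat.pos_of_ne_zero hW.ne_zero
  have hPs := squarefree_prod_primes fun p hp => (hP p hp).1
  have hPc : Nat.Coprime W (∏ p ∈ P, p) :=
    Nat.Coprime.prod_right fun p hp => ((hP p hp).1.coprime_iff_not_dvd.2 (hP p hp).2.2).symm
  have key := abs_sum_sq_sub_le hP'
    {n ∈ Ioc 0 x | n ≡ 1 [MOD W] ∧ n + m * W ∈ bigPrimes x} (fun n => Real.log (n + m * W : ℕ))
    (fun n => shiftInd W n) (fun n p i j => shiftInd_mul hP n p i j)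
    ((∑ p ∈ bigPrimes x, Real.log p) / W.totient)
    (fun p l => l.elim 1 (fun i => if i = m then 0 else (((p : ℕ) : ℝ) - 1)⁻¹))
    (fun q => distError x (W * q)) (fun _ => distError_nonneg _ _) ?_
    (fun l hl => abs_sum_log_prod_shiftInd_sub_le hW0 hP hk m l
      ((Nat.mul_le_mul_left W hl).trans hR)) c hc hcR
  · refine key.trans ((le_of_eq ?_).trans
      (sum_divisors_distError_le hW hP x (R ^ 2) ((k + 1) ^ 3) (Nat.one_le_pow _ _ k.succ_pos)))
    push_cast
    rfl
  · rintro d q ⟨e, rfl⟩ hq hqR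
    have hsq := hPs.squarefree_of_dvd hq
    have hcop : Nat.Coprime (W * d) e := by
      refine Nat.Coprime.mul_left ?_ (Nat.coprime_of_squarefree_mul hsq)
      exact hPc.coprime_dvd_right ((Dvd.intro_left d rfl).trans hq)
    have hde : 0 < d * e := Nat.pos_of_ne_zero hsq.ne_zero
    have := distError_le_mul_distError (x := x) hcop (by rw [mul_assoc]; exact Nat.mul_pos hW0 hde)
      (by rw [mul_assoc]; exact (Nat.mul_le_mul_left W hqR).trans hR)
    rw [mul_assoc W d e] at this
    push_cast
    rw [mul_assoc (d : ℝ)]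
    exact mul_le_mul_of_nonneg_left this (Nat.cast_nonneg d)

end BoundedGaps

namespace BoundedGaps
open Finset Filter

theorem eventually_le_sum_log_bigPrimes :
    ∀ᶠ x : ℕ in atTop, (x : ℝ) / 2 ≤ ∑ p ∈ bigPrimes x, Real.log p := by
  filter_upwards [eventually_log_pow_le_sqrt_sqrt 100 (by norm_num) 1,
    tendsto_sqrt_sqrt_natCast.eventually_ge_atTop 20, eventually_ge_atTop 1] with x h1 h2 hx
  have hx' : (1 : ℝ) ≤ x := by exact_mod_cast hx
  rw [sum_log_bigPrimes]
  have t1 := Chebyshev.theta_ge x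
  have t2 := Chebyshev.theta_le_log4_mul_x (x := (Nat.sqrt x : ℝ)) (Nat.cast_nonneg _)
  have t3 : (Nat.sqrt x : ℝ) ≤ √x := Real.nat_sqrt_le_real_sqrt
  have e1 : √(x : ℝ) = √√(x : ℝ) ^ 2 := (Real.sq_sqrt (Real.sqrt_nonneg _)).symm
  have e2 : (x : ℝ) = √(x : ℝ) ^ 2 := (Real.sq_sqrt (by linarith)).symm
  have l1 : Real.log (x + 1) ≤ 1 + Real.log x := by
    have : Real.log (x + 1) ≤ Real.log (2 * x) := Real.log_le_log (by linarith) (by linarith)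
    rw [Real.log_mul (by norm_num) (by linarith)] at this
    linarith [Real.log_two_lt_d9]
  have l4 : Real.log 4 ≤ 2 := by
    rw [show (4 : ℝ) = 2 ^ 2 by norm_num, Real.log_pow]
    push_cast
    linarith [Real.log_two_lt_d9]
  have t4 : Real.log 4 * (Nat.sqrt x : ℝ) ≤ 2 * √x :=
    mul_le_mul l4 t3 (Nat.cast_nonneg _) (by norm_num)
  rw [pow_one] at h1
  have l0 : 0 ≤ Real.log x := Real.log_nonneg hx'
  generalize Real.log (x : ℝ) = ℓ at *
  have l2 := Real.log_two_gt_d9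
  have t5 : (x : ℝ) * 0.69 ≤ x * Real.log 2 := by gcongr; linarith
  have t6 : 2 * √(x : ℝ) * ℓ ≤ 2 * √(x : ℝ) * (√√(x : ℝ) / 100) := by gcongr; linarith
  have key : 1 + √√(x : ℝ) / 100 + 2 * √(x : ℝ) * (√√(x : ℝ) / 100) + 2 * √(x : ℝ) ≤
      0.19 * x := by
    generalize √√(x : ℝ) = s at *
    generalize √(x : ℝ) = r at *
    subst e1
    rw [e2]
    nlinarith [mul_le_mul h2 h2 (by norm_num) (by linarith), pow_le_pow_left₀ (by norm_num) h2 3,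
      mul_nonneg (sub_nonneg.2 h2) (pow_nonneg (show 0 ≤ s by linarith) 3)]
  linarith

theorem exists_pair_of_lt {k W x : ℕ} {s : ℕ → ℝ} (hs : ∀ n, 0 ≤ s n)
    (h : Real.log x * ∑ n ∈ Ioc 0 x with n ≡ 1 [MOD W], s n <
      ∑ m : Fin k, ∑ n ∈ Ioc 0 x with n ≡ 1 [MOD W] ∧ n + m * W ∈ bigPrimes x,
        Real.log (n + m * W : ℕ) * s n) :
    ∃ (n : ℕ) (i j : Fin k), i < j ∧ n + i * W ∈ bigPrimes x ∧ n + j * W ∈ bigPrimes x := by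
  classical
  by_contra hcon
  push Not at hcon
  refine absurd h (not_lt.2 ?_)
  have hlog : ∀ n ∈ bigPrimes x, Real.log n ≤ Real.log x := fun n hn => by
    rw [bigPrimes, mem_filter, mem_Ioc] at hn
    exact Real.log_le_log (by exact_mod_cast hn.2.pos) (by exact_mod_cast hn.1.2)
  have h0 : 0 ≤ Real.log x := Real.log_natCast_nonneg x
  calc _ = ∑ n ∈ Ioc 0 x with n ≡ 1 [MOD W], ∑ m : Fin k,
        if n + m * W ∈ bigPrimes x then Real.log (n + m * W : ℕ) * s n else 0 := by
        rw [sum_comm]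
        refine sum_congr rfl fun m _ => ?_
        rw [← filter_filter, sum_filter]
    _ ≤ ∑ n ∈ Ioc 0 x with n ≡ 1 [MOD W], Real.log x * s n := by
        refine sum_le_sum fun n _ => ?_
        by_cases hn : ∃ i : Fin k, n + i * W ∈ bigPrimes x
        · obtain ⟨i, hi⟩ := hn
          rw [sum_eq_single i, if_pos hi]
          · exact mul_le_mul_of_nonneg_right (hlog _ hi) (hs n)
          · intro j _ hj
            refine if_neg fun hj' => ?_
            rcases lt_or_gt_of_ne hj with h | h
            · exact hcon n j i h hj' hi
            · exact hcon n i j h hi hj'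
          · simp
        · push Not at hn
          rw [sum_eq_zero fun i _ => if_neg (hn i)]
          exact mul_nonneg h0 (hs n)
    _ = _ := (mul_sum _ _ _).symm

theorem exists_pow_le_lt_pow (x : ℕ) : ∃ R : ℕ, R ^ 40 ≤ x ∧ x < (R + 1) ^ 40 := by
  have h : ∃ n : ℕ, x < (n + 1) ^ 40 :=
    ⟨x, (Nat.lt_succ_self x).trans_le (Nat.le_self_pow (by norm_num) _)⟩
  refine ⟨Nat.find h, ?_, Nat.find_spec h⟩
  rcases hn : Nat.find h with _ | m
  · simp
  · exact not_lt.1 (Nat.find_min h (show m < Nat.find h by omega))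

theorem log_le_mul_log {x R : ℕ} (hR : 2 ≤ R) (hx : x < (R + 1) ^ 40) :
    Real.log x ≤ 80 * Real.log R := by
  rcases Nat.eq_zero_or_pos x with rfl | hx0
  · simp only [Nat.cast_zero, Real.log_zero]
    exact mul_nonneg (by norm_num) (Real.log_natCast_nonneg R)
  have h1 : x ≤ R ^ 80 := by
    calc x ≤ (R + 1) ^ 40 := hx.le
      _ ≤ (R ^ 2) ^ 40 := Nat.pow_le_pow_left (by nlinarith) 40
      _ = R ^ 80 := by rw [← pow_mul]
  have h2 : Real.log x ≤ Real.log ((R : ℝ) ^ 80) :=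
    Real.log_le_log (by exact_mod_cast hx0) (by exact_mod_cast h1)
  rw [Real.log_pow] at h2
  exact_mod_cast h2

theorem le_of_abs_sub_mul_le {S Y M e B : ℝ} (h : |S - Y * M| ≤ e) (hM : M ≤ B) (hY : 0 ≤ Y) :
    S ≤ Y * B + e := by
  have := mul_le_mul_of_nonneg_left hM hY
  linarith [(abs_le.1 h).2]

theorem le_of_abs_sub_mul_le' {S Y Y' M e B : ℝ} (h : |S - Y * M| ≤ e) (hM : B ≤ M) (hY : Y' ≤ Y)
    (hY' : 0 ≤ Y') (hB : 0 ≤ B) : Y' * B - e ≤ S := by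
  have := mul_le_mul hY hM hB (hY'.trans hY)
  linarith [(abs_le.1 h).1]

theorem sieve_contradiction {k : ℕ} (hk : 0 < k) {x W φ ℓ r L G Z : ℝ} (hx : 0 < x) (hW : 0 < W)
    (hφ : 0 < φ) (hr : 0 < r) (hZ : 1 ≤ Z) (hℓ : ℓ ≤ 80 * r)
    (hL : 5242880 < L) (hLZ : φ / W * r * L * Z ≤ 2048 * k * G ^ 2) :
    ℓ * (2 * (x / W) * Z ^ k) < k * (x / 2 / φ * (G ^ 2 * Z ^ (k - 1) / 8)) := by
  have hk' : (0 : ℝ) < k := by exact_mod_cast hk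
  have hZ0 : 0 < Z := by linarith
  have e : Z ^ k = Z * Z ^ (k - 1) := by
    rw [← pow_succ', Nat.sub_add_cancel hk]
  have h1 : φ / W * r * 5242880 * Z < 2048 * k * G ^ 2 := by
    refine lt_of_lt_of_le ?_ hLZ
    gcongr
  have h2 : φ / W * ℓ * 65536 * Z < 2048 * k * G ^ 2 := by
    refine lt_of_le_of_lt ?_ h1
    calc φ / W * ℓ * 65536 * Z ≤ φ / W * (80 * r) * 65536 * Z := by gcongr
      _ = _ := by ring
  have hp : 0 < x / φ * Z ^ (k - 1) / 32768 := by positivity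
  have h3 := mul_lt_mul_of_pos_left h2 hp
  rw [e]
  calc _ = x / φ * Z ^ (k - 1) / 32768 * (φ / W * ℓ * 65536 * Z) := by
        generalize Z ^ (k - 1) = y
        field_simp
        ring
    _ < _ := h3
    _ = _ := by ring

set_option maxHeartbeats 1000000 in
theorem exists_pair_of_large {k D K R x W : ℕ} {T C₁ C₂ : ℝ} (hk0 : 0 < k) (hT : 1 ≤ T)
    (hL : 5242880 < Real.log (1 + T)) (hTk : 2 * T ≤ k * (64 * Real.log (1 + T)))
    (hD : 4 * (4 * k ^ 2 + 7 * k) ≤ D) (hK : K = (k + 1) ^ 3) (hWdef : W = primorial D)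
    (hω : ∀ q : ℕ, q ≠ 0 → (K : ℝ) ^ #q.primeFactors ≤ C₁ * √q) (hC₂ : 0 < C₂)
    (hE : ∀ x R : ℕ, R ≤ Nat.sqrt x →
      ∑ q ∈ Icc 1 R with Squarefree q, (K : ℝ) ^ #q.primeFactors * distError x q ≤
        C₂ * (1 + Real.log R) ^ (2 * K) * ∑ i ∈ primChars R, ‖primeCharSum x i.2‖ / √i.1)
    (hsum : ∀ R : ℕ, 1 ≤ R → R ^ 15 ≤ x →
      ∑ i ∈ primChars R, ‖primeCharSum x i.2‖ / √i.1 ≤ x / Real.log x ^ (2 * K + 1))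
    (hθ : (x : ℝ) / 2 ≤ ∑ p ∈ bigPrimes x, Real.log p)
    (hpow : ∀ j ≤ 40, R ^ j ≤ x) (hxR : Real.log x ≤ 80 * Real.log R) (hR2 : 2 ≤ R) (hWR : W ^ 2 ≤ R) (hkR : k ≤ R)
    (hC₁R : (W : ℝ) * C₁ ≤ R)
    (hR : 8 * (k * (64 * Real.log (1 + T)) * W) ≤ W.totient / W * Real.log R)
    (hC₂R : 16 * W * C₂ * 4 ^ K ≤ Real.log R) (hR1 : 1 ≤ Real.log R) :
    ∃ (n : ℕ) (i j : Fin k),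
      i < j ∧ n + i * W ∈ bigPrimes x ∧ n + j * W ∈ bigPrimes x := by
  have hkD : k ≤ D := by linarith [Nat.zero_le (k ^ 2)]
  have hW : 0 < W := hWdef ▸ primorial_pos D
  have hW1 : (1 : ℝ) ≤ W := by exact_mod_cast hW
  have hφ : (0 : ℝ) < W.totient := Nat.cast_pos.2 (Nat.totient_pos.2 hW)
  have hφW : (W.totient : ℝ) ≤ W := by exact_mod_cast Nat.totient_le W
  have hR0 : 0 < R := by omega
  have hWR' : W ≤ R := (Nat.le_self_pow two_ne_zero W).trans hWR
  have hRx' : R ≤ x := by simpa using hpow 1 (by norm_num)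
  have hx0 : (0 : ℝ) < x := by exact_mod_cast hR0.trans_le hRx'
  have hlogRx : Real.log R ≤ Real.log x :=
    Real.log_le_log (by exact_mod_cast hR0) (by exact_mod_cast hRx')
  have hsq : W * R ^ 2 ≤ Nat.sqrt x := by
    rw [Nat.le_sqrt']
    calc (W * R ^ 2) ^ 2 ≤ (R * R ^ 2) ^ 2 := by gcongr
      _ = R ^ 6 := by ring
      _ ≤ x := hpow 6 (by norm_num)
  have hkW : k * W ≤ Nat.sqrt x := by
    rw [Nat.le_sqrt']
    calc (k * W) ^ 2 ≤ (R * R) ^ 2 := by gcongr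
      _ = R ^ 4 := by ring
      _ ≤ x := hpow 4 (by norm_num)
  obtain ⟨c, G, Z, hc, hcR, hG, hZ, hLZ, hZk, hGZ⟩ := exists_sieve_coeffs (k := k) (D := D) (R := R)
    hk0 hT (by linarith) hTk hD (by rw [← hWdef]; exact hR)
  rw [← hWdef] at hLZ
  have hP : ∀ p ∈ ({p ∈ Ioc D R | p.Prime} : Finset ℕ), p.Prime ∧ k ≤ p ∧ ¬ p ∣ W := by
    intro p hp
    obtain ⟨h1, h2⟩ := mem_filter.1 hp
    have h3 := (mem_Ioc.1 h1).1
    refine ⟨h2, ?_, fun h => ?_⟩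
    · omega
    · rw [hWdef, h2.dvd_primorial_iff] at h
      omega
  have hRR' : (W : ℝ) * (C₁ * R ^ 3) ≤ x := by
    have h4 : (R : ℝ) ^ 4 ≤ x := by exact_mod_cast hpow 4 (by norm_num)
    calc (W : ℝ) * (C₁ * R ^ 3) = W * C₁ * R ^ 3 := by ring
      _ ≤ (R : ℝ) * (R : ℝ) ^ 3 := mul_le_mul_of_nonneg_right hC₁R (by positivity)
      _ = (R : ℝ) ^ 4 := by ring
      _ ≤ x := h4
  have hω' : ∀ q : ℕ, q ≠ 0 → ((k + 1 : ℝ) ^ 3) ^ #q.primeFactors ≤ C₁ * √q := by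
    intro q hq
    have := hω q hq
    rw [hK] at this
    push_cast at this
    exact this
  have hZk1 : 1 ≤ Z ^ k := one_le_pow₀ hZ
  have hS1 : ∑ n ∈ Ioc 0 x with n ≡ 1 [MOD W], sieveVal W c n ≤ 2 * (x / W) * Z ^ k := by
    have h0 := @abs_sum_sieveVal_sub_le {p ∈ Ioc D R | p.Prime} k W hW hP R C₁ hω' x c hc hcR
    have h := le_of_abs_sub_mul_le h0 hZk (show 0 ≤ (x : ℝ) / W by positivity)
    have h1 : C₁ * R ^ 3 ≤ x / W * Z ^ k := by
      refine le_trans ?_ (le_mul_of_one_le_right (by positivity) hZk1)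
      rw [le_div_iff₀ (by positivity)]
      linarith
    linarith
  have hlogx : 0 < Real.log x := by linarith
  have hWRx : W * R ^ 2 ≤ x := hsq.trans (Nat.sqrt_le_self x)
  have herr : ∑ q ∈ Icc 1 (W * R ^ 2) with Squarefree q,
      (K : ℝ) ^ #q.primeFactors * distError x q ≤ x / (16 * W) := by
    have hWR2 : 1 ≤ W * R ^ 2 := Nat.mul_pos hW (by positivity)
    have hlog : 1 + Real.log ((W * R ^ 2 : ℕ) : ℝ) ≤ 2 * Real.log x := by
      have : Real.log ((W * R ^ 2 : ℕ) : ℝ) ≤ Real.log x :=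
        Real.log_le_log (Nat.cast_pos.2 hWR2)
          (Nat.cast_le.2 hWRx)
      linarith
    have hlog0 : 0 ≤ Real.log ((W * R ^ 2 : ℕ) : ℝ) := Real.log_natCast_nonneg _
    have h15 : (W * R ^ 2) ^ 15 ≤ x := by
      calc (W * R ^ 2) ^ 15 = W ^ 15 * R ^ 30 := by ring
        _ ≤ W ^ 20 * R ^ 30 := Nat.mul_le_mul_right _ (Nat.pow_le_pow_right hW (by norm_num))
        _ = (W ^ 2) ^ 10 * R ^ 30 := by ring
        _ ≤ R ^ 10 * R ^ 30 := by gcongr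
        _ = R ^ 40 := by ring
        _ ≤ x := hpow 40 le_rfl
    calc _ ≤ C₂ * (1 + Real.log ((W * R ^ 2 : ℕ) : ℝ)) ^ (2 * K) *
          ∑ i ∈ primChars (W * R ^ 2), ‖primeCharSum x i.2‖ / √i.1 := hE x _ hsq
      _ ≤ C₂ * (2 * Real.log x) ^ (2 * K) * (x / Real.log x ^ (2 * K + 1)) := by
          refine mul_le_mul ?_ (hsum _ hWR2 h15) (sum_nonneg fun _ _ => by positivity)
            (by positivity)
          exact mul_le_mul_of_nonneg_left (pow_le_pow_left₀ (by positivity) hlog _) hC₂.le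
      _ = C₂ * 4 ^ K * x / Real.log x := by
          rw [mul_pow, pow_mul 2 2 K, pow_succ (Real.log x)]
          have : Real.log x ^ (2 * K) ≠ 0 := by positivity
          generalize Real.log x ^ (2 * K) = y at *
          norm_num
          field_simp
      _ ≤ _ := by
          rw [div_le_div_iff₀ hlogx (by positivity)]
          have := mul_le_mul_of_nonneg_right (hC₂R.trans hlogRx) hx0.le
          linarith
  have hY : 1 ≤ G ^ 2 * Z ^ (k - 1) :=
    one_le_mul_of_one_le_of_one_le (one_le_pow₀ hG) (one_le_pow₀ hZ)
  refine exists_pair_of_lt (k := k) (W := W) (s := sieveVal W c) (fun n => sq_nonneg _) ?_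
  have hS2 : ∀ m : Fin k, x / 2 / W.totient * (G ^ 2 * Z ^ (k - 1) / 8) ≤
      ∑ n ∈ Ioc 0 x with n ≡ 1 [MOD W] ∧ n + m * W ∈ bigPrimes x,
        Real.log (n + m * W : ℕ) * sieveVal W c n := by
    intro m
    have h0 := @abs_sum_log_mul_sieveVal_sub_le {p ∈ Ioc D R | p.Prime} k W
      (hWdef ▸ squarefree_primorial D) hP x R hsq hkW m c hc hcR
    rw [← hK] at h0
    have h := le_of_abs_sub_mul_le' h0 (hGZ m)
      (div_le_div_of_nonneg_right hθ hφ.le) (by positivity) (by positivity)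
    have h2 : (x : ℝ) / (16 * W) ≤ x / 2 / W.totient * (G ^ 2 * Z ^ (k - 1) / 8) := by
      calc (x : ℝ) / (16 * W) = x / 2 / W * (1 / 8) := by
            field_simp
            norm_num
        _ ≤ _ := by gcongr
    linarith
  calc Real.log x * _ ≤ Real.log x * (2 * (x / W) * Z ^ k) :=
        mul_le_mul_of_nonneg_left hS1 hlogx.le
    _ < k * (x / 2 / W.totient * (G ^ 2 * Z ^ (k - 1) / 8)) :=
        sieve_contradiction hk0 hx0 (by linarith) hφ (by linarith) hZ hxR
          hL hLZ
    _ = ∑ m : Fin k, x / 2 / W.totient * (G ^ 2 * Z ^ (k - 1) / 8) := by simp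
    _ ≤ _ := sum_le_sum fun m _ => hS2 m

theorem exists_pair_bigPrimes : ∃ k W : ℕ, 0 < W ∧ ∀ X₀ : ℕ, ∃ x ≥ X₀, ∃ (n : ℕ) (i j : Fin k),
    i < j ∧ n + i * W ∈ bigPrimes x ∧ n + j * W ∈ bigPrimes x := by
  obtain ⟨T, hTdef⟩ : ∃ T : ℝ, T = Real.exp 8388608 - 1 := ⟨_, rfl⟩
  have hL : Real.log (1 + T) = 8388608 := by
    rw [hTdef, add_sub_cancel, Real.log_exp]
  have hT : 1 ≤ T := by
    have := Real.add_one_le_exp (8388608 : ℝ)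
    linarith
  obtain ⟨k, hk⟩ := exists_nat_ge (2 * T)
  have hk0 : 0 < k := by
    have : (0 : ℝ) < k := by linarith
    exact_mod_cast this
  obtain ⟨W, hWdef⟩ : ∃ W, W = primorial (4 * (4 * k ^ 2 + 7 * k)) := ⟨_, rfl⟩
  have hW : 0 < W := hWdef ▸ primorial_pos _
  have hW1 : (1 : ℝ) ≤ W := by exact_mod_cast hW
  have hφ : (0 : ℝ) < W.totient := Nat.cast_pos.2 (Nat.totient_pos.2 hW)
  have hφW : (W.totient : ℝ) ≤ W := by exact_mod_cast Nat.totient_le W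
  have hTk : 2 * T ≤ k * (64 * Real.log (1 + T)) := by
    rw [hL]
    refine hk.trans ?_
    nlinarith [Nat.cast_nonneg (α := ℝ) k]
  obtain ⟨K, hK⟩ : ∃ K, K = (k + 1) ^ 3 := ⟨_, rfl⟩
  obtain ⟨C₁, hC₁, hω⟩ := exists_pow_card_primeFactors_le K
  obtain ⟨C₂, hC₂, hE⟩ := exists_sum_distError_le K
  refine ⟨k, W, hW, fun X₀ => ?_⟩
  have hev : ∀ᶠ R : ℕ in atTop, 2 ≤ R ∧ W ^ 2 ≤ R ∧ k ≤ R ∧ (W : ℝ) * C₁ ≤ R ∧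
      8 * (k * (64 * Real.log (1 + T)) * W) / (W.totient / W) ≤ Real.log R ∧
      16 * W * C₂ * 4 ^ K ≤ Real.log R ∧ 1 ≤ Real.log R := by
    filter_upwards [eventually_ge_atTop 2, eventually_ge_atTop (W ^ 2), eventually_ge_atTop k,
      tendsto_natCast_atTop_atTop.eventually_ge_atTop ((W : ℝ) * C₁),
      tendsto_log_natCast.eventually_ge_atTop
        (8 * (k * (64 * Real.log (1 + T)) * W) / (W.totient / W)),
      tendsto_log_natCast.eventually_ge_atTop (16 * W * C₂ * 4 ^ K),
      tendsto_log_natCast.eventually_ge_atTop 1] with R h1 h2 h3 h4 h5 h6 h7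
    exact ⟨h1, h2, h3, h4, h5, h6, h7⟩
  obtain ⟨R₀, hR₀⟩ := eventually_atTop.1 hev
  obtain ⟨x₁, hx₁⟩ := eventually_atTop.1 eventually_le_sum_log_bigPrimes
  obtain ⟨x, hx, hsum⟩ := exists_sum_primChars_le (2 * K + 1) (X₀ + x₁ + (R₀ + 1) ^ 40)
  obtain ⟨R, hRx, hxR⟩ := exists_pow_le_lt_pow x
  have hRR : R₀ ≤ R := by
    by_contra h
    have := Nat.pow_le_pow_left (show R + 1 ≤ R₀ + 1 by omega) 40
    omega
  obtain ⟨hR2, hWR, hkR, hC₁R, hR, hC₂R, hR1⟩ := hR₀ R hRR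
  exact ⟨x, by omega, exists_pair_of_large hk0 hT (by rw [hL]; norm_num) hTk le_rfl hK hWdef hω hC₂
    hE hsum (hx₁ x (by omega))
    (fun j hj => (Nat.pow_le_pow_right (by omega) hj).trans hRx) (log_le_mul_log hR2 hxR) hR2 hWR hkR hC₁R
    (by rwa [div_le_iff₀' (by positivity)] at hR) hC₂R hR1⟩

/-- There are infinitely many pairs of primes with bounded gap. -/
theorem bounded_gaps : ∃ H : ℕ, ∀ N : ℕ, ∃ p p' : ℕ,
    p.Prime ∧ p'.Prime ∧ N < p ∧ p < p' ∧ p' ≤ p + H := by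
  obtain ⟨k, W, hW, h⟩ := exists_pair_bigPrimes
  refine ⟨k * W, fun N => ?_⟩
  obtain ⟨x, hx, n, i, j, hij, hi, hj⟩ := h (N ^ 2)
  have hN : N ≤ Nat.sqrt x := Nat.le_sqrt'.2 hx
  rw [bigPrimes, mem_filter, mem_Ioc] at hi hj
  refine ⟨n + i * W, n + j * W, hi.2, hj.2, by omega, ?_, ?_⟩
  · have := Nat.mul_lt_mul_of_pos_right (Fin.lt_def.1 hij) hW
    omega
  · have := Nat.mul_le_mul_right W j.2.le
    omega

end BoundedGaps

namespace RamseyGen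

open SimpleGraph

/-- Zhang's bounded prime gap theorem, in Ramseyian form.
With `𝔾 = {K_{i+1}}_{i∈ℕ}` and, for each `m ∈ ℕ`, the admissible coloring families
`ℒ(m) = {L_i(m)}_{i∈ℕ}` defined from the prime-distance colorings along fixed
Hamiltonian paths — `Θ[i,m] : V(K_{i+1}) → {p_m, …, p_{m+i}}` a fixed bijection (`p_r`
the `r`-th prime, `Nat.nth Nat.Prime`), `σ_i ∈ K_{i+1}/P_i` a fixed copy of the path
graph `P_i` whose induced subgraph makes `Θ[i,m]⁻¹(p_{m+r})` adjacent to
`Θ[i,m]⁻¹(p_{m+r+1})` for all `r < i`, and `L_i(m)` the set of edge-colorings `η` of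
`K_{i+1}` agreeing with `d_{Θ[i,m]}` on `σ_i⁻¹(P_i)` — there exists `N ∈ ℕ` such that
for every `m ∈ ℕ` the Ramsey number `R_{(𝔾,ℒ(m))}({K_2},{(2N)_{K_2}})` exists. -/
theorem ramsey_zhang
    (Θ : ∀ m i : ℕ, Fin (i + 1) → ℕ)
    (hΘinj : ∀ m i, Function.Injective (Θ m i))
    (hΘimg : ∀ m i v, ∃ r ≤ i, Θ m i v = Nat.nth Nat.Prime (m + r))
    (hΘsurj : ∀ m i r, r ≤ i → ∃ v, Θ m i v = Nat.nth Nat.Prime (m + r))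
    (σ : ∀ m i : ℕ, Copy (SimpleGraph.pathGraph (i + 1)) (⊤ : SimpleGraph (Fin (i + 1))))
    (hσ : ∀ m i r, r < i → ∃ a b : Fin (i + 1),
        (SimpleGraph.pathGraph (i + 1)).Adj a b ∧
        Θ m i ((σ m i).toFun a) = Nat.nth Nat.Prime (m + r) ∧
        Θ m i ((σ m i).toFun b) = Nat.nth Nat.Prime (m + r + 1)) :
    ∃ N : ℕ, ∀ m : ℕ, ∃ n : ℕ, ∀ s, n ≤ s →
      ∀ η ∈ {η : (⊤ : SimpleGraph (Fin (s + 1))).edgeSet → ℕ |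
          ∀ e : (SimpleGraph.pathGraph (s + 1)).edgeSet,
            η ((σ m s).edgeMap e) =
              distColoring (G := (⊤ : SimpleGraph (Fin (s + 1)))) (Θ m s)
                ((σ m s).edgeMap e)},
        Hits (⊤ : SimpleGraph (Fin 2)) (fun _ => 2 * N)
          (⊤ : SimpleGraph (Fin (s + 1))) η := by
  obtain ⟨N, hN⟩ := BoundedGaps.exists_gap_infinitely_often BoundedGaps.bounded_gaps
  refine ⟨N, fun m => ?_⟩
  obtain ⟨r, hr, hgap⟩ := hN m
  refine ⟨r - m + 1, fun s hs η hη => ?_⟩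
  obtain ⟨a, b, hab, ha, hb⟩ := hσ m s (r - m) (by omega)
  rw [Nat.add_sub_cancel' hr] at ha hb
  have hne : (σ m s).toFun a ≠ (σ m s).toFun b := fun h => hab.ne ((σ m s).injective h)
  refine ⟨⟨![(σ m s).toFun a, (σ m s).toFun b], ?_, ?_⟩, ?_⟩
  · intro i j hij
    fin_cases i <;> fin_cases j <;> simp_all [eq_comm]
  · intro i j hij
    fin_cases i <;> fin_cases j <;> simp_all [eq_comm]
  · have key : η ((σ m s).edgeMap ⟨s(a, b), hab⟩) = 2 * N := by
      rw [hη]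
      simp only [distColoring, Copy.edgeMap, Sym2.map_mk, Sym2.lift_mk, ha, hb, hgap]
      simp [Nat.dist]
    rintro ⟨e, he⟩
    rw [← key]
    congr 1
    apply Subtype.ext
    induction e using Sym2.ind with
    | _ i j =>
      have hij : i ≠ j := by simpa using he
      fin_cases i <;> fin_cases j <;> simp_all [Copy.edgeMap, Sym2.eq_swap]

end RamseyGen
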